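/- For every ε > 0 there exists a constant C(ε) > 0 such that for all real X ≥ 10 one has |∫_2^X Δ(x)^8 dx − ((35·C₇ − 28·C₄)/(2048·π^8)) · ∫_2^X x^2 dx| ≤ C(ε) · X^{3 − 1/254 + ε}. -/

import Mathlib

open Real MeasureTheory

/-- number of positive divisors of `n` -/
noncomputable def dd (n : ℕ) : ℝ := n.divisors.card

/-- the term attached to an octuple of positive integers -/
noncomputable def octTerm (p : Fin 8 → ℕ) : ℝ :=
  (∏ i, dd (p i)) * (∏ i, ((p i : ℝ))) ^ (-(3 : ℝ) / 4)

/-- `√n+√m+√k+√l+√r+√s = √t+√j` -/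
def cond4 (p : Fin 8 → ℕ) : Prop :=
  Real.sqrt (p 0) + Real.sqrt (p 1) + Real.sqrt (p 2) + Real.sqrt (p 3) +
      Real.sqrt (p 4) + Real.sqrt (p 5) = Real.sqrt (p 6) + Real.sqrt (p 7)

/-- `√n+√m+√k+√l = √r+√s+√t+√j` -/
def cond7 (p : Fin 8 → ℕ) : Prop :=
  Real.sqrt (p 0) + Real.sqrt (p 1) + Real.sqrt (p 2) + Real.sqrt (p 3) =
    Real.sqrt (p 4) + Real.sqrt (p 5) + Real.sqrt (p 6) + Real.sqrt (p 7)

noncomputable def C4 : ℝ :=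
  ∑' p : {p : Fin 8 → ℕ // (∀ i, 0 < p i) ∧ cond4 p}, octTerm p.1

noncomputable def C7 : ℝ :=
  ∑' p : {p : Fin 8 → ℕ // (∀ i, 0 < p i) ∧ cond7 p}, octTerm p.1

/-- the error term in the Dirichlet divisor problem -/
noncomputable def Δ (x : ℝ) : ℝ :=
  (∑ n ∈ Finset.Icc 1 ⌊x⌋₊, dd n) - x * Real.log x -
    (2 * Real.eulerMascheroniConstant - 1) * x

noncomputable def ee (x : ℝ) : ℂ := Complex.exp (2 * π * x * Complex.I)

lemma ee_norm (x : ℝ) : ‖ee x‖ = 1 := by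
  rw [ee, show (2 * π * x * Complex.I : ℂ) = ((2 * π * x : ℝ) : ℂ) * Complex.I by push_cast; ring]
  exact Complex.norm_exp_ofReal_mul_I _
lemma ee_add (x y : ℝ) : ee (x + y) = ee x * ee y := by
  simp only [ee, ← Complex.exp_add]; congr 1; push_cast; ring
lemma ee_zero : ee 0 = 1 := by simp [ee]
lemma ee_neg (x : ℝ) : ee (-x) = starRingEnd ℂ (ee x) := by
  simp only [ee, ← Complex.exp_conj]; congr 1; simp [map_ofNat]
lemma ee_int (n : ℤ) : ee n = 1 := by
  rw [ee, show (2 * π * (n : ℝ) * Complex.I : ℂ) = n * (2 * π * Complex.I) by push_cast; ring]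
  exact Complex.exp_int_mul_two_pi_mul_I n
lemma ee_sub (x y : ℝ) : ee (x - y) = ee x * starRingEnd ℂ (ee y) := by
  rw [sub_eq_add_neg, ee_add, ee_neg]
lemma ee_re (x : ℝ) : (ee x).re = Real.cos (2 * π * x) := by
  rw [ee, show (2 * π * x * Complex.I : ℂ) = ((2 * π * x : ℝ) : ℂ) * Complex.I by push_cast; ring]
  exact Complex.exp_ofReal_mul_I_re _
lemma ee_im (x : ℝ) : (ee x).im = Real.sin (2 * π * x) := by
  rw [ee, show (2 * π * x * Complex.I : ℂ) = ((2 * π * x : ℝ) : ℂ) * Complex.I by push_cast; ring]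
  exact Complex.exp_ofReal_mul_I_im _
lemma ee_deriv {f : ℝ → ℝ} {f' x : ℝ} (hf : HasDerivAt f f' x) :
    HasDerivAt (fun y => ee (f y)) (2 * π * f' * Complex.I * ee (f x)) x := by
  have := ((hf.ofReal_comp.const_mul (2 * π : ℂ)).mul_const Complex.I).cexp
  rw [mul_comm (Complex.exp _)] at this
  exact this
lemma ee_cont : Continuous ee := by unfold ee; fun_prop
lemma ee_mul_conj (x : ℝ) : ee x * starRingEnd ℂ (ee x) = 1 := by
  rw [← ee_sub, sub_self, ee_zero]

lemma dd_nonneg (n : ℕ) : 0 ≤ dd n := by simp [dd]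
lemma dd_one_le {n : ℕ} (h : n ≠ 0) : 1 ≤ dd n := by
  have : 0 < n.divisors.card := Finset.card_pos.2 ⟨1, by simp [h]⟩
  unfold dd; exact_mod_cast this

lemma dd_bound (ε : ℝ) (hε : 0 < ε) : ∃ C : ℝ, 1 ≤ C ∧ ∀ n : ℕ, n ≠ 0 → dd n ≤ C * (n : ℝ) ^ ε := by
  obtain ⟨M, hM1, hM⟩ : ∃ M : ℝ, 1 ≤ M ∧ ∀ v : ℕ, (v + 1 : ℝ) ≤ M * 2 ^ (ε * v) := by
    refine ⟨1 + 1 / (ε * log 2), by have := log_pos one_lt_two; simp; positivity, fun v => ?_⟩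
    have hl := log_pos one_lt_two
    have h1 : ε * v * log 2 + 1 ≤ 2 ^ (ε * v) := by
      rw [rpow_def_of_pos two_pos, mul_comm (log 2)]; exact add_one_le_exp _
    have h2 : (1:ℝ) ≤ 2 ^ (ε * v) := one_le_rpow one_le_two (by positivity)
    have : 1 / (ε * log 2) * (ε * v * log 2) = v := by field_simp
    have h3 := mul_le_mul_of_nonneg_left h1 (show 0 ≤ 1 / (ε * log 2) by positivity)
    have : 0 ≤ 1 / (ε * log 2) := by positivity
    nlinarith
  set P : ℕ := ⌈(2:ℝ) ^ (1 / ε)⌉₊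
  refine ⟨M ^ P, one_le_pow₀ hM1, fun n hn => ?_⟩
  have h1 : (n : ℝ) ^ ε = ∏ p ∈ n.primeFactors, (p : ℝ) ^ (ε * n.factorization p) := by
    conv_lhs => rw [← Nat.prod_factorization_pow_eq_self hn]
    rw [Finsupp.prod, Nat.cast_prod, ← Real.finsetProd_rpow _ _ (by intros; positivity)]
    refine Finset.prod_congr (by simp) fun p _ => ?_
    rw [Nat.cast_pow, ← rpow_natCast, ← rpow_mul (by positivity), mul_comm]
  rw [h1, dd, Nat.card_divisors hn, Nat.cast_prod]
  calc (∏ p ∈ n.primeFactors, ((n.factorization p + 1 : ℕ) : ℝ))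
      ≤ ∏ p ∈ n.primeFactors, ((if p < P then M else 1) * (p : ℝ) ^ (ε * n.factorization p)) := by
        refine Finset.prod_le_prod (by intros; positivity) fun p hp => ?_
        have hp2 : (2:ℝ) ≤ p := by exact_mod_cast (Nat.prime_of_mem_primeFactors hp).two_le
        push_cast
        split_ifs with h
        · exact (hM _).trans (by gcongr)
        · push Not at h
          have h3 : (2:ℝ) ≤ (p:ℝ) ^ ε := by
            have : (2:ℝ) ^ (1/ε) ≤ p := (Nat.le_ceil _).trans (by exact_mod_cast h)
            calc (2:ℝ) = ((2:ℝ) ^ (1/ε)) ^ ε := by rw [← rpow_mul two_pos.le]; field_simp; simp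
              _ ≤ _ := by gcongr
          rw [one_mul, rpow_mul (by positivity), rpow_natCast]
          have h4 := one_add_mul_le_pow (a := (1:ℝ)) (by norm_num) (n.factorization p)
          calc ((n.factorization p : ℝ) + 1) ≤ 2 ^ (n.factorization p) := by norm_num at h4; linarith
            _ ≤ _ := by gcongr
    _ = (∏ p ∈ n.primeFactors, (if p < P then M else 1)) * _ := Finset.prod_mul_distrib
    _ ≤ _ := by
        gcongr
        rw [Finset.prod_ite, Finset.prod_const_one, mul_one, Finset.prod_const]
        refine pow_le_pow_right₀ hM1 ?_
        calc _ ≤ (Finset.range P).card := Finset.card_le_card (by intro x; simp)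
          _ = P := by simp

noncomputable def psi (u : ℝ) : ℝ := Int.fract u - 1 / 2
lemma psi_abs (u : ℝ) : |psi u| ≤ 1 / 2 := by
  have := Int.fract_nonneg u; have := (Int.fract_lt_one u).le
  rw [psi, abs_le]; constructor <;> linarith
lemma floor_eq_psi {u : ℝ} (hu : 0 ≤ u) : (⌊u⌋₊ : ℝ) = u - 1 / 2 - psi u := by
  have := Int.self_sub_floor u
  rw [psi, ← this, natCast_floor_eq_intCast_floor hu]; ring

lemma harm_step {n : ℕ} (hn : 1 ≤ n) :
    0 ≤ (1 / n + 1 / (n + 1) : ℝ) / 2 - (log (n + 1) - log n) ∧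
    (1 / n + 1 / (n + 1) : ℝ) / 2 - (log (n + 1) - log n) ≤ 1 / n ^ 2 - 1 / (n + 1) ^ 2 := by
  have hn' : (1:ℝ) ≤ n := by exact_mod_cast hn
  have h0 : (0:ℝ) < n := by linarith
  have h1 : log ((n + 1 : ℝ)) - log n = log (1 + 1 / n) := by
    rw [← log_div (by positivity) (by positivity)]; congr 1; field_simp
  rw [h1]
  constructor
  · have h := self_le_sinh_iff.2 (log_nonneg (show (1:ℝ) ≤ 1 + 1 / n by simp))
    rw [sinh_log (by positivity)] at h
    have : ((1 + 1 / (n:ℝ)) - (1 + 1 / (n:ℝ))⁻¹) / 2 = (1 / n + 1 / (n + 1) : ℝ) / 2 := by field_simp; ring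
    linarith
  · have h := le_log_one_add_of_nonneg (show (0:ℝ) ≤ 1 / n by positivity)
    have : (1 / n + 1 / (n + 1) : ℝ) / 2 - 2 * (1 / (n:ℝ)) / (1 / n + 2) ≤ 1 / n ^ 2 - 1 / (n + 1) ^ 2 := by
      have : (1 / n ^ 2 - 1 / (n + 1) ^ 2 : ℝ) - ((1 / n + 1 / (n + 1) : ℝ) / 2 - 2 * (1 / (n:ℝ)) / (1 / n + 2))
          = (2 * (2 * n + 1) ^ 2 - n * (n + 1)) / (2 * n ^ 2 * (n + 1) ^ 2 * (2 * n + 1)) := by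
        field_simp; ring
      have h2 : (0:ℝ) ≤ (2 * (2 * n + 1) ^ 2 - n * (n + 1)) / (2 * n ^ 2 * (n + 1) ^ 2 * (2 * n + 1)) :=
        div_nonneg (by nlinarith) (by positivity)
      linarith
    linarith

lemma harm_bound {N : ℕ} (hN : 1 ≤ N) :
    |(harmonic N : ℝ) - log N - eulerMascheroniConstant - 1 / (2 * N)| ≤ 1 / N ^ 2 := by
  set u : ℕ → ℝ := fun n => harmonic (n + 1) - log ((n + 1 : ℕ) : ℝ) - 1 / (2 * ((n : ℝ) + 1)) with hu
  have hlim : Filter.Tendsto u Filter.atTop (nhds eulerMascheroniConstant) := by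
    have h := (Filter.tendsto_add_atTop_iff_nat 1).2 tendsto_harmonic_sub_log
    have h2 := (tendsto_one_div_add_atTop_nhds_zero_nat (𝕜 := ℝ)).const_mul (1 / 2)
    have := h.sub h2
    simp only [mul_zero, sub_zero] at this
    refine this.congr fun n => ?_
    simp only [hu]; field_simp
  have hs : ∀ n : ℕ, u (n + 1) - u n = (1 / ((n + 1 : ℕ) : ℝ) + 1 / (((n + 1 : ℕ) : ℝ) + 1)) / 2 - (log (((n + 1 : ℕ) : ℝ) + 1) - log ((n + 1 : ℕ) : ℝ)) := by
    intro n
    simp only [hu, harmonic_succ (n + 1)]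
    push_cast; field_simp; ring
  have hm : Monotone u := monotone_nat_of_le_succ fun n => by
    have := (harm_step (Nat.le_add_left 1 n)).1
    rw [← hs] at this; linarith
  have ha : Antitone fun n => u n + 1 / ((n : ℝ) + 1) ^ 2 := antitone_nat_of_succ_le fun n => by
    have := (harm_step (Nat.le_add_left 1 n)).2
    rw [← hs] at this; push_cast at this ⊢; linarith
  have hl2 : Filter.Tendsto (fun n => u n + 1 / ((n : ℝ) + 1) ^ 2) Filter.atTop (nhds eulerMascheroniConstant) := by
    have h2 := (tendsto_one_div_add_atTop_nhds_zero_nat (𝕜 := ℝ)).pow 2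
    have := hlim.add h2
    simpa using this
  obtain ⟨n, rfl⟩ : ∃ n, N = n + 1 := ⟨N - 1, by omega⟩
  have h1 := hm.ge_of_tendsto hlim n
  have h2 := ha.le_of_tendsto hl2 n
  simp only [hu] at h1 h2
  push_cast at h1 h2 ⊢
  rw [abs_le]; constructor <;> [linarith; skip]
  have : (0:ℝ) ≤ 1 / ((n : ℝ) + 1) ^ 2 := by positivity
  linarith

lemma harm_real {A : ℝ} (hA : 1 / 2 ≤ A) :
    |(harmonic ⌊A⌋₊ : ℝ) - log A - eulerMascheroniConstant + psi A / A| ≤ 12 / A ^ 2 := by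
  have hf := floor_eq_psi (show 0 ≤ A by linarith)
  have hp := psi_abs A
  have hA0 : 0 < A := by linarith
  set N := ⌊A⌋₊
  rcases Nat.eq_zero_or_pos N with h | h
  · have h1 : A < 1 := by simpa using (Nat.floor_eq_zero.1 h)
    rw [h] at hf ⊢
    have : psi A / A = 1 - 1 / (2 * A) := by rw [show psi A = A - 1 / 2 by simp at hf; linarith]; field_simp
    have h3 : 12 ≤ 12 / A ^ 2 := by rw [le_div_iff₀ (by positivity)]; nlinarith
    have h4 : 1 / (2 * A) ≤ 1 := by rw [div_le_one (by positivity)]; linarith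
    have h5 : (0:ℝ) ≤ 1 / (2 * A) := by positivity
    have h6 := one_half_lt_eulerMascheroniConstant
    have h7 := eulerMascheroniConstant_lt_two_thirds
    have h8 := log_nonpos hA0.le h1.le
    have h9 := one_sub_inv_le_log_of_pos hA0
    have : A⁻¹ ≤ 2 := by rw [inv_le_comm₀ hA0 two_pos]; linarith
    rw [abs_le]; constructor <;> simp <;> linarith
  · have hb := harm_bound h
    have hN : (1:ℝ) ≤ N := by exact_mod_cast h
    have hN0 : (0:ℝ) < N := by linarith
    obtain ⟨f, hfA⟩ : ∃ f, A = N + f := ⟨A - N, by ring⟩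
    have hp2 : psi A = f - 1 / 2 := by linarith
    have hf0 : 0 ≤ f := by have := Nat.floor_le hA0.le; simp only [N] at hfA; linarith
    have hf1 : f ≤ 1 := by rw [hp2, abs_le] at hp; linarith
    have hAN : A ≤ 2 * N := by linarith
    have hl : log A - log N = log (1 + f / N) := by
      rw [← log_div hA0.ne' hN0.ne']; congr 1; rw [hfA]; field_simp
    have hl1 : log (1 + f / N) ≤ f / N := by
      have := log_le_sub_one_of_pos (show 0 < 1 + f / N by positivity); linarith
    have hl2 : f / N - 1 / N ^ 2 ≤ log (1 + f / N) := by
      refine le_trans ?_ (one_sub_inv_le_log_of_pos (show 0 < 1 + f / N by positivity))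
      have : (1 - (1 + f / N)⁻¹ : ℝ) - (f / N - 1 / N ^ 2) = (N * (1 - f ^ 2) + f) / (N ^ 2 * (N + f)) := by
        field_simp; ring
      have h2 : (0:ℝ) ≤ (N * (1 - f ^ 2) + f) / (N ^ 2 * (N + f)) := by
        apply div_nonneg _ (by positivity)
        have : 0 ≤ 1 - f ^ 2 := by linarith [pow_le_one₀ hf0 hf1 (n := 2)]
        positivity
      linarith
    have hq : |psi A / A - psi A / N| ≤ 1 / N ^ 2 := by
      have : psi A / A - psi A / N = - (psi A * f) / (A * N) := by
        field_simp; rw [hfA]; ring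
      rw [this, abs_div, abs_neg, abs_mul, abs_of_nonneg hf0, abs_of_pos (mul_pos hA0 hN0)]
      apply div_le_div₀ zero_le_one (mul_le_one₀ (by linarith) hf0 hf1) (by positivity) (by nlinarith)
    have h12 : 3 / (N:ℝ) ^ 2 ≤ 12 / A ^ 2 := by
      rw [div_le_div_iff₀ (by positivity) (by positivity)]; linarith [pow_le_pow_left₀ hA0.le (show A ≤ 2 * N by linarith) 2]
    have e1 : psi A / N = f / N - 1 / (2 * N) := by rw [hp2]; field_simp
    have e2 : 3 / (N:ℝ) ^ 2 = 1 / N ^ 2 + 1 / N ^ 2 + 1 / N ^ 2 := by ring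
    rw [abs_le] at hb hq ⊢
    constructor <;> linarith

lemma sum_dd_hyp {x A : ℝ} (hA : 0 < A) (hx : 0 < x) :
    (∑ n ∈ Finset.Icc 1 ⌊x⌋₊, dd n) = (∑ a ∈ Finset.Icc 1 ⌊A⌋₊, (⌊x / a⌋₊ : ℝ)) +
      (∑ a ∈ Finset.Icc 1 ⌊x / A⌋₊, (⌊x / a⌋₊ : ℝ)) - ⌊A⌋₊ * ⌊x / A⌋₊ := by
  classical
  set M : ℕ := max ⌊x⌋₊ (max ⌊A⌋₊ ⌊x / A⌋₊)
  have hM : ∀ (y : ℝ) (f : ℕ → ℝ), 0 ≤ y → ⌊y⌋₊ ≤ M →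
      ∑ a ∈ Finset.Icc 1 ⌊y⌋₊, f a = ∑ a ∈ Finset.Icc 1 M, if (a:ℝ) ≤ y then f a else 0 := by
    intro y f hy hyM
    rw [← Finset.sum_filter]
    refine Finset.sum_congr ?_ fun _ _ => rfl
    ext a; simp only [Finset.mem_filter, Finset.mem_Icc, Nat.le_floor_iff hy]
    exact ⟨fun h => ⟨⟨h.1, (Nat.le_floor h.2).trans hyM⟩, h.2⟩, fun h => ⟨h.1.1, h.2⟩⟩
  have hMx : ⌊x⌋₊ ≤ M := le_max_left _ _
  have hMA : ⌊A⌋₊ ≤ M := (le_max_left _ _).trans (le_max_right _ _)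
  have hMB : ⌊x / A⌋₊ ≤ M := (le_max_right _ _).trans (le_max_right _ _)
  have hc : ∀ y : ℝ, (⌊y⌋₊ : ℝ) = ∑ a ∈ Finset.Icc 1 ⌊y⌋₊, (1:ℝ) := by intro y; simp
  have hdiv : ∀ a ∈ Finset.Icc 1 M, (⌊x / a⌋₊ : ℝ) = ∑ b ∈ Finset.Icc 1 M, if (a * b : ℝ) ≤ x then (1:ℝ) else 0 := by
    intro a ha
    have ha' : (1:ℝ) ≤ a := by exact_mod_cast (Finset.mem_Icc.1 ha).1
    rw [hc, hM _ _ (by positivity) ((Nat.floor_le_floor (div_le_self hx.le ha')).trans hMx)]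
    refine Finset.sum_congr rfl fun b _ => ?_
    simp only [le_div_iff₀ (show (0:ℝ) < a by linarith), mul_comm (b:ℝ)]
  have hD : (∑ n ∈ Finset.Icc 1 ⌊x⌋₊, dd n) = ∑ a ∈ Finset.Icc 1 M, (⌊x / a⌋₊ : ℝ) := by
    have h := ArithmeticFunction.sum_Ioc_sigma0_eq_sum_div ⌊x⌋₊
    simp only [ArithmeticFunction.sigma_zero_apply] at h
    have h' := congrArg (Nat.cast (R := ℝ)) h
    push_cast at h'
    rw [show Finset.Icc 1 ⌊x⌋₊ = Finset.Ioc 0 ⌊x⌋₊ from rfl]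
    refine h'.trans ?_
    rw [show Finset.Ioc 0 ⌊x⌋₊ = Finset.Icc 1 ⌊x⌋₊ from rfl, hM x _ hx.le hMx]
    refine Finset.sum_congr rfl fun a ha => ?_
    have ha' : (1:ℝ) ≤ a := by exact_mod_cast (Finset.mem_Icc.1 ha).1
    rw [Nat.floor_div_natCast]
    split_ifs with h1
    · rfl
    · rw [Nat.div_eq_of_lt ((Nat.floor_lt hx.le).2 (not_le.1 h1))]; simp
  have hq : ∀ y : ℝ, 0 ≤ y → ⌊y⌋₊ ≤ M → ∑ a ∈ Finset.Icc 1 ⌊y⌋₊, (⌊x / a⌋₊ : ℝ) =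
      ∑ a ∈ Finset.Icc 1 M, ∑ b ∈ Finset.Icc 1 M, if (a:ℝ) ≤ y then (if (a * b : ℝ) ≤ x then (1:ℝ) else 0) else 0 := by
    intro y hy hyM
    rw [hM y _ hy hyM]
    refine Finset.sum_congr rfl fun a ha => ?_
    rw [hdiv a ha]; split_ifs <;> simp
  rw [hD, hq A hA.le hMA, hq (x / A) (by positivity) hMB, hc A, hc (x / A), hM A _ hA.le hMA,
    hM (x / A) _ (by positivity) hMB, Finset.sum_mul_sum, Finset.sum_congr rfl hdiv]
  rw [Finset.sum_comm (f := fun a b : ℕ => if (a:ℝ) ≤ x / A then (if (a * b : ℝ) ≤ x then (1:ℝ) else 0) else 0),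
    ← Finset.sum_add_distrib, ← Finset.sum_sub_distrib]
  refine Finset.sum_congr rfl fun a ha => ?_
  rw [← Finset.sum_add_distrib, ← Finset.sum_sub_distrib]
  refine Finset.sum_congr rfl fun b hb => ?_
  have hb' : (1:ℝ) ≤ b := by exact_mod_cast (Finset.mem_Icc.1 hb).1
  simp only [mul_comm (b:ℝ), le_div_iff₀ hA]
  split_ifs <;> first | (norm_num; done) | (exfalso; nlinarith)

lemma delta_psi {x A : ℝ} (hx : 1 ≤ x) (h1 : √x / 2 ≤ A) (h2 : A ≤ 2 * √x) :
    |Δ x + (∑ a ∈ Finset.Icc 1 ⌊A⌋₊, psi (x / a)) + ∑ a ∈ Finset.Icc 1 ⌊x / A⌋₊, psi (x / a)| ≤ 100 := by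
  have hs : 1 ≤ √x := one_le_sqrt.2 hx
  have hA : 1 / 2 ≤ A := by linarith
  have hA0 : 0 < A := by linarith
  have hss : √x * √x = x := mul_self_sqrt (by linarith)
  set B := x / A
  have hAB : A * B = x := by simp only [B]; field_simp
  have hB : √x / 2 ≤ B := by rw [le_div_iff₀ hA0]; nlinarith
  have hB2 : B ≤ 2 * √x := by rw [div_le_iff₀ hA0]; nlinarith
  have hB0 : 0 < B := by linarith
  have hsum : ∀ A' : ℝ, 0 ≤ A' → ∑ a ∈ Finset.Icc 1 ⌊A'⌋₊, (⌊x / a⌋₊ : ℝ) =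
      x * harmonic ⌊A'⌋₊ - ⌊A'⌋₊ / 2 - ∑ a ∈ Finset.Icc 1 ⌊A'⌋₊, psi (x / a) := by
    intro A' _
    rw [Finset.sum_congr rfl fun (a : ℕ) _ => floor_eq_psi (show 0 ≤ x / (a:ℝ) by positivity), Finset.sum_sub_distrib,
      Finset.sum_sub_distrib, harmonic_eq_sum_Icc]
    push_cast
    simp [Finset.mul_sum, div_eq_mul_inv]
  have k1 := harm_real hA
  have k2 := harm_real (show 1 / 2 ≤ B by linarith)
  have key : ∀ {A B : ℝ}, 0 < A → A * B = x → √x / 2 ≤ A → ∀ {h p : ℝ}, |h + p / A| ≤ 12 / A ^ 2 → |x * h + B * p| ≤ 48 := by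
    intro A B hA hAB hs' h p hh
    have : x * h + B * p = x * (h + p / A) := by rw [← hAB]; field_simp
    rw [this, abs_mul, abs_of_pos (by linarith)]
    calc x * |h + p / A| ≤ x * (12 / A ^ 2) := by gcongr
      _ ≤ 48 := by rw [mul_div_assoc', div_le_iff₀ (by positivity)]; nlinarith
  have k1' := key hA0 hAB h1 k1
  have k2' := key hB0 (by rw [mul_comm]; exact hAB) hB k2
  have hlog : log x = log A + log B := by rw [← hAB, log_mul hA0.ne' hB0.ne']
  have hpp : |psi A * psi B| ≤ 1 / 4 := by
    rw [abs_mul]; exact (mul_le_mul (psi_abs A) (psi_abs B) (abs_nonneg _) (by norm_num)).trans (by norm_num)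
  rw [Δ, sum_dd_hyp hA0 (by linarith), hsum A hA0.le, hsum B hB0.le, hlog]
  have f1 := floor_eq_psi hA0.le
  have f2 := floor_eq_psi hB0.le
  rw [abs_le] at k1' k2' hpp ⊢
  have : ((⌊A⌋₊ : ℝ) + 1 / 2) * (⌊B⌋₊ + 1 / 2) = x - B * psi A - A * psi B + psi A * psi B := by
    rw [f1, f2]; linear_combination hAB
  constructor <;> linarith

noncomputable def om (s : ℝ) : ℝ := smoothTransition (1 / 2 - s)
noncomputable def chi (s : ℝ) : ℝ := smoothTransition (2 - 2 * s ^ 2)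

lemma st_add (x : ℝ) : smoothTransition x + smoothTransition (1 - x) = 1 := by
  have := smoothTransition.pos_denom x
  simp only [smoothTransition, sub_sub_cancel]
  rw [add_comm (expNegInvGlue (1 - x)), ← add_div, div_self this.ne']
lemma om_add (s : ℝ) : om s + om (-s) = 1 := by
  have := st_add (1 / 2 - s)
  rw [show 1 - (1 / 2 - s) = 1 / 2 - -s by ring] at this; exact this
lemma om_nonneg (s : ℝ) : 0 ≤ om s := smoothTransition.nonneg _
lemma om_le (s : ℝ) : om s ≤ 1 := smoothTransition.le_one _
lemma om_one {s : ℝ} (h : s ≤ -1 / 2) : om s = 1 := smoothTransition.one_of_one_le (by linarith)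
lemma om_zero {s : ℝ} (h : 1 / 2 ≤ s) : om s = 0 := smoothTransition.zero_of_nonpos (by linarith)
lemma om_anti : Antitone om := fun _ _ h => smoothTransition.monotone (by linarith)
lemma om_cd {n : ℕ∞} : ContDiff ℝ n om := smoothTransition.contDiff.comp (contDiff_const.sub contDiff_id)
lemma om_hd (s : ℝ) : HasDerivAt om (deriv om s) s :=
  (om_cd (n := 1)).differentiable (by simp) |>.differentiableAt.hasDerivAt
lemma om_dc : Continuous (deriv om) := (om_cd (n := 1)).continuous_deriv (by simp)

lemma ii_sum {ι E : Type*} [NormedAddCommGroup E] {S : Finset ι} {f : ι → ℝ → E} {a b : ℝ}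
    (h : ∀ i ∈ S, IntervalIntegrable (f i) volume a b) : IntervalIntegrable (fun s => ∑ i ∈ S, f i s) volume a b := by
  have := IntervalIntegrable.sum S h
  rwa [show (∑ i ∈ S, f i) = fun s => ∑ i ∈ S, f i s by ext; simp] at this

lemma om_int (l : ℝ) : ∫ s in (-1 / 2 : ℝ)..1 / 2, (if l < s then -deriv om s else 0) = om l := by
  have hi : ∀ a b : ℝ, ∫ s in a..b, -deriv om s = om a - om b := by
    intro a b
    rw [intervalIntegral.integral_neg, intervalIntegral.integral_eq_sub_of_hasDerivAt (fun x _ => om_hd x) (om_dc.intervalIntegrable _ _)]; ring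
  set m := max (-1 / 2 : ℝ) (min l (1 / 2))
  have m1 : -1 / 2 ≤ m := le_max_left _ _
  have m2 : m ≤ 1 / 2 := max_le (by norm_num) (min_le_right _ _)
  have e1 : ∀ s ∈ Set.uIoc (-1 / 2) m, (if l < s then -deriv om s else 0) = 0 := by
    intro s hs
    rw [Set.uIoc_of_le m1] at hs
    rw [if_neg]
    have : s ≤ min l (1 / 2) := by
      rcases le_max_iff.1 hs.2 with h | h
      · linarith [hs.1]
      · exact h
    exact not_lt.2 (this.trans (min_le_left _ _))
  have e2 : ∀ s ∈ Set.uIoc m (1 / 2), (if l < s then -deriv om s else 0) = -deriv om s := by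
    intro s hs
    rw [Set.uIoc_of_le m2] at hs
    rw [if_pos]
    have h1 := (le_max_right (-1 / 2) (min l (1 / 2))).trans_lt hs.1
    rcases min_lt_iff.1 h1 with h | h
    · exact h
    · linarith [hs.2]
  rw [← intervalIntegral.integral_add_adjacent_intervals (b := m),
    intervalIntegral.integral_congr_ae (.of_forall e1), intervalIntegral.integral_congr_ae (.of_forall e2), hi]
  · simp only [intervalIntegral.integral_zero, zero_add, om_zero le_rfl, sub_zero]
    simp only [m]
    rcases le_total l (-1 / 2) with h | h
    · rw [om_one h, om_one]; simp only [max_le_iff, min_le_iff, le_rfl, true_and]; left; exact h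
    · rcases le_total l (1 / 2) with h' | h'
      · rw [min_eq_left h', max_eq_right h]
      · rw [om_zero h', om_zero]; rw [min_eq_right h']; exact le_max_right _ _
  · exact (intervalIntegrable_const (c := (0:ℝ))).congr fun s hs => (e1 s hs).symm
  · exact (om_dc.neg.intervalIntegrable _ _).congr fun s hs => (e2 s hs).symm

lemma om_int' (l : ℝ) : ∫ s in (-1 / 2 : ℝ)..1 / 2, (if l ≤ s then -deriv om s else 0) = om l := by
  rw [← om_int]
  refine intervalIntegral.integral_congr_ae ?_
  filter_upwards [compl_mem_ae_iff.2 (measure_singleton (μ := volume) l)] with s hs _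
  have : l ≤ s ↔ l < s := ⟨fun h => lt_of_le_of_ne h fun e => hs (by simp [e]), le_of_lt⟩
  simp [this]

lemma om_ii (l : ℝ) : IntervalIntegrable (fun s => if l ≤ s then -deriv om s else 0) volume (-1 / 2) (1 / 2) := by
  have := (om_dc.neg.intervalIntegrable (-1/2) (1/2) (μ := volume))
  rw [intervalIntegrable_iff] at this ⊢
  exact (this.indicator (measurableSet_Ici (a := l))).congr (.of_forall fun s => by simp [Set.indicator, Set.mem_Ici])

lemma delta_avg {t : ℝ} (ht : 1 ≤ t) :
    |Δ (t ^ 2) + 2 * ∑ a ∈ Finset.Icc 1 ⌊2 * t⌋₊, om (log (a / t)) * psi (t ^ 2 / a)| ≤ 100 := by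
  have hst : √(t ^ 2) = t := sqrt_sq (by linarith)
  have ht0 : 0 < t := by linarith
  set S := Finset.Icc 1 ⌊2 * t⌋₊
  set p : ℕ → ℝ := fun a => psi (t ^ 2 / a)
  set l : ℕ → ℝ := fun a => log (a / t)
  set F : ℝ → ℝ := fun s => Δ (t ^ 2) * (-deriv om s) + (∑ a ∈ S, p a * (if l a ≤ s then -deriv om s else 0)) +
    ∑ a ∈ S, p a * (-deriv om s - (if -l a < s then -deriv om s else 0)) 
  have hb : ∀ s ∈ Set.Ioc (-1/2 : ℝ) (1/2), ‖F s‖ ≤ 100 * -deriv om s := by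
    intro s hs
    have hd : 0 ≤ -deriv om s := by linarith [om_anti.deriv_nonpos (x := s)]
    have e1 : exp s ≤ 2 := by
      have h := exp_one_lt_d9
      have h2 : exp s ≤ exp (1 / 2) := exp_le_exp.2 hs.2
      have h3 : exp (1 / 2) * exp (1 / 2) = exp 1 := by rw [← exp_add]; norm_num
      nlinarith [exp_pos (1 / 2), exp_pos s]
    have e2 : exp (-s) ≤ 2 := by
      have h := exp_one_lt_d9
      have h2 : exp (-s) ≤ exp (1 / 2) := exp_le_exp.2 (by linarith [hs.1])
      have h3 : exp (1 / 2) * exp (1 / 2) = exp 1 := by rw [← exp_add]; norm_num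
      nlinarith [exp_pos (1 / 2), exp_pos (-s)]
    have e3 : exp s * exp (-s) = 1 := by rw [← exp_add]; simp
    have hA := delta_psi (x := t ^ 2) (A := t * exp s) (by nlinarith) (by rw [hst]; nlinarith [show 1 / 2 ≤ exp s by nlinarith [exp_pos s]]) (by rw [hst]; nlinarith)
    have hB : t ^ 2 / (t * exp s) = t * exp (-s) := by rw [exp_neg]; field_simp
    have hS : ∀ s : ℝ, exp s ≤ 2 → ∑ a ∈ Finset.Icc 1 ⌊t * exp s⌋₊, p a = ∑ a ∈ S, if l a ≤ s then p a else 0 := by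
      intro s hs
      rw [← Finset.sum_filter]
      refine Finset.sum_congr ?_ fun _ _ => rfl
      ext a
      simp only [S, Finset.mem_filter, Finset.mem_Icc, l]
      have : 1 ≤ a → (a ≤ ⌊t * exp s⌋₊ ↔ log (a / t) ≤ s) := fun h => by
        rw [Nat.le_floor_iff (by positivity), log_le_iff_le_exp (by positivity), div_le_iff₀ ht0, mul_comm]
      have h3 : ⌊t * exp s⌋₊ ≤ ⌊2 * t⌋₊ := Nat.floor_le_floor (by nlinarith)
      grind
    rw [hB, hS s e1, hS (-s) e2] at hA
    have : F s = (-deriv om s) * (Δ (t ^ 2) + (∑ a ∈ S, if l a ≤ s then p a else 0) + ∑ a ∈ S, if l a ≤ -s then p a else 0) := by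
      simp only [F, mul_add, Finset.mul_sum]
      congr 1
      · congr 1
        · ring
        · exact Finset.sum_congr rfl fun a _ => by split_ifs <;> ring
      · refine Finset.sum_congr rfl fun a _ => ?_
        by_cases h : l a ≤ -s
        · rw [if_neg (by linarith), if_pos h]; ring
        · rw [if_pos (by linarith), if_neg h]; ring
    rw [this, norm_mul, norm_of_nonneg hd, mul_comm]
    gcongr
    exact hA
  have hd : IntervalIntegrable (fun s => -deriv om s) volume (-1/2) (1/2) := om_dc.neg.intervalIntegrable _ _
  have i1 := intervalIntegral.norm_integral_le_of_norm_le (by norm_num : (-1/2:ℝ) ≤ 1/2)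
    (.of_forall hb) (hd.const_mul 100)
  have hone : ∫ s in (-1 / 2 : ℝ)..1 / 2, -deriv om s = 1 := by
    rw [intervalIntegral.integral_neg, intervalIntegral.integral_eq_sub_of_hasDerivAt (fun x _ => om_hd x) (om_dc.intervalIntegrable _ _), om_zero le_rfl, om_one le_rfl]; norm_num
  have om_ii' : ∀ l, IntervalIntegrable (fun s => if l < s then -deriv om s else 0) volume (-1 / 2) (1 / 2) := by
    intro l
    refine (om_ii l).congr_ae ?_
    refine ae_restrict_of_ae ?_
    filter_upwards [compl_mem_ae_iff.2 (measure_singleton (μ := volume) l)] with s hs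
    have : l ≤ s ↔ l < s := ⟨fun h => lt_of_le_of_ne h fun e => hs (by simp [e]), le_of_lt⟩
    simp [this]
  rw [intervalIntegral.integral_const_mul, hone] at i1
  have i2 : ∫ s in (-1 / 2 : ℝ)..1 / 2, F s = Δ (t ^ 2) + 2 * ∑ a ∈ S, om (l a) * p a := by
    simp only [F]
    rw [intervalIntegral.integral_add, intervalIntegral.integral_add, intervalIntegral.integral_const_mul, hone,
      intervalIntegral.integral_finsetSum, intervalIntegral.integral_finsetSum]
    · simp only [intervalIntegral.integral_const_mul, om_int']
      have : ∀ a, ∫ s in (-1 / 2 : ℝ)..1 / 2, (-deriv om s - (if -l a < s then -deriv om s else 0)) = om (l a) := by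
        intro a
        rw [intervalIntegral.integral_sub hd (om_ii' _), hone, om_int]; linarith [om_add (l a)]
      simp only [this, two_mul, mul_comm (p _)]; ring
    · exact fun a _ => (hd.sub (om_ii' _)).const_mul _
    · exact fun a _ => (om_ii _).const_mul _
    · exact hd.const_mul _
    · exact ii_sum fun a _ => (om_ii _).const_mul _
    · exact (hd.const_mul _).add (ii_sum fun a _ => (om_ii _).const_mul _)
    · exact ii_sum fun a _ => (hd.sub (om_ii' _)).const_mul _
  rw [i2] at i1
  simpa using i1

lemma chi_nonneg (s : ℝ) : 0 ≤ chi s := smoothTransition.nonneg _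
lemma chi_le (s : ℝ) : chi s ≤ 1 := smoothTransition.le_one _
lemma chi_one {s : ℝ} (h : s ^ 2 ≤ 1 / 2) : chi s = 1 := smoothTransition.one_of_one_le (by linarith)
lemma chi_zero {s : ℝ} (h : 1 ≤ s) : chi s = 0 := smoothTransition.zero_of_nonpos (by nlinarith)
lemma chi_cd {n : ℕ∞} : ContDiff ℝ n chi :=
  smoothTransition.contDiff.comp (contDiff_const.sub (contDiff_const.mul (contDiff_id.pow 2)))
lemma chi_hcs : HasCompactSupport chi := by
  refine HasCompactSupport.intro (isCompact_Icc (a := (-1:ℝ)) (b := 1)) fun x hx => ?_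
  refine smoothTransition.zero_of_nonpos ?_
  simp only [Set.mem_Icc, not_and_or, not_le] at hx
  rcases hx with h | h <;> nlinarith

lemma chi_bounds : ∃ M : ℝ, 1 ≤ M ∧ (∀ s, |deriv chi s| ≤ M) ∧ ∀ s, |deriv (deriv chi) s| ≤ M := by
  have c1 : ContDiff ℝ 1 (deriv chi) := (contDiff_succ_iff_deriv.1 (chi_cd (n := 2))).2.2
  obtain ⟨M1, h1⟩ := chi_hcs.deriv.exists_bound_of_continuous c1.continuous
  obtain ⟨M2, h2⟩ := chi_hcs.deriv.deriv.exists_bound_of_continuous (c1.continuous_deriv le_rfl)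
  exact ⟨max 1 (max M1 M2), le_max_left _ _, fun s => (h1 s).trans ((le_max_left _ _).trans (le_max_right _ _)),
    fun s => (h2 s).trans ((le_max_right _ _).trans (le_max_right _ _))⟩

lemma chi_second : ∃ M : ℝ, 1 ≤ M ∧ ∀ x d : ℝ, 0 ≤ d → |2 * chi x - chi (x - d) - chi (x + d)| ≤ M * d ^ 2 := by
  obtain ⟨M, hM, -, h2⟩ := chi_bounds
  have c1 : ContDiff ℝ 1 (deriv chi) := (contDiff_succ_iff_deriv.1 (chi_cd (n := 2))).2.2
  have hd1 : ∀ x, HasDerivAt chi (deriv chi x) x := fun x =>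
    ((chi_cd (n := 1)).differentiable (by simp)).differentiableAt.hasDerivAt
  have lip : ∀ x y, |deriv chi y - deriv chi x| ≤ M * |y - x| := fun x y =>
    Convex.norm_image_sub_le_of_norm_deriv_le (fun z _ => (c1.differentiable (by simp)).differentiableAt)
      (fun z _ => h2 z) convex_univ (Set.mem_univ x) (Set.mem_univ y)
  refine ⟨2 * M, by linarith, fun x d hd => ?_⟩
  have hg : ∀ s ∈ Set.Icc 0 d, HasDerivWithinAt (fun s => chi (x + s) + chi (x - s)) (deriv chi (x + s) - deriv chi (x - s)) (Set.Icc 0 d) s := by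
    intro s _
    have a1 := (hd1 (x + s)).comp s ((hasDerivAt_id s).const_add x)
    have a2 := (hd1 (x - s)).comp s ((hasDerivAt_id s).const_sub x)
    exact ((a1.add a2).congr_deriv (by ring)).hasDerivWithinAt
  have := Convex.norm_image_sub_le_of_norm_hasDerivWithin_le (C := 2 * M * d) hg (fun s hs => by
    refine (lip _ _).trans ?_
    rw [show x + s - (x - s) = 2 * s by ring, abs_of_nonneg (by linarith [hs.1])]
    nlinarith [hs.2]) (convex_Icc 0 d) (Set.left_mem_Icc.2 hd) (Set.right_mem_Icc.2 hd)
  simp only [norm_eq_abs, add_zero, sub_zero, abs_of_nonneg hd] at this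
  rw [← abs_neg] at this
  calc _ = _ := by congr 1; ring
    _ ≤ _ := this
    _ = _ := by ring

lemma fejer_id (c : ℕ → ℝ) (φ : ℝ) (N : ℕ) :
    (2 - 2 * cos φ) * (c 0 + 2 * ∑ h ∈ Finset.range N, c (h + 1) * cos ((h + 1 : ℕ) * φ)) =
    2 * (c 0 - c 1) + 2 * (∑ h ∈ Finset.range N, (2 * c (h + 1) - c h - c (h + 2)) * cos ((h + 1 : ℕ) * φ)) +
      2 * (c (N + 1) * cos (N * φ) - c N * cos ((N + 1 : ℕ) * φ)) := by
  induction N with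
  | zero => simp; ring
  | succ N ih =>
    rw [Finset.sum_range_succ, Finset.sum_range_succ]
    have : cos ((N + 1 + 1 : ℕ) * φ) + cos (N * φ) = 2 * cos φ * cos ((N + 1 : ℕ) * φ) := by
      rw [show ((N + 1 + 1 : ℕ) : ℝ) * φ = (N + 1 : ℕ) * φ + φ by push_cast; ring,
        show (N : ℝ) * φ = (N + 1 : ℕ) * φ - φ by push_cast; ring, cos_add, cos_sub]; ring
    linear_combination ih + 2 * c (N + 1) * this

noncomputable def psiS (H : ℕ) (J θ : ℝ) : ℝ :=
  -∑ h ∈ Finset.range H, chi ((h + 1 : ℕ) / J) * sin (2 * π * (h + 1 : ℕ) * θ) / (π * (h + 1 : ℕ))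

lemma psiS_approx : ∃ C : ℝ, 1 ≤ C ∧ ∀ (H : ℕ) (J θ : ℝ), 0 < J → J ≤ H → |psi θ - psiS H J θ| ≤ C / (1 + J * |θ - round θ|) := by
  obtain ⟨M, hM1, hM⟩ := chi_second
  -- kernel bound
  have hΦ : ∀ (H : ℕ) (J u : ℝ), 1 ≤ J → J ≤ H → 0 < u → u ≤ 1 / 2 →
      |1 + 2 * ∑ h ∈ Finset.range H, chi ((h + 1 : ℕ) / J) * cos ((h + 1 : ℕ) * (2 * π * u))| ≤ M / (J * u ^ 2) := by
    intro H J u hJ hH hu hu2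
    have hJ0 : 0 < J := by linarith
    have hid := fejer_id (fun h => chi (h / J)) (2 * π * u) H
    have z1 : chi (H / J) = 0 := chi_zero ((one_le_div hJ0).2 hH)
    have z2 : chi ((H + 1 : ℕ) / J) = 0 := chi_zero ((one_le_div hJ0).2 (by push_cast; linarith))
    have c0 : chi ((0:ℕ) / J) = 1 := chi_one (by simp)
    simp only [z1, z2, c0, zero_mul, sub_zero, mul_zero, add_zero] at hid
    have b1 : |1 - chi ((1:ℕ) / J)| ≤ 2 * M / J ^ 2 := by
      rw [abs_of_nonneg (by linarith [chi_le ((1:ℕ) / J)])]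
      have : 2 / J ^ 2 ≤ 2 * M / J ^ 2 := by gcongr; linarith
      refine le_trans ?_ this
      by_cases h : ((1:ℕ) / J) ^ 2 ≤ 1 / 2
      · rw [chi_one h]; simp; positivity
      · have := chi_nonneg ((1:ℕ) / J)
        have e : 2 / J ^ 2 = 2 * ((1:ℕ) / J) ^ 2 := by push_cast; field_simp
        linarith
    have b2 : |∑ h ∈ Finset.range H, (2 * chi ((h + 1 : ℕ) / J) - chi (h / J) - chi ((h + 2 : ℕ) / J)) * cos ((h + 1 : ℕ) * (2 * π * u))| ≤ 2 * M / J := by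
      refine (Finset.abs_sum_le_sum_abs _ _).trans ?_
      calc _ ≤ ∑ h ∈ Finset.range H, if h < ⌈J⌉₊ then M / J ^ 2 else 0 := by
            refine Finset.sum_le_sum fun h _ => ?_
            rw [abs_mul]
            split_ifs with hh
            · have := hM ((h + 1 : ℕ) / J) (1 / J) (by positivity)
              rw [show ((h + 1 : ℕ) : ℝ) / J - 1 / J = h / J by push_cast; ring,
                show ((h + 1 : ℕ) : ℝ) / J + 1 / J = (h + 2 : ℕ) / J by push_cast; ring,
                show M * (1 / J) ^ 2 = M / J ^ 2 by ring] at this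
              calc _ ≤ M / J ^ 2 * 1 := mul_le_mul this (abs_cos_le_one _) (abs_nonneg _) (by positivity)
                _ = _ := mul_one _
            · have hJh : J ≤ h := (Nat.le_ceil J).trans (by exact_mod_cast not_lt.1 hh)
              rw [chi_zero ((one_le_div hJ0).2 (by push_cast; linarith)), chi_zero ((one_le_div hJ0).2 hJh),
                chi_zero ((one_le_div hJ0).2 (by push_cast; linarith))]; simp
        _ ≤ ⌈J⌉₊ * (M / J ^ 2) := by
            rw [← Finset.sum_filter, Finset.sum_const, nsmul_eq_mul]
            gcongr
            calc _ ≤ (Finset.range ⌈J⌉₊).card := Finset.card_le_card (by intro x; simp)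
              _ = _ := by simp
        _ ≤ 2 * J * (M / J ^ 2) := by
            gcongr; have := Nat.ceil_lt_add_one hJ0.le; linarith
        _ = _ := by field_simp
    have hsin : 16 * u ^ 2 ≤ 2 - 2 * cos (2 * π * u) := by
      have h1 := mul_le_sin (x := π * u) (by positivity) (by nlinarith [pi_pos])
      have h2 : 2 / π * (π * u) = 2 * u := by field_simp
      rw [h2] at h1
      have h3 := cos_sq' (π * u)
      have h4 := cos_two_mul (π * u)
      rw [show 2 * (π * u) = 2 * π * u by ring] at h4
      nlinarith
    rw [le_div_iff₀ (by positivity)]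
    set Φ := 1 + 2 * ∑ h ∈ Finset.range H, chi ((h + 1 : ℕ) / J) * cos ((h + 1 : ℕ) * (2 * π * u))
    have h5 : |(2 - 2 * cos (2 * π * u)) * Φ| ≤ 8 * M / J := by
      rw [hid]
      refine (abs_add_le _ _).trans ?_
      rw [abs_mul, abs_mul, abs_two]
      have : 2 * M / J ^ 2 ≤ 2 * M / J := by gcongr; nlinarith
      have : 8 * M / J = 2 * (2 * M / J) + 2 * (2 * M / J) := by ring
      linarith
    rw [abs_mul, abs_of_nonneg (by nlinarith)] at h5
    rw [le_div_iff₀ hJ0] at h5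
    linarith [abs_nonneg Φ, mul_le_mul_of_nonneg_right hsin (mul_nonneg (abs_nonneg Φ) hJ0.le)]
  -- bound on (0,1/2]
  have hmain : ∀ (H : ℕ) (J θ : ℝ), 1 ≤ J → J ≤ H → 0 < θ → θ ≤ 1 / 2 → |(θ - 1 / 2) - psiS H J θ| ≤ 6 * M / (1 + J * θ) := by
    intro H J θ hJ hH hθ hθ2
    have hJ0 : 0 < J := by linarith
    by_cases hs : J * θ ≤ 1
    · have b : |psiS H J θ| ≤ 2 := by
        rw [psiS, abs_neg]
        refine (Finset.abs_sum_le_sum_abs _ _).trans ?_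
        calc _ ≤ ∑ h ∈ Finset.range H, if h < ⌊J⌋₊ then 2 * θ else 0 := by
              refine Finset.sum_le_sum fun h _ => ?_
              split_ifs with hh
              · rw [abs_div, abs_mul, abs_of_nonneg (chi_nonneg _), abs_of_pos (show 0 < π * ((h + 1 : ℕ) : ℝ) by positivity), div_le_iff₀ (by positivity)]
                have := abs_sin_le_abs (x := 2 * π * (h + 1 : ℕ) * θ)
                rw [abs_of_nonneg (show 0 ≤ 2 * π * (h + 1 : ℕ) * θ by positivity)] at this
                calc _ ≤ 1 * (2 * π * (h + 1 : ℕ) * θ) := mul_le_mul (chi_le _) this (abs_nonneg _) zero_le_one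
                  _ = _ := by ring
              · rw [chi_zero ((one_le_div hJ0).2 ?_)]; · simp
                have := (Nat.lt_floor_add_one J); push_cast
                have : (⌊J⌋₊ : ℝ) ≤ h := by exact_mod_cast not_lt.1 hh
                linarith
          _ ≤ ⌊J⌋₊ * (2 * θ) := by
              rw [← Finset.sum_filter, Finset.sum_const, nsmul_eq_mul]
              gcongr
              calc _ ≤ (Finset.range ⌊J⌋₊).card := Finset.card_le_card (by intro x; simp)
                _ = _ := by simp
          _ ≤ J * (2 * θ) := by gcongr; exact Nat.floor_le hJ0.le
          _ ≤ 2 := by linarith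
      rw [le_div_iff₀ (by positivity)]
      have h3 : |(θ - 1 / 2) - psiS H J θ| ≤ 3 := by
        rw [abs_le] at b ⊢; constructor <;> linarith
      nlinarith [abs_nonneg ((θ - 1 / 2) - psiS H J θ), mul_pos hJ0 hθ]
    · push Not at hs
      set f : ℝ → ℝ := fun u => (u - 1 / 2) - psiS H J u
      set f' : ℝ → ℝ := fun u => 1 + 2 * ∑ h ∈ Finset.range H, chi ((h + 1 : ℕ) / J) * cos ((h + 1 : ℕ) * (2 * π * u))
      have hf : ∀ u, HasDerivAt f (f' u) u := by
        intro u
        simp only [f, psiS, sub_neg_eq_add, f', Finset.mul_sum]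
        refine ((hasDerivAt_id u).sub_const _).add (HasDerivAt.fun_sum fun h _ => ?_)
        have := (((hasDerivAt_id u).const_mul (2 * π * (h + 1 : ℕ))).sin.const_mul (chi ((h + 1 : ℕ) / J))).div_const (π * (h + 1 : ℕ))
        refine this.congr_deriv ?_
        simp only [id, mul_one]
        rw [show ((h + 1 : ℕ) : ℝ) * (2 * π * u) = 2 * π * (h + 1 : ℕ) * u by ring]
        field_simp
      have hfc : Continuous f' := by simp only [f']; fun_prop
      have i1 := intervalIntegral.integral_eq_sub_of_hasDerivAt (a := θ) (b := 1 / 2) (fun x _ => hf x) (hfc.intervalIntegrable _ _)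
      have hg : ∀ u ∈ Set.uIcc θ (1 / 2), HasDerivAt (fun u => -(M / J) * u⁻¹) (M / (J * u ^ 2)) u := by
        intro u hu
        rw [Set.uIcc_of_le hθ2] at hu
        have := (hasDerivAt_inv (show u ≠ 0 by linarith [hu.1])).const_mul (-(M / J))
        refine this.congr_deriv ?_; field_simp
      have hgi : IntervalIntegrable (fun u => M / (J * u ^ 2)) volume θ (1 / 2) := by
        apply ContinuousOn.intervalIntegrable
        rw [Set.uIcc_of_le hθ2]
        refine continuousOn_const.div (by fun_prop) fun u hu => ?_
        have : 0 < u := by linarith [hu.1]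
        positivity
      have i2 := intervalIntegral.integral_eq_sub_of_hasDerivAt hg hgi
      have i3 := intervalIntegral.norm_integral_le_of_norm_le (f := f') hθ2 (.of_forall fun u hu => hΦ H J u hJ hH (hθ.trans hu.1) hu.2) hgi
      have h12 : f (1 / 2) = 0 := by
        simp only [f, psiS]
        rw [Finset.sum_eq_zero]; · simp
        intro h _
        rw [show 2 * π * ((h + 1 : ℕ) : ℝ) * (1 / 2) = (h + 1 : ℕ) * π by ring, sin_nat_mul_pi]; simp
      rw [i1, i2, h12, zero_sub, norm_neg] at i3
      refine i3.trans ?_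
      rw [le_div_iff₀ (by positivity)]
      have e : -(M / J) * (1 / 2)⁻¹ - -(M / J) * θ⁻¹ ≤ M / (J * θ) := by
        rw [show M / (J * θ) = M / J * θ⁻¹ by field_simp]
        have : 0 ≤ M / J := by positivity
        linarith
      calc _ ≤ M / (J * θ) * (2 * (J * θ)) := mul_le_mul e (by linarith) (by positivity) (by positivity)
        _ = 2 * M := by field_simp
        _ ≤ 6 * M := by linarith
  refine ⟨6 * M, by linarith, fun H J θ hJ hH => ?_⟩
  have hr : |θ - round θ| ≤ 1 / 2 := abs_sub_round θ
  have hps : ∀ (n : ℤ) (u : ℝ), psiS H J (u + n) = psiS H J u := by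
    intro n u
    simp only [psiS]
    congr 1
    refine Finset.sum_congr rfl fun h _ => ?_
    rw [show 2 * π * ((h + 1 : ℕ) : ℝ) * (u + n) = 2 * π * (h + 1 : ℕ) * u + ((h + 1 : ℕ) * n : ℤ) * (2 * π) by push_cast; ring, sin_add_int_mul_two_pi]
  rcases lt_or_ge J 1 with h | hJ1
  · have : psiS H J θ = 0 := by
      simp only [psiS]
      rw [Finset.sum_eq_zero, neg_zero]
      intro h' _
      rw [chi_zero ((one_le_div hJ).2 (by push_cast; linarith [Nat.cast_nonneg (α := ℝ) h']))]; simp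
    rw [this, sub_zero]
    refine (psi_abs θ).trans ?_
    rw [le_div_iff₀ (by positivity)]
    nlinarith [abs_nonneg (θ - round θ)]
  · obtain ⟨v, hv⟩ : ∃ v, v = θ - round θ := ⟨_, rfl⟩
    have e1 : psiS H J θ = psiS H J v := by rw [← hps (round θ) v, hv]; congr 1; ring
    have e2 : psi θ = psi v := by simp [psi, hv]
    rw [e1, e2, ← hv]
    rw [← hv, abs_le] at hr
    rcases lt_trichotomy v 0 with h0 | h0 | h0
    · have h1 := hmain H J (-v) hJ1 hH (by linarith) (by linarith [hr.1])
      have h2 : psiS H J (-v) = -psiS H J v := by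
        simp only [psiS, mul_neg, sin_neg, neg_div, Finset.sum_neg_distrib]
      have h3 : psi v = v + 1 - 1 / 2 := by
        rw [psi, ← Int.fract_add_one v, Int.fract_eq_self.2 ⟨by linarith [hr.1], by linarith⟩]
      rw [abs_of_neg h0, h3, ← abs_neg]
      convert h1 using 2
      rw [h2]; ring
    · have : psiS H J 0 = 0 := by simp [psiS]
      rw [h0, this]; simp [psi]; linarith
    · have h3 : psi v = v - 1 / 2 := by
        rw [psi, Int.fract_eq_self.2 ⟨by linarith, by linarith [hr.2]⟩]
      rw [abs_of_pos h0, h3]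
      exact hmain H J v hJ1 hH h0 hr.2

lemma harm_near (x : ℝ) (hx : 1 ≤ x) (K : ℕ) (hK : ⌊x⌋₊ ≤ K) :
    ∑ k ∈ Finset.Icc 1 K, 1 / (1 + |x - k|) ≤ 4 * (1 + log K) := by
  set n := ⌊x⌋₊ with hn
  have h1 : (n : ℝ) ≤ x := Nat.floor_le (by linarith)
  have h2 : x < n + 1 := Nat.lt_floor_add_one x
  have hK1 : ∑ j ∈ Finset.Icc 1 K, 1 / (j : ℝ) ≤ 1 + log K := by
    have := harmonic_le_one_add_log K
    rw [harmonic_eq_sum_Icc] at this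
    push_cast at this
    simpa using this
  have hterm : ∀ k ∈ Finset.Icc 1 K, 1 / (1 + |x - k|) ≤
      2 * ((if k ≤ n then 1 / ((n + 1 - k : ℕ) : ℝ) else 0) + if k ≤ n then 0 else 1 / ((k - n : ℕ) : ℝ)) := by
    intro k _
    split_ifs with h
    · have h' : (k : ℝ) ≤ n := by exact_mod_cast h
      rw [Nat.cast_sub (by omega), abs_of_nonneg (by linarith), add_zero, mul_one_div]
      push_cast
      rw [div_le_div_iff₀ (by linarith) (by linarith)]; linarith
    · have h' : (n : ℝ) + 1 ≤ k := by exact_mod_cast (by omega)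
      rw [Nat.cast_sub (by omega), abs_of_nonpos (by linarith), zero_add, mul_one_div]
      rw [div_le_div_iff₀ (by linarith) (by linarith)]; linarith
  refine (Finset.sum_le_sum hterm).trans ?_
  rw [← Finset.mul_sum, Finset.sum_add_distrib]
  have a1 : ∑ k ∈ Finset.Icc 1 K, (if k ≤ n then 1 / ((n + 1 - k : ℕ) : ℝ) else 0) ≤ 1 + log K := by
    refine le_trans ?_ hK1
    rw [← Finset.sum_filter, ← Finset.sum_image (f := fun j : ℕ => 1 / (j : ℝ)) (g := fun k => n + 1 - k)]
    · refine Finset.sum_le_sum_of_subset_of_nonneg ?_ fun _ _ _ => by positivity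
      intro j hj
      simp only [Finset.mem_image, Finset.mem_filter, Finset.mem_Icc] at hj ⊢
      omega
    · intro a ha b hb hab
      simp only [Finset.coe_filter, Finset.mem_Icc, Set.mem_ofPred_eq] at ha hb hab
      omega
  have a2 : ∑ k ∈ Finset.Icc 1 K, (if k ≤ n then 0 else 1 / ((k - n : ℕ) : ℝ)) ≤ 1 + log K := by
    refine le_trans ?_ hK1
    rw [Finset.sum_congr rfl fun k _ => (ite_not (k ≤ n) (1 / ((k - n : ℕ) : ℝ)) 0).symm]
    rw [← Finset.sum_filter, ← Finset.sum_image (f := fun j : ℕ => 1 / (j : ℝ)) (g := fun k => k - n)]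
    · refine Finset.sum_le_sum_of_subset_of_nonneg ?_ fun _ _ _ => by positivity
      intro j hj
      simp only [Finset.mem_image, Finset.mem_filter, Finset.mem_Icc] at hj ⊢
      omega
    · intro a ha b hb hab
      simp only [Finset.coe_filter, Finset.mem_Icc, Set.mem_ofPred_eq] at ha hb hab
      omega
  linarith

lemma one_add_log_le (ε : ℝ) (hε : 0 < ε) : ∃ C : ℝ, 1 ≤ C ∧ ∀ x : ℝ, 1 ≤ x → 1 + log x ≤ C * x ^ ε := by
  refine ⟨1 + 1 / ε, by linarith [one_div_pos.2 hε], fun x hx => ?_⟩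
  have h1 := Real.log_le_rpow_div (by linarith : 0 ≤ x) hε
  have h2 := Real.one_le_rpow hx hε.le
  calc _ ≤ x ^ ε + x ^ ε / ε := by linarith
    _ = _ := by ring

lemma sum_near (ε : ℝ) (hε : 0 < ε) : ∃ C : ℝ, 1 ≤ C ∧ ∀ t D : ℝ, 1 ≤ t → 1 ≤ D →
    ∑ a ∈ Finset.Icc 1 ⌊2 * t⌋₊, 1 / (1 + a / D * |t ^ 2 / a - round (t ^ 2 / a)|) ≤ C * D * t ^ ε := by
  obtain ⟨C1, hC1, h1⟩ := dd_bound (ε / 4) (by linarith)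
  obtain ⟨C2, hC2, h2⟩ := one_add_log_le (ε / 4) (by linarith)
  refine ⟨C1 * (4 * C2) * (3 : ℝ) ^ (ε / 4 + ε / 4), ?_, fun t D ht hD => ?_⟩
  · have : (1:ℝ) ≤ 3 ^ (ε / 4 + ε / 4) := Real.one_le_rpow (by norm_num) (by linarith)
    have : (1:ℝ) ≤ C1 * (4 * C2) := by nlinarith
    nlinarith
  set x := t ^ 2 with hx
  have hx1 : 1 ≤ x := by nlinarith
  set K := ⌊2 * x⌋₊ with hKdef
  set kk : ℕ → ℕ := fun a => a * (round (x / a)).toNat with hkk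
  have key : ∀ a ∈ Finset.Icc 1 ⌊2 * t⌋₊, kk a ∈ Finset.Icc 1 K ∧ 1 / (1 + a / D * |x / a - round (x / a)|) ≤ D * (1 / (1 + |x - kk a|)) := by
    intro a ha
    rw [Finset.mem_Icc] at ha
    have ha1 : (1 : ℝ) ≤ a := by exact_mod_cast ha.1
    have ha2 : (a : ℝ) ≤ 2 * t := (Nat.le_floor_iff (by linarith)).1 ha.2
    have hr := abs_sub_round (x / a)
    have hxa : 1 / 2 ≤ x / a := by
      rw [div_le_div_iff₀ (by norm_num) (by linarith)]; nlinarith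
    have hr1 : 1 ≤ round (x / a) := by
      rw [round_eq, Int.le_floor]; push_cast; linarith
    have hc : ((round (x / a)).toNat : ℝ) = (round (x / a) : ℝ) := by
      have := Int.toNat_of_nonneg (show 0 ≤ round (x / a) by omega)
      exact_mod_cast this
    have hk : (kk a : ℝ) = a * (round (x / a) : ℝ) := by simp only [hkk]; push_cast; rw [hc]
    have hd : a * |x / a - round (x / a)| = |x - kk a| := by
      rw [hk, ← abs_of_pos (show (0:ℝ) < a by linarith), ← abs_mul, abs_of_pos (show (0:ℝ) < a by linarith)]
      congr 1; field_simp
    have hd2 : |x - kk a| ≤ t := by rw [← hd]; nlinarith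
    refine ⟨Finset.mem_Icc.2 ⟨?_, ?_⟩, ?_⟩
    · have : 1 ≤ (round (x / a)).toNat := by omega
      exact Nat.mul_pos ha.1 this
    · rw [Nat.le_floor_iff (by linarith)]
      have := (abs_le.1 hd2).1
      nlinarith
    · rw [div_mul_eq_mul_div, hd, mul_one_div, div_le_div_iff₀ (by positivity) (by positivity)]
      have : |x - kk a| / D * D = |x - kk a| := by field_simp
      linarith [abs_nonneg (x - kk a)]
  have hKle : (K : ℝ) ≤ 2 * x := Nat.floor_le (by linarith)
  have hK1 : 1 ≤ K := Nat.le_floor (by push_cast; linarith)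
  have hK1' : (1 : ℝ) ≤ K := by exact_mod_cast hK1
  calc _ ≤ ∑ a ∈ Finset.Icc 1 ⌊2 * t⌋₊, D * (1 / (1 + |x - kk a|)) := Finset.sum_le_sum fun a ha => (key a ha).2
    _ = ∑ k ∈ Finset.Icc 1 K, ∑ a ∈ Finset.Icc 1 ⌊2 * t⌋₊ with kk a = k, D * (1 / (1 + |x - kk a|)) :=
        (Finset.sum_fiberwise_of_maps_to (fun a ha => (key a ha).1) _).symm
    _ ≤ ∑ k ∈ Finset.Icc 1 K, (C1 * (K : ℝ) ^ (ε / 4)) * (D * (1 / (1 + |x - k|))) := by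
        refine Finset.sum_le_sum fun k hk => ?_
        rw [Finset.mem_Icc] at hk
        calc _ = ∑ a ∈ Finset.Icc 1 ⌊2 * t⌋₊ with kk a = k, D * (1 / (1 + |x - k|)) :=
              Finset.sum_congr rfl fun a ha => by rw [(Finset.mem_filter.1 ha).2]
          _ = _ := by rw [Finset.sum_const, nsmul_eq_mul]
          _ ≤ dd k * (D * (1 / (1 + |x - k|))) := by
              refine mul_le_mul_of_nonneg_right ?_ (by positivity)
              unfold dd
              norm_cast
              refine Finset.card_le_card fun a ha => ?_
              rw [Finset.mem_filter] at ha
              rw [Nat.mem_divisors]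
              exact ⟨⟨_, ha.2.symm⟩, by omega⟩
          _ ≤ _ := by
              refine mul_le_mul_of_nonneg_right ((h1 k (by omega)).trans ?_) (by positivity)
              have : (k:ℝ) ≤ K := by exact_mod_cast hk.2
              gcongr
    _ = C1 * (K : ℝ) ^ (ε / 4) * D * ∑ k ∈ Finset.Icc 1 K, 1 / (1 + |x - k|) := by
        rw [Finset.mul_sum]; refine Finset.sum_congr rfl fun k _ => by ring
    _ ≤ C1 * (K : ℝ) ^ (ε / 4) * D * (4 * (C2 * (K:ℝ) ^ (ε / 4))) := by
        refine mul_le_mul_of_nonneg_left ((harm_near x hx1 K (Nat.floor_le_floor (by linarith))).trans ?_) (by positivity)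
        linarith [h2 K hK1']
    _ = C1 * (4 * C2) * D * ((K:ℝ) ^ (ε / 4 + ε / 4)) := by rw [Real.rpow_add (by linarith)]; ring
    _ ≤ C1 * (4 * C2) * D * ((3:ℝ) ^ (ε / 4 + ε / 4) * t ^ ε) := by
        refine mul_le_mul_of_nonneg_left ?_ (by positivity)
        have : t ^ ε = (t ^ 2) ^ (ε / 4 + ε / 4) := by
          rw [← Real.rpow_natCast t 2, ← Real.rpow_mul (by linarith)]; congr 1; push_cast; ring
        rw [this, ← Real.mul_rpow (by norm_num) (by positivity)]
        exact Real.rpow_le_rpow (by linarith) (by linarith) (by linarith)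
    _ = _ := by ring

lemma delta_S (ε : ℝ) (hε : 0 < ε) : ∃ C : ℝ, 1 ≤ C ∧ ∀ (t η : ℝ) (H : ℕ), 1 ≤ t → 1 ≤ η * t → 2 ≤ η * H →
    |Δ (t ^ 2) + 2 * ∑ a ∈ Finset.Icc 1 ⌊2 * t⌋₊, om (log (a / t)) * psiS H (a / (η * t)) (t ^ 2 / a)| ≤ C * (η * t) * t ^ ε := by
  obtain ⟨C0, hC0, h0⟩ := psiS_approx
  obtain ⟨C1, hC1, h1⟩ := sum_near ε hε
  refine ⟨100 + 2 * C0 * C1, by nlinarith, fun t η H ht hη hH => ?_⟩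
  have A := delta_avg ht
  have hη0 : 0 < η := by by_contra h; push Not at h; nlinarith
  have hte := Real.one_le_rpow ht hε.le
  have B : |∑ a ∈ Finset.Icc 1 ⌊2 * t⌋₊, om (log (a / t)) * psi (t ^ 2 / a) - ∑ a ∈ Finset.Icc 1 ⌊2 * t⌋₊, om (log (a / t)) * psiS H (a / (η * t)) (t ^ 2 / a)| ≤ C0 * (C1 * (η * t) * t ^ ε) := by
    rw [← Finset.sum_sub_distrib]
    refine (Finset.abs_sum_le_sum_abs _ _).trans (le_trans ?_ (mul_le_mul_of_nonneg_left (h1 t (η * t) ht hη) (by linarith)))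
    rw [Finset.mul_sum]
    refine Finset.sum_le_sum fun a ha => ?_
    rw [Finset.mem_Icc] at ha
    have ha1 : (1 : ℝ) ≤ a := by exact_mod_cast ha.1
    have ha2 : (a : ℝ) ≤ 2 * t := (Nat.le_floor_iff (by linarith)).1 ha.2
    rw [← mul_sub, abs_mul, abs_of_nonneg (om_nonneg _), mul_one_div]
    have := h0 H (a / (η * t)) (t ^ 2 / a) (by positivity) (by
      rw [div_le_iff₀ (by positivity)]; nlinarith)
    exact (mul_le_of_le_one_left (abs_nonneg _) (om_le _)).trans this
  have hp : 100 ≤ 100 * (η * t * t ^ ε) := by nlinarith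
  rw [abs_le] at *
  constructor <;> linarith [A.1, A.2, B.1, B.2]

lemma ibp {a b : ℝ} (hab : a ≤ b) {φ φ' W W' K K' : ℝ → ℝ}
    (h1 : ∀ v ∈ Set.Icc a b, HasDerivAt φ (φ' v) v) (h2 : ∀ v ∈ Set.Icc a b, HasDerivAt W (W' v) v)
    (h3 : ∀ v ∈ Set.Icc a b, HasDerivAt K (K' v) v) (c1 : ContinuousOn φ' (Set.Icc a b))
    (c2 : ContinuousOn W' (Set.Icc a b)) (c3 : ContinuousOn K' (Set.Icc a b))
    (h : ∀ v ∈ Set.Icc a b, |W' v| ≤ K' v) :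
    ‖∫ v in a..b, ((W v * φ' v : ℝ) : ℂ) * ee (φ v)‖ ≤ |W a| + |W b| + (K b - K a) := by
  have cφ : ContinuousOn φ (Set.Icc a b) := fun v hv => (h1 v hv).continuousAt.continuousWithinAt
  have cW : ContinuousOn W (Set.Icc a b) := fun v hv => (h2 v hv).continuousAt.continuousWithinAt
  have ce : ContinuousOn (fun v => ee (φ v)) (Set.Icc a b) := ee_cont.comp_continuousOn cφ
  have hd : ∀ v ∈ Set.uIcc a b, HasDerivAt (fun v => (W v : ℂ) * ee (φ v))
      ((W' v : ℂ) * ee (φ v) + W v * (2 * π * φ' v * Complex.I * ee (φ v))) v := by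
    intro v hv
    rw [Set.uIcc_of_le hab] at hv
    exact ((h2 v hv).ofReal_comp).mul ((ee_deriv (h1 v hv)).congr_deriv (by ring))
  have i1 : IntervalIntegrable (fun v => (W' v : ℂ) * ee (φ v)) volume a b :=
    ContinuousOn.intervalIntegrable (by rw [Set.uIcc_of_le hab]; exact (Complex.continuous_ofReal.comp_continuousOn c2).mul ce)
  have i2 : IntervalIntegrable (fun v => ((W v * φ' v : ℝ) : ℂ) * ee (φ v)) volume a b :=
    ContinuousOn.intervalIntegrable (by rw [Set.uIcc_of_le hab]; exact (Complex.continuous_ofReal.comp_continuousOn (cW.mul c1)).mul ce)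
  have heq : (fun v => (W' v : ℂ) * ee (φ v) + W v * (2 * π * φ' v * Complex.I * ee (φ v))) =
      fun v => (W' v : ℂ) * ee (φ v) + (2 * π * Complex.I) * (((W v * φ' v : ℝ) : ℂ) * ee (φ v)) := by
    funext v; push_cast; ring
  have F := intervalIntegral.integral_eq_sub_of_hasDerivAt hd (by rw [heq]; exact i1.add (i2.const_mul _))
  rw [heq, intervalIntegral.integral_add i1 (i2.const_mul _), intervalIntegral.integral_const_mul] at F
  have k1 : ‖∫ v in a..b, (W' v : ℂ) * ee (φ v)‖ ≤ K b - K a := by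
    rw [← intervalIntegral.integral_eq_sub_of_hasDerivAt (fun v hv => h3 v (by rwa [Set.uIcc_of_le hab] at hv))
      (ContinuousOn.intervalIntegrable (by rwa [Set.uIcc_of_le hab]))]
    refine intervalIntegral.norm_integral_le_of_norm_le hab (.of_forall fun v hv => ?_)
      (ContinuousOn.intervalIntegrable (by rwa [Set.uIcc_of_le hab]))
    rw [norm_mul, ee_norm, mul_one, Complex.norm_real]
    exact h v ⟨hv.1.le, hv.2⟩
  set I := ∫ v in a..b, ((W v * φ' v : ℝ) : ℂ) * ee (φ v)
  have k2 : (2 * π * Complex.I) * I = (W b : ℂ) * ee (φ b) - (W a : ℂ) * ee (φ a) - ∫ v in a..b, (W' v : ℂ) * ee (φ v) := by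
    rw [← F]; ring
  have k3 : ‖(2 * π * Complex.I) * I‖ = 2 * π * ‖I‖ := by simp [abs_of_pos pi_pos]
  have k4 : ‖(2 * π * Complex.I) * I‖ ≤ |W a| + |W b| + (K b - K a) := by
    rw [k2]
    refine (norm_sub_le _ _).trans ?_
    have : ‖(W b : ℂ) * ee (φ b) - (W a : ℂ) * ee (φ a)‖ ≤ |W a| + |W b| := by
      refine (norm_sub_le _ _).trans ?_
      rw [norm_mul, norm_mul, ee_norm, ee_norm, Complex.norm_real, Complex.norm_real]
      simp [add_comm]
    linarith
  rw [k3] at k4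
  nlinarith [pi_gt_three, norm_nonneg I]

lemma self_le_sinh {v : ℝ} (h : 0 ≤ v) : v ≤ sinh v := Real.self_le_sinh_iff.2 h

lemma cosh_le_two {v : ℝ} (h : |v| ≤ 1) : cosh v ≤ 2 := by
  have : cosh v ≤ cosh 1 := Real.cosh_le_cosh.2 (by simpa using h)
  rw [Real.cosh_eq 1] at this
  have h1 := Real.exp_one_lt_d9
  have h2 : exp (-1) ≤ 1 := Real.exp_le_one_iff.2 (by norm_num)
  linarith

lemma near0 {f f' : ℝ → ℝ} {M c : ℝ} (hc : 1 ≤ c) (hf : ∀ v, HasDerivAt f (f' v) v)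
    (cf : Continuous f') (h0 : f 0 = 0) (hM : ∀ v ∈ Set.Icc (0:ℝ) 1, |f' v| ≤ M) :
    ‖∫ v in (0:ℝ)..1, (f v : ℂ) * ee (2 * c * cosh v)‖ ≤ 5 * M * (1 + log c) / c := by
  have cff : Continuous f := continuous_iff_continuousAt.2 fun v => (hf v).continuousAt
  have hM0 : 0 ≤ M := (abs_nonneg _).trans (hM 0 (by simp))
  have hb : ∀ v ∈ Set.Icc (0:ℝ) 1, |f v| ≤ M * v := by
    intro v hv
    have := Convex.norm_image_sub_le_of_norm_hasDerivWithin_le (fun x _ => (hf x).hasDerivWithinAt) (fun x hx => hM x hx) (convex_Icc 0 1) (Set.left_mem_Icc.2 zero_le_one) hv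
    simpa [h0, abs_of_nonneg hv.1] using this
  set s := 1 / sqrt c with hs
  have hsc : 1 ≤ sqrt c := Real.one_le_sqrt.2 hc
  have hs0 : 0 < s := by positivity
  have hs1 : s ≤ 1 := by rw [hs, div_le_one (by positivity)]; exact hsc
  have hs2 : s ^ 2 = 1 / c := by rw [hs, div_pow, Real.sq_sqrt (by linarith)]; simp
  have hlog : log s = - (log c / 2) := by rw [hs, log_div one_ne_zero (by positivity), log_sqrt (by linarith)]; simp
  have hii : ∀ x y : ℝ, IntervalIntegrable (fun v => (f v : ℂ) * ee (2 * c * cosh v)) volume x y := fun x y =>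
    ((Complex.continuous_ofReal.comp cff).mul (ee_cont.comp (continuous_const.mul continuous_cosh))).intervalIntegrable _ _
  rw [← intervalIntegral.integral_add_adjacent_intervals (hii 0 s) (hii s 1)]
  have p1 : ‖∫ v in (0:ℝ)..s, (f v : ℂ) * ee (2 * c * cosh v)‖ ≤ M / c := by
    have := intervalIntegral.norm_integral_le_of_norm_le_const (a := 0) (b := s) (C := M * s) (f := fun v => (f v : ℂ) * ee (2 * c * cosh v)) (by
      intro v hv
      rw [Set.uIoc_of_le hs0.le] at hv
      rw [norm_mul, ee_norm, mul_one, Complex.norm_real]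
      exact (hb v ⟨hv.1.le, hv.2.trans hs1⟩).trans (by gcongr; exact hv.2))
    refine this.trans (le_of_eq ?_)
    rw [sub_zero, abs_of_pos hs0, mul_assoc, ← sq, hs2]; ring
  have hpos : ∀ v ∈ Set.Icc s 1, 0 < v ∧ v ≤ sinh v ∧ 0 < sinh v := fun v hv =>
    have h : 0 < v := hs0.trans_le hv.1
    ⟨h, self_le_sinh h.le, h.trans_le (self_le_sinh h.le)⟩
  have p2 := ibp (a := s) (b := 1) hs1 (φ := fun v => 2 * c * cosh v) (φ' := fun v => 2 * c * sinh v)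
    (W := fun v => f v / (2 * c * sinh v)) (W' := fun v => (f' v * (2 * c * sinh v) - f v * (2 * c * cosh v)) / (2 * c * sinh v) ^ 2)
    (K := fun v => 3 * M / (2 * c) * log v) (K' := fun v => 3 * M / (2 * c) * v⁻¹)
    (fun v _ => (hasDerivAt_cosh v).const_mul _)
    (fun v hv => (hf v).div ((hasDerivAt_sinh v).const_mul _) (by have := (hpos v hv).2.2; positivity))
    (fun v hv => (hasDerivAt_log (hpos v hv).1.ne').const_mul _)
    (by fun_prop)
    (ContinuousOn.div (by fun_prop) (by fun_prop) fun v hv => by have := (hpos v hv).2.2; positivity)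
    (continuousOn_const.mul (continuousOn_inv₀.mono fun v hv => (hpos v hv).1.ne'))
    (by
      intro v hv
      obtain ⟨q1, q2, q3⟩ := hpos v hv
      have hv' : v ∈ Set.Icc (0:ℝ) 1 := ⟨q1.le, hv.2⟩
      have r1 := hM v hv'
      have r2 := hb v hv'
      have r3 := cosh_le_two (v := v) (by rw [abs_of_pos q1]; exact hv.2)
      have r4 := cosh_pos v
      rw [abs_div, abs_of_nonneg (show 0 ≤ (2 * c * sinh v) ^ 2 by positivity), div_le_iff₀ (by positivity)]
      calc _ ≤ |f' v * (2 * c * sinh v)| + |f v * (2 * c * cosh v)| := abs_sub _ _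
        _ = |f' v| * (2 * c * sinh v) + |f v| * (2 * c * cosh v) := by
            rw [abs_mul (f' v), abs_mul (f v), abs_of_pos (show 0 < 2 * c * sinh v by positivity), abs_of_pos (show 0 < 2 * c * cosh v by positivity)]
        _ ≤ M * (2 * c * sinh v) + (M * v) * (2 * c * 2) := by gcongr
        _ ≤ M * (2 * c * sinh v) + (M * sinh v) * (2 * c * 2) := by gcongr
        _ = 6 * M * c * sinh v := by ring
        _ ≤ 6 * M * c * sinh v * (sinh v / v) := by
            refine le_mul_of_one_le_right (by positivity) ?_
            rw [le_div_iff₀ q1]; linarith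
        _ = _ := by field_simp; ring)
  have e1 : ∀ v ∈ Set.Icc s 1, |f v / (2 * c * sinh v)| ≤ M / (2 * c) := by
    intro v hv
    obtain ⟨q1, q2, q3⟩ := hpos v hv
    rw [abs_div, abs_of_pos (show 0 < 2 * c * sinh v by positivity), div_le_div_iff₀ (by positivity) (by positivity)]
    have r2 := hb v ⟨q1.le, hv.2⟩
    have : |f v| ≤ M * sinh v := r2.trans (by gcongr)
    linarith [mul_le_mul_of_nonneg_right this (show 0 ≤ 2 * c by positivity)]
  have p3 : ‖∫ v in s..1, (f v : ℂ) * ee (2 * c * cosh v)‖ ≤ M / c + 3 * M / (2 * c) * (log c / 2) := by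
    have : ∫ v in s..1, (f v : ℂ) * ee (2 * c * cosh v) = ∫ v in s..1, ((f v / (2 * c * sinh v) * (2 * c * sinh v) : ℝ) : ℂ) * ee (2 * c * cosh v) := by
      refine intervalIntegral.integral_congr fun v hv => ?_
      rw [Set.uIcc_of_le hs1] at hv
      have := (hpos v hv).2.2
      rw [div_mul_cancel₀ _ (by positivity)]
    rw [this]
    refine p2.trans ?_
    have a1 := e1 s ⟨le_rfl, hs1⟩
    have a2 := e1 1 ⟨hs1, le_rfl⟩
    have : M / c = M / (2 * c) + M / (2 * c) := by field_simp; norm_num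
    simp only [log_one, hlog]
    linarith
  refine (norm_add_le _ _).trans ((add_le_add p1 p3).trans ?_)
  rw [le_div_iff₀ (by linarith)]
  have hl := log_nonneg hc
  have : (M / c + (M / c + 3 * M / (2 * c) * (log c / 2))) * c = 2 * M + 3 / 4 * (M * log c) := by field_simp; ring
  rw [this]
  nlinarith [mul_nonneg hM0 hl]

lemma gsqrt {c : ℝ} (hc : 1 ≤ c) :
    ‖((1 / (1 - 8 * c * Complex.I) : ℂ) ^ (1 / 2 : ℂ)) - ee (1 / 8) / sqrt (8 * c)‖ ≤ 1 / c := by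
  set b : ℂ := 1 - 8 * c * Complex.I with hb
  have hb0 : b ≠ 0 := by
    intro h; have := congrArg Complex.re h; simp [hb] at this
  set z := (1 / b) ^ (1 / 2 : ℂ) with hz
  set z0 : ℂ := ee (1 / 8) / sqrt (8 * c) with hz0
  have hs : (sqrt (8 * c)) ^ 2 = 8 * c := Real.sq_sqrt (by linarith)
  have hsp : 0 < sqrt (8 * c) := Real.sqrt_pos.2 (by linarith)
  have z2 : z ^ 2 = 1 / b := by
    rw [hz, ← Complex.cpow_nat_mul]; norm_num
  have e4 : ee (1 / 8) ^ 2 = Complex.I := by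
    rw [sq, ← ee_add, ee]
    rw [show (2 * π * ((1 / 8 + 1 / 8 : ℝ) : ℂ) * Complex.I) = π / 2 * Complex.I by push_cast; ring, Complex.exp_pi_div_two_mul_I]
  have z02 : z0 ^ 2 = Complex.I / (8 * c) := by
    rw [hz0, div_pow, e4]; congr 1; exact_mod_cast hs
  have zre : 0 ≤ z.re := by
    rw [hz, Complex.cpow_def_of_ne_zero (one_div_ne_zero hb0), Complex.exp_re]
    refine mul_nonneg (Real.exp_nonneg _) (Real.cos_nonneg_of_mem_Icc ?_)
    have : (Complex.log (1 / b) * (1 / 2)).im = Complex.arg (1 / b) / 2 := by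
      rw [show (1 / 2 : ℂ) = ((1 / 2 : ℝ) : ℂ) by push_cast; rfl, Complex.im_mul_ofReal, Complex.log_im]; ring
    rw [this]
    have a1 := Complex.neg_pi_lt_arg (1 / b)
    have a2 := Complex.arg_le_pi (1 / b)
    constructor <;> linarith
  have z0re : 1 / (2 * sqrt (8 * c)) ≤ z0.re := by
    rw [hz0, Complex.div_ofReal_re, ee_re, show 2 * π * (1 / 8) = π / 4 by ring, cos_pi_div_four, div_le_div_iff₀ (by positivity) hsp]
    have : 1 ≤ sqrt 2 := Real.one_le_sqrt.2 (by norm_num)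
    nlinarith
  have hsum : 1 / (2 * sqrt (8 * c)) ≤ ‖z + z0‖ := by
    refine le_trans ?_ (Complex.re_le_norm _)
    rw [Complex.add_re]; linarith
  have hc8 : (8 * c : ℂ) ≠ 0 := by
    have : (c:ℂ) ≠ 0 := by exact_mod_cast (by linarith : c ≠ 0)
    simpa using this
  have hdiff : (z - z0) * (z + z0) = -Complex.I / (b * (8 * c)) := by
    rw [show (z - z0) * (z + z0) = z ^ 2 - z0 ^ 2 by ring, z2, z02]
    rw [div_sub_div _ _ hb0 hc8]
    congr 1
    rw [hb]; ring_nf; rw [Complex.I_sq]; ring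
  have nb : 8 * c ≤ ‖b‖ := by
    have := Complex.abs_im_le_norm b
    have h2 : b.im = -(8 * c) := by simp [hb]
    rw [h2, abs_neg, abs_of_pos (by linarith)] at this; exact this
  have hn : ‖z - z0‖ * ‖z + z0‖ ≤ 1 / (8 * c) ^ 2 := by
    rw [← norm_mul, hdiff, norm_div, norm_neg, Complex.norm_I, norm_mul, show ‖(8 * c : ℂ)‖ = 8 * c by
      rw [show (8 * c : ℂ) = ((8 * c : ℝ) : ℂ) by push_cast; rfl, Complex.norm_real, norm_of_nonneg (by linarith)]]
    rw [sq]; gcongr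
  have h9 : ‖z - z0‖ * (1 / (2 * sqrt (8 * c))) ≤ 1 / (8 * c) ^ 2 :=
    (mul_le_mul_of_nonneg_left hsum (norm_nonneg _)).trans hn
  have h10 : ‖z - z0‖ ≤ 1 / (8 * c) ^ 2 * (2 * sqrt (8 * c)) := by
    rw [mul_one_div, div_le_iff₀ (by positivity)] at h9; exact h9
  refine h10.trans ?_
  have : sqrt (8 * c) ≤ 8 * c := by
    rw [Real.sqrt_le_left (by linarith)]; nlinarith
  rw [one_div_mul_eq_div, div_le_div_iff₀ (by positivity) (by positivity)]
  nlinarith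

lemma gtail {c : ℝ} (hc : 1 ≤ c) {a b : ℝ} (ha : 1 / 2 ≤ a) (hab : a ≤ b) :
    ‖∫ w in a..b, Complex.exp (-(π * (1 - 8 * c * Complex.I)) * (w:ℂ) ^ 2)‖ ≤ 1 / c := by
  have hw : ∀ w ∈ Set.Icc a b, 0 < w := fun w hw => by linarith [hw.1]
  have := ibp hab (φ := fun w => 4 * c * w ^ 2) (φ' := fun w => 4 * c * (2 * w))
    (W := fun w => exp (-π * w ^ 2) / (4 * c * (2 * w)))
    (W' := fun w => (exp (-π * w ^ 2) * (-π * (2 * w)) * (4 * c * (2 * w)) - exp (-π * w ^ 2) * (4 * c * 2)) / (4 * c * (2 * w)) ^ 2)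
    (K := fun w => -(exp (-π * w ^ 2) / (4 * c * (2 * w))))
    (K' := fun w => -((exp (-π * w ^ 2) * (-π * (2 * w)) * (4 * c * (2 * w)) - exp (-π * w ^ 2) * (4 * c * 2)) / (4 * c * (2 * w)) ^ 2))
    (fun w _ => by simpa using (hasDerivAt_pow 2 w).const_mul (4 * c))
    (fun w hv => ?_) (fun w hv => ?_) (by fun_prop) ?_ ?_ ?_
  · have hW : ∀ w, a ≤ w → 0 ≤ exp (-π * w ^ 2) / (4 * c * (2 * w)) ∧ exp (-π * w ^ 2) / (4 * c * (2 * w)) ≤ 1 / (4 * c) := by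
      intro w hw
      have h0 : 0 < w := by linarith
      refine ⟨by positivity, ?_⟩
      have e1 : exp (-π * w ^ 2) ≤ 1 := Real.exp_le_one_iff.2 (by nlinarith [pi_pos, sq_nonneg w])
      rw [div_le_div_iff₀ (by positivity) (by positivity)]
      nlinarith
    have h1 := hW a le_rfl
    have h2 := hW b hab
    rw [abs_of_nonneg h1.1, abs_of_nonneg h2.1] at this
    have h3 : 1 / c = 4 * (1 / (4 * c)) := by field_simp
    refine le_trans (le_of_eq ?_) (this.trans (by linarith))
    congr 1
    refine intervalIntegral.integral_congr fun w hw' => ?_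
    rw [Set.uIcc_of_le hab] at hw'
    have := hw w hw'
    rw [div_mul_cancel₀ _ (by positivity), Complex.ofReal_exp, ee, ← Complex.exp_add]
    congr 1; push_cast; ring
  · have := hw w hv
    refine HasDerivAt.div ?_ (by simpa using ((hasDerivAt_id w).const_mul 2).const_mul (4 * c)) (by positivity)
    exact ((hasDerivAt_pow 2 w).const_mul (-π)).exp.congr_deriv (by simp)
  · have := hw w hv
    refine (HasDerivAt.div ?_ (by simpa using ((hasDerivAt_id w).const_mul 2).const_mul (4 * c)) (by positivity)).neg
    exact ((hasDerivAt_pow 2 w).const_mul (-π)).exp.congr_deriv (by simp)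
  · exact ContinuousOn.div (by fun_prop) (by fun_prop) fun w hv => by have := hw w hv; positivity
  · exact (ContinuousOn.div (by fun_prop) (by fun_prop) fun w hv => by have := hw w hv; positivity).neg
  · intro w hv
    have := hw w hv
    rw [abs_of_nonpos]
    refine div_nonpos_of_nonpos_of_nonneg ?_ (by positivity)
    have := pi_pos
    have : 0 ≤ exp (-π * w ^ 2) * (π * (2 * w)) * (4 * c * (2 * w)) := by positivity
    have : 0 ≤ exp (-π * w ^ 2) * (4 * c * 2) := by positivity
    linarith

lemma fres {c : ℝ} (hc : 1 ≤ c) :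
    ‖(∫ v in (0:ℝ)..1, ((cosh (v / 2) * exp (-π * sinh (v / 2) ^ 2) : ℝ) : ℂ) * ee (2 * c * cosh v)) - ee (2 * c + 1 / 8) / (2 * sqrt (2 * c))‖ ≤ 3 / c := by
  set b : ℂ := π * (1 - 8 * c * Complex.I) with hb
  set f : ℝ → ℂ := fun w => Complex.exp (-b * (w:ℂ) ^ 2) with hf
  have hbre : 0 < b.re := by simp [hb, pi_pos]
  have cf : Continuous f := by simp only [hf]; fun_prop
  set w1 := sinh (1 / 2) with hw1
  have hw : 1 / 2 ≤ w1 := self_le_sinh (by norm_num)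
  have h1 : ∫ v in (0:ℝ)..1, ((cosh (v / 2) * exp (-π * sinh (v / 2) ^ 2) : ℝ) : ℂ) * ee (2 * c * cosh v) = 2 * ee (2 * c) * ∫ w in (0:ℝ)..w1, f w := by
    have := intervalIntegral.integral_deriv_smul_comp (a := 0) (b := 1) (f := fun v => sinh (v / 2)) (f' := fun v => cosh (v / 2) * (1 / 2)) (g := f)
      (fun v _ => ((hasDerivAt_id v).div_const 2).sinh) (by fun_prop) cf
    simp only [zero_div, sinh_zero] at this
    rw [hw1, ← this, ← intervalIntegral.integral_const_mul]
    refine intervalIntegral.integral_congr fun v _ => ?_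
    have hcv : 2 * c * cosh v = 2 * c + 4 * c * sinh (v / 2) ^ 2 := by
      have := Real.cosh_two_mul (v / 2)
      rw [show 2 * (v / 2) = v by ring] at this
      rw [this, Real.cosh_sq]; ring
    simp only [Function.comp, hf, hcv, ee_add, Complex.real_smul]
    have : (Complex.exp (-b * ((sinh (v / 2) : ℝ) : ℂ) ^ 2)) = ((exp (-π * sinh (v / 2) ^ 2) : ℝ) : ℂ) * ee (4 * c * sinh (v / 2) ^ 2) := by
      rw [Complex.ofReal_exp, ee, ← Complex.exp_add]
      congr 1; rw [hb]; push_cast; ring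
    rw [this]; push_cast; ring
  have h2 := integral_gaussian_complex_Ioi hbre
  have hint : Integrable f := integrable_cexp_neg_mul_sq hbre
  have h3 : ‖(∫ w in (0:ℝ)..w1, f w) - (π / b) ^ (1 / 2 : ℂ) / 2‖ ≤ 1 / c := by
    rw [← h2]
    have lim := intervalIntegral_tendsto_integral_Ioi (0:ℝ) hint.integrableOn Filter.tendsto_id
    have lim2 := (tendsto_const_nhds (x := ∫ w in (0:ℝ)..w1, f w)).sub lim
    refine le_of_tendsto lim2.norm ?_
    filter_upwards [Filter.eventually_ge_atTop w1] with R hR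
    rw [norm_sub_rev, id, intervalIntegral.integral_interval_sub_left (cf.intervalIntegrable _ _) (cf.intervalIntegrable _ _)]
    exact gtail hc hw hR
  have hpb : (π / b : ℂ) = 1 / (1 - 8 * c * Complex.I) := by
    have : (π : ℂ) ≠ 0 := by exact_mod_cast pi_ne_zero
    rw [hb, div_mul_eq_div_div, div_self this]
  rw [hpb] at h3
  have h4 := gsqrt hc
  have hs : sqrt (8 * c) = 2 * sqrt (2 * c) := by
    rw [show 8 * c = 2 ^ 2 * (2 * c) by ring, Real.sqrt_mul (by norm_num), Real.sqrt_sq (by norm_num)]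
  rw [h1, ee_add]
  set z := ((1 / (1 - 8 * c * Complex.I) : ℂ) ^ (1 / 2 : ℂ))
  set I := ∫ w in (0:ℝ)..w1, f w
  have : 2 * ee (2 * c) * I - ee (2 * c) * ee (1 / 8) / (2 * sqrt (2 * c)) = ee (2 * c) * (2 * (I - z / 2) + (z - ee (1 / 8) / sqrt (8 * c))) := by
    rw [hs]; push_cast; ring
  rw [this, norm_mul, ee_norm, one_mul]
  refine (norm_add_le _ _).trans ?_
  rw [norm_mul]
  have : ‖(2:ℂ)‖ = 2 := by simp
  rw [this]
  have : 3 / c = 2 * (1 / c) + 1 / c := by ring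
  linarith

lemma near1 : ∃ C : ℝ, 1 ≤ C ∧ ∀ (f f' : ℝ → ℝ) (M c : ℝ), 1 ≤ c → (∀ v, HasDerivAt f (f' v) v) → Continuous f' →
    (∀ v ∈ Set.Icc (0:ℝ) 1, |f' v| ≤ M) → |f 0| ≤ 1 → 1 ≤ M →
    ‖(∫ v in (0:ℝ)..1, (f v : ℂ) * ee (2 * c * cosh v)) - f 0 * (ee (2 * c + 1 / 8) / (2 * sqrt (2 * c)))‖ ≤ C * M * (1 + log c) / c := by
  set q : ℝ → ℝ := fun v => cosh (v / 2) * exp (-π * sinh (v / 2) ^ 2) with hq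
  have qd : ContDiff ℝ 1 q := by
    have : ContDiff ℝ 1 (fun v : ℝ => v / 2) := by fun_prop
    exact (Real.contDiff_cosh.comp this).mul ((contDiff_const.mul ((Real.contDiff_sinh.comp this).pow 2)).exp)
  have qd' : ∀ v, HasDerivAt q (deriv q v) v := fun v => (qd.differentiable (by simp)).differentiableAt.hasDerivAt
  have qc : Continuous (deriv q) := qd.continuous_deriv (by simp)
  obtain ⟨B, hB⟩ := isCompact_Icc.exists_bound_of_continuousOn (s := Set.Icc (0:ℝ) 1) qc.continuousOn
  have hB0 : 0 ≤ B := (norm_nonneg _).trans (hB 0 (by simp))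
  refine ⟨5 * (1 + B) + 3, by linarith, fun f f' M c hc hf cf hM h0 hM1 => ?_⟩
  have hl := log_nonneg hc
  have q0 : q 0 = 1 := by simp [hq]
  have n0 := near0 (f := fun v => f v - f 0 * q v) (f' := fun v => f' v - f 0 * deriv q v) (M := M + B) hc
    (fun v => (hf v).sub ((qd' v).const_mul _)) (cf.sub (continuous_const.mul qc)) (by simp [q0]) (by
      intro v hv
      refine (abs_sub _ _).trans (add_le_add (hM v hv) ?_)
      rw [abs_mul]
      have := hB v hv
      rw [norm_eq_abs] at this
      nlinarith [abs_nonneg (f 0), abs_nonneg (deriv q v)])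
  have cff : Continuous f := continuous_iff_continuousAt.2 fun v => (hf v).continuousAt
  have ce : Continuous fun v => ee (2 * c * cosh v) := ee_cont.comp (continuous_const.mul continuous_cosh)
  have s1 : ∫ v in (0:ℝ)..1, (f v : ℂ) * ee (2 * c * cosh v) = (∫ v in (0:ℝ)..1, ((f v - f 0 * q v : ℝ) : ℂ) * ee (2 * c * cosh v)) + f 0 * ∫ v in (0:ℝ)..1, (q v : ℂ) * ee (2 * c * cosh v) := by
    rw [← intervalIntegral.integral_const_mul, ← intervalIntegral.integral_add]
    · refine intervalIntegral.integral_congr fun v _ => ?_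
      push_cast; ring
    · exact ((Complex.continuous_ofReal.comp (cff.sub (continuous_const.mul qd.continuous))).mul ce).intervalIntegrable _ _
    · exact (continuous_const.mul ((Complex.continuous_ofReal.comp qd.continuous).mul ce)).intervalIntegrable _ _
  have F := fres hc
  rw [s1, add_sub_assoc, ← mul_sub]
  refine (norm_add_le _ _).trans ((add_le_add n0 (show _ ≤ 3 / c from ?_)).trans ?_)
  · rw [norm_mul, Complex.norm_real, norm_eq_abs]
    calc _ ≤ 1 * (3 / c) := by gcongr
      _ = _ := one_mul _
  · rw [← add_div]
    gcongr
    have : 0 ≤ M * log c := by positivity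
    linarith [mul_nonneg hB0 hl, mul_nonneg hB0 (mul_nonneg (by linarith : 0 ≤ M) hl), mul_nonneg (by linarith : 0 ≤ M - 1) hB0, mul_nonneg (mul_nonneg (by linarith : 0 ≤ M - 1) hB0) hl]

noncomputable def chiT (s : ℝ) : ℝ := chi (exp (-s))
noncomputable def gg (l k v : ℝ) : ℝ := om (v + l) * chiT (v + k)
noncomputable def gg' (l k v : ℝ) : ℝ := deriv om (v + l) * chiT (v + k) + om (v + l) * deriv chiT (v + k)

lemma chiT_cd : ContDiff ℝ 1 chiT := (chi_cd (n := 1)).comp (contDiff_neg.exp)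
lemma chiT_hd (s : ℝ) : HasDerivAt chiT (deriv chiT s) s := (chiT_cd.differentiable (by simp)).differentiableAt.hasDerivAt
lemma chiT_dc : Continuous (deriv chiT) := chiT_cd.continuous_deriv (by simp)
lemma chiT_mono : Monotone chiT := by
  intro a b h
  refine smoothTransition.monotone ?_
  have : exp (-b) ≤ exp (-a) := Real.exp_le_exp.2 (by linarith)
  have := Real.exp_pos (-b)
  nlinarith
lemma chiT_nonneg (s : ℝ) : 0 ≤ chiT s := chi_nonneg _
lemma chiT_le (s : ℝ) : chiT s ≤ 1 := chi_le _
lemma chiT_zero {s : ℝ} (h : s ≤ 0) : chiT s = 0 := chi_zero (Real.one_le_exp (by linarith))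

lemma gg_hd (l k v : ℝ) : HasDerivAt (gg l k) (gg' l k v) v :=
  ((om_hd _).comp_add_const v l).mul ((chiT_hd _).comp_add_const v k)
lemma gg'_c (l k : ℝ) : Continuous (gg' l k) := by
  have a := continuous_add_const (M := ℝ) l; have b := continuous_add_const (M := ℝ) k
  exact ((om_dc.comp a).mul (chiT_cd.continuous.comp b)).add (((om_cd (n := 0)).continuous.comp a).mul (chiT_dc.comp b))

lemma gg_c (l k : ℝ) : Continuous (gg l k) := continuous_iff_continuousAt.2 fun v => (gg_hd l k v).continuousAt
lemma gg_nonneg (l k v : ℝ) : 0 ≤ gg l k v := mul_nonneg (om_nonneg _) (chiT_nonneg _)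
lemma gg_le (l k v : ℝ) : gg l k v ≤ 1 := mul_le_one₀ (om_le _) (chiT_nonneg _) (chiT_le _)
lemma gg'_le (l k v : ℝ) : |gg' l k v| ≤ deriv chiT (v + k) - deriv om (v + l) := by
  have h1 : deriv om (v + l) ≤ 0 := om_anti.deriv_nonpos
  have h2 : 0 ≤ deriv chiT (v + k) := chiT_mono.deriv_nonneg
  have := om_nonneg (v + l); have := om_le (v + l); have := chiT_nonneg (v + k); have := chiT_le (v + k)
  unfold gg'
  rw [abs_le]; constructor <;> nlinarith

lemma gg'_bd : ∃ M : ℝ, 1 ≤ M ∧ ∀ l k v, |gg' l k v| ≤ M := by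
  obtain ⟨M, hM, h1, -⟩ := chi_bounds
  have hc : HasCompactSupport (deriv om) := by
    refine HasCompactSupport.intro (isCompact_Icc (a := (-1/2:ℝ)) (b := 1/2)) fun x hx => ?_
    simp only [Set.mem_Icc, not_and_or, not_le] at hx
    rcases hx with h | h
    · have : om =ᶠ[nhds x] fun _ => 1 := by
        filter_upwards [Iio_mem_nhds h] with y hy using om_one (le_of_lt hy)
      rw [this.deriv_eq]; simp
    · have : om =ᶠ[nhds x] fun _ => 0 := by
        filter_upwards [Ioi_mem_nhds h] with y hy using om_zero (le_of_lt hy)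
      rw [this.deriv_eq]; simp
  obtain ⟨M1, hM1⟩ := hc.exists_bound_of_continuous om_dc
  have hM10 : 0 ≤ M1 := (norm_nonneg _).trans (hM1 0)
  refine ⟨M + M1, by linarith, fun l k v => (gg'_le l k v).trans ?_⟩
  have a1 := hM1 (v + l)
  have a2 : deriv chiT (v + k) ≤ M := by
    set s := v + k
    rcases lt_or_ge s 0 with h | h
    · have : chiT =ᶠ[nhds s] fun _ => 0 := by
        filter_upwards [Iio_mem_nhds h] with y hy using chiT_zero (le_of_lt hy)
      rw [this.deriv_eq]; simp; linarith
    · have hd : HasDerivAt chiT (deriv chi (exp (-s)) * (exp (-s) * -1)) s :=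
        HasDerivAt.comp s (((chi_cd (n := 1)).differentiable (by simp)).differentiableAt.hasDerivAt) (hasDerivAt_neg s).exp
      rw [hd.deriv]
      refine (le_abs_self _).trans ?_
      rw [abs_mul, mul_neg_one, abs_neg, abs_of_pos (exp_pos _)]
      have : exp (-s) ≤ 1 := Real.exp_le_one_iff.2 (by linarith)
      nlinarith [h1 (exp (-s)), abs_nonneg (deriv chi (exp (-s)))]
  rw [norm_eq_abs, abs_le] at a1
  linarith

lemma far {a b : ℝ} (hab : a ≤ b) (l k : ℝ) {φ φ' E E' : ℝ → ℝ} {B σ : ℝ} (hσ : σ = 1 ∨ σ = -1)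
    (h1 : ∀ v ∈ Set.Icc a b, HasDerivAt φ (φ' v) v) (h2 : ∀ v ∈ Set.Icc a b, HasDerivAt E (E' v) v)
    (c1 : ContinuousOn φ' (Set.Icc a b)) (c2 : ContinuousOn E' (Set.Icc a b))
    (hE : ∀ v ∈ Set.Icc a b, |E v| ≤ B) (hs : ∀ v ∈ Set.Icc a b, 0 ≤ σ * E' v) {A : ℝ → ℝ}
    (hA : ∀ v ∈ Set.Icc a b, A v = E v * φ' v) :
    ‖∫ v in a..b, ((gg l k v * A v : ℝ) : ℂ) * ee (φ v)‖ ≤ 6 * B := by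
  have cE : ContinuousOn E (Set.Icc a b) := fun v hv => (h2 v hv).continuousAt.continuousWithinAt
  have hB : 0 ≤ B := (abs_nonneg _).trans (hE a ⟨le_rfl, hab⟩)
  have := ibp hab (φ := φ) (φ' := φ') (W := fun v => gg l k v * E v) (W' := fun v => gg' l k v * E v + gg l k v * E' v)
    (K := fun v => B * (chiT (v + k) - om (v + l)) + σ * E v) (K' := fun v => B * (deriv chiT (v + k) - deriv om (v + l)) + σ * E' v)
    h1 (fun v hv => (gg_hd l k v).mul (h2 v hv))
    (fun v hv => ((((chiT_hd _).comp_add_const v k).sub ((om_hd _).comp_add_const v l)).const_mul _).add ((h2 v hv).const_mul _))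
    c1 (((gg'_c l k).continuousOn.mul cE).add ((gg_c l k).continuousOn.mul c2))
    (by
      have q1 := om_dc; have q2 := chiT_dc
      exact ContinuousOn.add (by fun_prop) (continuousOn_const.mul c2))
    (by
      intro v hv
      refine (abs_add_le _ _).trans ?_
      rw [abs_mul, abs_mul, abs_of_nonneg (gg_nonneg l k v)]
      have q1 := gg'_le l k v
      have q2 := hE v hv
      have q3 : |E' v| = σ * E' v := by
        rw [← abs_of_nonneg (hs v hv), abs_mul]
        rcases hσ with h | h <;> simp [h]
      have q4 := mul_le_of_le_one_left (abs_nonneg (E' v)) (gg_le l k v)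
      have : |gg' l k v| * |E v| ≤ (deriv chiT (v + k) - deriv om (v + l)) * B := mul_le_mul q1 q2 (abs_nonneg _) ((abs_nonneg _).trans q1)
      linarith)
  have heq : ∫ v in a..b, ((gg l k v * A v : ℝ) : ℂ) * ee (φ v) = ∫ v in a..b, ((gg l k v * E v * φ' v : ℝ) : ℂ) * ee (φ v) := by
    refine intervalIntegral.integral_congr fun v hv => ?_
    rw [Set.uIcc_of_le hab] at hv
    simp only [hA v hv, mul_assoc]
  rw [heq]
  refine this.trans ?_
  have w : ∀ v ∈ Set.Icc a b, |gg l k v * E v| ≤ B ∧ |σ * E v| ≤ B := fun v hv => by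
    rw [abs_mul, abs_of_nonneg (gg_nonneg l k v)]
    have : |σ * E v| = |E v| := by rw [abs_mul]; rcases hσ with h | h <;> simp [h]
    rw [this]
    exact ⟨(mul_le_of_le_one_left (abs_nonneg (E v)) (gg_le l k v)).trans (hE v hv), hE v hv⟩
  have wa := w a ⟨le_rfl, hab⟩
  have wb := w b ⟨hab, le_rfl⟩
  have k1 : chiT (b + k) - om (b + l) - (chiT (a + k) - om (a + l)) ≤ 2 := by
    linarith [chiT_le (b + k), om_nonneg (b + l), chiT_nonneg (a + k), om_le (a + l)]
  have := mul_le_mul_of_nonneg_left k1 hB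
  have z1 := abs_le.1 wa.2
  have z2 := abs_le.1 wb.2
  linarith [wa.1, wb.1, z1.1, z1.2, z2.1, z2.2]

lemma esinh_hd {v c : ℝ} (hc : 0 < c) (hv : v ≠ 0) :
    HasDerivAt (fun v => exp v / (2 * c * sinh v)) (-1 / (2 * c * sinh v ^ 2)) v := by
  have hs : sinh v ≠ 0 := by rwa [Ne, Real.sinh_eq_zero]
  refine ((Real.hasDerivAt_exp v).div ((hasDerivAt_sinh v).const_mul (2 * c)) (by positivity)).congr_deriv ?_
  have : exp v * cosh v - exp v * sinh v = 1 := by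
    rw [← mul_sub, Real.cosh_sub_sinh, ← Real.exp_add]; simp
  rw [div_eq_div_iff (by positivity) (by positivity)]
  linear_combination (-4 * c ^ 2 * sinh v ^ 2) * this

lemma SP : ∃ C : ℝ, 1 ≤ C ∧ ∀ l k c a b : ℝ, 1 ≤ c → a ≤ -1 → 1 ≤ b →
    ‖(∫ v in a..b, ((gg l k v * exp v : ℝ) : ℂ) * ee (2 * c * cosh v)) - gg l k 0 * (ee (2 * c + 1 / 8) / sqrt (2 * c))‖ ≤ C * (1 + log c) / c := by
  obtain ⟨C0, hC0, h0⟩ := near1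
  obtain ⟨M, hM, hg'⟩ := gg'_bd
  refine ⟨2 * (C0 * (3 * (M + 1))) + 24, by nlinarith, fun l k c a b hc ha hb => ?_⟩
  have hcp : 0 < c := by linarith
  have hl := log_nonneg hc
  set F : ℝ → ℂ := fun v => ((gg l k v * exp v : ℝ) : ℂ) * ee (2 * c * cosh v) with hF
  have cF : Continuous F := (Complex.continuous_ofReal.comp ((gg_c l k).mul continuous_exp)).mul
    (ee_cont.comp (continuous_const.mul continuous_cosh))
  have ii : ∀ x y, IntervalIntegrable F volume x y := fun x y => cF.intervalIntegrable _ _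
  have split : ∫ v in a..b, F v = (∫ v in a..(-1), F v) + (∫ v in (0:ℝ)..1, F (-v)) + (∫ v in (0:ℝ)..1, F v) + ∫ v in (1:ℝ)..b, F v := by
    rw [intervalIntegral.integral_comp_neg, neg_zero, intervalIntegral.integral_add_adjacent_intervals (ii _ _) (ii _ _),
      intervalIntegral.integral_add_adjacent_intervals (ii _ _) (ii _ _), intervalIntegral.integral_add_adjacent_intervals (ii _ _) (ii _ _)]
  have e1 : exp 1 ≤ 3 := by linarith [Real.exp_one_lt_d9]
  have e2 : 2 ≤ exp 1 := by linarith [Real.add_one_le_exp 1]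
  have P : ‖∫ v in (1:ℝ)..b, F v‖ ≤ 6 * (2 / c) := by
    refine far hb l k (φ := fun v => 2 * c * cosh v) (φ' := fun v => 2 * c * sinh v) (E := fun v => exp v / (2 * c * sinh v))
      (E' := fun v => -1 / (2 * c * sinh v ^ 2)) (σ := -1) (Or.inr rfl) (fun v _ => (hasDerivAt_cosh v).const_mul _)
      (fun v hv => esinh_hd hcp (by linarith [hv.1])) (by fun_prop)
      (ContinuousOn.div (by fun_prop) (by fun_prop) fun v hv => ?_) ?_ ?_ ?_
    · have : 0 < sinh v := Real.sinh_pos_iff.2 (by linarith [hv.1])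
      positivity
    · intro v hv
      have : 0 < sinh v := Real.sinh_pos_iff.2 (by linarith [hv.1])
      rw [abs_of_pos (by positivity), div_le_div_iff₀ (by positivity) hcp]
      have q1 : exp 1 ≤ exp v := Real.exp_le_exp.2 hv.1
      have q2 : exp (-v) ≤ 1 := Real.exp_le_one_iff.2 (by linarith [hv.1])
      rw [Real.sinh_eq]
      nlinarith
    · intro v hv
      rw [show -1 * (-1 / (2 * c * sinh v ^ 2)) = 1 / (2 * c * sinh v ^ 2) by ring]; positivity
    · intro v hv
      have : 0 < sinh v := Real.sinh_pos_iff.2 (by linarith [hv.1])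
      field_simp
  have N : ‖∫ v in a..(-1), F v‖ ≤ 6 * (2 / c) := by
    have hsn : ∀ v ∈ Set.Icc a (-1), sinh v < 0 := fun v hv => Real.sinh_neg_iff.2 (by linarith [hv.2])
    refine far ha l k (φ := fun v => 2 * c * cosh v) (φ' := fun v => 2 * c * sinh v) (E := fun v => exp v / (2 * c * sinh v))
      (E' := fun v => -1 / (2 * c * sinh v ^ 2)) (σ := -1) (Or.inr rfl) (fun v _ => (hasDerivAt_cosh v).const_mul _)
      (fun v hv => esinh_hd hcp (by linarith [hv.2])) (by fun_prop)
      (ContinuousOn.div (by fun_prop) (by fun_prop) fun v hv => ?_) ?_ ?_ ?_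
    · have := (hsn v hv).ne; positivity
    · intro v hv
      have h3 := hsn v hv
      rw [abs_div, abs_of_pos (exp_pos v), abs_of_neg (by nlinarith), div_le_div_iff₀ (by nlinarith) hcp]
      have q1 : exp 1 ≤ exp (-v) := Real.exp_le_exp.2 (by linarith [hv.2])
      have q2 : exp v ≤ 1 := Real.exp_le_one_iff.2 (by linarith [hv.2])
      rw [Real.sinh_eq]
      nlinarith
    · intro v hv
      rw [show -1 * (-1 / (2 * c * sinh v ^ 2)) = 1 / (2 * c * sinh v ^ 2) by ring]; positivity
    · intro v hv
      have := (hsn v hv).ne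
      field_simp
  have g0 := gg_nonneg l k 0
  have ex : ∀ v ∈ Set.Icc (0:ℝ) 1, exp v ≤ 3 ∧ exp (-v) ≤ 3 := fun v hv =>
    ⟨(Real.exp_le_exp.2 hv.2).trans e1, (Real.exp_le_one_iff.2 (by linarith [hv.1])).trans (by norm_num)⟩
  have A1 := h0 (fun v => gg l k v * exp v) (fun v => gg' l k v * exp v + gg l k v * exp v) (3 * (M + 1)) c hc
    (fun v => (gg_hd l k v).mul (Real.hasDerivAt_exp v)) (((gg'_c l k).mul continuous_exp).add ((gg_c l k).mul continuous_exp))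
    (fun v hv => by
      rw [← add_mul, abs_mul, abs_of_pos (exp_pos v), mul_comm (3:ℝ)]
      refine mul_le_mul ((abs_add_le _ _).trans (add_le_add (hg' l k v) ?_)) (ex v hv).1 (exp_pos v).le (by linarith)
      rw [abs_of_nonneg (gg_nonneg _ _ _)]; exact gg_le _ _ _) (by simpa [abs_of_nonneg g0] using gg_le l k 0) (by linarith)
  have A2 := h0 (fun v => gg l k (-v) * exp (-v)) (fun v => -gg' l k (-v) * exp (-v) + gg l k (-v) * (exp (-v) * -1)) (3 * (M + 1)) c hc
    (fun v => (((gg_hd l k (-v)).comp v (hasDerivAt_neg v)).congr_deriv (by ring)).mul (hasDerivAt_neg v).exp)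
    (by have := gg'_c l k; have := gg_c l k; fun_prop)
    (fun v hv => by
      rw [show -gg' l k (-v) * exp (-v) + gg l k (-v) * (exp (-v) * -1) = -(gg' l k (-v) + gg l k (-v)) * exp (-v) by ring, abs_mul, abs_neg, abs_of_pos (exp_pos (-v)), mul_comm (3:ℝ)]
      refine mul_le_mul ((abs_add_le _ _).trans (add_le_add (hg' l k (-v)) ?_)) (ex v hv).2 (exp_pos (-v)).le (by linarith)
      rw [abs_of_nonneg (gg_nonneg _ _ _)]; exact gg_le _ _ _) (by simpa [abs_of_nonneg g0] using gg_le l k 0) (by linarith)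
  simp only [neg_zero, exp_zero, mul_one] at A1 A2
  have hF2 : ∫ v in (0:ℝ)..1, F (-v) = ∫ v in (0:ℝ)..1, ((gg l k (-v) * exp (-v) : ℝ) : ℂ) * ee (2 * c * cosh v) := by
    simp only [hF, Real.cosh_neg]
  rw [← hF2] at A2
  have hh : (ee (2 * c + 1 / 8) / sqrt (2 * c) : ℂ) = ee (2 * c + 1 / 8) / (2 * sqrt (2 * c)) + ee (2 * c + 1 / 8) / (2 * sqrt (2 * c)) := by
    ring
  rw [split, hh]
  set z : ℂ := ee (2 * c + 1 / 8) / (2 * sqrt (2 * c))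
  rw [show ∀ p q r s g : ℂ, p + q + r + s - g * (z + z) = p + s + ((q - g * z) + (r - g * z)) by intros; ring]
  refine (norm_add_le _ _).trans ((add_le_add ((norm_add_le _ _).trans (add_le_add N P)) ((norm_add_le _ _).trans (add_le_add A2 A1))).trans ?_)
  have : 24 / c ≤ 24 * (1 + log c) / c := by gcongr; linarith
  calc _ = 24 / c + 2 * (C0 * (3 * (M + 1))) * (1 + log c) / c := by ring
    _ ≤ 24 * (1 + log c) / c + 2 * (C0 * (3 * (M + 1))) * (1 + log c) / c := by linarith
    _ = _ := by ring

lemma SPneg (l k c a b : ℝ) (hc : 0 < c) (hab : a ≤ b) :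
    ‖∫ v in a..b, ((gg l k v * exp v : ℝ) : ℂ) * ee (-(2 * c * sinh v))‖ ≤ 6 * (1 / c) := by
  refine far hab l k (φ := fun v => -(2 * c * sinh v)) (φ' := fun v => -(2 * c * cosh v)) (E := fun v => -(exp v / (2 * c * cosh v)))
      (E' := fun v => -(1 / (2 * c * cosh v ^ 2))) (σ := -1) (Or.inr rfl) (fun v _ => ((hasDerivAt_sinh v).const_mul _).neg)
      (fun v hv => ?_) (by fun_prop) (ContinuousOn.neg (ContinuousOn.div (by fun_prop) (by fun_prop) fun v hv => ?_)) ?_ ?_ ?_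
  · have hcv := cosh_pos v
    refine ((Real.hasDerivAt_exp v).div ((hasDerivAt_cosh v).const_mul (2 * c)) (by positivity)).neg.congr_deriv ?_
    have : exp v * cosh v - exp v * sinh v = 1 := by
      rw [← mul_sub, Real.cosh_sub_sinh, ← Real.exp_add]; simp
    rw [neg_inj, div_eq_div_iff (by positivity) (by positivity)]
    linear_combination (4 * c ^ 2 * cosh v ^ 2) * this
  · have hcv := cosh_pos v
    positivity
  · intro v hv
    have hcv := cosh_pos v
    rw [abs_neg, abs_of_pos (by positivity), div_le_div_iff₀ (by positivity) hc, Real.cosh_eq]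
    nlinarith [exp_pos (-v), exp_pos v]
  · intro v hv
    rw [show -1 * -(1 / (2 * c * cosh v ^ 2)) = 1 / (2 * c * cosh v ^ 2) by ring]; positivity
  · intro v hv
    have hcv := cosh_pos v
    field_simp

lemma SPzero (l k N a b : ℝ) (hN : 0 < N) (hab : a ≤ b) (hb : b ≤ 1) :
    ‖∫ v in a..b, ((gg l k v * exp v : ℝ) : ℂ) * ee (N * exp (-v))‖ ≤ 6 * (9 / N) := by
  refine far hab l k (φ := fun v => N * exp (-v)) (φ' := fun v => N * (exp (-v) * -1)) (E := fun v => -(exp v * exp v / N))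
      (E' := fun v => -((exp v * exp v + exp v * exp v) / N)) (σ := -1) (Or.inr rfl) (fun v _ => (hasDerivAt_neg v).exp.const_mul N)
      (fun v hv => (((Real.hasDerivAt_exp v).mul (Real.hasDerivAt_exp v)).div_const N).neg) (by fun_prop) (by fun_prop) ?_ ?_ ?_
  · intro v hv
    have e1 : exp v ≤ 3 := (Real.exp_le_exp.2 (hv.2.trans hb)).trans (by linarith [Real.exp_one_lt_d9])
    rw [abs_neg, abs_of_pos (by positivity)]
    gcongr
    nlinarith [exp_pos v]
  · intro v hv
    rw [show -1 * -((exp v * exp v + exp v * exp v) / N) = (exp v * exp v + exp v * exp v) / N by ring]; positivity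
  · intro v hv
    rw [Real.exp_neg]
    field_simp

noncomputable def wJ (J u : ℝ) : ℝ := 1 / (1 + J * |u - round u|)

lemma wJ_bd (J u : ℝ) (hJ : 0 ≤ J) : 0 ≤ wJ J u ∧ wJ J u ≤ 1 := by
  have : 0 ≤ J * |u - round u| := by positivity
  unfold wJ
  exact ⟨by positivity, by rw [div_le_one (by linarith)]; linarith⟩

lemma wJ_ii (J a b : ℝ) (hJ : 0 ≤ J) : IntervalIntegrable (wJ J) volume a b := by
  have hm : Measurable (wJ J) := by
    unfold wJ
    have : Measurable fun u : ℝ => ((round u : ℤ) : ℝ) := by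
      simp only [round_eq]; exact measurable_from_top.comp (Int.measurable_floor.comp (measurable_id.add_const _))
    fun_prop
  refine (intervalIntegrable_const (c := (1:ℝ))).mono_fun hm.aestronglyMeasurable (.of_forall fun u => ?_)
  have := wJ_bd J u hJ
  simp [abs_of_nonneg this.1, this.2]

lemma wJ_int (J : ℝ) (hJ : 1 ≤ J) (n : ℕ) : ∫ u in (1:ℝ)..(1 + n), wJ J u ≤ n * (2 * (1 + log J) / J) := by
  have hJ0 : 0 < J := by linarith
  have hper : Function.Periodic (wJ J) 1 := by
    intro u
    have : round (u + 1) = round u + 1 := round_add_one u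
    simp only [wJ, this]; push_cast; rw [add_sub_add_right_eq_sub]
  have h1 := hper.intervalIntegral_add_zsmul_eq n 1 (fun a b => wJ_ii J a b hJ0.le)
  simp only [natCast_zsmul, nsmul_eq_mul, mul_one] at h1
  rw [h1]
  refine mul_le_mul_of_nonneg_left ?_ (Nat.cast_nonneg n)
  rw [hper.intervalIntegral_add_eq 1 (-1/2)]
  have e1 : ∫ u in (-1/2:ℝ)..(-1/2 + 1), wJ J u = ∫ u in (-1/2:ℝ)..(-1/2+1), 1 / (1 + J * |u|) := by
    refine intervalIntegral.integral_congr_ae ?_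
    filter_upwards [(Set.finite_singleton (1/2:ℝ)).measure_zero volume |> measure_eq_zero_iff_ae_notMem.1] with u hu hu2
    rw [Set.uIoc_of_le (by norm_num)] at hu2
    have : round u = 0 := by
      rw [round_eq_zero_iff]
      refine ⟨by linarith [hu2.1], lt_of_le_of_ne (by linarith [hu2.2]) (by simpa using hu)⟩
    simp [wJ, this]
  rw [e1]
  have hc : Continuous fun u : ℝ => 1 / (1 + J * |u|) := by
    refine continuous_const.div (by fun_prop) fun u => ?_
    have : 0 ≤ J * |u| := by positivity
    linarith
  rw [show (-1/2+1 : ℝ) = 1/2 by norm_num, ← intervalIntegral.integral_add_adjacent_intervals (b := 0) (hc.intervalIntegrable _ _) (hc.intervalIntegrable _ _)]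
  have e2 : ∫ u in (-1/2:ℝ)..0, 1 / (1 + J * |u|) = ∫ u in (0:ℝ)..(1/2), 1 / (1 + J * |u|) := by
    have := intervalIntegral.integral_comp_neg (a := 0) (b := 1/2) (fun u : ℝ => 1 / (1 + J * |u|))
    simp only [abs_neg, neg_zero] at this
    rw [this, show -(1/2:ℝ) = -1/2 by ring]
  have e3 : ∫ u in (0:ℝ)..(1/2), 1 / (1 + J * |u|) = log (1 + J * (1/2)) / J := by
    have : ∀ u ∈ Set.uIcc (0:ℝ) (1/2), HasDerivAt (fun u => log (1 + J * u) / J) (1 / (1 + J * |u|)) u := by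
      intro u hu
      rw [Set.uIcc_of_le (by norm_num)] at hu
      have h0 : 0 ≤ J * u := mul_nonneg hJ0.le hu.1
      refine ((((hasDerivAt_id u).const_mul J).const_add 1).log (by simp; linarith) |>.div_const J).congr_deriv ?_
      rw [abs_of_nonneg hu.1]; simp; field_simp
    rw [intervalIntegral.integral_eq_sub_of_hasDerivAt this (hc.intervalIntegrable _ _)]; simp
  rw [e2, e3, ← two_mul, ← mul_div_assoc]
  have : log (1 + J * (1/2)) ≤ 1 + log J := by
    have : log (1 + J * (1 / 2)) ≤ log (exp 1 * J) := by
      refine Real.log_le_log (by positivity) ?_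
      nlinarith [Real.add_one_le_exp 1]
    rwa [Real.log_mul (exp_pos 1).ne' hJ0.ne', Real.log_exp] at this
  gcongr

lemma psi_meas : Measurable psi := by unfold psi; fun_prop

lemma poisson : ∃ C : ℝ, 1 ≤ C ∧ ∀ (F F' : ℝ → ℂ) (b B : ℝ) (J : ℕ), 1 ≤ b → 1 ≤ J →
    (∀ u ∈ Set.Icc 1 b, HasDerivAt F (F' u) u) → ContinuousOn F' (Set.Icc 1 b) → F 1 = 0 → F b = 0 →
    (∀ u ∈ Set.Icc 1 b, ‖F' u‖ ≤ B) →
    ‖(∑ a ∈ Finset.Icc 1 ⌊b⌋₊, F a) - ((∫ u in (1:ℝ)..b, F u) + ∑ m ∈ Finset.range J, (chi ((m + 1 : ℕ) / J) : ℂ) *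
      ((∫ u in (1:ℝ)..b, F u * ee ((m + 1 : ℕ) * u)) + ∫ u in (1:ℝ)..b, F u * ee (-((m + 1 : ℕ) * u))))‖ ≤ C * B * b * (1 + log J) / J := by
  obtain ⟨C, hC, hps⟩ := psiS_approx
  refine ⟨4 * C, by linarith, fun F F' b B J hb hJ hF cF' F1 Fb hB => ?_⟩
  have hB0 : 0 ≤ B := (norm_nonneg _).trans (hB 1 ⟨le_rfl, hb⟩)
  have hJ1 : (1:ℝ) ≤ J := by exact_mod_cast hJ
  have hu : Set.uIcc 1 b = Set.Icc 1 b := Set.uIcc_of_le hb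
  have cF : ContinuousOn F (Set.Icc 1 b) := fun v hv => (hF v hv).continuousAt.continuousWithinAt
  have iF' : ∀ g : ℝ → ℂ, Continuous g → IntervalIntegrable (fun u => F' u * g u) volume 1 b := fun g hg =>
    ContinuousOn.intervalIntegrable (by rw [hu]; exact cF'.mul hg.continuousOn)
  have iF : ∀ g : ℝ → ℂ, Continuous g → IntervalIntegrable (fun u => F u * g u) volume 1 b := fun g hg =>
    ContinuousOn.intervalIntegrable (by rw [hu]; exact cF.mul hg.continuousOn)
  have parts : ∀ g g' : ℝ → ℂ, (∀ u, HasDerivAt g (g' u) u) → Continuous g' → ∫ u in (1:ℝ)..b, F' u * g u = -∫ u in (1:ℝ)..b, F u * g' u := by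
    intro g g' hg cg
    have := intervalIntegral.integral_mul_deriv_eq_deriv_mul (a := 1) (b := b) (u := F) (v := g) (u' := F') (v' := g')
      (fun x hx => hF x (by rwa [hu] at hx)) (fun x _ => hg x) (ContinuousOn.intervalIntegrable (by rwa [hu])) (cg.intervalIntegrable _ _)
    rw [F1, Fb] at this
    rw [this]; simp
  have bp : ∀ u : ℝ, |psi u| ≤ 1 := fun u => (psi_abs u).trans (by norm_num)
  have ipsi : IntervalIntegrable (fun u => F' u * (psi u : ℂ)) volume 1 b := by
    refine (intervalIntegrable_const (c := B)).mono_fun' ?_ ?_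
    · rw [Set.uIoc_of_le hb]
      exact ((cF'.mono Set.Ioc_subset_Icc_self).aestronglyMeasurable measurableSet_Ioc).mul (Complex.measurable_ofReal.comp psi_meas).aestronglyMeasurable
    · rw [Set.uIoc_of_le hb]
      refine (ae_restrict_iff' measurableSet_Ioc).2 (.of_forall fun u hu => ?_)
      show ‖F' u * (psi u : ℂ)‖ ≤ B
      rw [norm_mul, Complex.norm_real, norm_eq_abs]
      have h1 := hB u ⟨hu.1.le, hu.2⟩
      exact (mul_le_of_le_one_right (norm_nonneg _) (bp u)).trans h1
  have S1 : ∑ a ∈ Finset.Icc 1 ⌊b⌋₊, F a = (∫ u in (1:ℝ)..b, F u) + ∫ u in (1:ℝ)..b, F' u * (psi u : ℂ) := by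
    have hdF : Set.EqOn (deriv F) F' (Set.Icc 1 b) := fun u hu => (hF u hu).deriv
    have A := sum_mul_eq_sub_integral_mul₀ (fun k => if k = 0 then (0:ℂ) else 1) (f := F) (by simp) b (fun u hu => (hF u hu).differentiableAt)
      ((cF'.integrableOn_Icc).congr_fun hdF.symm measurableSet_Icc)
    have q1 : ∀ N : ℕ, ∑ k ∈ Finset.Icc 0 N, (if k = 0 then (0:ℂ) else 1) = N := by
      intro N
      rw [← Nat.range_succ_eq_Icc_zero, Finset.sum_range_succ']; simp
    have q2 : ∑ k ∈ Finset.Icc 0 ⌊b⌋₊, F k * (if k = 0 then (0:ℂ) else 1) = ∑ a ∈ Finset.Icc 1 ⌊b⌋₊, F a := by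
      symm
      refine Finset.sum_subset_zero_on_sdiff (Finset.Icc_subset_Icc_left (by norm_num)) (fun x hx => ?_) (fun x hx => ?_)
      · have : x = 0 := by simp at hx; omega
        simp [this]
      · rw [if_neg (by simp at hx; omega), mul_one]
    rw [q2, Fb, zero_mul, zero_sub, ← intervalIntegral.integral_of_le hb] at A
    simp only [q1] at A
    have q3 : ∫ u in (1:ℝ)..b, deriv F u * (⌊u⌋₊ : ℂ) = (∫ u in (1:ℝ)..b, F' u * ((u - 1 / 2 : ℝ) : ℂ)) - ∫ u in (1:ℝ)..b, F' u * (psi u : ℂ) := by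
      rw [← intervalIntegral.integral_sub (iF' _ (by fun_prop)) ipsi]
      refine intervalIntegral.integral_congr fun u hu' => ?_
      rw [hu] at hu'
      rw [hdF hu', ← mul_sub]
      congr 1
      rw [← Complex.ofReal_sub, ← floor_eq_psi (by linarith [hu'.1])]; simp
    rw [q3, parts (fun u => ((u - 1 / 2 : ℝ) : ℂ)) (fun _ => 1) (fun u => by
      simpa using ((hasDerivAt_id u).sub_const (1/2)).ofReal_comp) continuous_const] at A
    simp only [mul_one] at A
    rw [A]; ring
  have S2 : ∫ u in (1:ℝ)..b, F' u * (psiS J J u : ℂ) = ∑ m ∈ Finset.range J, (chi ((m + 1 : ℕ) / J) : ℂ) *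
      ((∫ u in (1:ℝ)..b, F u * ee ((m + 1 : ℕ) * u)) + ∫ u in (1:ℝ)..b, F u * ee (-((m + 1 : ℕ) * u))) := by
    have q1 : ∀ u, F' u * (psiS J J u : ℂ) = ∑ m ∈ Finset.range J, (-(chi ((m + 1 : ℕ) / J) / (π * (m + 1 : ℕ)) : ℝ) : ℂ) * (F' u * (sin (2 * π * (m + 1 : ℕ) * u) : ℝ)) := by
      intro u
      simp only [psiS]
      push_cast
      rw [← Finset.sum_neg_distrib, Finset.mul_sum]
      refine Finset.sum_congr rfl fun m _ => ?_
      ring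
    simp only [q1]
    rw [intervalIntegral.integral_finsetSum fun m _ => (iF' _ (by fun_prop)).const_mul _]
    refine Finset.sum_congr rfl fun m _ => ?_
    rw [intervalIntegral.integral_const_mul, parts _ (fun u => ((cos (2 * π * (m + 1 : ℕ) * u) * (2 * π * (m + 1 : ℕ)) : ℝ) : ℂ)) (fun u => by
      have := ((hasDerivAt_id u).const_mul (2 * π * (m + 1 : ℕ))).sin.ofReal_comp
      simpa using this) (by fun_prop)]
    rw [← intervalIntegral.integral_add (iF _ (by have := ee_cont; fun_prop)) (iF _ (by have := ee_cont; fun_prop))]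
    rw [mul_neg, ← neg_mul, ← intervalIntegral.integral_const_mul, ← intervalIntegral.integral_const_mul]
    refine intervalIntegral.integral_congr fun u _ => ?_
    have hm : ((m + 1 : ℕ) : ℂ) ≠ 0 := by exact_mod_cast Nat.succ_ne_zero m
    have hpi : (π : ℂ) ≠ 0 := by exact_mod_cast pi_ne_zero
    have q2 : ee ((m + 1 : ℕ) * u) + ee (-((m + 1 : ℕ) * u)) = ((2 * cos (2 * π * (m + 1 : ℕ) * u) : ℝ) : ℂ) := by
      rw [ee_neg, Complex.add_conj, ee_re]; congr 3; ring
    rw [← mul_add, q2]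
    push_cast
    push_cast at hm
    field_simp
  rw [S1, ← S2, add_sub_add_left_eq_sub, ← intervalIntegral.integral_sub ipsi (iF' _ (by
    unfold psiS; fun_prop))]
  have hn : b ≤ 1 + ⌈b⌉₊ := by linarith [Nat.le_ceil b]
  have hn2 : (⌈b⌉₊ : ℝ) ≤ 2 * b := by linarith [Nat.ceil_lt_add_one (by linarith : 0 ≤ b)]
  have hl := log_nonneg hJ1
  calc _ ≤ ∫ u in (1:ℝ)..b, (B * C) * wJ J u := by
        refine intervalIntegral.norm_integral_le_of_norm_le hb (.of_forall fun u hu => ?_) ((wJ_ii J _ _ (by linarith)).const_mul _)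
        rw [← mul_sub, norm_mul, ← Complex.ofReal_sub, Complex.norm_real, norm_eq_abs, mul_assoc]
        have := hps J J u (by linarith) le_rfl
        refine mul_le_mul (hB u ⟨hu.1.le, hu.2⟩) (this.trans (le_of_eq ?_)) (abs_nonneg _) hB0
        rw [wJ]; ring
    _ = (B * C) * ∫ u in (1:ℝ)..b, wJ J u := intervalIntegral.integral_const_mul _ _
    _ ≤ (B * C) * ∫ u in (1:ℝ)..(1 + ⌈b⌉₊), wJ J u := by
        refine mul_le_mul_of_nonneg_left ?_ (by positivity)
        exact intervalIntegral.integral_mono_interval le_rfl hb hn (.of_forall fun u => (wJ_bd J u (by linarith)).1) (wJ_ii J _ _ (by linarith))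
    _ ≤ (B * C) * (⌈b⌉₊ * (2 * (1 + log J) / J)) := mul_le_mul_of_nonneg_left (wJ_int J hJ1 _) (by positivity)
    _ ≤ (B * C) * (2 * b * (2 * (1 + log J) / J)) := by gcongr
    _ = _ := by ring

noncomputable def Fv (t η h u : ℝ) : ℂ := (gg 0 (-log (h * η)) (log (u / t)) : ℂ) * ee (h * t ^ 2 / u)
noncomputable def Fv' (t η h u : ℝ) : ℂ := ((gg' 0 (-log (h * η)) (log (u / t)) * u⁻¹ : ℝ) : ℂ) * ee (h * t ^ 2 / u)
  + (gg 0 (-log (h * η)) (log (u / t)) : ℂ) * (2 * π * (h * t ^ 2 * (-(u ^ 2)⁻¹) : ℝ) * Complex.I * ee (h * t ^ 2 / u))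

lemma Fv_hd {t u : ℝ} (η h : ℝ) (ht : 1 ≤ t) (hu : 0 < u) : HasDerivAt (Fv t η h) (Fv' t η h u) u := by
  have h1 : HasDerivAt (fun u : ℝ => log (u / t)) u⁻¹ u :=
    (((hasDerivAt_id u).div_const t).log (by simp; constructor <;> linarith)).congr_deriv (by simp; field_simp)
  have h2 := ((gg_hd 0 (-log (h * η)) (log (u / t))).comp u h1).ofReal_comp
  have h3 : HasDerivAt (fun u : ℝ => h * t ^ 2 / u) (h * t ^ 2 * (-(u ^ 2)⁻¹)) u := (hasDerivAt_inv hu.ne').const_mul _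
  exact h2.mul (ee_deriv h3)

lemma Fv_c (t η h : ℝ) (ht : 1 ≤ t) : ContinuousOn (Fv t η h) (Set.Ioi 0) := fun _ hu => (Fv_hd η h ht hu).continuousAt.continuousWithinAt

lemma Fv'_c (t η h : ℝ) (ht : 1 ≤ t) : ContinuousOn (Fv' t η h) (Set.Ioi 0) := by
  have l : ContinuousOn (fun u : ℝ => log (u / t)) (Set.Ioi 0) := fun u hu =>
    (ContinuousAt.log (continuousAt_id.div_const t) (by simp; exact ⟨ne_of_gt hu, by linarith⟩)).continuousWithinAt
  have c0 : ContinuousOn (fun u : ℝ => u⁻¹) (Set.Ioi 0) := continuousOn_inv₀.mono (fun u hu => ne_of_gt hu)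
  have c1 : ContinuousOn (fun u : ℝ => h * t ^ 2 / u) (Set.Ioi 0) := continuousOn_const.mul c0
  have c2 : ContinuousOn (fun u : ℝ => (u ^ 2)⁻¹) (Set.Ioi 0) := (c0.pow 2).congr fun u _ => by simp
  have a1 := (gg'_c 0 (-log (h * η))).comp_continuousOn l
  have a2 := (gg_c 0 (-log (h * η))).comp_continuousOn l
  have a3 := ee_cont.comp_continuousOn c1
  unfold Fv'
  exact ((Complex.continuous_ofReal.comp_continuousOn (a1.mul c0)).mul a3).add ((Complex.continuous_ofReal.comp_continuousOn a2).mul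
    (((continuousOn_const.mul (Complex.continuous_ofReal.comp_continuousOn (continuousOn_const.mul c2.neg))).mul continuousOn_const).mul a3))

lemma Fv_one {t η h : ℝ} (ht : 1 ≤ t) (h1 : 1 ≤ h * (η * t)) : Fv t η h 1 = 0 := by
  have : 0 < h * η := by by_contra! q; nlinarith
  rw [Fv, gg, chiT_zero]; · simp
  rw [log_div one_ne_zero (by linarith), log_one]
  have := log_nonneg h1
  rw [← mul_assoc, log_mul (by linarith) (by linarith)] at this
  linarith

lemma log2_half : (1:ℝ) / 2 ≤ log 2 := by linarith [log_two_gt_d9]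

lemma Fv_two {t : ℝ} (η h : ℝ) (ht : 1 ≤ t) : Fv t η h (2 * t) = 0 := by
  rw [Fv, gg, om_zero]; · simp
  rw [mul_div_assoc, div_self (by linarith), mul_one, add_zero]; exact log2_half

lemma cov {t η h : ℝ} (ht : 1 ≤ t) (h1 : 1 ≤ h * (η * t)) (m l a b : ℝ) (ha : a ≤ -log t - l) (hb : log 2 - l ≤ b) :
    ∫ u in (1:ℝ)..(2 * t), Fv t η h u * ee (m * u) = ((t * exp l : ℝ) : ℂ) * ∫ v in a..b, ((gg l (-log (h * η) + l) v * exp v : ℝ) : ℂ) *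
      ee (h * t * exp (-l) * exp (-v) + m * t * exp l * exp v) := by
  have hp : 0 < h * η := by by_contra! q; nlinarith
  have t0 : 0 < t := by linarith
  have hlg := log_nonneg h1
  rw [← mul_assoc, log_mul hp.ne' t0.ne'] at hlg
  set f : ℝ → ℂ := fun v => ((gg l (-log (h * η) + l) v * exp v : ℝ) : ℂ) * ee (h * t * exp (-l) * exp (-v) + m * t * exp l * exp v)
  have hs : Function.support f ⊆ Set.Ioc (-log t - l) (log 2 - l) := by
    intro v hv
    by_contra hc
    apply hv
    simp only [f, gg]
    rw [Set.mem_Ioc, not_and_or] at hc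
    rcases hc with hc | hc
    · rw [chiT_zero (by push Not at hc; linarith)]; simp
    · rw [om_zero (by push Not at hc; linarith [log2_half])]; simp
  rw [intervalIntegral.integral_eq_integral_of_support_subset (hs.trans (Set.Ioc_subset_Ioc ha hb)),
    ← intervalIntegral.integral_eq_integral_of_support_subset hs, ← intervalIntegral.integral_const_mul]
  have ex : ∀ v, HasDerivAt (fun v => t * exp (v + l)) (t * exp (v + l)) v := fun v => by
    simpa using ((hasDerivAt_id v).add_const l).exp.const_mul t
  have := intervalIntegral.integral_deriv_smul_comp' (a := -log t - l) (b := log 2 - l) (f := fun v => t * exp (v + l)) (f' := fun v => t * exp (v + l))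
    (g := fun u => Fv t η h u * ee (m * u)) (fun v _ => ex v) (by fun_prop) (by
      refine ((Fv_c t η h ht).mul (ee_cont.comp (continuous_const.mul continuous_id)).continuousOn).mono ?_
      rintro _ ⟨v, _, rfl⟩
      exact mul_pos t0 (exp_pos _))
  simp only [sub_add_cancel, exp_neg, exp_log t0, exp_log (show (0:ℝ) < 2 by norm_num)] at this
  rw [mul_inv_cancel₀ t0.ne', mul_comm t 2] at this
  rw [← this]
  refine intervalIntegral.integral_congr fun v _ => ?_
  simp only [Function.comp, Fv, f]
  rw [mul_div_cancel_left₀ _ t0.ne', log_exp, mul_assoc (gg _ _ _ : ℂ), ← ee_add]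
  have e1 : h * t ^ 2 / (t * exp (v + l)) + m * (t * exp (v + l)) = h * t * exp (-l) * exp (-v) + m * t * exp l * exp v := by
    rw [exp_add, exp_neg, exp_neg]; field_simp
  have e2 : gg 0 (-log (h * η)) (v + l) = gg l (-log (h * η) + l) v := by simp only [gg]; congr 2 <;> ring
  rw [e1, e2, Complex.real_smul, exp_add]
  push_cast; ring

lemma Fv'_bd : ∃ M : ℝ, 1 ≤ M ∧ ∀ t η h u : ℝ, 0 ≤ h → 1 ≤ u → ‖Fv' t η h u‖ ≤ M + 7 * (h * t ^ 2) := by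
  obtain ⟨M, hM, hg'⟩ := gg'_bd
  refine ⟨M, hM, fun t η h u hh hu => ?_⟩
  have u1 : u⁻¹ ≤ 1 := inv_le_one_of_one_le₀ hu
  have u0 : 0 ≤ u⁻¹ := by positivity
  have u2 : (u ^ 2)⁻¹ ≤ 1 := inv_le_one_of_one_le₀ (by nlinarith)
  unfold Fv'
  refine (norm_add_le _ _).trans (add_le_add ?_ ?_)
  · rw [norm_mul, ee_norm, mul_one, Complex.norm_real, norm_eq_abs, abs_mul, abs_of_nonneg u0]
    exact (mul_le_of_le_one_right (abs_nonneg _) u1).trans (hg' _ _ _)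
  · simp only [norm_mul, ee_norm, Complex.norm_I, mul_one, Complex.norm_real, norm_eq_abs, abs_neg, abs_of_nonneg (gg_nonneg _ _ _)]
    rw [abs_of_nonneg hh, abs_of_nonneg (show 0 ≤ (u ^ 2)⁻¹ by positivity), abs_of_nonneg (sq_nonneg t), abs_of_nonneg pi_nonneg, Complex.norm_two]
    have p := pi_lt_d2
    have hht : 0 ≤ h * t ^ 2 := by positivity
    have q : h * t ^ 2 * (u ^ 2)⁻¹ ≤ h * t ^ 2 := mul_le_of_le_one_right hht u2
    have q0 : 0 ≤ h * t ^ 2 * (u ^ 2)⁻¹ := by positivity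
    calc _ ≤ 1 * (2 * π * (h * t ^ 2 * (u ^ 2)⁻¹)) := by gcongr; exact gg_le _ _ _
      _ ≤ _ := by nlinarith [pi_pos]

/-- the main Voronoi term -/
noncomputable def vmain (t η h m : ℝ) : ℂ :=
  ((sqrt (t / 2) * h ^ ((1:ℝ) / 4) * m ^ (-(3:ℝ) / 4) * (om (1 / 2 * log (h / m)) * chi (η * sqrt (h * m))) : ℝ) : ℂ) * ee (2 * t * sqrt (h * m) + 1 / 8)

lemma vint : ∃ C : ℝ, 1 ≤ C ∧ ∀ t η h m : ℝ, 1 ≤ t → 1 ≤ h → 1 ≤ m → 1 ≤ η * t →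
    ‖(∫ u in (1:ℝ)..(2 * t), Fv t η h u * ee (m * u)) - vmain t η h m‖ ≤ C * (1 + log (t * sqrt (h * m))) / m ∧
    ‖∫ u in (1:ℝ)..(2 * t), Fv t η h u * ee (-(m * u))‖ ≤ 6 / m ∧ ‖∫ u in (1:ℝ)..(2 * t), Fv t η h u‖ ≤ 54 := by
  obtain ⟨C, hC, sp⟩ := SP
  refine ⟨C, hC, fun t η h m ht hh hm he => ?_⟩
  have h0 : 0 < h := by linarith
  have m0 : 0 < m := by linarith
  have t0 : 0 < t := by linarith
  have e0 : 0 < η := by by_contra! q; nlinarith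
  have h1 : 1 ≤ h * (η * t) := one_le_mul_of_one_le_of_one_le hh he
  set l := 1 / 2 * log (h / m) with hl
  have el : exp l = sqrt h / sqrt m := by
    rw [hl, ← sqrt_div' _ m0.le, sqrt_eq_rpow, rpow_def_of_pos (by positivity)]; ring_nf
  have sh : 0 < sqrt h := sqrt_pos.2 h0
  have sm : 0 < sqrt m := sqrt_pos.2 m0
  have qh : sqrt h * sqrt h = h := mul_self_sqrt h0.le
  have qm : sqrt m * sqrt m = m := mul_self_sqrt m0.le
  have shm : sqrt (h * m) = sqrt h * sqrt m := sqrt_mul h0.le m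
  set c := t * sqrt (h * m) with hc
  have c1 : 1 ≤ c := one_le_mul_of_one_le_of_one_le ht (one_le_sqrt.2 (one_le_mul_of_one_le_of_one_le hh hm))
  have E1 : h * t * exp (-l) = c := by rw [exp_neg, el, hc, shm]; field_simp; linarith
  have E2 : m * t * exp l = c := by rw [el, hc, shm]; field_simp; linarith
  have tc : t * exp l / c = 1 / m := by rw [el, hc, shm]; field_simp; linarith
  have lt := log_nonneg ht
  have l2 : log 2 ≤ 1 := by linarith [log_two_lt_d9]
  have ab1 := neg_abs_le l
  have ab2 := le_abs_self l
  have te : 0 ≤ t * exp l := by positivity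
  refine ⟨?_, ?_, ?_⟩
  · rw [cov ht h1 m l (-log t - |l| - 1) (1 + |l|) (by linarith) (by linarith), E1, E2]
    have : vmain t η h m = ((t * exp l : ℝ) : ℂ) * (gg l (-log (h * η) + l) 0 * (ee (2 * c + 1 / 8) / sqrt (2 * c))) := by
      have g1 : gg l (-log (h * η) + l) 0 = om l * chi (η * sqrt (h * m)) := by
        simp only [gg, zero_add, chiT]
        congr 2
        rw [neg_add, neg_neg, exp_add, exp_log (by positivity), exp_neg, el, shm]; field_simp; linarith
      have g2 : sqrt (t / 2) * h ^ ((1:ℝ) / 4) * m ^ (-(3:ℝ) / 4) = t * exp l / sqrt (2 * c) := by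
        rw [eq_div_iff (by positivity), el, hc]
        have s1 : sqrt (2 * (t * sqrt (h * m))) = sqrt (t / 2) * 2 * h ^ ((1:ℝ) / 4) * m ^ ((1:ℝ) / 4) := by
          rw [show 2 * (t * sqrt (h * m)) = (t / 2) * (2 ^ 2) * sqrt (h * m) by ring, sqrt_mul (by positivity), sqrt_mul (by positivity), sqrt_sq (by norm_num),
            shm, sqrt_mul sh.le]
          simp only [sqrt_eq_rpow, ← rpow_mul h0.le, ← rpow_mul m0.le]
          norm_num; ring
        rw [s1]
        have s2 : sqrt (t / 2) * sqrt (t / 2) = t / 2 := mul_self_sqrt (by positivity)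
        have s3 : h ^ ((1:ℝ) / 4) * h ^ ((1:ℝ) / 4) = sqrt h := by rw [← rpow_add h0, sqrt_eq_rpow]; norm_num
        have s4 : m ^ (-(3:ℝ) / 4) * m ^ ((1:ℝ) / 4) = (sqrt m)⁻¹ := by rw [← rpow_add m0, sqrt_eq_rpow, ← rpow_neg m0.le]; norm_num
        calc _ = (sqrt (t / 2) * sqrt (t / 2)) * 2 * (h ^ ((1:ℝ) / 4) * h ^ ((1:ℝ) / 4)) * (m ^ (-(3:ℝ) / 4) * m ^ ((1:ℝ) / 4)) := by ring
          _ = _ := by rw [s2, s3, s4]; ring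
      rw [vmain, g1, g2, ← hl, show 2 * t * sqrt (h * m) = 2 * c by rw [hc]; ring]
      push_cast; ring
    rw [this, ← mul_sub, norm_mul, Complex.norm_real, norm_of_nonneg te]
    have := sp l (-log (h * η) + l) c (-log t - |l| - 1) (1 + |l|) c1 (by linarith [abs_nonneg l]) (by linarith [abs_nonneg l])
    calc _ ≤ (t * exp l) * (C * (1 + log c) / c) := by
          refine mul_le_mul_of_nonneg_left (le_trans (le_of_eq ?_) this) te
          congr 2
          refine intervalIntegral.integral_congr fun v _ => ?_
          rw [cosh_eq]; congr 2; ring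
      _ = C * (1 + log c) * (t * exp l / c) := by ring
      _ = _ := by rw [tc]; ring
  · have := cov ht h1 (-m) l (-log t - |l| - 1) (1 + |l|) (by linarith) (by linarith)
    rw [E1, show -m * t * exp l = -c by rw [← E2]; ring] at this
    simp only [neg_mul] at this
    rw [this, norm_mul, Complex.norm_real, norm_of_nonneg te]
    have := SPneg l (-log (h * η) + l) c (-log t - |l| - 1) (1 + |l|) (by linarith) (by linarith [abs_nonneg l])
    calc _ ≤ (t * exp l) * (6 * (1 / c)) := by
          refine mul_le_mul_of_nonneg_left (le_trans (le_of_eq ?_) this) te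
          congr 1
          refine intervalIntegral.integral_congr fun v _ => ?_
          rw [sinh_eq]; congr 2; ring
      _ = 6 * (t * exp l / c) := by ring
      _ = _ := by rw [tc]; ring
  · have := cov ht h1 0 0 (-log t) 1 (by linarith) (by linarith)
    simp only [zero_mul, ee_zero, mul_one, neg_zero, exp_zero, add_zero] at this
    rw [this, norm_mul, Complex.norm_real, norm_of_nonneg t0.le]
    have := SPzero 0 (-log (h * η)) (h * t) (-log t) 1 (by positivity) (by linarith) le_rfl
    calc _ ≤ t * (6 * (9 / (h * t))) := mul_le_mul_of_nonneg_left this t0.le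
      _ = 54 * h⁻¹ := by field_simp; norm_num
      _ ≤ _ := by linarith [inv_le_one_of_one_le₀ hh]

lemma sum_r1 {E : Type*} [AddCommMonoid E] (f : ℕ → E) (H : ℕ) : ∑ h ∈ Finset.range H, f (h + 1) = ∑ h ∈ Finset.Icc 1 H, f h := by
  rw [Finset.range_eq_Ico, Finset.sum_Ico_add' f 0 H 1]; rfl

lemma harm_le (J : ℕ) : ∑ m ∈ Finset.range J, 1 / ((m + 1 : ℕ) : ℝ) ≤ 1 + log J := by
  refine le_trans (le_of_eq ?_) (harmonic_le_one_add_log J)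
  rw [harmonic]; push_cast; simp

lemma vmain_ne {t η : ℝ} {h m : ℝ} (he : 1 ≤ η * t) (ht : 1 ≤ t) (hh : 1 ≤ h) (hm : 1 ≤ m) (hv : vmain t η h m ≠ 0) : η ^ 2 * (h * m) < 1 ∧ h * m < t ^ 2 := by
  have e0 : 0 < η := by by_contra! q; nlinarith
  have h1 : η * sqrt (h * m) < 1 := by
    by_contra! q
    apply hv
    rw [vmain, chi_zero q]; simp
  have hs := sq_sqrt (show 0 ≤ h * m by positivity)
  have q0 : 0 ≤ sqrt (h * m) := sqrt_nonneg _
  have h3 : sqrt (h * m) < t := by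
    by_contra! q
    nlinarith
  constructor
  · calc _ = (η * sqrt (h * m)) ^ 2 := by rw [mul_pow, hs]
      _ < 1 := by nlinarith [mul_nonneg e0.le q0]
  · rw [← hs]; nlinarith

lemma perh : ∃ C : ℝ, 1 ≤ C ∧ ∀ (t η : ℝ) (h H : ℕ), 1 ≤ t → 1 ≤ η * t → 1 ≤ h → h ≤ H → t ^ 2 ≤ H → 2 ≤ H →
    ‖(∑ a ∈ Finset.Icc 1 ⌊2 * t⌋₊, Fv t η h a) - ∑ m ∈ Finset.range (H ^ 4), vmain t η h (m + 1 : ℕ)‖ ≤ C * (1 + log (H ^ 4 : ℕ)) ^ 2 := by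
  obtain ⟨C1, hC1, vi⟩ := vint
  obtain ⟨C2, hC2, po⟩ := poisson
  obtain ⟨M, hM, hF'⟩ := Fv'_bd
  refine ⟨54 + (C1 + 6) + C2 * (M + 7) * 2, by nlinarith, fun t η h H ht he hh hH htH hH2 => ?_⟩
  set J := H ^ 4 with hJ
  set L := 1 + log (J : ℕ) with hL
  have hhr : (1:ℝ) ≤ h := by exact_mod_cast hh
  have hHr : (h:ℝ) ≤ H := by exact_mod_cast hH
  have hH2r : (2:ℝ) ≤ H := by exact_mod_cast hH2
  have t0 : 0 < t := by linarith
  have J1 : 1 ≤ J := Nat.one_le_pow _ _ (by omega)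
  have JH : (J:ℝ) = (H:ℝ) ^ 4 := by rw [hJ]; push_cast; rfl
  have L1 : 1 ≤ L := by have := log_nonneg (show (1:ℝ) ≤ J by exact_mod_cast J1); linarith
  have tH : t ≤ H := by nlinarith
  have P := po (Fv t η h) (Fv' t η h) (2 * t) (M + 7 * (h * t ^ 2)) J (by linarith) J1 (fun u hu => Fv_hd η h ht (by linarith [hu.1]))
    ((Fv'_c t η h ht).mono fun u hu => lt_of_lt_of_le one_pos hu.1) (Fv_one ht (one_le_mul_of_one_le_of_one_le hhr he)) (Fv_two η h ht)
    (fun u hu => hF' t η h u (by positivity) hu.1)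
  have hm1 : ∀ m : ℕ, (1:ℝ) ≤ (m + 1 : ℕ) := fun m => by push_cast; linarith [(Nat.cast_nonneg m : (0:ℝ) ≤ m)]
  have ch : ∀ m : ℕ, (chi ((m + 1 : ℕ) / J) : ℂ) * vmain t η h (m + 1 : ℕ) = vmain t η h (m + 1 : ℕ) := by
    intro m
    by_cases hv : vmain t η h (m + 1 : ℕ) = 0
    · rw [hv, mul_zero]
    · have := (vmain_ne he ht hhr (hm1 m) hv).2
      have hm := hm1 m
      set m' : ℝ := ((m + 1 : ℕ) : ℝ)
      have m2 : m' / J ≤ 1 / 2 := by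
        rw [div_le_iff₀ (by exact_mod_cast J1), JH]
        have : m' ≤ H := by nlinarith
        have h4 : (2:ℝ) ^ 3 ≤ (H:ℝ) ^ 3 := by gcongr
        linarith [mul_le_mul_of_nonneg_left h4 (show (0:ℝ) ≤ H by positivity)]
      rw [chi_one (by have : 0 ≤ m' / J := by positivity
                      nlinarith), Complex.ofReal_one, one_mul]
  set I0 := ∫ u in (1:ℝ)..(2 * t), Fv t η h u
  set Ip : ℕ → ℂ := fun m => ∫ u in (1:ℝ)..(2 * t), Fv t η h u * ee ((m + 1 : ℕ) * u)
  set In : ℕ → ℂ := fun m => ∫ u in (1:ℝ)..(2 * t), Fv t η h u * ee (-((m + 1 : ℕ) * u))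
  have E1 : ‖(I0 + ∑ m ∈ Finset.range J, (chi ((m + 1 : ℕ) / J) : ℂ) * (Ip m + In m)) - ∑ m ∈ Finset.range J, vmain t η h (m + 1 : ℕ)‖
      ≤ 54 + ∑ m ∈ Finset.range J, (C1 + 6) * L * (1 / ((m + 1 : ℕ) : ℝ)) := by
    rw [add_sub_assoc, ← Finset.sum_sub_distrib]
    refine (norm_add_le _ _).trans (add_le_add (vi t η h 1 ht hhr le_rfl he).2.2 (norm_sum_le_of_le _ fun m hm => ?_))
    obtain ⟨v1, v2, -⟩ := vi t η h (m + 1 : ℕ) ht hhr (hm1 m) he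
    conv_lhs => rw [← ch m, ← mul_sub]
    rw [norm_mul, Complex.norm_real, norm_of_nonneg (chi_nonneg _)]
    refine (mul_le_of_le_one_left (norm_nonneg _) (chi_le _)).trans ?_
    rw [add_sub_right_comm]
    refine (norm_add_le _ _).trans ((add_le_add v1 v2).trans ?_)
    have hmJ : ((m + 1 : ℕ) : ℝ) ≤ J := by exact_mod_cast Finset.mem_range.1 hm
    have lc : 1 + log (t * sqrt (h * (m + 1 : ℕ))) ≤ L := by
      rw [hL]; gcongr
      have : sqrt (h * (m + 1 : ℕ)) ≤ (H:ℝ) ^ 3 := by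
        rw [sqrt_le_left (by positivity)]
        calc (h : ℝ) * (m + 1 : ℕ) ≤ H * J := by gcongr
          _ = (H:ℝ) ^ 5 := by rw [JH]; ring
          _ ≤ (H:ℝ) ^ 6 := by gcongr <;> norm_num; linarith
          _ = _ := by ring
      calc _ ≤ (H:ℝ) * H ^ 3 := by gcongr
        _ = _ := by rw [JH]; ring
    rw [← add_div, mul_one_div]
    gcongr
    nlinarith
  rw [← Finset.mul_sum] at E1
  have hs := harm_le J
  have E2 : (C1 + 6) * L * ∑ m ∈ Finset.range J, 1 / ((m + 1 : ℕ) : ℝ) ≤ (C1 + 6) * L * L := by gcongr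
  have E3 : C2 * (M + 7 * (h * t ^ 2)) * (2 * t) * (1 + log J) / J ≤ C2 * (M + 7) * 2 * L := by
    rw [← hL, div_le_iff₀ (by exact_mod_cast J1), JH]
    have q : (h:ℝ) * t ^ 2 ≤ H * H := by gcongr
    have q2 : (M + 7 * (h * t ^ 2)) * t ≤ (M + 7) * H ^ 4 := by
      have : (M + 7 * (h * t ^ 2)) * t ≤ (M + 7 * (H * H)) * H := by gcongr
      have h1 : (1:ℝ) ≤ (H:ℝ) ^ 3 := one_le_pow₀ (by linarith)
      have h2 : (M * H : ℝ) ≤ M * H * H ^ 3 := le_mul_of_one_le_right (by positivity) h1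
      have h3 : (H:ℝ) ^ 3 ≤ H ^ 4 := by gcongr <;> norm_num; linarith
      linarith
    calc _ = C2 * 2 * L * ((M + 7 * (h * t ^ 2)) * t) := by ring
      _ ≤ C2 * 2 * L * ((M + 7) * H ^ 4) := by gcongr
      _ = _ := by ring
  refine (norm_sub_le_norm_sub_add_norm_sub _ _ _).trans ((add_le_add P E1).trans ?_)
  have : 1 ≤ L * L := one_le_mul_of_one_le_of_one_le L1 L1
  have q : L ≤ L * L := le_mul_of_one_le_left (by linarith) L1
  have q3 : C2 * (M + 7) * 2 * L ≤ C2 * (M + 7) * 2 * (L * L) := by gcongr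
  linarith

lemma sum_om (n : ℕ) : ∑ x ∈ n.divisorsAntidiagonal, om (1 / 2 * log ((x.1:ℝ) / x.2)) = dd n / 2 := by
  have h1 : ∑ x ∈ n.divisorsAntidiagonal, om (1 / 2 * log ((x.1:ℝ) / x.2)) = ∑ x ∈ n.divisorsAntidiagonal, om (-(1 / 2 * log ((x.1:ℝ) / x.2))) := by
    conv_lhs => rw [← Nat.map_swap_divisorsAntidiagonal, Finset.sum_map]
    refine Finset.sum_congr rfl fun x _ => ?_
    simp only [Equiv.coe_toEmbedding, Equiv.prodComm_apply, Prod.fst_swap, Prod.snd_swap]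
    rw [← mul_neg, ← log_inv, inv_div]
  have h2 : ∑ x ∈ n.divisorsAntidiagonal, (om (1 / 2 * log ((x.1:ℝ) / x.2)) + om (-(1 / 2 * log ((x.1:ℝ) / x.2)))) = dd n := by
    simp only [om_add, Finset.sum_const, nsmul_one]
    rw [dd, ← Nat.map_div_right_divisors, Finset.card_map]
  rw [Finset.sum_add_distrib, ← h1] at h2
  linarith

lemma main_sum {t η : ℝ} {H N : ℕ} (ht : 1 ≤ t) (he : 1 ≤ η * t) (hN : 1 ≤ η ^ 2 * N) (htH : t ^ 2 ≤ H) (hH2 : 2 ≤ H) :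
    ∑ h ∈ Finset.range H, ((1 / ((h + 1 : ℕ) : ℝ) : ℝ) : ℂ) * ∑ m ∈ Finset.range (H ^ 4), vmain t η (h + 1 : ℕ) (m + 1 : ℕ)
      = ∑ n ∈ Finset.Icc 1 N, ((sqrt (t / 2) * (dd n / 2 * (n:ℝ) ^ (-(3:ℝ) / 4) * chi (η * sqrt n)) : ℝ) : ℂ) * ee (2 * t * sqrt n + 1 / 8) := by
  set f : ℕ × ℕ → ℂ := fun x => ((1 / (x.1 : ℝ) : ℝ) : ℂ) * vmain t η x.1 x.2 with hf
  have e0 : 0 < η := by by_contra! q; nlinarith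
  have hHJ : H ≤ H ^ 4 := Nat.le_self_pow (by norm_num) H
  have key : ∀ x : ℕ × ℕ, 1 ≤ x.1 → 1 ≤ x.2 → f x ≠ 0 → x.1 ≤ H ∧ x.2 ≤ H ^ 4 ∧ x.1 * x.2 ≤ N := by
    intro x h1 h2 hx
    have a1 : (1:ℝ) ≤ x.1 := by exact_mod_cast h1
    have a2 : (1:ℝ) ≤ x.2 := by exact_mod_cast h2
    obtain ⟨b1, b2⟩ := vmain_ne he ht a1 a2 (right_ne_zero_of_mul hx)
    have c : x.1 * x.2 < H := by exact_mod_cast b2.trans_le htH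
    refine ⟨by nlinarith, by nlinarith, ?_⟩
    have : ((x.1 * x.2 : ℕ) : ℝ) < N := by
      push_cast
      have := b1.trans_le hN
      exact lt_of_mul_lt_mul_left this (by positivity)
    exact_mod_cast this.le
  have s1 : ∑ h ∈ Finset.range H, ((1 / ((h + 1 : ℕ) : ℝ) : ℝ) : ℂ) * ∑ m ∈ Finset.range (H ^ 4), vmain t η (h + 1 : ℕ) (m + 1 : ℕ)
      = ∑ x ∈ Finset.Icc 1 H ×ˢ Finset.Icc 1 (H ^ 4), f x := by
    rw [sum_r1 (fun h : ℕ => ((1 / (h : ℝ) : ℝ) : ℂ) * ∑ m ∈ Finset.range (H ^ 4), vmain t η h (m + 1 : ℕ)), Finset.sum_product]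
    refine Finset.sum_congr rfl fun h _ => ?_
    rw [sum_r1 (fun m : ℕ => vmain t η h m), Finset.mul_sum]
  classical
  rw [s1, ← Finset.sum_filter_ne_zero, ← Finset.sum_fiberwise_of_maps_to (g := fun x : ℕ × ℕ => x.1 * x.2) (t := Finset.Icc 1 N)]
  · refine Finset.sum_congr rfl fun n hn => ?_
    rw [Finset.mem_Icc] at hn
    have hn0 : (0:ℝ) < n := by exact_mod_cast hn.1
    have : ∀ x ∈ n.divisorsAntidiagonal, f x = ((sqrt (t / 2) * (om (1 / 2 * log ((x.1:ℝ) / x.2)) * (n:ℝ) ^ (-(3:ℝ) / 4) * chi (η * sqrt n)) : ℝ) : ℂ) * ee (2 * t * sqrt n + 1 / 8) := by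
      intro x hx
      obtain ⟨hx1, hx2⟩ := Nat.mem_divisorsAntidiagonal.1 hx
      have x1 : x.1 ≠ 0 := by rintro q; rw [q] at hx1; simp at hx1; omega
      have x2 : x.2 ≠ 0 := by rintro q; rw [q] at hx1; simp at hx1; omega
      have p1 : (0:ℝ) < x.1 := by positivity
      have p2 : (0:ℝ) < x.2 := by positivity
      have hr : (n:ℝ) = x.1 * x.2 := by exact_mod_cast hx1.symm
      simp only [hf, vmain]
      rw [hr, mul_rpow p1.le p2.le, ← mul_assoc, ← Complex.ofReal_mul]
      have : (x.1:ℝ) ^ ((1:ℝ) / 4) = x.1 * (x.1:ℝ) ^ (-(3:ℝ) / 4) := by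
        conv_rhs => rw [← rpow_one_add' p1.le (by norm_num)]
        norm_num
      rw [this]
      congr 2
      field_simp
    rw [← sum_om n, Finset.sum_mul, Finset.sum_mul, Finset.mul_sum, Complex.ofReal_sum, Finset.sum_mul]
    rw [← Finset.sum_congr rfl this]
    refine Finset.sum_subset (fun x hx => ?_) (fun x hx hx2 => ?_)
    · simp only [Finset.mem_filter] at hx
      rw [Nat.mem_divisorsAntidiagonal]; exact ⟨hx.2, by omega⟩
    · by_contra hne
      obtain ⟨hx1, hx3⟩ := Nat.mem_divisorsAntidiagonal.1 hx
      have x1 : 1 ≤ x.1 := Nat.pos_of_ne_zero (by rintro q; rw [q] at hx1; simp at hx1; omega)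
      have x2 : 1 ≤ x.2 := Nat.pos_of_ne_zero (by rintro q; rw [q] at hx1; simp at hx1; omega)
      have k := key x x1 x2 hne
      apply hx2
      simp only [Finset.mem_filter, Finset.mem_product, Finset.mem_Icc]
      exact ⟨⟨⟨⟨x1, k.1⟩, x2, k.2.1⟩, hne⟩, hx1⟩
  · intro x hx
    simp only [Finset.mem_filter, Finset.mem_product, Finset.mem_Icc] at hx
    obtain ⟨⟨⟨a, -⟩, b, -⟩, c⟩ := hx
    exact Finset.mem_Icc.2 ⟨Nat.mul_pos a b, (key x a b c).2.2⟩

theorem voronoi (ε : ℝ) (hε : 0 < ε) : ∃ C : ℝ, 1 ≤ C ∧ ∀ (t η : ℝ) (N : ℕ), 1 ≤ t → 1 ≤ η * t → 1 ≤ η ^ 2 * N →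
    |Δ (t ^ 2) - sqrt t / (π * sqrt 2) * ∑ n ∈ Finset.Icc 1 N, dd n * (n:ℝ) ^ (-(3:ℝ) / 4) * chi (η * sqrt n) * cos (4 * π * sqrt n * t - π / 4)| ≤ C * (η * t) * t ^ ε := by
  obtain ⟨C1, hC1, ds⟩ := delta_S ε hε
  obtain ⟨C2, hC2, ph⟩ := perh
  obtain ⟨C3, hC3, ll⟩ := one_add_log_le (ε / 3) (by positivity)
  refine ⟨C1 + C2 * (8 * C3) ^ 3, by linarith [show (0:ℝ) ≤ C2 * (8 * C3) ^ 3 by positivity], fun t η N ht he hN => ?_⟩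
  have t0 : 0 < t := by linarith
  have e0 : 0 < η := by by_contra! q; nlinarith
  set H := ⌈2 * t ^ 2⌉₊ with hH
  have H1 : 2 * t ^ 2 ≤ H := Nat.le_ceil _
  have H2 : (H:ℝ) ≤ 3 * t ^ 2 := by have := Nat.ceil_lt_add_one (show 0 ≤ 2 * t ^ 2 by positivity); nlinarith
  have H3 : 2 ≤ H := by have : (2:ℝ) ≤ H := by nlinarith
                        exact_mod_cast this
  have D := ds t η H ht he (by nlinarith)
  set L := 1 + log (H ^ 4 : ℕ) with hL
  have L0 : 1 ≤ L := by have := log_nonneg (show (1:ℝ) ≤ (H ^ 4 : ℕ) by exact_mod_cast Nat.one_le_pow _ _ (by omega)); linarith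
  have L1 : L ≤ 8 * (1 + log t) := by
    rw [hL]; push_cast; rw [log_pow]
    have : log H ≤ log 3 + 2 * log t := by
      calc log H ≤ log (3 * t ^ 2) := log_le_log (lt_of_lt_of_le (by positivity) H1) H2
        _ = _ := by rw [log_mul (by norm_num) (by positivity), log_pow]; push_cast; ring
    have l3 : log 3 ≤ 1.4 := by
      rw [log_le_iff_le_exp (by norm_num)]
      have := quadratic_le_exp_of_nonneg (show (0:ℝ) ≤ 1.4 by norm_num)
      linarith
    push_cast; linarith
  have L3 : L ^ 3 ≤ (8 * C3) ^ 3 * t ^ ε := by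
    calc L ^ 3 ≤ (8 * (C3 * t ^ (ε / 3))) ^ 3 := by gcongr; exact L1.trans (by gcongr; exact ll t ht)
      _ = (8 * C3) ^ 3 * (t ^ (ε / 3)) ^ 3 := by ring
      _ = _ := by rw [← rpow_natCast (t ^ (ε / 3)), ← rpow_mul t0.le]; congr 2; push_cast; ring
  set Z : ℂ := ∑ h ∈ Finset.range H, ((1 / ((h + 1 : ℕ) : ℝ) : ℝ) : ℂ) * ∑ a ∈ Finset.Icc 1 ⌊2 * t⌋₊, Fv t η (h + 1 : ℕ) a with hZ
  have z1 : ∑ a ∈ Finset.Icc 1 ⌊2 * t⌋₊, om (log (a / t)) * psiS H (a / (η * t)) (t ^ 2 / a) = -(1 / π) * Z.im := by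
    rw [hZ, Complex.im_sum, Finset.mul_sum]
    simp only [Complex.im_ofReal_mul, Complex.im_sum, Finset.mul_sum, psiS, ← Finset.sum_neg_distrib]
    rw [Finset.sum_comm]
    refine Finset.sum_congr rfl fun h _ => Finset.sum_congr rfl fun a ha => ?_
    have a0 : (0:ℝ) < a := by exact_mod_cast (Finset.mem_Icc.1 ha).1
    have h0 : (0:ℝ) < (h + 1 : ℕ) := by positivity
    rw [Fv, Complex.im_ofReal_mul, ee_im, gg, chiT, add_zero]
    rw [show exp (-(log (a / t) + -log (((h + 1 : ℕ) : ℝ) * η))) = ((h + 1 : ℕ) : ℝ) / (a / (η * t)) by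
      rw [neg_add, neg_neg, exp_add, exp_neg, exp_log (by positivity), exp_log (by positivity)]; field_simp]
    rw [show 2 * π * (((h + 1 : ℕ) : ℝ) * t ^ 2 / a) = 2 * π * ((h + 1 : ℕ) : ℝ) * (t ^ 2 / a) by ring]
    field_simp
  have z2 := main_sum ht he hN (by linarith : t ^ 2 ≤ H) H3
  set Z0 : ℂ := ∑ n ∈ Finset.Icc 1 N, ((sqrt (t / 2) * (dd n / 2 * (n:ℝ) ^ (-(3:ℝ) / 4) * chi (η * sqrt n)) : ℝ) : ℂ) * ee (2 * t * sqrt n + 1 / 8) with hZ0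
  have z3 : ‖Z - Z0‖ ≤ C2 * L ^ 3 := by
    rw [← z2, hZ, ← Finset.sum_sub_distrib]
    calc _ ≤ ∑ h ∈ Finset.range H, (1 / ((h + 1 : ℕ) : ℝ)) * (C2 * L ^ 2) := by
          refine norm_sum_le_of_le _ fun h hh => ?_
          rw [← mul_sub, norm_mul, Complex.norm_real, norm_of_nonneg (by positivity)]
          gcongr
          exact ph t η (h + 1) H ht he (by omega) (Finset.mem_range.1 hh) (by linarith) H3
      _ = (∑ h ∈ Finset.range H, (1 / ((h + 1 : ℕ) : ℝ))) * (C2 * L ^ 2) := by rw [Finset.sum_mul]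
      _ ≤ L * (C2 * L ^ 2) := by
          gcongr
          refine (harm_le H).trans ?_
          rw [hL]; gcongr
          exact Nat.le_self_pow (by norm_num) H
      _ = _ := by ring
  have z4 : sqrt t / (π * sqrt 2) * ∑ n ∈ Finset.Icc 1 N, dd n * (n:ℝ) ^ (-(3:ℝ) / 4) * chi (η * sqrt n) * cos (4 * π * sqrt n * t - π / 4) = 2 / π * Z0.im := by
    rw [hZ0, Complex.im_sum, Finset.mul_sum, Finset.mul_sum]
    refine Finset.sum_congr rfl fun n _ => ?_
    rw [Complex.im_ofReal_mul, ee_im, sqrt_div t0.le, ← sin_add_pi_div_two]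
    rw [show 4 * π * sqrt n * t - π / 4 + π / 2 = 2 * π * (2 * t * sqrt n + 1 / 8) by ring]
    field_simp
  rw [z4]
  rw [z1] at D
  have z5 : |Z.im - Z0.im| ≤ C2 * L ^ 3 := by rw [← Complex.sub_im]; exact (Complex.abs_im_le_norm _).trans z3
  have p1 : 2 / π ≤ 1 := by rw [div_le_one pi_pos]; linarith [pi_gt_three]
  have p0 : 0 ≤ 2 / π := by positivity
  calc _ = |(Δ (t ^ 2) + 2 * (-(1 / π) * Z.im)) + 2 / π * (Z.im - Z0.im)| := by congr 1; ring
    _ ≤ C1 * (η * t) * t ^ ε + 1 * (C2 * L ^ 3) := by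
        refine (abs_add_le _ _).trans (add_le_add D ?_)
        rw [abs_mul, abs_of_nonneg p0]
        gcongr
    _ ≤ C1 * (η * t) * t ^ ε + (η * t) * (C2 * ((8 * C3) ^ 3 * t ^ ε)) := by gcongr
    _ = _ := by ring

lemma weyl (z : ℕ → ℂ) {N H : ℕ} (h1 : 1 ≤ H) (hHN : H ≤ N) :
    ‖∑ n ∈ Finset.range N, z n‖ ^ 2 ≤ 4 * N / H * ∑ d ∈ Finset.range H, ‖∑ n ∈ Finset.range (N - d), z (n + d) * starRingEnd ℂ (z n)‖ := by
  set r : ℕ → ℝ := fun d => ‖∑ n ∈ Finset.range (N - d), z (n + d) * starRingEnd ℂ (z n)‖ with hr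
  set w : ℕ → ℕ → ℂ := fun m h => if h ≤ m ∧ m < N + h then z (m - h) else 0 with hw
  have sh : ∀ (g : ℕ → ℂ) (a b : ℕ), b ≤ N + H → ∑ m ∈ Finset.range (N + H), (if a ≤ m ∧ m < b then g m else 0) = ∑ n ∈ Finset.range (b - a), g (a + n) := by
    intro g a b hb
    rw [← Finset.sum_filter, ← Finset.sum_Ico_eq_sum_range]
    refine Finset.sum_congr ?_ fun _ _ => rfl
    ext m; simp only [Finset.mem_filter, Finset.mem_range, Finset.mem_Ico]; omega
  have s1 : ∀ h ∈ Finset.range H, ∑ m ∈ Finset.range (N + H), w m h = ∑ n ∈ Finset.range N, z n := by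
    intro h hh
    have := sh (fun m => z (m - h)) h (N + h) (by have := Finset.mem_range.1 hh; omega)
    simpa using this
  have s2 : ∀ h ∈ Finset.range H, ∀ h' ∈ Finset.range H, h ≤ h' → ‖∑ m ∈ Finset.range (N + H), w m h * starRingEnd ℂ (w m h')‖ = r (h' - h) := by
    intro h hh h' hh' hle
    have := sh (fun m => z (m - h) * starRingEnd ℂ (z (m - h'))) h' (N + h) (by have := Finset.mem_range.1 hh; omega)
    have e : ∀ m, w m h * starRingEnd ℂ (w m h') = if h' ≤ m ∧ m < N + h then z (m - h) * starRingEnd ℂ (z (m - h')) else 0 := by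
      intro m
      simp only [hw]
      by_cases a : h' ≤ m ∧ m < N + h
      · rw [if_pos a, if_pos (by omega), if_pos (by omega)]
      · rw [if_neg a]
        by_cases b : h ≤ m ∧ m < N + h
        · rw [if_neg (show ¬ (h' ≤ m ∧ m < N + h') by omega)]; simp
        · rw [if_neg b]; simp
    simp only [e]
    rw [this, hr]
    simp only
    rw [show N + h - h' = N - (h' - h) by omega]
    congr 1
    refine Finset.sum_congr rfl fun n _ => ?_
    rw [show h' + n - h = n + (h' - h) by omega, show h' + n - h' = n by omega]
  have s3 : ∀ h ∈ Finset.range H, ∀ h' ∈ Finset.range H, ‖∑ m ∈ Finset.range (N + H), w m h * starRingEnd ℂ (w m h')‖ = r ((h' - h) + (h - h')) := by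
    intro h hh h' hh'
    rcases le_total h h' with q | q
    · rw [s2 h hh h' hh' q]; congr 1; omega
    · rw [show (h' - h) + (h - h') = h - h' by omega, ← s2 h' hh' h hh q, ← Complex.norm_conj]
      simp only [map_sum, map_mul, Complex.conj_conj, mul_comm]
  have s4 : ∀ h, ∑ h' ∈ Finset.range H, r ((h' - h) + (h - h')) ≤ 2 * ∑ d ∈ Finset.range H, r d ∨ H ≤ h := by
    intro h
    by_cases hh : H ≤ h
    · exact Or.inr hh
    left
    rw [← Finset.sum_fiberwise_of_maps_to (g := fun h' => (h' - h) + (h - h')) (t := Finset.range H) (by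
      intro x hx; simp at hx ⊢; omega), Finset.mul_sum]
    refine Finset.sum_le_sum fun d _ => ?_
    rw [Finset.sum_congr rfl (g := fun _ => r d) (fun x hx => by rw [(Finset.mem_filter.1 hx).2]), Finset.sum_const, nsmul_eq_mul]
    refine mul_le_mul_of_nonneg_right ?_ (norm_nonneg _)
    have : (Finset.range H |>.filter fun h' => (h' - h) + (h - h') = d) ⊆ {h - d, h + d} := by
      intro x hx; simp at hx ⊢; omega
    exact_mod_cast (Finset.card_le_card this).trans Finset.card_le_two
  set S := ∑ n ∈ Finset.range N, z n
  have e1 : (H : ℂ) * S = ∑ m ∈ Finset.range (N + H), ∑ h ∈ Finset.range H, w m h := by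
    rw [Finset.sum_comm, Finset.sum_congr rfl s1]; simp
  have e2 : (H * ‖S‖) ^ 2 ≤ (N + H : ℕ) * ∑ m ∈ Finset.range (N + H), ‖∑ h ∈ Finset.range H, w m h‖ ^ 2 := by
    have : (H:ℝ) * ‖S‖ ≤ ∑ m ∈ Finset.range (N + H), ‖∑ h ∈ Finset.range H, w m h‖ := by
      rw [← Complex.norm_natCast, ← norm_mul, e1]; exact norm_sum_le _ _
    refine (pow_le_pow_left₀ (by positivity) this 2).trans ?_
    simpa using sq_sum_le_card_mul_sum_sq (s := Finset.range (N + H)) (f := fun m => ‖∑ h ∈ Finset.range H, w m h‖)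
  have e3 : ∑ m ∈ Finset.range (N + H), ‖∑ h ∈ Finset.range H, w m h‖ ^ 2 ≤ ∑ h ∈ Finset.range H, ∑ h' ∈ Finset.range H, r ((h' - h) + (h - h')) := by
    have : ((∑ m ∈ Finset.range (N + H), ‖∑ h ∈ Finset.range H, w m h‖ ^ 2 : ℝ) : ℂ) =
        ∑ h ∈ Finset.range H, ∑ h' ∈ Finset.range H, ∑ m ∈ Finset.range (N + H), w m h * starRingEnd ℂ (w m h') := by
      push_cast
      simp only [← Complex.mul_conj', map_sum, Finset.sum_mul_sum]
      rw [Finset.sum_comm]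
      refine Finset.sum_congr rfl fun h _ => Finset.sum_comm
    have p0 : 0 ≤ ∑ m ∈ Finset.range (N + H), ‖∑ h ∈ Finset.range H, w m h‖ ^ 2 := Finset.sum_nonneg fun _ _ => by positivity
    rw [← abs_of_nonneg p0, ← norm_eq_abs, ← Complex.norm_real, this]
    refine norm_sum_le_of_le _ fun h hh => norm_sum_le_of_le _ fun h' hh' => (s3 h hh h' hh').le
  have e4 : ∑ h ∈ Finset.range H, ∑ h' ∈ Finset.range H, r ((h' - h) + (h - h')) ≤ H * (2 * ∑ d ∈ Finset.range H, r d) := by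
    refine (Finset.sum_le_sum (g := fun _ => 2 * ∑ d ∈ Finset.range H, r d) fun h hh => ?_).trans (by simp)
    exact (s4 h).resolve_right (by simpa using hh)
  have H0 : (0:ℝ) < H := by exact_mod_cast h1
  have r0 : 0 ≤ ∑ d ∈ Finset.range H, r d := Finset.sum_nonneg fun _ _ => norm_nonneg _
  have NH : ((N + H : ℕ) : ℝ) ≤ 2 * N := by push_cast; have : (H:ℝ) ≤ N := by exact_mod_cast hHN
                                            linarith
  rw [div_mul_eq_mul_div, le_div_iff₀ H0]
  refine le_of_mul_le_mul_right ?_ H0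
  calc ‖S‖ ^ 2 * H * H = (H * ‖S‖) ^ 2 := by ring
    _ ≤ (2 * N) * (H * (2 * ∑ d ∈ Finset.range H, r d)) := e2.trans (mul_le_mul NH (e3.trans e4) (Finset.sum_nonneg fun _ _ => by positivity) (by positivity))
    _ = _ := by ring

lemma ee_sub_one_ge {d : ℝ} (h0 : 0 ≤ d) (h1 : d ≤ 1 / 2) : 4 * d ≤ ‖ee d - 1‖ := by
  have : ee d = Complex.exp (Complex.I * (2 * π * d : ℝ)) := by rw [ee]; push_cast; ring_nf
  rw [this, Complex.norm_exp_I_mul_ofReal_sub_one, show 2 * π * d / 2 = π * d by ring, norm_mul, norm_eq_abs (sin _)]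
  have := mul_le_sin (show 0 ≤ π * d by positivity) (by nlinarith [pi_pos])
  have e : 2 / π * (π * d) = 2 * d := by field_simp
  rw [e] at this
  rw [norm_eq_abs, abs_two]
  linarith [le_abs_self (sin (π * d))]

lemma ee_lip (a b : ℝ) : ‖ee a - ee b‖ ≤ 7 * |a - b| := by
  have : ee a - ee b = ee b * (Complex.exp (Complex.I * (2 * π * (a - b) : ℝ)) - 1) := by
    have : Complex.exp (Complex.I * (2 * π * (a - b) : ℝ)) = ee (a - b) := by rw [ee]; push_cast; ring_nf
    rw [this, mul_sub, mul_one, ← ee_add]; ring_nf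
  rw [this, norm_mul, ee_norm, one_mul]
  refine (Real.norm_exp_I_mul_ofReal_sub_one_le).trans ?_
  rw [norm_eq_abs, abs_mul, abs_of_pos (by positivity)]
  gcongr
  linarith [pi_lt_d2]

noncomputable def fD (f : ℕ → ℝ) (n : ℕ) : ℝ := f (n + 1) - f n

lemma KL {f : ℕ → ℝ} {N : ℕ} {l : ℝ} (hl : 0 < l) (h1 : ∀ n ≤ N, l ≤ fD f n ∧ fD f n ≤ 1 / 2) (h2 : ∀ n < N, fD f (n + 1) ≤ fD f n) :
    ‖∑ n ∈ Finset.range N, ee (f n)‖ ≤ 1 / l := by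
  set c : ℕ → ℂ := fun n => (ee (fD f n) - 1)⁻¹ with hc
  have dp : ∀ n ≤ N, 0 < fD f n := fun n hn => hl.trans_le (h1 n hn).1
  have lb : ∀ n ≤ N, 4 * fD f n ≤ ‖ee (fD f n) - 1‖ := fun n hn => ee_sub_one_ge (dp n hn).le (h1 n hn).2
  have ne : ∀ n ≤ N, ee (fD f n) - 1 ≠ 0 := fun n hn => norm_pos_iff.1 (lt_of_lt_of_le (by linarith [dp n hn]) (lb n hn))
  have cb : ∀ n ≤ N, ‖c n‖ ≤ 1 / 4 * (1 / fD f n) := by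
    intro n hn
    rw [hc]; simp only [norm_inv]
    rw [← one_div, one_div_mul_one_div]
    exact one_div_le_one_div_of_le (by linarith [dp n hn]) (by linarith [lb n hn])
  have step : ∀ n ≤ N, ‖(∑ i ∈ Finset.range n, ee (f i)) - c n * ee (f n)‖ ≤ 1 / 4 * (1 / fD f 0) + 7 / 16 * (1 / fD f n - 1 / fD f 0) := by
    intro n
    induction n with
    | zero => intro _; simpa [ee_norm] using cb 0 (Nat.zero_le _)
    | succ n ih =>
      intro hn
      have hn' : n ≤ N := by omega
      have k1 : c n * (ee (f (n + 1)) - ee (f n)) = ee (f n) := by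
        rw [show f (n + 1) = f n + fD f n by rw [fD]; ring, ee_add, hc]
        simp only
        rw [show ee (f n) * ee (fD f n) - ee (f n) = (ee (fD f n) - 1) * ee (f n) by ring, ← mul_assoc, inv_mul_cancel₀ (ne n hn'), one_mul]
      have k2 : (∑ i ∈ Finset.range (n + 1), ee (f i)) - c (n + 1) * ee (f (n + 1)) = ((∑ i ∈ Finset.range n, ee (f i)) - c n * ee (f n)) + (c n - c (n + 1)) * ee (f (n + 1)) := by
        rw [Finset.sum_range_succ]; linear_combination -k1
      have k3 : ‖c n - c (n + 1)‖ ≤ 7 / 16 * (1 / fD f (n + 1) - 1 / fD f n) := by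
        have p := dp n hn'
        have p' := dp (n + 1) hn
        have hd := h2 n (by omega)
        rw [hc]; simp only
        rw [inv_sub_inv (ne n hn') (ne _ hn), norm_div, norm_mul, sub_sub_sub_cancel_right]
        have q := ee_lip (fD f (n + 1)) (fD f n)
        rw [abs_of_nonpos (by linarith)] at q
        calc _ ≤ (7 * -(fD f (n + 1) - fD f n)) / ((4 * fD f n) * (4 * fD f (n + 1))) := by
              have := lb n hn'; have := lb _ hn
              gcongr
              linarith
          _ = _ := by field_simp; ring
      rw [k2]
      refine (norm_add_le _ _).trans ?_
      rw [norm_mul, ee_norm, mul_one]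
      linarith [ih hn']
  have s := step N le_rfl
  have b1 : 1 / fD f N ≤ 1 / l := one_div_le_one_div_of_le hl (h1 N le_rfl).1
  have b0 : 0 < 1 / fD f 0 := one_div_pos.2 (dp 0 (Nat.zero_le _))
  have cN := cb N le_rfl
  have : ∑ n ∈ Finset.range N, ee (f n) = ((∑ i ∈ Finset.range N, ee (f i)) - c N * ee (f N)) + c N * ee (f N) := by ring
  rw [this]
  refine (norm_add_le _ _).trans ?_
  rw [norm_mul, ee_norm, mul_one]
  linarith [one_div_pos.2 hl]

lemma sum_rpow_le {s : ℝ} (h0 : 0 ≤ s) (h1 : s < 1) (N : ℕ) : ∑ n ∈ Finset.range N, ((n + 1 : ℕ) : ℝ) ^ (-s) ≤ (N:ℝ) ^ (1 - s) / (1 - s) := by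
  have p : 0 < 1 - s := by linarith
  rw [le_div_iff₀ p]
  induction N with
  | zero => simp; positivity
  | succ n ih =>
    rw [Finset.sum_range_succ, add_mul]
    have n0 : (0:ℝ) < ((n + 1 : ℕ) : ℝ) := by positivity
    set m : ℝ := ((n + 1 : ℕ) : ℝ) with hm
    have e : (n:ℝ) = m * (1 + -(1 / m)) := by field_simp; rw [hm]; push_cast; ring
    have m1 : 1 / m ≤ 1 := by rw [div_le_one n0, hm]; push_cast; linarith [(Nat.cast_nonneg n : (0:ℝ) ≤ n)]
    have b := rpow_one_add_le_one_add_mul_self (show -1 ≤ -(1 / m) by linarith) p.le (by linarith)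
    have : (n:ℝ) ^ (1 - s) ≤ m ^ (1 - s) * (1 + (1 - s) * -(1 / m)) := by
      rw [e, mul_rpow n0.le (by linarith)]; gcongr
    have e2 : m ^ (-s) = m ^ (1 - s) * (1 / m) := by rw [sub_eq_add_neg, rpow_add n0, rpow_one]; field_simp
    rw [e2]
    linarith

noncomputable def fsh (f : ℕ → ℝ) (d n : ℕ) : ℝ := f (n + d) - f n

lemma fD_sh (k : ℕ) (f : ℕ → ℝ) (d n : ℕ) : fD^[k] (fsh f d) n = ∑ i ∈ Finset.range d, fD^[k + 1] f (n + i) := by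
  have h1 : ∀ (k : ℕ) (f : ℕ → ℝ) n, fD^[k] (fsh f d) n = fD^[k] f (n + d) - fD^[k] f n := by
    intro k
    induction k with
    | zero => intro f n; rfl
    | succ k ih =>
      intro f n
      rw [Function.iterate_succ_apply', Function.iterate_succ_apply', fD, ih, ih, fD, fD, add_right_comm]; ring
  rw [h1]
  simp only [Function.iterate_succ_apply']
  exact (Finset.sum_range_sub (fun i => fD^[k] f (n + i)) d).symm

lemma fD_sh_bd {k N d : ℕ} {f : ℕ → ℝ} {lo hi : ℝ} (h : ∀ n ≤ N, lo ≤ fD^[k + 1] f n ∧ fD^[k + 1] f n ≤ hi) {n : ℕ} (hn : n + d ≤ N) :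
    d * lo ≤ fD^[k] (fsh f d) n ∧ fD^[k] (fsh f d) n ≤ d * hi := by
  rw [fD_sh]
  have hi' : ∀ i ∈ Finset.range d, n + i ≤ N := fun i hi => by have := Finset.mem_range.1 hi; omega
  constructor
  · simpa using Finset.card_nsmul_le_sum (Finset.range d) (fun i => fD^[k + 1] f (n + i)) lo (fun i hi => (h _ (hi' i hi)).1)
  · simpa using Finset.sum_le_card_nsmul (Finset.range d) (fun i => fD^[k + 1] f (n + i)) hi (fun i hi => (h _ (hi' i hi)).2)

lemma fD_sh_np {k N d : ℕ} {f : ℕ → ℝ} (h : ∀ n ≤ N, fD^[k + 1] f n ≤ 0) {n : ℕ} (hn : n + d ≤ N) : fD^[k] (fsh f d) n ≤ 0 := by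
  rw [fD_sh]
  exact Finset.sum_nonpos fun i hi => h _ (by have := Finset.mem_range.1 hi; omega)

lemma ee_sum_le (N : ℕ) (f : ℕ → ℝ) : ‖∑ n ∈ Finset.range N, ee (f n)‖ ≤ N := by
  refine (norm_sum_le _ _).trans ?_; simp [ee_norm]

lemma weylf {f : ℕ → ℝ} {N H : ℕ} (h1 : 1 ≤ H) (hHN : H ≤ N) {B : ℕ → ℝ}
    (hB : ∀ d, 1 ≤ d → d < H → ‖∑ n ∈ Finset.range (N - d), ee (fsh f d n)‖ ≤ B d) :
    ‖∑ n ∈ Finset.range N, ee (f n)‖ ^ 2 ≤ 4 * N / H * (N + ∑ d ∈ Finset.range (H - 1), B (d + 1)) := by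
  refine (weyl (fun n => ee (f n)) h1 hHN).trans ?_
  gcongr
  simp only [← ee_sub]
  obtain ⟨H', rfl⟩ : ∃ H', H = H' + 1 := ⟨H - 1, by omega⟩
  rw [Finset.sum_range_succ', add_comm]
  refine add_le_add ?_ (Finset.sum_le_sum fun d hd => hB (d + 1) (by omega) (by simpa using hd))
  exact (ee_sum_le _ (fsh f 0)).trans (by simp)

/-- the k-th derivative test with exponents a, b -/
def kd (k : ℕ) (a b : ℝ) : Prop := ∀ A : ℝ, 1 ≤ A → ∃ C : ℝ, 1 ≤ C ∧ ∀ (N : ℕ) (f : ℕ → ℝ) (l : ℝ), 0 < l →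
  (∀ n ≤ N, l ≤ fD^[k] f n ∧ fD^[k] f n ≤ A * l) → (∀ n ≤ N, fD^[k + 1] f n ≤ 0) →
  ‖∑ n ∈ Finset.range N, ee (f n)‖ ≤ C * (1 + log N) * (N * l ^ a + (N:ℝ) ^ (1 - b) * l ^ (-a))

lemma sq_trick {s C L X : ℝ} (hC : 1 ≤ C) (hL : 1 ≤ L) (hX : 0 ≤ X) (h : s ^ 2 ≤ C * L * X ^ 2) : s ≤ C * L * X := by
  refine abs_le_of_sq_le_sq' ?_ (by positivity) |>.2
  have : 1 ≤ C * L := one_le_mul_of_one_le_of_one_le hC hL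
  calc s ^ 2 ≤ C * L * X ^ 2 := h
    _ ≤ (C * L) * (C * L * X ^ 2) := le_mul_of_one_le_left (by positivity) this
    _ = _ := by ring

lemma kd2 : kd 2 (1 / 2) 1 := by
  intro A hA
  refine ⟨40 * A, by linarith, fun N f l hl h1 h2 => ?_⟩
  rw [sub_self, rpow_zero, one_mul]
  rcases Nat.eq_zero_or_pos N with rfl | hN
  · simp; positivity
  have N1 : (1:ℝ) ≤ N := by exact_mod_cast hN
  have L1 : 1 ≤ 1 + log N := by linarith [log_nonneg N1]
  set L := 1 + log N
  rw [rpow_neg hl.le, ← sqrt_eq_rpow]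
  have sp : 0 < sqrt l := sqrt_pos.2 hl
  have ss : sqrt l * sqrt l = l := mul_self_sqrt hl.le
  set X := N * sqrt l + (sqrt l)⁻¹ with hX
  have X0 : 0 ≤ X := by positivity
  by_cases hc : 1 / (2 * A * l) < 1
  · rw [div_lt_one (by positivity)] at hc
    refine (ee_sum_le N f).trans ?_
    have : 1 ≤ 40 * A * sqrt l := by nlinarith [mul_pos (show 0 < A by linarith) sp]
    calc (N:ℝ) ≤ N * (40 * A * sqrt l) := le_mul_of_one_le_right (by positivity) this
      _ ≤ 40 * A * X := by rw [hX]; linarith [show 0 < A * (sqrt l)⁻¹ by positivity]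
      _ ≤ _ := mul_le_mul_of_nonneg_right (le_mul_of_one_le_right (by positivity) L1) X0
  push Not at hc
  set H := min N ⌊1 / (2 * A * l)⌋₊ with hH
  have f1 : 1 ≤ ⌊1 / (2 * A * l)⌋₊ := Nat.le_floor (by simpa using hc)
  have H1 : 1 ≤ H := le_min hN f1
  have H0 : (0:ℝ) < H := by exact_mod_cast H1
  have Hi : 1 / (H:ℝ) ≤ 1 / N + 4 * A * l := by
    rcases min_choice N ⌊1 / (2 * A * l)⌋₊ with q | q
    · rw [hH, q]; linarith [show 0 < A * l by positivity]
    · rw [hH, q]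
      have : 1 / (4 * A * l) ≤ (⌊1 / (2 * A * l)⌋₊ : ℝ) := by
        have a := Nat.lt_floor_add_one (1 / (2 * A * l))
        have b : (1:ℝ) ≤ ⌊1 / (2 * A * l)⌋₊ := by exact_mod_cast f1
        have : 1 / (4 * A * l) = 1 / (2 * A * l) / 2 := by field_simp; norm_num
        rw [this]; linarith
      have := one_div_le_one_div_of_le (by positivity) this
      rw [one_div_one_div] at this
      linarith [show 0 < 1 / (N:ℝ) by positivity]
  have W := weylf (f := f) H1 (min_le_left _ _) (B := fun d => 1 / (d * l)) (by
    intro d hd hdH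
    have d0 : (0:ℝ) < d := by exact_mod_cast hd
    refine KL (by positivity) (fun n hn => ?_) (fun n hn => ?_)
    · obtain ⟨a, b⟩ := fD_sh_bd (k := 1) h1 (show n + d ≤ N by have := min_le_left N ⌊1 / (2 * A * l)⌋₊; omega)
      refine ⟨a, b.trans ?_⟩
      have : (d:ℝ) ≤ 1 / (2 * A * l) := by
        have : d ≤ ⌊1 / (2 * A * l)⌋₊ := by have := min_le_right N ⌊1 / (2 * A * l)⌋₊; omega
        exact (Nat.cast_le.2 this).trans (Nat.floor_le (by positivity))
      rw [le_div_iff₀ (by positivity)] at this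
      linarith
    · have := fD_sh_np (k := 2) h2 (show n + d ≤ N by omega)
      rw [Function.iterate_succ_apply', Function.iterate_one, fD] at this
      linarith)
  have s1 : ∑ d ∈ Finset.range (H - 1), 1 / (((d + 1 : ℕ) : ℝ) * l) ≤ L / l := by
    have : ∀ d : ℕ, 1 / (((d + 1 : ℕ) : ℝ) * l) = 1 / ((d + 1 : ℕ) : ℝ) / l := fun d => by rw [div_div]
    simp only [this]
    rw [← Finset.sum_div]
    gcongr
    refine le_trans (Finset.sum_le_sum_of_subset_of_nonneg (Finset.range_mono (show H - 1 ≤ N by omega)) fun _ _ _ => by positivity) (harm_le N)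
  have am : (N:ℝ) ≤ N ^ 2 * l + 1 / l := by
    rw [← ss]
    have : 1 / (sqrt l * sqrt l) = (sqrt l)⁻¹ ^ 2 := by field_simp
    have i : sqrt l * (sqrt l)⁻¹ = 1 := mul_inv_cancel₀ sp.ne'
    rw [this]
    have : (N:ℝ) = (N * sqrt l) * (sqrt l)⁻¹ := by rw [mul_assoc, i, mul_one]
    linarith [two_mul_le_add_sq (N * sqrt l) (sqrt l)⁻¹, (Nat.cast_nonneg N : (0:ℝ) ≤ N)]
  refine sq_trick (by linarith) L1 X0 (W.trans ?_)
  have X2 : (N:ℝ) ^ 2 * l + 1 / l ≤ X ^ 2 := by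
    have : X ^ 2 = N ^ 2 * (sqrt l * sqrt l) + 2 * N * (sqrt l * (sqrt l)⁻¹) + (sqrt l * sqrt l)⁻¹ := by rw [hX, mul_inv]; ring
    rw [this, ss, mul_inv_cancel₀ sp.ne', one_div]; linarith
  have q0 : 0 < 1 / l := by positivity
  calc 4 * (N:ℝ) / H * (N + ∑ d ∈ Finset.range (H - 1), 1 / (((d + 1 : ℕ) : ℝ) * l))
      ≤ 4 * N * (1 / N + 4 * A * l) * (N + L / l) := by rw [div_eq_mul_one_div]; gcongr
    _ = 4 * N + 4 * L * (1 / l) + 16 * A * (N ^ 2 * l) + 16 * A * L * N := by field_simp; ring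
    _ ≤ 4 * A * L * (N ^ 2 * l + 1 / l) + 4 * A * L * (N ^ 2 * l + 1 / l) + 16 * A * L * (N ^ 2 * l + 1 / l) + 16 * A * L * (N ^ 2 * l + 1 / l) := by
        have a1 : 1 ≤ A * L := one_le_mul_of_one_le_of_one_le hA L1
        have p2 : 0 < (N:ℝ) ^ 2 * l := by positivity
        gcongr ?_ + ?_ + ?_ + ?_
        · linarith [mul_nonneg (sub_nonneg.2 a1) (show 0 ≤ N ^ 2 * l + 1 / l by positivity)]
        · linarith [mul_nonneg (mul_nonneg (sub_nonneg.2 hA) (show 0 ≤ L by linarith)) q0.le, show 0 ≤ A * L * (N ^ 2 * l) by positivity]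
        · linarith [mul_nonneg (mul_nonneg (show 0 ≤ A by linarith) (sub_nonneg.2 L1)) p2.le, show 0 ≤ A * L * (1 / l) by positivity]
        · gcongr
    _ = 40 * A * L * (N ^ 2 * l + 1 / l) := by ring
    _ ≤ _ := by gcongr

set_option maxHeartbeats 1000000 in
lemma kd_step {k : ℕ} {a b : ℝ} (ha : 0 < a) (ha2 : a ≤ 1 / 2) (hb : 0 ≤ b) (hb1 : b ≤ 1) (h : kd k a b) : kd (k + 1) (a / (2 * (1 + a))) (b / 2) := by
  intro A hA
  obtain ⟨C, hC, hk⟩ := h A hA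
  refine ⟨12 * C, by linarith, fun N f l hl h1 h2 => ?_⟩
  set a' := a / (2 * (1 + a)) with ha'
  have a'0 : 0 < a' := by positivity
  rcases Nat.eq_zero_or_pos N with rfl | hN
  · simp; positivity
  have N1 : (1:ℝ) ≤ N := by exact_mod_cast hN
  have N0 : (0:ℝ) < N := by linarith
  have L1 : 1 ≤ 1 + log N := by linarith [log_nonneg N1]
  set L := 1 + log N
  set X := N * l ^ a' + (N:ℝ) ^ (1 - b / 2) * l ^ (-a') with hX
  have X1 : 0 ≤ N * l ^ a' := by positivity
  have X2 : 0 ≤ (N:ℝ) ^ (1 - b / 2) * l ^ (-a') := by positivity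
  have X0 : 0 ≤ X := by positivity
  have CL : 1 ≤ 12 * C * L := one_le_mul_of_one_le_of_one_le (by linarith) L1
  have triv : (N:ℝ) ≤ X → ‖∑ n ∈ Finset.range N, ee (f n)‖ ≤ 12 * C * L * X := fun q =>
    (ee_sum_le N f).trans (q.trans (le_mul_of_one_le_left X0 CL))
  by_cases hl1 : 1 ≤ l
  · exact triv (le_add_of_le_of_nonneg (le_mul_of_one_le_right N0.le (one_le_rpow hl1 a'0.le)) X2)
  push Not at hl1
  set H0 := l ^ (-(2 * a')) with hH0
  have H01 : 1 ≤ H0 := one_le_rpow_of_pos_of_le_one_of_nonpos hl hl1.le (by linarith)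
  have H00 : 0 < H0 := by linarith
  have hs : l ^ (-a') = sqrt H0 := by rw [sqrt_eq_rpow, hH0, ← rpow_mul hl.le]; congr 1; ring
  by_cases hHN : (N:ℝ) < H0
  · apply triv
    have : (N:ℝ) = (N:ℝ) ^ (1 - b / 2) * (N:ℝ) ^ (b / 2) := by rw [← rpow_add N0]; simp
    have q : (N:ℝ) ^ (b / 2) ≤ l ^ (-a') := by
      rw [hs, sqrt_eq_rpow]
      exact (rpow_le_rpow_of_exponent_le N1 (by linarith)).trans (rpow_le_rpow N0.le hHN.le (by norm_num))
    calc (N:ℝ) = (N:ℝ) ^ (1 - b / 2) * (N:ℝ) ^ (b / 2) := this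
      _ ≤ (N:ℝ) ^ (1 - b / 2) * l ^ (-a') := mul_le_mul_of_nonneg_left q (by positivity)
      _ ≤ X := by linarith
  push Not at hHN
  set H := ⌈H0⌉₊
  have Hge : H0 ≤ H := Nat.le_ceil _
  have Hle : (H:ℝ) ≤ 2 * H0 := by linarith [Nat.ceil_lt_add_one H00.le]
  have HN : H ≤ N := Nat.ceil_le.2 hHN
  have H1 : 1 ≤ H := Nat.one_le_ceil_iff.2 H00
  have Hp : (0:ℝ) < H := by linarith
  have key : (H0 * l) ^ a = H0⁻¹ := by
    rw [hH0, ← rpow_add_one hl.ne', ← rpow_mul hl.le, ← rpow_neg hl.le]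
    congr 1
    rw [ha']; field_simp; ring
  have W := weylf (f := f) H1 HN (B := fun d => C * L * (N * (H * l) ^ a + (N:ℝ) ^ (1 - b) * l ^ (-a) * (d:ℝ) ^ (-a))) (by
    intro d hd hdH
    have d0 : (0:ℝ) < d := by exact_mod_cast hd
    have := hk (N - d) (fsh f d) (d * l) (by positivity) (fun n hn => by
      have := fD_sh_bd h1 (show n + d ≤ N by omega)
      exact ⟨this.1, this.2.trans (le_of_eq (by ring))⟩) (fun n hn => fD_sh_np h2 (show n + d ≤ N by omega))
    refine this.trans ?_
    have Nd : ((N - d : ℕ) : ℝ) ≤ N := by exact_mod_cast Nat.sub_le _ _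
    have Lb : 1 + log (N - d : ℕ) ≤ L := by
      rcases Nat.eq_zero_or_pos (N - d) with q | q
      · rw [q]; simpa using L1
      · have : (0:ℝ) < (N - d : ℕ) := by exact_mod_cast q
        show _ ≤ 1 + log N
        gcongr
    have dH : (d:ℝ) ≤ H := by exact_mod_cast hdH.le
    rw [mul_assoc _ (l ^ (-a)), mul_comm (l ^ (-a)), ← mul_rpow d0.le hl.le]
    gcongr ?_ * ?_ * (?_ + ?_ * _)
    · gcongr
    · exact rpow_le_rpow (by positivity) Nd (by linarith))
  have s1 : ∑ d ∈ Finset.range (H - 1), C * L * (N * (H * l) ^ a + (N:ℝ) ^ (1 - b) * l ^ (-a) * ((d + 1 : ℕ) : ℝ) ^ (-a))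
      ≤ C * L * (H * (N * (H * l) ^ a) + (N:ℝ) ^ (1 - b) * l ^ (-a) * (2 * (H:ℝ) ^ (1 - a))) := by
    refine (Finset.sum_le_sum_of_subset_of_nonneg (Finset.range_mono (Nat.sub_le H 1)) fun _ _ _ => by positivity).trans ?_
    rw [← Finset.mul_sum, Finset.sum_add_distrib, Finset.sum_const, Finset.card_range, nsmul_eq_mul, ← Finset.mul_sum]
    refine mul_le_mul_of_nonneg_left (add_le_add_right (mul_le_mul_of_nonneg_left ?_ (show 0 ≤ (N:ℝ) ^ (1 - b) * l ^ (-a) by positivity)) _) (show 0 ≤ C * L by positivity)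
    refine (sum_rpow_le ha.le (by linarith) H).trans ?_
    rw [div_le_iff₀ (by linarith)]
    linarith [mul_nonneg (show 0 ≤ (H:ℝ) ^ (1 - a) by positivity) (show 0 ≤ 1 - 2 * a by linarith)]
  refine sq_trick (by linarith) L1 X0 (W.trans ?_)
  have t1 : (H * l) ^ a ≤ 2 * H0⁻¹ := by
    calc (H * l) ^ a ≤ (2 * (H0 * l)) ^ a := rpow_le_rpow (by positivity) (by linarith [mul_le_mul_of_nonneg_right Hle hl.le]) ha.le
      _ = 2 ^ a * H0⁻¹ := by rw [mul_rpow (by norm_num) (by positivity), key]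
      _ ≤ 2 ^ (1:ℝ) * H0⁻¹ := by gcongr <;> linarith
      _ = _ := by rw [rpow_one]
  have t2 : (H * l) ^ (-a) ≤ H0 := by
    calc (H * l) ^ (-a) ≤ (H0 * l) ^ (-a) := rpow_le_rpow_of_nonpos (by positivity) (by gcongr) (by linarith)
      _ = H0 := by rw [rpow_neg (by positivity), key, inv_inv]
  have e1 : (N * l ^ a') ^ 2 = N ^ 2 * H0⁻¹ := by
    rw [mul_pow, hH0, ← rpow_neg hl.le, ← rpow_natCast (l ^ a'), ← rpow_mul hl.le]; congr 2; push_cast; ring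
  have e2 : ((N:ℝ) ^ (1 - b / 2) * l ^ (-a')) ^ 2 = N * (N:ℝ) ^ (1 - b) * H0 := by
    rw [mul_pow, hs, sq_sqrt H00.le, ← rpow_natCast ((N:ℝ) ^ _), ← rpow_mul N0.le, ← rpow_one_add' N0.le (by linarith)]
    congr 2; push_cast; ring
  have XX : (N:ℝ) ^ 2 * H0⁻¹ + N * (N:ℝ) ^ (1 - b) * H0 ≤ X ^ 2 := by
    rw [← e1, ← e2, hX]; linarith [mul_nonneg X1 X2]
  have Hi : (H:ℝ)⁻¹ ≤ H0⁻¹ := inv_anti₀ H00 Hge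
  have hH : (H:ℝ) ^ (1 - a) * l ^ (-a) = H * (H * l) ^ (-a) := by
    rw [mul_rpow Hp.le hl.le, sub_eq_add_neg, rpow_add Hp, rpow_one]; ring
  calc _ ≤ 4 * (N:ℝ) / H * (N + C * L * (H * (N * (H * l) ^ a) + (N:ℝ) ^ (1 - b) * l ^ (-a) * (2 * (H:ℝ) ^ (1 - a)))) := by gcongr
    _ = 4 * (N:ℝ) / H * (N + C * L * (H * (N * (H * l) ^ a) + 2 * (N:ℝ) ^ (1 - b) * ((H:ℝ) ^ (1 - a) * l ^ (-a)))) := by ring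
    _ = 4 * N ^ 2 * (H:ℝ)⁻¹ + 4 * C * L * (N ^ 2 * (H * l) ^ a) + 8 * C * L * (N * (N:ℝ) ^ (1 - b) * (H * l) ^ (-a)) := by rw [hH]; field_simp; ring
    _ ≤ 4 * N ^ 2 * H0⁻¹ + 4 * C * L * (N ^ 2 * (2 * H0⁻¹)) + 8 * C * L * (N * (N:ℝ) ^ (1 - b) * H0) := by gcongr
    _ ≤ 12 * C * L * (N ^ 2 * H0⁻¹ + N * (N:ℝ) ^ (1 - b) * H0) := by
        have p1 : 0 ≤ (N:ℝ) ^ 2 * H0⁻¹ := by positivity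
        have p2 : 0 ≤ N * (N:ℝ) ^ (1 - b) * H0 := by positivity
        have : 1 ≤ C * L := one_le_mul_of_one_le_of_one_le hC L1
        linarith [mul_nonneg (sub_nonneg.2 this) p1, show 0 ≤ C * L * (N * (N:ℝ) ^ (1 - b) * H0) by positivity]
    _ ≤ _ := by gcongr

lemma kd3 : kd 3 (1 / 6) (1 / 2) := by
  convert kd_step (by norm_num) (by norm_num) (by norm_num) (by norm_num) kd2 using 1; norm_num
lemma kd5 : kd 5 (1 / 30) (1 / 8) := by
  convert kd_step (by norm_num) (by norm_num) (by norm_num) (by norm_num) (kd_step (by norm_num) (by norm_num) (by norm_num) (by norm_num) kd3) using 1 <;> norm_num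

lemma fD_bd (k : ℕ) : ∀ (F : ℕ → ℝ → ℝ) (_ : ∀ i x, 0 ≤ x → HasDerivAt (F i) (F (i + 1) x) x) (n : ℕ) (lo hi : ℝ)
    (_ : ∀ x : ℝ, 0 ≤ x → x ≤ n + k → lo ≤ F k x ∧ F k x ≤ hi), lo ≤ fD^[k] (fun m => F 0 m) n ∧ fD^[k] (fun m => F 0 m) n ≤ hi := by
  induction k with
  | zero => intro F _ n lo hi h; exact h n (by positivity) (by simp)
  | succ k ih =>
    intro F hF n lo hi h
    have e : fD (fun m => F 0 m) = fun m : ℕ => (fun i x => F i (x + 1) - F i x) 0 (m:ℝ) := by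
      funext m; simp [fD]
    rw [Function.iterate_succ_apply, e]
    refine ih (fun i x => F i (x + 1) - F i x) (fun i x hx => ?_) n lo hi fun x hx hxn => ?_
    · exact ((hF i (x + 1) (by linarith)).comp_add_const x 1).sub (hF i x hx)
    · obtain ⟨c, hc, e⟩ := exists_hasDerivAt_eq_slope (F k) (F (k + 1)) (show x < x + 1 by linarith)
        (fun z hz => (hF k z (hx.trans hz.1)).continuousAt.continuousWithinAt) (fun z hz => hF k z (hx.trans hz.1.le))
      have := h c (by linarith [hc.1]) (by push_cast; linarith [hc.2])
      rw [e] at this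
      simpa using this

noncomputable def cc : ℕ → ℝ
  | 0 => 1
  | i + 1 => cc i * (1 / 2 - i)

lemma fD_sqrt {M N k n : ℕ} {s : ℝ} (hM : 1 ≤ M) (hN : N ≤ M) (hn : n ≤ N) (hk : k ≤ 6) (h1 : 1 ≤ k) :
    (0 ≤ s * cc k → s * cc k * (9 * M : ℝ) ^ ((1:ℝ) / 2 - k) ≤ fD^[k] (fun n => s * sqrt (M + n)) n ∧ fD^[k] (fun n => s * sqrt (M + n)) n ≤ s * cc k * (M : ℝ) ^ ((1:ℝ) / 2 - k)) ∧
    (s * cc k ≤ 0 → fD^[k] (fun n => s * sqrt (M + n)) n ≤ 0) := by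
  have M1 : (1:ℝ) ≤ M := by exact_mod_cast hM
  have k1 : (1:ℝ) ≤ k := by exact_mod_cast h1
  have nM : (n:ℝ) + k ≤ 8 * M := by
    have : n + k ≤ 8 * M := by omega
    exact_mod_cast this
  have hF : ∀ (i : ℕ) (x : ℝ), 0 ≤ x → HasDerivAt (fun x : ℝ => s * cc i * (M + x) ^ ((1:ℝ) / 2 - i)) (s * cc (i + 1) * (M + x) ^ ((1:ℝ) / 2 - (i + 1 : ℕ))) x := by
    intro i x hx
    refine (((hasDerivAt_id' x).const_add (M:ℝ)).rpow_const (p := (1:ℝ) / 2 - i) (Or.inl (by positivity))).const_mul (s * cc i) |>.congr_deriv ?_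
    rw [cc]; push_cast; rw [show (1:ℝ) / 2 - (i + 1) = 1 / 2 - i - 1 by ring]; ring
  have e : (fun n : ℕ => s * sqrt (M + n)) = fun m : ℕ => (fun (i : ℕ) (x : ℝ) => s * cc i * (M + x) ^ ((1:ℝ) / 2 - i)) 0 m := by
    funext m; simp [cc, sqrt_eq_rpow]
  have key := fD_bd k (fun i x => s * cc i * (M + x) ^ ((1:ℝ) / 2 - i)) hF n
  rw [e]
  refine ⟨fun h => key _ _ fun x h0 hx => ?_, fun h => ?_⟩
  · exact ⟨mul_le_mul_of_nonneg_left (rpow_le_rpow_of_nonpos (by positivity) (by linarith) (by linarith)) h,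
      mul_le_mul_of_nonneg_left (rpow_le_rpow_of_nonpos (by positivity) (by linarith) (by linarith)) h⟩
  · refine (key (s * cc k * (M : ℝ) ^ ((1:ℝ) / 2 - k)) 0 fun x h0 hx => ⟨?_, ?_⟩).2
    · exact mul_le_mul_of_nonpos_left (rpow_le_rpow_of_nonpos (by positivity) (by linarith) (by linarith)) h
    · exact mul_nonpos_of_nonpos_of_nonneg h (by positivity)

lemma sq_KL {M N : ℕ} {t : ℝ} (hM : 1 ≤ M) (hN : N ≤ M) (ht : 0 < t) (h : t ≤ sqrt M) :
    ‖∑ n ∈ Finset.range N, ee (t * sqrt (M + n))‖ ≤ 6 * sqrt M / t := by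
  have M0 : (0:ℝ) < M := by exact_mod_cast hM
  have c1 : cc 1 = 1 / 2 := by norm_num [cc]
  have c2 : cc 2 = -1 / 4 := by norm_num [cc]
  have sM := sqrt_pos.2 M0
  have e : ∀ x : ℝ, 0 ≤ x → x ^ ((1:ℝ) / 2 - (1:ℕ)) = (sqrt x)⁻¹ := fun x hx => by
    rw [sqrt_eq_rpow, ← rpow_neg hx]; norm_num
  have := KL (f := fun n => t * sqrt (M + n)) (N := N) (l := t / (6 * sqrt M)) (by positivity) (fun n hn => ?_) (fun n hn => ?_)
  · rwa [one_div_div] at this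
  · have := (fD_sqrt (k := 1) (s := t) hM hN hn (by norm_num) le_rfl).1 (by rw [c1]; positivity)
    rw [e _ (by positivity), e _ (by positivity), sqrt_mul (by norm_num), show (9:ℝ) = 3 ^ 2 by norm_num, sqrt_sq (by norm_num), c1] at this
    refine ⟨le_trans (le_of_eq (by field_simp; norm_num)) this.1, this.2.trans ?_⟩
    rw [← div_eq_mul_inv, div_le_iff₀ sM]; linarith
  · have := (fD_sqrt (k := 2) (s := t) hM hN hn.le (by norm_num) (by norm_num)).2 (by rw [c2]; linarith)
    rw [Function.iterate_succ_apply', Function.iterate_one, fD] at this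
    linarith

lemma sq_kd {k : ℕ} {a b σ : ℝ} (hσ : σ = 1 ∨ σ = -1) (h : kd k a b) (ha : 0 < a) (hb : b ≤ 1) (k1 : 1 ≤ k) (k5 : k ≤ 5) (c1 : 0 < σ * cc k) (c2 : σ * cc (k + 1) ≤ 0) :
    ∃ C : ℝ, 1 ≤ C ∧ ∀ (M N : ℕ) (t : ℝ), 1 ≤ M → N ≤ M → 0 < t →
    ‖∑ n ∈ Finset.range N, ee (t * sqrt (M + n))‖ ≤ C * (1 + log M) * (M * (t * (M:ℝ) ^ ((1:ℝ) / 2 - k)) ^ a + (M:ℝ) ^ (1 - b) * (t * (M:ℝ) ^ ((1:ℝ) / 2 - k)) ^ (-a)) := by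
  set e : ℝ := (1:ℝ) / 2 - k with he
  have e0 : e ≤ 0 := by have : (1:ℝ) ≤ k := by exact_mod_cast k1
                        linarith
  have g0 : (0:ℝ) < 9 ^ e := by positivity
  obtain ⟨C, hC, hk⟩ := h ((9:ℝ) ^ e)⁻¹ ((one_le_inv₀ g0).2 (rpow_le_one_of_one_le_of_nonpos (by norm_num) e0))
  set g := σ * cc k * 9 ^ e with hg
  have g1 : 0 < g := by positivity
  refine ⟨C * (1 + g ^ a + g ^ (-a)), by nlinarith [rpow_pos_of_pos g1 a, rpow_pos_of_pos g1 (-a)], fun M N t hM hN ht => ?_⟩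
  have M1 : (1:ℝ) ≤ M := by exact_mod_cast hM
  have M0 : (0:ℝ) < M := by linarith
  have LM := log_nonneg M1
  have eq : ‖∑ n ∈ Finset.range N, ee (t * sqrt (M + n))‖ = ‖∑ n ∈ Finset.range N, ee ((σ * t) * sqrt (M + n))‖ := by
    rcases hσ with r | r
    · simp [r]
    · rw [r]; simp only [neg_mul, one_mul, ee_neg, ← map_sum, Complex.norm_conj]
  rw [eq]
  have B := hk N (fun n => (σ * t) * sqrt (M + n)) (g * (t * (M:ℝ) ^ e)) (by positivity) (fun n hn => ?_) (fun n hn => ?_)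
  rotate_left
  · have := (fD_sqrt (k := k) (s := σ * t) hM hN hn (by omega) k1).1 (by nlinarith)
    rw [← he, mul_rpow (by norm_num) M0.le] at this
    refine ⟨le_trans (le_of_eq (by rw [hg]; ring)) this.1, this.2.trans (le_of_eq ?_)⟩
    rw [hg]; field_simp
  · exact (fD_sqrt (k := k + 1) (s := σ * t) hM hN hn (by omega) (by omega)).2 (by nlinarith)
  refine B.trans ?_
  have NM : (N:ℝ) ≤ M := by exact_mod_cast hN
  have LL : 1 + log N ≤ 1 + log M := by
    rcases Nat.eq_zero_or_pos N with q | q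
    · rw [q]; simpa using LM
    · have : (0:ℝ) < N := by exact_mod_cast q
      gcongr
  have x0 : 0 < t * (M:ℝ) ^ e := by positivity
  set x := t * (M:ℝ) ^ e
  have LN : 0 ≤ 1 + log (N:ℝ) := by linarith [log_natCast_nonneg N]
  have nb : (N:ℝ) ^ (1 - b) ≤ (M:ℝ) ^ (1 - b) := rpow_le_rpow (by positivity) NM (by linarith)
  have p1 := rpow_pos_of_pos g1 a
  have p2 := rpow_pos_of_pos g1 (-a)
  have q1 : (0:ℝ) < M * x ^ a := by positivity
  have q2 : (0:ℝ) < (M:ℝ) ^ (1 - b) * x ^ (-a) := by positivity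
  rw [mul_rpow g1.le x0.le, mul_rpow g1.le x0.le]
  calc _ ≤ C * (1 + log M) * (M * (g ^ a * x ^ a) + (M:ℝ) ^ (1 - b) * (g ^ (-a) * x ^ (-a))) := by gcongr
    _ ≤ C * (1 + log M) * ((1 + g ^ a + g ^ (-a)) * (M * x ^ a + (M:ℝ) ^ (1 - b) * x ^ (-a))) := by
        gcongr; linarith [mul_pos p1 q1, mul_pos p2 q2, mul_pos p1 q2, mul_pos p2 q1]
    _ = _ := by ring

lemma abel_le {c : ℕ → ℂ} {w : ℕ → ℝ} (hw : ∀ n, w (n + 1) ≤ w n) (h0 : ∀ n, 0 ≤ w n) {B : ℕ → ℝ} {N : ℕ} (hB : ∀ m ≤ N, ‖∑ n ∈ Finset.range m, c n‖ ≤ B m) :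
    ‖∑ n ∈ Finset.range N, (w n : ℂ) * c n‖ ≤ w N * B N + ∑ n ∈ Finset.range N, (w n - w (n + 1)) * B (n + 1) := by
  have e : ∑ n ∈ Finset.range N, (w n : ℂ) * c n = w N * ∑ n ∈ Finset.range N, c n + ∑ n ∈ Finset.range N, ((w n - w (n + 1) : ℝ) : ℂ) * ∑ m ∈ Finset.range (n + 1), c m := by
    clear hB
    induction N with
    | zero => simp
    | succ N ih => rw [Finset.sum_range_succ, ih, Finset.sum_range_succ (fun n => ((w n - w (n + 1) : ℝ) : ℂ) * _), Finset.sum_range_succ c]; push_cast; ring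
  rw [e]
  refine (norm_add_le _ _).trans (add_le_add ?_ ((norm_sum_le _ _).trans (Finset.sum_le_sum fun n hn => ?_)))
  · rw [norm_mul, Complex.norm_real, norm_of_nonneg (h0 N)]; exact mul_le_mul_of_nonneg_left (hB N le_rfl) (h0 N)
  · rw [norm_mul, Complex.norm_real, norm_of_nonneg (sub_nonneg.2 (hw n))]
    exact mul_le_mul_of_nonneg_left (hB _ (by have := Finset.mem_range.1 hn; omega)) (sub_nonneg.2 (hw n))

lemma abel_const {c : ℕ → ℂ} {w : ℕ → ℝ} (hw : ∀ n, w (n + 1) ≤ w n) (h0 : ∀ n, 0 ≤ w n) {B : ℝ} {N : ℕ} (hB : ∀ m ≤ N, ‖∑ n ∈ Finset.range m, c n‖ ≤ B) :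
    ‖∑ n ∈ Finset.range N, (w n : ℂ) * c n‖ ≤ w 0 * B := by
  refine (abel_le hw h0 hB).trans (le_of_eq ?_)
  rw [← Finset.sum_mul, Finset.sum_range_sub' w N]; ring

lemma rp_mono2 {x s p q p' q' : ℝ} (hx : 0 < x) (hs : 0 < s) (h : p * log x + q * log s ≤ p' * log x + q' * log s) : x ^ p * s ^ q ≤ x ^ p' * s ^ q' := by
  rw [rpow_def_of_pos hx, rpow_def_of_pos hs, rpow_def_of_pos hx, rpow_def_of_pos hs, ← exp_add, ← exp_add]
  exact exp_le_exp.2 (by linarith)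

lemma rp_exp {x s c e a : ℝ} (hx : 0 < x) (hs : 0 < s) : x ^ c * (s * x ^ e) ^ a = x ^ (c + e * a) * s ^ a := by
  rw [mul_rpow hs.le (by positivity), ← rpow_mul hx.le, rpow_add hx]; ring

lemma sq_block : ∃ C : ℝ, 1 ≤ C ∧ ∀ (M N : ℕ) (t : ℝ), 1 ≤ M → N ≤ M → 0 < t →
    ‖∑ n ∈ Finset.range N, ee (2 * t * sqrt (M + n))‖ ≤ C * (1 + log M) * sqrt M * (1 / t + t ^ ((1:ℝ) / 4)) := by
  obtain ⟨C2, h2, H2⟩ := sq_kd (σ := -1) (Or.inr rfl) kd2 (by norm_num) le_rfl (by norm_num) (by norm_num) (by norm_num [cc]) (by norm_num [cc])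
  obtain ⟨C3, h3, H3⟩ := sq_kd (σ := 1) (Or.inl rfl) kd3 (by norm_num) (by norm_num) (by norm_num) (by norm_num) (by norm_num [cc]) (by norm_num [cc])
  refine ⟨4 * (C2 + C3), by linarith, fun M N t hM hN ht => ?_⟩
  have M1 : (1:ℝ) ≤ M := by exact_mod_cast hM
  have M0 : (0:ℝ) < M := by linarith
  have lM := log_nonneg M1
  set s := 2 * t with hs
  have s0 : 0 < s := by positivity
  have tq : s ^ ((1:ℝ) / 4) ≤ 2 * t ^ ((1:ℝ) / 4) := by
    rw [hs, mul_rpow (by norm_num) ht.le]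
    have : (2:ℝ) ^ ((1:ℝ) / 4) ≤ 2 ^ (1:ℝ) := rpow_le_rpow_of_exponent_le (by norm_num) (by norm_num)
    rw [rpow_one] at this; gcongr
  have t4 : 0 < t ^ ((1:ℝ) / 4) := by positivity
  have ti : 0 < 1 / t := by positivity
  have sM : 0 < sqrt M := sqrt_pos.2 M0
  have fin : ∀ C, 0 ≤ C → C ≤ C2 + C3 → C * (1 + log M) * (2 * (sqrt M * s ^ ((1:ℝ) / 4))) ≤ 4 * (C2 + C3) * (1 + log M) * sqrt M * (1 / t + t ^ ((1:ℝ) / 4)) := fun C c0 hC => by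
    calc C * (1 + log M) * (2 * (sqrt M * s ^ ((1:ℝ) / 4))) ≤ (C2 + C3) * (1 + log M) * (2 * (sqrt M * (2 * t ^ ((1:ℝ) / 4)))) := by gcongr
      _ = 4 * (C2 + C3) * (1 + log M) * sqrt M * t ^ ((1:ℝ) / 4) := by ring
      _ ≤ _ := mul_le_mul_of_nonneg_left (by linarith) (by positivity)
  have sr : sqrt M = (M:ℝ) ^ ((1:ℝ) / 2) := sqrt_eq_rpow _
  by_cases c1 : s ≤ sqrt M
  · refine (sq_KL hM hN s0 c1).trans ?_
    rw [hs]
    calc 6 * sqrt M / (2 * t) = 3 * 1 * sqrt M * (1 / t) := by field_simp; norm_num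
      _ ≤ 4 * (C2 + C3) * (1 + log M) * sqrt M * (1 / t) := by gcongr <;> linarith
      _ ≤ _ := mul_le_mul_of_nonneg_left (by linarith) (by positivity)
  push Not at c1
  have ls : 1 / 2 * log M ≤ log s := by
    rw [← log_rpow M0, ← sr]; exact log_le_log sM c1.le
  by_cases c2 : s ≤ M
  · have ls2 : log s ≤ log M := log_le_log s0 c2
    refine (H2 M N s hM hN s0).trans (le_trans ?_ (fin C2 (by linarith) (by linarith)))
    refine mul_le_mul_of_nonneg_left ?_ (by positivity)
    have e1 := rp_exp (c := 1) (e := (1:ℝ) / 2 - (2:ℕ)) (a := 1 / 2) M0 s0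
    rw [rpow_one] at e1
    rw [e1, rp_exp M0 s0, sr, two_mul]
    refine add_le_add (rp_mono2 M0 s0 ?_) (rp_mono2 M0 s0 ?_)
    · push_cast; linarith
    · push_cast; linarith
  · push Not at c2
    have ls2 : log M ≤ log s := log_le_log M0 c2.le
    refine (H3 M N s hM hN s0).trans (le_trans ?_ (fin C3 (by linarith) (by linarith)))
    refine mul_le_mul_of_nonneg_left ?_ (by positivity)
    have e1 := rp_exp (c := 1) (e := (1:ℝ) / 2 - (3:ℕ)) (a := 1 / 6) M0 s0
    rw [rpow_one] at e1
    rw [e1, rp_exp M0 s0, sr, two_mul]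
    refine add_le_add (rp_mono2 M0 s0 ?_) (rp_mono2 M0 s0 ?_)
    · push_cast; linarith
    · push_cast; linarith

lemma dyadic_sum {c : ℕ → ℂ} {B : ℝ} {Y : ℕ} (hY : 1 ≤ Y) (h : ∀ M N, 1 ≤ M → N ≤ M → M ≤ Y → ‖∑ n ∈ Finset.range N, c (M + n)‖ ≤ B) :
    ‖∑ n ∈ Finset.Icc 1 Y, c n‖ ≤ 3 * (1 + log Y) * B := by
  have B0 : 0 ≤ B := (norm_nonneg _).trans (h 1 1 le_rfl le_rfl hY)
  have key : ∀ J Z : ℕ, Z ≤ Y → Z < 2 ^ J → ‖∑ n ∈ Finset.Ico 1 (Z + 1), c n‖ ≤ J * B := by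
    intro J
    induction J with
    | zero => intro Z _ hZ; simp at hZ; simp [hZ]
    | succ J ih =>
      intro Z hZY hZ
      by_cases q : Z < 2 ^ J
      · refine (ih Z hZY q).trans ?_; push_cast; linarith
      · push Not at q
        have p : 1 ≤ 2 ^ J := Nat.one_le_two_pow
        rw [← Finset.sum_Ico_consecutive _ p (show 2 ^ J ≤ Z + 1 by omega), Finset.sum_Ico_eq_sum_range c (2 ^ J)]
        refine (norm_add_le _ _).trans ?_
        have a := ih (2 ^ J - 1) (by omega) (by omega)
        rw [Nat.sub_add_cancel p] at a
        have b := h (2 ^ J) (Z + 1 - 2 ^ J) p (by rw [pow_succ] at hZ; omega) (by omega)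
        push_cast; linarith
  have := key (Nat.log 2 Y + 1) Y le_rfl (Nat.lt_pow_succ_log_self (by norm_num) Y)
  refine (show ‖∑ n ∈ Finset.Icc 1 Y, c n‖ ≤ _ from this).trans (mul_le_mul_of_nonneg_right ?_ B0)
  have Y1 : (1:ℝ) ≤ Y := by exact_mod_cast hY
  have : (Nat.log 2 Y : ℝ) * log 2 ≤ log Y := by
    rw [← log_pow]; refine log_le_log (by positivity) ?_
    exact_mod_cast Nat.pow_log_le_self 2 (by omega)
  push_cast
  nlinarith [log_two_gt_d9, log_nonneg Y1]

noncomputable def Kw (Y : ℕ) (t : ℝ) : ℂ := ∑ n ∈ Finset.Icc 1 Y, (((sqrt n)⁻¹ : ℝ) : ℂ) * ee (2 * t * sqrt n)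

lemma Kw_neg (Y : ℕ) (t : ℝ) : ‖Kw Y (-t)‖ = ‖Kw Y t‖ := by
  rw [← Complex.norm_conj (Kw Y t), Kw, Kw, map_sum]
  congr 1; refine Finset.sum_congr rfl fun n _ => ?_
  rw [map_mul, Complex.conj_ofReal, ← ee_neg]; congr 2; ring

lemma Kw_bd : ∃ C : ℝ, 1 ≤ C ∧ ∀ (Y : ℕ) (t : ℝ), 1 ≤ Y → ‖Kw Y t‖ ≤ C * (1 + log Y) ^ 2 * (1 / (1 / sqrt Y + |t|) + |t| ^ ((1:ℝ) / 4)) := by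
  obtain ⟨C, hC, H⟩ := sq_block
  refine ⟨6 * C, by linarith, fun Y t hY => ?_⟩
  wlog ht : 0 ≤ t generalizing t
  · have := this (-t) (by linarith); rwa [Kw_neg, abs_neg] at this
  rw [abs_of_nonneg ht]
  have Y1 : (1:ℝ) ≤ Y := by exact_mod_cast hY
  have lY := log_nonneg Y1
  have s0 : 0 < sqrt Y := sqrt_pos.2 (by linarith)
  have t4 : 0 ≤ t ^ ((1:ℝ) / 4) := by positivity
  have i0 : 0 < 1 / sqrt Y := by positivity
  by_cases c : t ≤ 1 / sqrt Y
  · have : ‖Kw Y t‖ ≤ 2 * sqrt Y := by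
      refine (norm_sum_le _ _).trans ?_
      have := sum_rpow_le (s := 1 / 2) (by norm_num) (by norm_num) Y
      rw [sum_r1 (fun n : ℕ => (n:ℝ) ^ (-(1 / 2) : ℝ)) Y, show (1:ℝ) - 1 / 2 = 1 / 2 by norm_num, ← sqrt_eq_rpow] at this
      refine le_trans (Finset.sum_le_sum fun n _ => le_of_eq ?_) (this.trans (by linarith))
      rw [norm_mul, ee_norm, mul_one, Complex.norm_real, norm_of_nonneg (by positivity), sqrt_eq_rpow, rpow_neg (by positivity)]
    refine this.trans ?_
    have q : sqrt Y / 2 ≤ 1 / (1 / sqrt Y + t) := by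
      rw [le_div_iff₀ (by positivity)]
      have : sqrt Y * (1 / sqrt Y) = 1 := by field_simp
      nlinarith
    calc 2 * sqrt Y ≤ 6 * (sqrt Y / 2) := by linarith
      _ ≤ 6 * C * (1 + log Y) ^ 2 * (1 / (1 / sqrt Y + t) + t ^ ((1:ℝ) / 4)) := by
        refine mul_le_mul ?_ (by linarith) (by positivity) (by positivity)
        nlinarith [one_le_pow₀ (show 1 ≤ 1 + log (Y:ℝ) by linarith) (n := 2)]
  push Not at c
  have t0 : 0 < t := i0.trans c
  have D := dyadic_sum (c := fun n => (((sqrt n)⁻¹ : ℝ) : ℂ) * ee (2 * t * sqrt n)) (B := C * (1 + log Y) * (1 / t + t ^ ((1:ℝ) / 4))) (Y := Y) hY (by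
    intro M N hM hN hMY
    have M1 : (1:ℝ) ≤ M := by exact_mod_cast hM
    have MY : (M:ℝ) ≤ Y := by exact_mod_cast hMY
    have sM : 0 < sqrt M := sqrt_pos.2 (by linarith)
    push_cast
    have := abel_const (c := fun n : ℕ => ee (2 * t * sqrt (M + n))) (w := fun n : ℕ => (sqrt (M + n))⁻¹) (N := N)
      (fun n => inv_anti₀ (sqrt_pos.2 (by positivity)) (sqrt_le_sqrt (by push_cast; linarith))) (fun n => by positivity) (fun m hm => H M m t hM (hm.trans hN) t0)
    push_cast at this
    refine this.trans ?_
    rw [add_zero]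
    calc (sqrt M)⁻¹ * (C * (1 + log M) * sqrt M * (1 / t + t ^ ((1:ℝ) / 4))) = C * (1 + log M) * (1 / t + t ^ ((1:ℝ) / 4)) := by field_simp
      _ ≤ _ := by gcongr)
  refine D.trans ?_
  have q : 1 / t ≤ 2 * (1 / (1 / sqrt Y + t)) := by
    rw [mul_one_div, div_le_div_iff₀ t0 (by positivity)]; linarith
  calc 3 * (1 + log Y) * (C * (1 + log Y) * (1 / t + t ^ ((1:ℝ) / 4))) = 3 * C * (1 + log Y) ^ 2 * (1 / t + t ^ ((1:ℝ) / 4)) := by ring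
    _ ≤ 3 * C * (1 + log Y) ^ 2 * (2 * (1 / (1 / sqrt Y + t) + t ^ ((1:ℝ) / 4))) := mul_le_mul_of_nonneg_left (by linarith) (by positivity)
    _ = _ := by ring

noncomputable def SS (a : ℕ → ℂ) (Y : ℕ) (t : ℝ) : ℂ := ∑ n ∈ Finset.Icc 1 Y, a n * ee (2 * t * sqrt n)

lemma SS_cont (a : ℕ → ℂ) (Y : ℕ) : Continuous (SS a Y) := by
  unfold SS; exact continuous_finsetSum _ fun n _ => continuous_const.mul (ee_cont.comp (by fun_prop))

lemma SS_le (a : ℕ → ℂ) (Y : ℕ) (t : ℝ) : ‖SS a Y t‖ ≤ ∑ n ∈ Finset.Icc 1 Y, ‖a n‖ := by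
  refine (norm_sum_le _ _).trans (Finset.sum_le_sum fun n _ => ?_); rw [norm_mul, ee_norm, mul_one]

lemma Kw_SS (Y : ℕ) : Kw Y = SS (fun n => (((sqrt n)⁻¹ : ℝ) : ℂ)) Y := rfl

lemma bint {α E : Type*} [TopologicalSpace α] [MeasurableSpace α] [OpensMeasurableSpace α] [NormedAddCommGroup E] [SecondCountableTopology E] [MeasurableSpace E] [BorelSpace E] [TopologicalSpace.PseudoMetrizableSpace α]
    (μ : Measure α) [IsFiniteMeasure μ] {f : α → E} (hf : Continuous f) {B : ℝ} (hB : ∀ x, ‖f x‖ ≤ B) : Integrable f μ :=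
  Integrable.of_bound hf.aestronglyMeasurable B (Filter.Eventually.of_forall hB)

lemma dual (a : ℕ → ℂ) (Y : ℕ) (μ : Measure ℝ) [IsFiniteMeasure μ] {κ : ℝ} (κ0 : 0 ≤ κ) (hκ : ∀ᵐ t ∂μ, ∫ t', ‖Kw Y (t - t')‖ ∂μ ≤ κ) :
    ∫ t, ‖SS a Y t‖ ^ 2 ∂μ ≤ (∑ n ∈ Finset.Icc 1 Y, ‖a n‖ ^ 2 * sqrt n) * κ := by
  set X := ∫ t, ‖SS a Y t‖ ^ 2 ∂μ with hX
  set Λ := ∑ n ∈ Finset.Icc 1 Y, ‖a n‖ ^ 2 * sqrt n with hΛ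
  have Λ0 : 0 ≤ Λ := Finset.sum_nonneg fun _ _ => by positivity
  have X0 : 0 ≤ X := integral_nonneg fun _ => by positivity
  set B := ∑ n ∈ Finset.Icc 1 Y, ‖a n‖
  set D := ∑ n ∈ Finset.Icc 1 Y, ‖(((sqrt n)⁻¹ : ℝ) : ℂ)‖
  have hB := SS_le a Y
  have hD : ∀ t, ‖Kw Y t‖ ≤ D := fun t => by rw [Kw_SS]; exact SS_le _ Y t
  have B0 : 0 ≤ B := (norm_nonneg _).trans (hB 0)
  have D0 : 0 ≤ D := (norm_nonneg _).trans (hD 0)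
  have cS := SS_cont a Y
  have cK : Continuous (Kw Y) := by rw [Kw_SS]; exact SS_cont _ Y
  have cE : ∀ r : ℝ, Continuous fun t : ℝ => ee (2 * t * r) := fun r => ee_cont.comp (by fun_prop)
  have cj : Continuous fun t => (starRingEnd ℂ) (SS a Y t) := Complex.continuous_conj.comp cS
  set c : ℕ → ℂ := fun n => ∫ t, ee (2 * t * sqrt n) * (starRingEnd ℂ) (SS a Y t) ∂μ with hc
  have ic : ∀ r : ℝ, Integrable (fun t => ee (2 * t * r) * (starRingEnd ℂ) (SS a Y t)) μ := fun r =>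
    bint μ ((cE r).mul cj) (B := B) fun t => by rw [norm_mul, ee_norm, one_mul, Complex.norm_conj]; exact hB t
  have e1 : (X:ℂ) = ∑ n ∈ Finset.Icc 1 Y, a n * c n := by
    simp only [hc, ← integral_const_mul]
    rw [← integral_finsetSum _ fun n _ => (ic _).const_mul _, hX, ← integral_complex_ofReal]
    refine integral_congr_ae (Filter.Eventually.of_forall fun t => ?_)
    show ((‖SS a Y t‖ ^ 2 : ℝ) : ℂ) = _
    simp only [← mul_assoc, ← Finset.sum_mul]
    exact (Complex.mul_conj' (SS a Y t)).symm ▸ by push_cast; rfl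
  have iKS : ∀ t, Integrable (fun t' => Kw Y (t - t') * SS a Y t') μ := fun t =>
    bint μ ((cK.comp (by fun_prop)).mul cS) (B := D * B) fun t' => by rw [norm_mul]; exact mul_le_mul (hD _) (hB _) (norm_nonneg _) D0
  have e2 : ((∑ n ∈ Finset.Icc 1 Y, ‖c n‖ ^ 2 * (sqrt n)⁻¹ : ℝ) : ℂ) = ∫ t, (starRingEnd ℂ) (SS a Y t) * ∫ t', Kw Y (t - t') * SS a Y t' ∂μ ∂μ := by
    have : ∀ t, (starRingEnd ℂ) (SS a Y t) * ∫ t', Kw Y (t - t') * SS a Y t' ∂μ = ∑ n ∈ Finset.Icc 1 Y, (ee (2 * t * sqrt n) * (starRingEnd ℂ) (SS a Y t)) * ((((sqrt n)⁻¹ : ℝ) : ℂ) * (starRingEnd ℂ) (c n)) := by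
      intro t
      have : ∫ t', Kw Y (t - t') * SS a Y t' ∂μ = ∑ n ∈ Finset.Icc 1 Y, ee (2 * t * sqrt n) * ((((sqrt n)⁻¹ : ℝ) : ℂ) * (starRingEnd ℂ) (c n)) := by
        simp only [hc, ← integral_conj, ← integral_const_mul]
        rw [← integral_finsetSum]
        · refine integral_congr_ae (Filter.Eventually.of_forall fun t' => ?_)
          show Kw Y (t - t') * _ = _
          rw [Kw, Finset.sum_mul]
          refine Finset.sum_congr rfl fun n _ => ?_
          rw [map_mul, Complex.conj_conj, ← ee_neg, show 2 * (t - t') * sqrt n = 2 * t * sqrt n + -(2 * t' * sqrt n) by ring, ee_add]; ring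
        · intro n _
          refine Integrable.const_mul (Integrable.const_mul ?_ _) _
          exact bint μ (Complex.continuous_conj.comp ((cE _).mul cj)) (B := B) fun t => by rw [Complex.norm_conj, norm_mul, ee_norm, one_mul, Complex.norm_conj]; exact hB t
      rw [this, Finset.mul_sum]
      refine Finset.sum_congr rfl fun n _ => by ring
    simp only [this]
    rw [integral_finsetSum _ fun n _ => (ic _).mul_const _]
    push_cast
    refine Finset.sum_congr rfl fun n _ => ?_
    rw [integral_mul_const, ← Complex.mul_conj' (c n)]; ring
  have e3 : ∑ n ∈ Finset.Icc 1 Y, ‖c n‖ ^ 2 * (sqrt n)⁻¹ ≤ X * κ := by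
    have n0 : 0 ≤ ∑ n ∈ Finset.Icc 1 Y, ‖c n‖ ^ 2 * (sqrt n)⁻¹ := Finset.sum_nonneg fun _ _ => by positivity
    rw [← norm_of_nonneg n0, ← Complex.norm_real, e2]
    set F : ℝ × ℝ → ℝ := fun z => ‖SS a Y z.1‖ ^ 2 * ‖Kw Y (z.1 - z.2)‖ with hF
    have cF : Continuous F := by
      simp only [hF]; exact ((cS.comp continuous_fst).norm.pow 2).mul ((cK.comp (by fun_prop)).norm)
    have bF : ∀ z, ‖F z‖ ≤ B ^ 2 * D := fun z => by
      rw [norm_of_nonneg (show 0 ≤ ‖SS a Y z.1‖ ^ 2 * ‖Kw Y (z.1 - z.2)‖ by positivity)]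
      exact mul_le_mul (pow_le_pow_left₀ (norm_nonneg _) (hB _) 2) (hD _) (norm_nonneg _) (by positivity)
    have iF : Integrable F (μ.prod μ) := bint _ cF bF
    have iF1 := iF.integral_prod_left
    have iF2 : Integrable (fun z : ℝ × ℝ => F z.swap) (μ.prod μ) := bint _ (cF.comp continuous_swap) fun z => bF _
    have iF3 : Integrable (fun x => ∫ y, F (y, x) ∂μ) μ := iF2.integral_prod_left
    have sw : ∫ t, ∫ t', F (t', t) ∂μ ∂μ = ∫ t, ∫ t', F (t, t') ∂μ ∂μ := integral_integral_swap (f := fun t t' => F (t', t)) iF2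
    have up : ∫ t, ∫ t', F (t, t') ∂μ ∂μ ≤ X * κ := by
      rw [hX, ← integral_mul_const]
      refine integral_mono_ae iF1 ((bint μ (cS.norm.pow 2) (B := B ^ 2) fun t => ?_).mul_const _) ?_
      · show ‖‖SS a Y t‖ ^ 2‖ ≤ B ^ 2
        rw [norm_of_nonneg (show 0 ≤ ‖SS a Y t‖ ^ 2 by positivity)]; exact pow_le_pow_left₀ (norm_nonneg _) (hB _) 2
      · filter_upwards [hκ] with t ht
        show ∫ t', ‖SS a Y t‖ ^ 2 * ‖Kw Y (t - t')‖ ∂μ ≤ _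
        rw [integral_const_mul]
        exact mul_le_mul_of_nonneg_left ht (by positivity)
    calc _ ≤ ∫ t, (1 / 2) * ((∫ t', F (t, t') ∂μ) + ∫ t', F (t', t) ∂μ) ∂μ := by
          refine norm_integral_le_of_norm_le ((iF1.add iF3).const_mul _) (Filter.Eventually.of_forall fun t => ?_)
          have j1 : Integrable (fun t' => F (t, t')) μ := bint μ (cF.comp (by fun_prop)) fun z => bF _
          have j2 : Integrable (fun t' => F (t', t)) μ := bint μ (cF.comp (by fun_prop)) fun z => bF _
          rw [← integral_const_mul, ← integral_add j1 j2, ← integral_const_mul]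
          refine norm_integral_le_of_norm_le ((j1.add j2).const_mul _) (Filter.Eventually.of_forall fun t' => ?_)
          simp only [hF]
          rw [norm_mul, Complex.norm_conj, norm_mul, show ‖Kw Y (t' - t)‖ = ‖Kw Y (t - t')‖ by rw [← Kw_neg]; congr 2; ring]
          linarith [mul_nonneg (norm_nonneg (Kw Y (t - t'))) (sq_nonneg (‖SS a Y t‖ - ‖SS a Y t'‖))]
      _ = ∫ t, ∫ t', F (t, t') ∂μ ∂μ := by rw [integral_const_mul, integral_add iF1 iF3, sw]; ring
      _ ≤ _ := up
  have cs : X ^ 2 ≤ Λ * (X * κ) := by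
    have h1 : X ≤ ∑ n ∈ Finset.Icc 1 Y, (‖a n‖ * sqrt (sqrt n)) * (‖c n‖ * (sqrt (sqrt n))⁻¹) := by
      rw [← norm_of_nonneg X0, ← Complex.norm_real, e1]
      refine (norm_sum_le _ _).trans (Finset.sum_le_sum fun n hn => le_of_eq ?_)
      have : 0 < sqrt (sqrt n) := sqrt_pos.2 (sqrt_pos.2 (by exact_mod_cast (Finset.mem_Icc.1 hn).1))
      rw [norm_mul]; field_simp
    refine (pow_le_pow_left₀ X0 h1 2).trans ((Finset.sum_mul_sq_le_sq_mul_sq _ _ _).trans (mul_le_mul (le_of_eq ?_) (le_trans (le_of_eq ?_) e3) (Finset.sum_nonneg fun _ _ => by positivity) Λ0))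
    · exact Finset.sum_congr rfl fun n _ => by rw [mul_pow, sq_sqrt (by positivity)]
    · exact Finset.sum_congr rfl fun n _ => by rw [mul_pow, inv_pow, sq_sqrt (by positivity)]
  rcases X0.eq_or_lt with q | q
  · rw [← q]; positivity
  · nlinarith

lemma int_inv {u L δ t : ℝ} (hδ : 0 < δ) (h1 : u ≤ t) (h2 : t ≤ u + L) : ∫ s in u..u + L, 1 / (δ + |t - s|) ≤ 2 * log (1 + L / δ) := by
  have c : Continuous fun s => 1 / (δ + |t - s|) := continuous_const.div (by fun_prop) fun s => by positivity
  have key : ∀ x, 0 ≤ x → x ≤ L → ∫ s in (0:ℝ)..x, 1 / (δ + s) ≤ log (1 + L / δ) := fun x h0 hx => by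
    rw [intervalIntegral.integral_comp_add_left (fun s => 1 / s) δ, integral_one_div_of_pos (by linarith) (by linarith)]
    refine log_le_log (by positivity) ?_
    rw [add_zero, add_div, div_self hδ.ne']; gcongr
  rw [← intervalIntegral.integral_add_adjacent_intervals (c.intervalIntegrable u t) (c.intervalIntegrable t _), two_mul]
  refine add_le_add ?_ ?_
  · rw [intervalIntegral.integral_congr (g := fun s => (fun r => 1 / (δ + r)) (t - s)) fun s hs => ?_, intervalIntegral.integral_comp_sub_left (fun r => 1 / (δ + r)) t, sub_self]
    · exact key _ (by linarith) (by linarith)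
    · rw [Set.uIcc_of_le h1] at hs
      simp only [abs_of_nonneg (show 0 ≤ t - s by linarith [hs.2])]
  · rw [intervalIntegral.integral_congr (g := fun s => (fun r => 1 / (δ + r)) (s - t)) fun s hs => ?_, intervalIntegral.integral_comp_sub_right (fun r => 1 / (δ + r)) t, sub_self]
    · exact key _ (by linarith) (by linarith)
    · rw [Set.uIcc_of_le h2] at hs
      simp only [abs_of_nonpos (show t - s ≤ 0 by linarith [hs.1]), neg_sub]

lemma SS_triv {a : ℕ → ℂ} {Y : ℕ} (ha : ∀ n, 1 ≤ n → ‖a n‖ ≤ (n:ℝ) ^ (-(3:ℝ) / 4)) (t : ℝ) : ‖SS a Y t‖ ≤ 4 * (Y:ℝ) ^ ((1:ℝ) / 4) := by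
  have := sum_rpow_le (s := 3 / 4) (by norm_num) (by norm_num) Y
  rw [sum_r1 (fun n : ℕ => (n:ℝ) ^ (-(3 / 4) : ℝ)) Y, show (1:ℝ) - 3 / 4 = 1 / 4 by norm_num] at this
  refine (SS_le a Y t).trans (le_trans (Finset.sum_le_sum fun n hn => ?_) (this.trans (by linarith)))
  rw [← neg_div]; exact ha n (Finset.mem_Icc.1 hn).1

lemma SS_wt {a : ℕ → ℂ} {Y : ℕ} (ha : ∀ n, 1 ≤ n → ‖a n‖ ≤ (n:ℝ) ^ (-(3:ℝ) / 4)) : ∑ n ∈ Finset.Icc 1 Y, ‖a n‖ ^ 2 * sqrt n ≤ 1 + log Y := by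
  have := harm_le Y
  rw [sum_r1 (fun n : ℕ => 1 / (n:ℝ))] at this
  refine le_trans (Finset.sum_le_sum fun n hn => ?_) this
  have n1 := (Finset.mem_Icc.1 hn).1
  have n0 : (0:ℝ) < n := by exact_mod_cast n1
  calc ‖a n‖ ^ 2 * sqrt n ≤ ((n:ℝ) ^ (-(3:ℝ) / 4)) ^ 2 * sqrt n := by gcongr; exact ha n n1
    _ = 1 / (n:ℝ) := by
      rw [← rpow_natCast ((n:ℝ) ^ _), ← rpow_mul n0.le, sqrt_eq_rpow, ← rpow_add n0, show -(3:ℝ) / 4 * (2:ℕ) + 1 / 2 = -1 by norm_num, rpow_neg_one, one_div]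

def lvSet (a : ℕ → ℂ) (Y : ℕ) (u U V : ℝ) : Set ℝ := {t | u ≤ t ∧ t ≤ u + U ∧ V ≤ ‖SS a Y t‖}

lemma lvSet_meas (a Y u U V) : MeasurableSet (lvSet a Y u U V) :=
  measurableSet_Ici.inter (measurableSet_Iic.inter (measurableSet_le measurable_const (SS_cont a Y).norm.measurable))

lemma lvSet_fin (a Y u U V) : volume (lvSet a Y u U V) ≠ ⊤ :=
  ne_top_of_le_ne_top (b := volume (Set.Icc u (u + U))) (by simp) (measure_mono fun _ h => ⟨h.1, h.2.1⟩)

lemma lv0 : ∃ C : ℝ, 1 ≤ C ∧ ∀ (a : ℕ → ℂ) (Y : ℕ) (u L V : ℝ), 1 ≤ Y → 0 < L → 0 < V → (∀ n, 1 ≤ n → ‖a n‖ ≤ (n:ℝ) ^ (-(3:ℝ) / 4)) →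
    V ^ 2 * volume.real (lvSet a Y u L V) ≤ C * (1 + log Y) ^ 3 * (2 * log (1 + L * sqrt Y) + L ^ ((1:ℝ) / 4) * volume.real (lvSet a Y u L V)) := by
  obtain ⟨C, hC, hK⟩ := Kw_bd
  refine ⟨C, hC, fun a Y u L V hY hL hV ha => ?_⟩
  set E := lvSet a Y u L V with hE
  have mE := lvSet_meas a Y u L V
  have fE := lvSet_fin a Y u L V
  have Y1 : (1:ℝ) ≤ Y := by exact_mod_cast hY
  have lY := log_nonneg Y1
  have sY : 0 < sqrt Y := sqrt_pos.2 (by linarith)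
  have i0 : 0 < 1 / sqrt Y := by positivity
  have : IsFiniteMeasure (volume.restrict E) := ⟨by rw [Measure.restrict_apply_univ]; exact fE.lt_top⟩
  have lL : 0 ≤ log (1 + L * sqrt Y) := log_nonneg (by nlinarith)
  set κ := C * (1 + log Y) ^ 2 * (2 * log (1 + L * sqrt Y) + L ^ ((1:ℝ) / 4) * volume.real E)
  have κ0 : 0 ≤ κ := by positivity
  have D := dual a Y (volume.restrict E) κ0 (by
    rw [ae_restrict_iff' mE]
    refine Filter.Eventually.of_forall fun t ht => ?_
    have c1 : Continuous fun s => 1 / (1 / sqrt Y + |t - s|) := continuous_const.div (by fun_prop) fun s => by positivity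
    have i1 : IntegrableOn (fun s => 1 / (1 / sqrt Y + |t - s|)) E := (c1.integrableOn_Icc (a := u) (b := u + L)).mono_set fun _ h => ⟨h.1, h.2.1⟩
    have i2 : IntegrableOn (fun _ : ℝ => L ^ ((1:ℝ) / 4)) E := integrableOn_const fE
    calc ∫ s in E, ‖Kw Y (t - s)‖ ≤ ∫ s in E, C * (1 + log Y) ^ 2 * (1 / (1 / sqrt Y + |t - s|) + L ^ ((1:ℝ) / 4)) := by
          refine setIntegral_mono_on₀ ?_ ((i1.add i2).const_mul _) mE.nullMeasurableSet fun s hs => ?_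
          · exact ((by rw [Kw_SS]; exact (SS_cont _ Y).comp (by fun_prop) : Continuous fun s => Kw Y (t - s)).norm.integrableOn_Icc (a := u) (b := u + L)).mono_set fun _ h => ⟨h.1, h.2.1⟩
          · refine (hK Y (t - s) hY).trans ?_
            gcongr
            exact abs_le.2 ⟨by linarith [ht.1, hs.2.1], by linarith [hs.1, ht.2.1]⟩
      _ = C * (1 + log Y) ^ 2 * ((∫ s in E, 1 / (1 / sqrt Y + |t - s|)) + L ^ ((1:ℝ) / 4) * volume.real E) := by
          rw [integral_const_mul, integral_add i1 i2, setIntegral_const, smul_eq_mul, mul_comm (L ^ _)]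
      _ ≤ κ := by
          have : ∫ s in E, 1 / (1 / sqrt Y + |t - s|) ≤ 2 * log (1 + L * sqrt Y) := by
            refine le_trans ?_ (le_trans (int_inv (u := u) (L := L) i0 ht.1 ht.2.1) (le_of_eq (by rw [div_div_eq_mul_div, div_one])))
            rw [intervalIntegral.integral_of_le (by linarith), ← integral_Icc_eq_integral_Ioc]
            exact setIntegral_mono_set c1.integrableOn_Icc (Filter.Eventually.of_forall fun s => by simp only [Pi.zero_apply]; positivity) (Filter.Eventually.of_forall fun s h => ⟨h.1, h.2.1⟩)
          show _ ≤ C * (1 + log Y) ^ 2 * (2 * log (1 + L * sqrt Y) + L ^ ((1:ℝ) / 4) * volume.real E)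
          gcongr)
  have lo : V ^ 2 * volume.real E ≤ ∫ t in E, ‖SS a Y t‖ ^ 2 := by
    have := setIntegral_ge_of_const_le_real mE fE (c := V ^ 2) (f := fun t => ‖SS a Y t‖ ^ 2) (fun t ht => pow_le_pow_left₀ hV.le ht.2.2 2)
      ((((SS_cont a Y).norm.pow 2).integrableOn_Icc (a := u) (b := u + L)).mono_set fun _ h => ⟨h.1, h.2.1⟩)
    exact this
  calc _ ≤ _ := lo.trans D
    _ ≤ (1 + log Y) * κ := mul_le_mul_of_nonneg_right (SS_wt ha) κ0
    _ = _ := by simp only [κ]; ring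

lemma lv1 : ∃ C : ℝ, 1 ≤ C ∧ ∀ (a : ℕ → ℂ) (Y : ℕ) (u U V : ℝ), 1 ≤ Y → 0 ≤ U → 0 < V → (∀ n, 1 ≤ n → ‖a n‖ ≤ (n:ℝ) ^ (-(3:ℝ) / 4)) →
    volume.real (lvSet a Y u U V) ≤ C * (1 + log Y) ^ 16 * ((V ^ 2)⁻¹ + U * (V ^ 10)⁻¹) := by
  obtain ⟨C, hC, h0⟩ := lv0
  refine ⟨48 * C * (2 * C) ^ 4, by nlinarith [one_le_pow₀ (show 1 ≤ 2 * C by linarith) (n := 4)], fun a Y u U V hY hU hV ha => ?_⟩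
  have Y1 : (1:ℝ) ≤ Y := by exact_mod_cast hY
  have lY := log_nonneg Y1
  set l := 1 + log (Y:ℝ) with hl
  have l1 : 1 ≤ l := by linarith
  by_cases hV4 : 4 * (Y:ℝ) ^ ((1:ℝ) / 4) < V
  · have : lvSet a Y u U V = ∅ := Set.eq_empty_of_forall_notMem fun t ht => by linarith [ht.2.2, SS_triv (Y := Y) ha t]
    rw [this, measureReal_empty]; positivity
  push Not at hV4
  have V4 : V ^ 4 ≤ 256 * Y := by
    calc V ^ 4 ≤ (4 * (Y:ℝ) ^ ((1:ℝ) / 4)) ^ 4 := pow_le_pow_left₀ hV.le hV4 4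
      _ = 256 * Y := by rw [mul_pow, ← rpow_natCast ((Y:ℝ) ^ _), ← rpow_mul (by linarith)]; norm_num
  have q0 : 0 < 2 * C * l ^ 3 := by positivity
  set L := (V ^ 2 / (2 * C * l ^ 3)) ^ 4 with hL
  have L0 : 0 < L := by positivity
  have L4 : L ^ ((1:ℝ) / 4) = V ^ 2 / (2 * C * l ^ 3) := by
    rw [hL, ← rpow_natCast (V ^ 2 / _), ← rpow_mul (by positivity)]; norm_num
  have LV : L ≤ V ^ 8 := by
    have : V ^ 2 / (2 * C * l ^ 3) ≤ V ^ 2 := div_le_self (by positivity) (by nlinarith [one_le_pow₀ l1 (n := 3)])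
    exact (pow_le_pow_left₀ (by positivity) this 4).trans (le_of_eq (by ring))
  have lg : log (1 + L * sqrt Y) ≤ 12 * l := by
    have s1 : sqrt Y ≤ Y := by rw [sqrt_le_left (by linarith)]; nlinarith
    have : 1 + L * sqrt Y ≤ 100000 * (Y:ℝ) ^ 3 := by
      have : L * sqrt Y ≤ (256 * Y) ^ 2 * Y := mul_le_mul (LV.trans (by rw [show V ^ 8 = (V ^ 4) ^ 2 by ring]; gcongr)) s1 (by positivity) (by positivity)
      linarith [one_le_pow₀ Y1 (n := 3)]
    refine (log_le_log (by positivity) this).trans ?_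
    rw [log_mul (by norm_num) (by positivity), log_pow]
    have : log 100000 ≤ 12 := by
      rw [show (100000:ℝ) = (10:ℝ) ^ 5 by norm_num, log_pow]
      have : log 10 ≤ log (2 ^ 3 * (5/4)) := log_le_log (by norm_num) (by norm_num)
      rw [log_mul (by norm_num) (by norm_num), log_pow] at this
      have h2 := log_le_sub_one_of_pos (show (0:ℝ) < 5 / 4 by norm_num)
      push_cast at this ⊢; linarith [log_two_lt_d9]
    rw [hl]; push_cast; linarith
  have one : ∀ u, volume.real (lvSet a Y u L V) ≤ 48 * C * l ^ 4 * (V ^ 2)⁻¹ := fun u => by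
    have := h0 a Y u L V hY L0 hV ha
    rw [L4] at this
    set m := volume.real (lvSet a Y u L V)
    have e : C * l ^ 3 * (2 * log (1 + L * sqrt Y) + V ^ 2 / (2 * C * l ^ 3) * m) = 2 * C * l ^ 3 * log (1 + L * sqrt Y) + V ^ 2 * m / 2 := by field_simp
    rw [← hl, e] at this
    rw [← div_eq_mul_inv, le_div_iff₀ (by positivity)]
    have := mul_le_mul_of_nonneg_left lg (show 0 ≤ 2 * C * l ^ 3 by positivity)
    linarith
  set b := 48 * C * l ^ 4 * (V ^ 2)⁻¹
  have b0 : 0 ≤ b := by positivity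
  have many : ∀ k : ℕ, volume.real (lvSet a Y u (k * L) V) ≤ (k + 1) * b := by
    intro k
    induction k with
    | zero => 
      refine le_trans (measureReal_mono (show lvSet a Y u ((0:ℕ) * L) V ⊆ lvSet a Y u L V from fun t ht => ⟨ht.1, ht.2.1.trans (by simp [L0.le]), ht.2.2⟩) (lvSet_fin a Y u L V)) ((one u).trans (by simp))
    | succ k ih =>
      have : lvSet a Y u ((k + 1 : ℕ) * L) V ⊆ lvSet a Y u (k * L) V ∪ lvSet a Y (u + k * L) L V := fun t ht => by
        rcases le_total t (u + k * L) with c | c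
        · exact Or.inl ⟨ht.1, c, ht.2.2⟩
        · refine Or.inr ⟨c, ht.2.1.trans (by push_cast; linarith), ht.2.2⟩
      refine (measureReal_mono this (measure_union_ne_top (lvSet_fin a Y _ _ V) (lvSet_fin a Y _ _ V))).trans ((measureReal_union_le _ _).trans ?_)
      push_cast; linarith [one (u + k * L)]
  have hk : U ≤ ⌈U / L⌉₊ * L := by rw [← div_le_iff₀ L0]; exact Nat.le_ceil _
  have cl := Nat.ceil_lt_add_one (show 0 ≤ U / L by positivity)
  have m2 := (measureReal_mono (μ := volume) (fun t ht => ⟨ht.1, ht.2.1.trans (by linarith), ht.2.2⟩ : lvSet a Y u U V ⊆ lvSet a Y u (⌈U / L⌉₊ * L) V) (lvSet_fin a Y _ _ V)).trans (many ⌈U / L⌉₊)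
  have one' : 1 ≤ (2 * C) ^ 4 * l ^ 12 := one_le_mul_of_one_le_of_one_le (one_le_pow₀ (by linarith)) (one_le_pow₀ l1)
  calc _ ≤ (2 + U / L) * b := m2.trans (mul_le_mul_of_nonneg_right (by linarith) b0)
    _ = 48 * C * l ^ 4 * (2 * (V ^ 2)⁻¹ + (2 * C) ^ 4 * l ^ 12 * (U * (V ^ 10)⁻¹)) := by
        simp only [b, hL]; field_simp
    _ ≤ 48 * C * l ^ 4 * ((2 * C) ^ 4 * l ^ 12 * (V ^ 2)⁻¹ + (2 * C) ^ 4 * l ^ 12 * (U * (V ^ 10)⁻¹)) := by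
        gcongr
        have : (2:ℝ) ≤ (2 * C) ^ 4 := le_trans (by norm_num) (pow_le_pow_left₀ (by norm_num) (show 2 ≤ 2 * C by linarith) 4)
        exact this.trans (le_mul_of_one_le_right (by positivity) (one_le_pow₀ l1))
    _ = _ := by ring

lemma dyad_pt {x : ℝ} {J0 J : ℕ} (p : ℕ) (h0 : 2 ^ J0 ≤ x) (hx : x < 2 ^ J) : x ^ p ≤ ∑ j ∈ Finset.Ico J0 J, 2 ^ (p * (j + 1)) * (if 2 ^ j ≤ x then (1:ℝ) else 0) := by
  induction J with
  | zero => exfalso; linarith [one_le_pow₀ (show (1:ℝ) ≤ 2 by norm_num) (n := J0), pow_zero (2:ℝ)]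
  | succ J ih =>
    have hJ : J0 ≤ J := Nat.lt_succ_iff.1 ((pow_lt_pow_iff_right₀ (show (1:ℝ) < 2 by norm_num)).1 (h0.trans_lt hx))
    rw [Finset.sum_Ico_succ_top hJ]
    by_cases c : x < 2 ^ J
    · exact (ih c).trans (le_add_of_nonneg_right (by positivity))
    · push Not at c
      rw [if_pos c, mul_one]
      refine le_add_of_nonneg_of_le (Finset.sum_nonneg fun _ _ => by positivity) ?_
      rw [mul_comm, pow_mul]
      exact pow_le_pow_left₀ (le_trans (by positivity) h0) hx.le p

/-- moment from level sets -/
lemma mom_lev {I : Set ℝ} (mI : MeasurableSet I) (fI : volume I ≠ ⊤) {f : ℝ → ℝ} (hf : Measurable f) (f0 : ∀ t, 0 ≤ f t) {J0 J : ℕ} (p : ℕ)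
    (h0 : ∀ t ∈ I, f t ≠ 0 → 2 ^ J0 ≤ f t) (h1 : ∀ t ∈ I, f t < 2 ^ J) (hp : p ≠ 0) :
    ∫ t in I, f t ^ p ≤ ∑ j ∈ Finset.Ico J0 J, 2 ^ (p * (j + 1)) * volume.real {t | t ∈ I ∧ 2 ^ j ≤ f t} := by
  have ms : ∀ j : ℕ, MeasurableSet {t | (2:ℝ) ^ j ≤ f t} := fun j => measurableSet_le measurable_const hf
  have ii : ∀ j : ℕ, IntegrableOn (fun t => if (2:ℝ) ^ j ≤ f t then (1:ℝ) else 0) I := fun j =>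
    have : IsFiniteMeasure (volume.restrict I) := ⟨by rw [Measure.restrict_apply_univ]; exact fI.lt_top⟩
    Integrable.of_bound (C := 1) (Measurable.ite (ms j) measurable_const measurable_const).aestronglyMeasurable (Filter.Eventually.of_forall fun t => by show ‖ite _ _ _‖ ≤ _; split_ifs <;> simp)
  calc ∫ t in I, f t ^ p ≤ ∫ t in I, ∑ j ∈ Finset.Ico J0 J, 2 ^ (p * (j + 1)) * (if 2 ^ j ≤ f t then (1:ℝ) else 0) := by
        refine integral_mono_of_nonneg (Filter.Eventually.of_forall fun t => pow_nonneg (f0 t) p) (integrable_finsetSum _ fun j _ => (ii j).const_mul _) ?_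
        filter_upwards [ae_restrict_mem mI] with t ht
        by_cases c : f t = 0
        · simp only [c, zero_pow hp]; exact Finset.sum_nonneg fun _ _ => by positivity
        · exact dyad_pt p (h0 t ht c) (h1 t ht)
    _ = _ := by
        rw [integral_finsetSum _ fun j _ => (ii j).const_mul _]
        refine Finset.sum_congr rfl fun j _ => ?_
        rw [integral_const_mul]
        congr 1
        rw [show (fun t => if (2:ℝ) ^ j ≤ f t then (1:ℝ) else 0) = Set.indicator {t | 2 ^ j ≤ f t} 1 from rfl, integral_indicator_one (ms j), measureReal_restrict_apply (ms j)]
        congr 1; ext t; exact and_comm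

lemma SS_scale {a : ℕ → ℂ} {Y : ℕ} {D : ℝ} (hD : 0 < D) (ha : ∀ n ∈ Finset.Icc 1 Y, ‖a n‖ ≤ D * (n:ℝ) ^ (-(3:ℝ) / 4)) :
    ∃ a' : ℕ → ℂ, (∀ n, 1 ≤ n → ‖a' n‖ ≤ (n:ℝ) ^ (-(3:ℝ) / 4)) ∧ ∀ t, ‖SS a Y t‖ = D * ‖SS a' Y t‖ := by
  refine ⟨fun n => if n ≤ Y then a n / D else 0, fun n hn => ?_, fun t => ?_⟩
  · dsimp only; split_ifs with h
    · rw [norm_div, Complex.norm_real, norm_of_nonneg hD.le, div_le_iff₀ hD, mul_comm]; exact ha n (Finset.mem_Icc.2 ⟨hn, h⟩)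
    · simp only [norm_zero]; positivity
  · rw [show D = ‖(D:ℂ)‖ by rw [Complex.norm_real, norm_of_nonneg hD.le], ← norm_mul, Complex.norm_real, norm_of_nonneg hD.le]
    congr 1
    unfold SS
    rw [Finset.mul_sum]
    refine Finset.sum_congr rfl fun n hn => ?_
    have : (D:ℂ) ≠ 0 := by exact_mod_cast hD.ne'
    simp only [if_pos (Finset.mem_Icc.1 hn).2]; field_simp

lemma mom10a : ∃ C : ℝ, 1 ≤ C ∧ ∀ (a : ℕ → ℂ) (Y : ℕ) (u U : ℝ), 1 ≤ Y → 0 ≤ U → (∀ n, 1 ≤ n → ‖a n‖ ≤ (n:ℝ) ^ (-(3:ℝ) / 4)) →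
    ∫ t in u..u + U, ‖SS a Y t‖ ^ 10 ≤ C * (1 + log Y) ^ 17 * (U + Y ^ 2) := by
  obtain ⟨C, hC, h⟩ := lv1
  refine ⟨2 ^ 36 * C, by linarith, fun a Y u U hY hU ha => ?_⟩
  set m := Nat.log 2 Y
  set J := m / 4 + 3
  have Y1 : (1:ℝ) ≤ Y := by exact_mod_cast hY
  set l := 1 + log Y with hl
  have l1 : 1 ≤ l := by have := log_nonneg Y1; linarith
  have q1 : (Y:ℝ) < 2 ^ (m + 1) := by exact_mod_cast Nat.lt_pow_succ_log_self (by norm_num) Y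
  have q2 : (2:ℝ) ^ m ≤ Y := by exact_mod_cast Nat.pow_log_le_self 2 (by omega)
  have hJl : (J:ℝ) ≤ 3 * l := by
    have : (m:ℝ) * log 2 ≤ log Y := by rw [← log_pow]; exact log_le_log (by positivity) q2
    have : (J:ℝ) ≤ m + 3 := by exact_mod_cast (show m / 4 + 3 ≤ m + 3 by omega)
    nlinarith [log_two_gt_d9]
  have hJ4 : 4 * (Y:ℝ) ^ ((1:ℝ) / 4) < 2 ^ J := by
    refine lt_of_pow_lt_pow_left₀ 4 (by positivity) ?_
    rw [mul_pow, ← rpow_natCast ((Y:ℝ) ^ _), ← rpow_mul (by positivity), ← pow_mul]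
    norm_num
    calc (256:ℝ) * Y < 256 * 2 ^ (m + 1) := by linarith
      _ = 2 ^ (m + 9) := by ring
      _ ≤ 2 ^ (J * 4) := pow_le_pow_right₀ (by norm_num) (by omega)
  have hJ8 : (2:ℝ) ^ (8 * J) ≤ 2 ^ 24 * Y ^ 2 := by
    calc (2:ℝ) ^ (8 * J) ≤ 2 ^ (24 + m * 2) := pow_le_pow_right₀ (by norm_num) (by omega)
      _ = 2 ^ 24 * (2 ^ m) ^ 2 := by ring
      _ ≤ _ := by gcongr
  set f : ℝ → ℝ := fun t => if 1 ≤ ‖SS a Y t‖ then ‖SS a Y t‖ else 0 with hf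
  have cN := (SS_cont a Y).norm
  have f0 : ∀ t, 0 ≤ f t := fun t => by simp only [hf]; split_ifs <;> positivity
  have mf : Measurable f := Measurable.ite (measurableSet_le measurable_const cN.measurable) cN.measurable measurable_const
  have fle : ∀ t, f t ≤ ‖SS a Y t‖ := fun t => by simp only [hf]; split_ifs <;> simp
  have ml := mom_lev (I := Set.Ioc u (u + U)) measurableSet_Ioc (by simp) mf f0 (J0 := 0) (J := J) 10
    (fun t _ h => by simp only [hf] at h ⊢; split_ifs at h ⊢ with c <;> [simpa using c; simp at h]) (fun t _ => (fle t).trans_lt ((SS_triv ha t).trans_lt hJ4)) (by norm_num)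
  have i0 : IntegrableOn (fun t => ‖SS a Y t‖ ^ 10) (Set.Ioc u (u + U)) := (cN.pow 10).integrableOn_Ioc
  have i1 : IntegrableOn (fun t => f t ^ 10) (Set.Ioc u (u + U)) := by
    refine Integrable.mono' i0 (mf.pow_const 10).aestronglyMeasurable (Filter.Eventually.of_forall fun t => ?_)
    rw [norm_of_nonneg (pow_nonneg (f0 t) 10)]; exact pow_le_pow_left₀ (f0 t) (fle t) 10
  have s1 : ∀ j ∈ Finset.Ico 0 J, 2 ^ (10 * (j + 1)) * volume.real {t | t ∈ Set.Ioc u (u + U) ∧ 2 ^ j ≤ f t} ≤ 2 ^ 10 * (C * l ^ 16) * (2 ^ (8 * J) * (2:ℝ)⁻¹ ^ (J - 1 - j) + U) := fun j hj => by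
    have jJ : j < J := (Finset.mem_Ico.1 hj).2
    have e := h a Y u U (2 ^ j) hY hU (by positivity) ha
    have sub : {t | t ∈ Set.Ioc u (u + U) ∧ 2 ^ j ≤ f t} ⊆ lvSet a Y u U (2 ^ j) := fun t ht => ⟨ht.1.1.le, ht.1.2, ht.2.trans (fle t)⟩
    refine (mul_le_mul_of_nonneg_left ((measureReal_mono sub (lvSet_fin a Y u U _)).trans e) (by positivity)).trans ?_
    have e2 : (2:ℝ) ^ (10 * (j + 1)) * (C * l ^ 16 * (((2 ^ j) ^ 2)⁻¹ + U * ((2 ^ j) ^ 10)⁻¹)) = 2 ^ 10 * (C * l ^ 16) * (2 ^ (8 * j) + U) := by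
      rw [show (2:ℝ) ^ (10 * (j + 1)) = 2 ^ 10 * (2 ^ j) ^ 10 by ring, show (2:ℝ) ^ (8 * j) = (2 ^ j) ^ 8 by ring]; field_simp
    rw [e2]
    refine mul_le_mul_of_nonneg_left (add_le_add_left ?_ _) (by positivity)
    rw [inv_pow, ← div_eq_mul_inv, le_div_iff₀ (by positivity), ← pow_add]
    exact pow_le_pow_right₀ (by norm_num) (by omega)
  have gs : ∑ j ∈ Finset.Ico 0 J, (2:ℝ)⁻¹ ^ (J - 1 - j) ≤ 2 := by
    rw [← Finset.range_eq_Ico, Finset.sum_range_reflect (fun j => (2:ℝ)⁻¹ ^ j) J]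
    have := geom_sum_eq (show (2:ℝ)⁻¹ ≠ 1 by norm_num) J
    rw [this]; have : (0:ℝ) ≤ 2⁻¹ ^ J := by positivity
    rw [div_le_iff_of_neg (by norm_num)]; linarith
  rw [intervalIntegral.integral_of_le (by linarith)]
  calc ∫ t in Set.Ioc u (u + U), ‖SS a Y t‖ ^ 10 ≤ ∫ t in Set.Ioc u (u + U), (1 + f t ^ 10) := by
        refine setIntegral_mono_on i0 ((integrable_const _).add i1) measurableSet_Ioc fun t _ => ?_
        simp only [hf]; split_ifs with c
        · linarith
        · push Not at c; linarith [pow_le_one₀ (norm_nonneg (SS a Y t)) c.le (n := 10)]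
    _ = U + ∫ t in Set.Ioc u (u + U), f t ^ 10 := by rw [integral_add (integrable_const _) i1]; simp [hU]
    _ ≤ U + 2 ^ 10 * (C * l ^ 16) * (2 ^ (8 * J) * 2 + J * U) := by
        refine add_le_add_right (ml.trans ((Finset.sum_le_sum s1).trans ?_)) _
        rw [← Finset.mul_sum, Finset.sum_add_distrib, ← Finset.mul_sum]
        refine mul_le_mul_of_nonneg_left (add_le_add (mul_le_mul_of_nonneg_left gs (by positivity)) (by simp)) (by positivity)
    _ ≤ U + 2 ^ 10 * (C * l ^ 16) * (2 ^ 24 * Y ^ 2 * (2 * l) + 3 * l * U) := by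
        refine add_le_add_right (mul_le_mul_of_nonneg_left (add_le_add (mul_le_mul hJ8 (by linarith) (by norm_num) (by positivity)) (mul_le_mul_of_nonneg_right hJl hU)) (by positivity)) _
    _ ≤ _ := by
        have k1 : 1 ≤ C * l ^ 17 := one_le_mul_of_one_le_of_one_le hC (one_le_pow₀ l1)
        have k2 : U ≤ C * l ^ 17 * U := le_mul_of_one_le_left hU k1
        have k3 : 0 ≤ C * l ^ 17 * (Y:ℝ) ^ 2 := by positivity
        have e : 2 ^ 10 * (C * l ^ 16) * (2 ^ 24 * (Y:ℝ) ^ 2 * (2 * l) + 3 * l * U) = 2 ^ 35 * (C * l ^ 17 * (Y:ℝ) ^ 2) + 3072 * (C * l ^ 17 * U) := by ring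
        rw [e]; linarith

lemma eps_pack (ε : ℝ) (hε : 0 < ε) : ∃ C : ℝ, 1 ≤ C ∧ ∀ Y : ℕ, 1 ≤ Y → ∃ D : ℝ, 1 ≤ D ∧ (∀ n ∈ Finset.Icc 1 Y, dd n ≤ D) ∧ D ^ 10 * (1 + log Y) ^ 17 ≤ C * (Y:ℝ) ^ ε := by
  obtain ⟨C1, h1, H1⟩ := dd_bound (ε / 20) (by positivity)
  obtain ⟨C2, h2, H2⟩ := one_add_log_le (ε / 34) (by positivity)
  refine ⟨C1 ^ 10 * C2 ^ 17, one_le_mul_of_one_le_of_one_le (one_le_pow₀ h1) (one_le_pow₀ h2), fun Y hY => ⟨C1 * (Y:ℝ) ^ (ε / 20), ?_, fun n hn => ?_, ?_⟩⟩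
  · exact one_le_mul_of_one_le_of_one_le h1 (one_le_rpow (by exact_mod_cast hY) (by positivity))
  · have := Finset.mem_Icc.1 hn
    exact (H1 n (by omega)).trans (mul_le_mul_of_nonneg_left (rpow_le_rpow (by positivity) (by exact_mod_cast this.2) (by positivity)) (by linarith))
  · have Y1 : (1:ℝ) ≤ Y := by exact_mod_cast hY
    have l0 := log_nonneg Y1
    have := pow_le_pow_left₀ (by positivity) (H2 Y Y1) 17
    refine (mul_le_mul_of_nonneg_left this (by positivity)).trans (le_of_eq ?_)
    rw [mul_pow, mul_pow, ← rpow_natCast ((Y:ℝ) ^ (ε / 20)), ← rpow_natCast ((Y:ℝ) ^ (ε / 34)), ← rpow_mul (by positivity), ← rpow_mul (by positivity)]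
    rw [show C1 ^ 10 * (Y:ℝ) ^ (ε / 20 * (10:ℕ)) * (C2 ^ 17 * (Y:ℝ) ^ (ε / 34 * (17:ℕ))) = C1 ^ 10 * C2 ^ 17 * ((Y:ℝ) ^ (ε / 20 * (10:ℕ)) * (Y:ℝ) ^ (ε / 34 * (17:ℕ))) by ring, ← rpow_add (by positivity)]
    congr 2; push_cast; ring

/-- tenth moment and large values for coefficients bounded by `d(n)n^{-3/4}` -/
lemma mom10 (ε : ℝ) (hε : 0 < ε) : ∃ C : ℝ, 1 ≤ C ∧ ∀ (a : ℕ → ℂ) (Y : ℕ) (u U : ℝ), 1 ≤ Y → 0 ≤ U → (∀ n ∈ Finset.Icc 1 Y, ‖a n‖ ≤ dd n * (n:ℝ) ^ (-(3:ℝ) / 4)) →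
    (∫ t in u..u + U, ‖SS a Y t‖ ^ 10 ≤ C * (Y:ℝ) ^ ε * (U + Y ^ 2)) ∧
    ∀ V, 0 < V → volume.real (lvSet a Y u U V) ≤ C * (Y:ℝ) ^ ε * ((V ^ 2)⁻¹ + U * (V ^ 10)⁻¹) := by
  obtain ⟨C1, h1, H1⟩ := mom10a
  obtain ⟨C2, h2, H2⟩ := lv1
  obtain ⟨C3, h3, H3⟩ := eps_pack ε hε
  refine ⟨(C1 + C2) * C3, by nlinarith, fun a Y u U hY hU ha => ?_⟩
  obtain ⟨D, D1, hD, hDC⟩ := H3 Y hY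
  have D0 : 0 < D := by linarith
  obtain ⟨a', ha', hS⟩ := SS_scale D0 (a := a) (Y := Y) fun n hn => (ha n hn).trans (mul_le_mul_of_nonneg_right (hD n hn) (by positivity))
  have l1 : 1 ≤ 1 + log Y := by have := log_nonneg (show (1:ℝ) ≤ Y by exact_mod_cast hY); linarith
  have Ye : 0 ≤ (Y:ℝ) ^ ε := by positivity
  constructor
  · simp only [hS, mul_pow]
    rw [intervalIntegral.integral_const_mul]
    calc _ ≤ D ^ 10 * (C1 * (1 + log Y) ^ 17 * (U + Y ^ 2)) := mul_le_mul_of_nonneg_left (H1 a' Y u U hY hU ha') (by positivity)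
      _ = C1 * (D ^ 10 * (1 + log Y) ^ 17) * (U + Y ^ 2) := by ring
      _ ≤ C1 * (C3 * (Y:ℝ) ^ ε) * (U + Y ^ 2) := by gcongr
      _ ≤ (C1 + C2) * (C3 * (Y:ℝ) ^ ε) * (U + Y ^ 2) := by gcongr; linarith
      _ = _ := by ring
  · intro V hV
    have e : lvSet a Y u U V = lvSet a' Y u U (V / D) := by
      ext t; simp only [lvSet, Set.mem_ofPred_eq, hS, div_le_iff₀ D0, mul_comm D]
    rw [e]
    calc _ ≤ C2 * (1 + log Y) ^ 16 * (((V / D) ^ 2)⁻¹ + U * ((V / D) ^ 10)⁻¹) := H2 a' Y u U _ hY hU (by positivity) ha'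
      _ = C2 * (1 + log Y) ^ 16 * (D ^ 2 * (V ^ 2)⁻¹ + D ^ 10 * (U * (V ^ 10)⁻¹)) := by rw [div_pow, div_pow, inv_div, inv_div]; ring
      _ ≤ C2 * (1 + log Y) ^ 17 * (D ^ 10 * (V ^ 2)⁻¹ + D ^ 10 * (U * (V ^ 10)⁻¹)) := by
        refine mul_le_mul (mul_le_mul_of_nonneg_left (pow_le_pow_right₀ l1 (by norm_num)) (by linarith)) (add_le_add_left (mul_le_mul_of_nonneg_right (pow_le_pow_right₀ D1 (by norm_num)) (by positivity)) _) (by positivity) (by positivity)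
      _ = C2 * (D ^ 10 * (1 + log Y) ^ 17) * ((V ^ 2)⁻¹ + U * (V ^ 10)⁻¹) := by ring
      _ ≤ (C1 + C2) * (C3 * (Y:ℝ) ^ ε) * ((V ^ 2)⁻¹ + U * (V ^ 10)⁻¹) := by gcongr; linarith
      _ = _ := by ring

noncomputable def bw (η : ℝ) (n : ℕ) : ℝ := dd n * (n:ℝ) ^ (-(3:ℝ) / 4) * chi (η * sqrt n)

lemma bw_norm (η : ℝ) (n : ℕ) : ‖(bw η n : ℂ)‖ ≤ dd n * (n:ℝ) ^ (-(3:ℝ) / 4) := by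
  have := dd_nonneg n
  have c := chi_nonneg (η * sqrt n)
  rw [Complex.norm_real, bw, norm_of_nonneg (by positivity)]
  exact mul_le_of_le_one_right (by positivity) (chi_le _)

lemma cos_SS (b : ℕ → ℝ) (Y : ℕ) (t : ℝ) : ∑ n ∈ Finset.Icc 1 Y, b n * cos (4 * π * sqrt n * t - π / 4) = (ee (-(1 / 8)) * SS (fun n => (b n : ℂ)) Y t).re := by
  rw [SS, Finset.mul_sum, Complex.re_sum]
  refine Finset.sum_congr rfl fun n _ => ?_
  rw [mul_left_comm, ← ee_add, Complex.re_ofReal_mul, ee_re]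
  congr 2; ring

lemma vor (ε : ℝ) (hε : 0 < ε) : ∃ C : ℝ, 1 ≤ C ∧ ∀ (t η : ℝ) (N : ℕ), 1 ≤ t → 1 ≤ η * t → 1 ≤ η ^ 2 * N →
    |Δ (t ^ 2) - sqrt t / (π * sqrt 2) * (ee (-(1 / 8)) * SS (fun n => (bw η n : ℂ)) N t).re| ≤ C * (η * t) * t ^ ε := by
  obtain ⟨C, hC, h⟩ := voronoi ε hε
  refine ⟨C, hC, fun t η N h1 h2 h3 => ?_⟩
  rw [← cos_SS]; exact h t η N h1 h2 h3

lemma hyp_sum (f : ℕ → ℂ) (N : ℕ) : ∑ n ∈ Finset.Icc 1 N, (dd n : ℂ) * f n =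
    2 * ∑ a ∈ Finset.Icc 1 (Nat.sqrt N), ∑ b ∈ Finset.Icc 1 (N / a), f (a * b) - ∑ a ∈ Finset.Icc 1 (Nat.sqrt N), ∑ b ∈ Finset.Icc 1 (Nat.sqrt N), f (a * b) := by
  classical
  set A := Nat.sqrt N
  have AN : A ≤ N := Nat.sqrt_le_self N
  have ext : ∀ (B : ℕ) (g : ℕ → ℂ), B ≤ N → ∑ a ∈ Finset.Icc 1 B, g a = ∑ a ∈ Finset.Icc 1 N, if a ≤ B then g a else 0 := fun B g hB => by
    rw [← Finset.sum_filter]; congr 1; ext a; simp only [Finset.mem_filter, Finset.mem_Icc]; omega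
  have e1 : ∑ n ∈ Finset.Icc 1 N, (dd n : ℂ) * f n = ∑ a ∈ Finset.Icc 1 N, ∑ b ∈ Finset.Icc 1 N, if a * b ≤ N then f (a * b) else 0 := by
    calc _ = ∑ n ∈ Finset.Icc 1 N, ∑ a ∈ Finset.Icc 1 N, ∑ b ∈ Finset.Icc 1 N, if a * b = n then f n else 0 := by
          refine Finset.sum_congr rfl fun n hn => ?_
          obtain ⟨n1, n2⟩ := Finset.mem_Icc.1 hn
          rw [dd, ← Finset.sum_product', ← Finset.sum_filter, Finset.sum_const, nsmul_eq_mul, Complex.ofReal_natCast, ← Finset.card_map, Nat.map_div_right_divisors]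
          congr 3; ext ⟨a, b⟩
          simp only [Nat.mem_divisorsAntidiagonal, Finset.mem_filter, Finset.mem_product, Finset.mem_Icc]
          refine ⟨fun h => ⟨?_, h.1⟩, fun h => ⟨h.2, by omega⟩⟩
          have h1 : 0 < a := Nat.pos_of_ne_zero fun e => by simp [e] at h; omega
          have h2 : 0 < b := Nat.pos_of_ne_zero fun e => by simp [e] at h; omega
          exact ⟨⟨h1, by nlinarith [h.1]⟩, h2, by nlinarith [h.1]⟩
      _ = _ := by
          rw [Finset.sum_comm]
          refine Finset.sum_congr rfl fun a ha => ?_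
          rw [Finset.sum_comm]
          refine Finset.sum_congr rfl fun b hb => ?_
          have := Nat.mul_pos (Finset.mem_Icc.1 ha).1 (Finset.mem_Icc.1 hb).1
          simp only [Finset.sum_ite_eq, Finset.mem_Icc, show 1 ≤ a * b from this, true_and]
  have e2 : ∑ a ∈ Finset.Icc 1 A, ∑ b ∈ Finset.Icc 1 (N / a), f (a * b) = ∑ a ∈ Finset.Icc 1 N, ∑ b ∈ Finset.Icc 1 N, if a ≤ A ∧ a * b ≤ N then f (a * b) else 0 := by
    rw [ext A _ AN]
    refine Finset.sum_congr rfl fun a ha => ?_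
    split_ifs with c
    · rw [ext _ _ (Nat.div_le_self N a)]
      simp only [Nat.le_div_iff_mul_le (Finset.mem_Icc.1 ha).1, mul_comm a, c, true_and]
    · simp [c]
  have e3 : ∑ a ∈ Finset.Icc 1 A, ∑ b ∈ Finset.Icc 1 (N / a), f (a * b) = ∑ a ∈ Finset.Icc 1 N, ∑ b ∈ Finset.Icc 1 N, if b ≤ A ∧ a * b ≤ N then f (a * b) else 0 := by
    rw [e2, Finset.sum_comm]; simp only [mul_comm]
  have e4 : ∑ a ∈ Finset.Icc 1 A, ∑ b ∈ Finset.Icc 1 A, f (a * b) = ∑ a ∈ Finset.Icc 1 N, ∑ b ∈ Finset.Icc 1 N, if a ≤ A ∧ b ≤ A then f (a * b) else 0 := by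
    rw [ext A _ AN]
    refine Finset.sum_congr rfl fun a ha => ?_
    split_ifs with c
    · rw [ext _ _ AN]; simp [c]
    · simp [c]
  rw [two_mul]; nth_rw 1 [e2]
  rw [e1, e3, e4, ← Finset.sum_add_distrib, ← Finset.sum_sub_distrib]
  refine Finset.sum_congr rfl fun a _ => ?_
  rw [← Finset.sum_add_distrib, ← Finset.sum_sub_distrib]
  refine Finset.sum_congr rfl fun b _ => ?_
  by_cases c1 : a ≤ A <;> by_cases c2 : b ≤ A
  · have : a * b ≤ N := (Nat.mul_le_mul c1 c2).trans (Nat.sqrt_le N)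
    simp [c1, c2, this]
  · simp [c1, c2]
  · simp [c1, c2]
  · have : ¬ a * b ≤ N := by
      have := Nat.mul_le_mul (show A + 1 ≤ a by omega) (show A + 1 ≤ b by omega)
      exact fun h => absurd (this.trans h) (not_le.2 (Nat.lt_succ_sqrt N))
    simp [c1, c2, this]

lemma pt_aux {a m n t : ℝ} (ha : 1 ≤ a) (hm : 0 < m) (ht : 0 < t) (h : a * m ≤ n) :
    (a * m) ^ (-(3:ℝ) / 4) * (m * (2 * t * sqrt a * m ^ ((1:ℝ) / 2 - (5:ℕ))) ^ ((1:ℝ) / 30)) ≤ 2 * (a ^ (-(5:ℝ) / 6) * (n ^ ((1:ℝ) / 10) * t ^ ((1:ℝ) / 30))) ∧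
    (a * m) ^ (-(3:ℝ) / 4) * (m ^ (1 - (1:ℝ) / 8) * (2 * t * sqrt a * m ^ ((1:ℝ) / 2 - (5:ℕ))) ^ (-((1:ℝ) / 30))) ≤ (1 / a) * (n ^ ((11:ℝ) / 40) * t ^ (-(1:ℝ) / 30)) := by
  have n0 : 0 < n := lt_of_lt_of_le (by positivity) h
  have a0 : 0 < a := by linarith
  have l2 := log_nonneg (show (1:ℝ) ≤ 2 by norm_num)
  have la := log_nonneg ha
  have ln := log_le_log (by positivity) h
  rw [log_mul a0.ne' hm.ne'] at ln
  rw [← exp_log a0, ← exp_log hm, ← exp_log ht, ← exp_log n0, ← exp_log (show (0:ℝ) < 2 by norm_num)]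
  simp only [sqrt_eq_rpow, ← exp_mul, ← exp_add, one_div, ← exp_neg, exp_le_exp] at *
  rw [exp_neg, exp_log two_pos]
  norm_num
  constructor <;> linarith

lemma pt_inner : ∃ C : ℝ, 1 ≤ C ∧ ∀ (a Y N : ℕ) (t η : ℝ), 1 ≤ a → 1 ≤ Y → a * Y ≤ N → 1 ≤ t → 0 ≤ η →
    ‖∑ b ∈ Finset.Icc 1 Y, ((((a * b : ℕ) : ℝ) ^ (-(3:ℝ) / 4) * chi (η * sqrt (a * b : ℕ)) : ℝ) : ℂ) * ee (2 * t * sqrt (a * b : ℕ))‖ ≤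
      C * (1 + log N) ^ 2 * ((a:ℝ) ^ (-(5:ℝ) / 6) * ((N:ℝ) ^ ((1:ℝ) / 10) * t ^ ((1:ℝ) / 30)) + (1 / (a:ℝ)) * ((N:ℝ) ^ ((11:ℝ) / 40) * t ^ (-(1:ℝ) / 30))) := by
  obtain ⟨C, hC, H⟩ := sq_kd (σ := 1) (Or.inl rfl) kd5 (by norm_num) (by norm_num) (by norm_num) (by norm_num) (by norm_num [cc]) (by norm_num [cc])
  refine ⟨6 * C, by linarith, fun a Y N t η ha hY hN ht hη => ?_⟩
  have a1 : (1:ℝ) ≤ a := by exact_mod_cast ha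
  have a0 : (0:ℝ) < a := by linarith
  have YN : Y ≤ N := le_trans (Nat.le_mul_of_pos_left _ ha) hN
  have N1 : (1:ℝ) ≤ N := by exact_mod_cast hY.trans YN
  have lN := log_nonneg N1
  have sa : 1 ≤ sqrt a := one_le_sqrt.2 a1
  set s := 2 * t * sqrt a with hs
  have s0 : 0 < s := by positivity
  set P := (a:ℝ) ^ (-(5:ℝ) / 6) * ((N:ℝ) ^ ((1:ℝ) / 10) * t ^ ((1:ℝ) / 30)) with hP
  set Q := (1 / (a:ℝ)) * ((N:ℝ) ^ ((11:ℝ) / 40) * t ^ (-(1:ℝ) / 30)) with hQ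
  have D := dyadic_sum (c := fun b => ((((a * b : ℕ) : ℝ) ^ (-(3:ℝ) / 4) * chi (η * sqrt (a * b : ℕ)) : ℝ) : ℂ) * ee (2 * t * sqrt (a * b : ℕ))) (B := C * (1 + log N) * (2 * P + Q)) (Y := Y) hY (by
    intro M K hM hK hMY
    have M1 : (1:ℝ) ≤ M := by exact_mod_cast hM
    have M0 : (0:ℝ) < M := by linarith
    have MN : (a:ℝ) * M ≤ N := by exact_mod_cast le_trans (Nat.mul_le_mul_left a hMY) hN
    have lM : log M ≤ log N := log_le_log M0 ((le_mul_of_one_le_left M0.le a1).trans MN)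
    have lM0 := log_nonneg M1
    have ab := abel_const (c := fun n : ℕ => ee (s * sqrt (M + n))) (w := fun n : ℕ => ((a:ℝ) * (M + n)) ^ (-(3:ℝ) / 4) * chi (η * sqrt (a * (M + n)))) (N := K)
      (fun n => by
        have h : (a:ℝ) * (M + n) ≤ a * (M + (n + 1 : ℕ)) := by push_cast; linarith
        have h2 := mul_le_mul_of_nonneg_left (sqrt_le_sqrt h) hη
        refine mul_le_mul (rpow_le_rpow_of_nonpos (by positivity) h (by norm_num)) ?_ (chi_nonneg _) (by positivity)
        exact smoothTransition.monotone (by linarith [pow_le_pow_left₀ (by positivity) h2 2]))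
      (fun n => mul_nonneg (by positivity) (chi_nonneg _)) (fun m hm => H M m s hM (hm.trans hK) s0)
    have e : ∀ n : ℕ, ((((a * (M + n) : ℕ) : ℝ) ^ (-(3:ℝ) / 4) * chi (η * sqrt (a * (M + n) : ℕ)) : ℝ) : ℂ) * ee (2 * t * sqrt (a * (M + n) : ℕ)) =
        ((((a:ℝ) * (M + n)) ^ (-(3:ℝ) / 4) * chi (η * sqrt (a * (M + n))) : ℝ) : ℂ) * ee (s * sqrt (M + n)) := fun n => by
      push_cast
      rw [hs, mul_assoc (2 * t), ← sqrt_mul a0.le]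
    simp only [e]
    refine ab.trans ?_
    rw [Nat.cast_zero, add_zero]
    obtain ⟨k1, k2⟩ := pt_aux a1 M0 (show 0 < t by linarith) MN
    calc _ ≤ ((a:ℝ) * M) ^ (-(3:ℝ) / 4) * 1 * (C * (1 + log M) * (M * (s * (M:ℝ) ^ ((1:ℝ) / 2 - (5:ℕ))) ^ ((1:ℝ) / 30) + (M:ℝ) ^ (1 - (1:ℝ) / 8) * (s * (M:ℝ) ^ ((1:ℝ) / 2 - (5:ℕ))) ^ (-((1:ℝ) / 30)))) :=
          mul_le_mul_of_nonneg_right (mul_le_mul_of_nonneg_left (chi_le _) (by positivity)) (by positivity)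
      _ = C * (1 + log M) * (((a:ℝ) * M) ^ (-(3:ℝ) / 4) * (M * (s * (M:ℝ) ^ ((1:ℝ) / 2 - (5:ℕ))) ^ ((1:ℝ) / 30)) + ((a:ℝ) * M) ^ (-(3:ℝ) / 4) * ((M:ℝ) ^ (1 - (1:ℝ) / 8) * (s * (M:ℝ) ^ ((1:ℝ) / 2 - (5:ℕ))) ^ (-((1:ℝ) / 30)))) := by ring
      _ ≤ _ := mul_le_mul (mul_le_mul_of_nonneg_left (by linarith) (by linarith)) (add_le_add k1 k2) (by positivity) (by positivity))
  refine D.trans ?_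
  have P0 : 0 ≤ P := by positivity
  have Q0 : 0 ≤ Q := by positivity
  have lY : log Y ≤ log N := log_le_log (by exact_mod_cast hY) (by exact_mod_cast YN)
  calc 3 * (1 + log Y) * (C * (1 + log N) * (2 * P + Q)) ≤ 3 * (1 + log N) * (C * (1 + log N) * (2 * (P + Q))) := by
        refine mul_le_mul (by linarith) (mul_le_mul_of_nonneg_left (by linarith) (by positivity)) (by positivity) (by positivity)
    _ = _ := by ring

lemma pt_sum : ∃ C : ℝ, 1 ≤ C ∧ ∀ (N : ℕ) (t η : ℝ), 1 ≤ N → 1 ≤ t → 0 ≤ η →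
    ‖SS (fun n => (bw η n : ℂ)) N t‖ ≤ C * (1 + log N) ^ 3 * ((N:ℝ) ^ ((11:ℝ) / 60) * t ^ ((1:ℝ) / 30) + (N:ℝ) ^ ((11:ℝ) / 40) * t ^ (-(1:ℝ) / 30)) := by
  obtain ⟨C, hC, H⟩ := pt_inner
  refine ⟨18 * C, by linarith, fun N t η hN ht hη => ?_⟩
  have N1 : (1:ℝ) ≤ N := by exact_mod_cast hN
  have N0 : (0:ℝ) < N := by linarith
  have lN := log_nonneg N1
  set A := Nat.sqrt N
  have A1 : 1 ≤ A := Nat.sqrt_pos.2 hN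
  have AA : A * A ≤ N := Nat.sqrt_le N
  set F : ℕ → ℂ := fun n => (((n:ℝ) ^ (-(3:ℝ) / 4) * chi (η * sqrt n) : ℝ) : ℂ) * ee (2 * t * sqrt n) with hF
  set R : ℕ → ℝ := fun a => C * (1 + log N) ^ 2 * ((a:ℝ) ^ (-(5:ℝ) / 6) * ((N:ℝ) ^ ((1:ℝ) / 10) * t ^ ((1:ℝ) / 30)) + (1 / (a:ℝ)) * ((N:ℝ) ^ ((11:ℝ) / 40) * t ^ (-(1:ℝ) / 30))) with hR
  have e : SS (fun n => (bw η n : ℂ)) N t = ∑ n ∈ Finset.Icc 1 N, (dd n : ℂ) * F n := by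
    refine Finset.sum_congr rfl fun n _ => ?_
    simp only [bw, hF]; push_cast; ring
  have b1 : ‖∑ a ∈ Finset.Icc 1 A, ∑ b ∈ Finset.Icc 1 (N / a), F (a * b)‖ ≤ ∑ a ∈ Finset.Icc 1 A, R a :=
    (norm_sum_le _ _).trans (Finset.sum_le_sum fun a ha => by
      obtain ⟨h1, h2⟩ := Finset.mem_Icc.1 ha
      exact H a (N / a) N t η h1 (Nat.div_pos (by nlinarith) h1) (Nat.mul_div_le N a) ht hη)
  have b2 : ‖∑ a ∈ Finset.Icc 1 A, ∑ b ∈ Finset.Icc 1 A, F (a * b)‖ ≤ ∑ a ∈ Finset.Icc 1 A, R a :=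
    (norm_sum_le _ _).trans (Finset.sum_le_sum fun a ha => by
      obtain ⟨h1, h2⟩ := Finset.mem_Icc.1 ha
      exact H a A N t η h1 A1 (le_trans (Nat.mul_le_mul_right A h2) AA) ht hη)
  have lA : log A ≤ log N := log_le_log (by exact_mod_cast A1) (by exact_mod_cast Nat.sqrt_le_self N)
  have s1 : ∑ a ∈ Finset.Icc 1 A, (a:ℝ) ^ (-(5:ℝ) / 6) ≤ 6 * (N:ℝ) ^ ((1:ℝ) / 12) := by
    have := sum_rpow_le (s := 5 / 6) (by norm_num) (by norm_num) A
    rw [sum_r1 (fun n : ℕ => (n:ℝ) ^ (-(5 / 6) : ℝ)) A, show (1:ℝ) - 5 / 6 = 1 / 6 by norm_num, ← neg_div] at this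
    refine this.trans ?_
    have : ((A:ℝ) ^ 2) ^ ((1:ℝ) / 12) ≤ (N:ℝ) ^ ((1:ℝ) / 12) := rpow_le_rpow (by positivity) (by rw [sq]; exact_mod_cast AA) (by norm_num)
    rw [← rpow_natCast, ← rpow_mul (by positivity)] at this
    norm_num at this ⊢; linarith
  have s2 : ∑ a ∈ Finset.Icc 1 A, 1 / (a:ℝ) ≤ 1 + log N := by
    have := harm_le A
    rw [sum_r1 (fun n : ℕ => 1 / (n:ℝ))] at this; linarith
  set P := (N:ℝ) ^ ((1:ℝ) / 10) * t ^ ((1:ℝ) / 30)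
  set Q := (N:ℝ) ^ ((11:ℝ) / 40) * t ^ (-(1:ℝ) / 30)
  have Q0 : 0 ≤ Q := by positivity
  have sR : ∑ a ∈ Finset.Icc 1 A, R a ≤ C * (1 + log N) ^ 2 * (6 * (N:ℝ) ^ ((1:ℝ) / 12) * P + (1 + log N) * Q) := by
    rw [← Finset.mul_sum, Finset.sum_add_distrib, ← Finset.sum_mul, ← Finset.sum_mul]
    exact mul_le_mul_of_nonneg_left (add_le_add (mul_le_mul_of_nonneg_right s1 (by positivity)) (mul_le_mul_of_nonneg_right s2 Q0)) (by positivity)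
  rw [e, hyp_sum]
  refine (norm_sub_le _ _).trans ?_
  rw [norm_mul, Complex.norm_ofNat]
  have eP : (N:ℝ) ^ ((1:ℝ) / 12) * P = (N:ℝ) ^ ((11:ℝ) / 60) * t ^ ((1:ℝ) / 30) := by
    rw [← mul_assoc, ← rpow_add N0]; norm_num
  calc _ ≤ 3 * (C * (1 + log N) ^ 2 * (6 * (N:ℝ) ^ ((1:ℝ) / 12) * P + (1 + log N) * Q)) := by linarith
    _ ≤ 3 * (C * (1 + log N) ^ 2 * (6 * (1 + log N) * ((N:ℝ) ^ ((1:ℝ) / 12) * P + Q))) := by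
        refine mul_le_mul_of_nonneg_left (mul_le_mul_of_nonneg_left ?_ (by positivity)) (by norm_num)
        have : 0 ≤ (N:ℝ) ^ ((1:ℝ) / 12) * P := by positivity
        linarith [mul_nonneg lN this, mul_nonneg lN Q0]
    _ = _ := by rw [eP]; ring

/-- pointwise bound, slightly below exponent 1/3 -/
lemma pointwise : ∃ C : ℝ, 1 ≤ C ∧ ∀ t : ℝ, 1 ≤ t → |Δ (t ^ 2)| ≤ C * t ^ ((331:ℝ) / 500) := by
  obtain ⟨C1, h1, H1⟩ := vor (1 / 500) (by norm_num)
  obtain ⟨C2, h2, H2⟩ := pt_sum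
  obtain ⟨C3, h3, H3⟩ := one_add_log_le (1 / 1000) (by norm_num)
  refine ⟨C1 + 4 * (C2 * C3 ^ 3), by nlinarith [one_le_pow₀ h3 (n := 3)], fun t ht => ?_⟩
  have t0 : 0 < t := by linarith
  set η := t ^ (-(17:ℝ) / 50) with hη
  set z := t ^ ((17:ℝ) / 25) with hz
  have z1 : 1 ≤ z := one_le_rpow ht (by norm_num)
  set N := ⌈z⌉₊
  have Nz : z ≤ N := Nat.le_ceil _
  have N2 : (N:ℝ) ≤ 2 * z := by linarith [Nat.ceil_lt_add_one (show 0 ≤ z by linarith)]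
  have N1 : 1 ≤ N := by exact_mod_cast z1.trans Nz
  have N0 : (0:ℝ) < N := by linarith
  have ηt : η * t = t ^ ((33:ℝ) / 50) := by rw [hη, ← rpow_add_one t0.ne']; norm_num
  have ηz : η ^ 2 * z = 1 := by rw [hη, ← rpow_natCast (t ^ _), ← rpow_mul t0.le, ← rpow_add t0]; norm_num
  have v := H1 t η N ht (by rw [ηt]; exact one_le_rpow ht (by norm_num)) (by rw [← ηz]; gcongr)
  have S := H2 N t η N1 ht (by positivity)
  set S0 := SS (fun n => (bw η n : ℂ)) N t
  have r : |(ee (-(1 / 8)) * S0).re| ≤ ‖S0‖ := (Complex.abs_re_le_norm _).trans (by rw [norm_mul, ee_norm, one_mul])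
  have c1 : sqrt t / (π * sqrt 2) ≤ t ^ ((1:ℝ) / 2) := by
    rw [← sqrt_eq_rpow]; refine div_le_self (sqrt_nonneg _) ?_
    exact one_le_mul_of_one_le_of_one_le (by linarith [pi_gt_three]) one_lt_sqrt_two.le
  have lN : (1 + log N) ^ 3 ≤ C3 ^ 3 * (N:ℝ) ^ ((3:ℝ) / 1000) := by
    have := pow_le_pow_left₀ (by have := log_nonneg (z1.trans Nz); linarith) (H3 N (z1.trans Nz)) 3
    rw [mul_pow, ← rpow_natCast ((N:ℝ) ^ _), ← rpow_mul (by positivity)] at this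
    norm_num at this ⊢; exact this
  have pw : ∀ p : ℝ, 0 ≤ p → p ≤ 1 → (N:ℝ) ^ p ≤ 2 * t ^ (17 / 25 * p) := fun p p0 p1 => by
    refine (rpow_le_rpow N0.le N2 p0).trans ?_
    rw [mul_rpow (by norm_num) (by linarith), hz, ← rpow_mul t0.le]
    refine mul_le_mul_of_nonneg_right ?_ (by positivity)
    calc (2:ℝ) ^ p ≤ 2 ^ (1:ℝ) := rpow_le_rpow_of_exponent_le (by norm_num) p1
      _ = 2 := rpow_one 2
  have m1 : t ^ ((1:ℝ) / 2) * ((N:ℝ) ^ ((3:ℝ) / 1000) * ((N:ℝ) ^ ((11:ℝ) / 60) * t ^ ((1:ℝ) / 30))) ≤ 2 * t ^ ((331:ℝ) / 500) := by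
    calc _ = (N:ℝ) ^ ((559:ℝ) / 3000) * t ^ ((8:ℝ) / 15) := by
          rw [show (8:ℝ) / 15 = 1 / 2 + 1 / 30 by norm_num, show (559:ℝ) / 3000 = 3 / 1000 + 11 / 60 by norm_num, rpow_add t0, rpow_add N0]; ring
      _ ≤ (2 * t ^ (17 / 25 * ((559:ℝ) / 3000))) * t ^ ((8:ℝ) / 15) := mul_le_mul_of_nonneg_right (pw _ (by norm_num) (by norm_num)) (by positivity)
      _ ≤ _ := by
          rw [mul_assoc, ← rpow_add t0]
          exact mul_le_mul_of_nonneg_left (rpow_le_rpow_of_exponent_le ht (by norm_num)) (by norm_num)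
  have m2 : t ^ ((1:ℝ) / 2) * ((N:ℝ) ^ ((3:ℝ) / 1000) * ((N:ℝ) ^ ((11:ℝ) / 40) * t ^ (-(1:ℝ) / 30))) ≤ 2 * t ^ ((331:ℝ) / 500) := by
    calc _ = (N:ℝ) ^ ((278:ℝ) / 1000) * t ^ ((7:ℝ) / 15) := by
          rw [show (7:ℝ) / 15 = 1 / 2 + -1 / 30 by norm_num, show (278:ℝ) / 1000 = 3 / 1000 + 11 / 40 by norm_num, rpow_add t0, rpow_add N0]; ring
      _ ≤ (2 * t ^ (17 / 25 * ((278:ℝ) / 1000))) * t ^ ((7:ℝ) / 15) := mul_le_mul_of_nonneg_right (pw _ (by norm_num) (by norm_num)) (by positivity)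
      _ ≤ _ := by
          rw [mul_assoc, ← rpow_add t0]
          exact mul_le_mul_of_nonneg_left (rpow_le_rpow_of_exponent_le ht (by norm_num)) (by norm_num)
  have er : C1 * (η * t) * t ^ ((1:ℝ) / 500) = C1 * t ^ ((331:ℝ) / 500) := by rw [ηt, mul_assoc, ← rpow_add t0]; norm_num
  have mn : |sqrt t / (π * sqrt 2) * (ee (-(1 / 8)) * S0).re| ≤ 4 * (C2 * C3 ^ 3) * t ^ ((331:ℝ) / 500) := by
    rw [abs_mul, abs_of_nonneg (by positivity)]
    calc _ ≤ t ^ ((1:ℝ) / 2) * (C2 * (C3 ^ 3 * (N:ℝ) ^ ((3:ℝ) / 1000)) * ((N:ℝ) ^ ((11:ℝ) / 60) * t ^ ((1:ℝ) / 30) + (N:ℝ) ^ ((11:ℝ) / 40) * t ^ (-(1:ℝ) / 30))) :=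
          mul_le_mul c1 (r.trans (S.trans (mul_le_mul_of_nonneg_right (mul_le_mul_of_nonneg_left lN (by linarith)) (by positivity)))) (abs_nonneg _) (by positivity)
      _ = (C2 * C3 ^ 3) * (t ^ ((1:ℝ) / 2) * ((N:ℝ) ^ ((3:ℝ) / 1000) * ((N:ℝ) ^ ((11:ℝ) / 60) * t ^ ((1:ℝ) / 30))) + t ^ ((1:ℝ) / 2) * ((N:ℝ) ^ ((3:ℝ) / 1000) * ((N:ℝ) ^ ((11:ℝ) / 40) * t ^ (-(1:ℝ) / 30)))) := by ring
      _ ≤ (C2 * C3 ^ 3) * (4 * t ^ ((331:ℝ) / 500)) := mul_le_mul_of_nonneg_left (by linarith) (by positivity)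
      _ = _ := by ring
  rw [er] at v
  calc |Δ (t ^ 2)| ≤ |Δ (t ^ 2) - sqrt t / (π * sqrt 2) * (ee (-(1 / 8)) * S0).re| + |sqrt t / (π * sqrt 2) * (ee (-(1 / 8)) * S0).re| := by
        have := abs_add_le (Δ (t ^ 2) - sqrt t / (π * sqrt 2) * (ee (-(1 / 8)) * S0).re) (sqrt t / (π * sqrt 2) * (ee (-(1 / 8)) * S0).re)
        rwa [sub_add_cancel] at this
    _ ≤ _ := by linarith

lemma osc (k : ℕ) {u v β : ℝ} (hu : 0 ≤ u) (hv : u ≤ v) (hβ : β ≠ 0) : ‖∫ t in u..v, ((t ^ k : ℝ) : ℂ) * ee (β * t)‖ ≤ v ^ k / |β| := by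
  set c : ℂ := 2 * π * β * Complex.I with hc
  have c0 : c ≠ 0 := by simp [hc, hβ, pi_ne_zero]
  have nc : ‖c‖ = 2 * π * |β| := by simp [hc, abs_of_pos pi_pos]
  have hd : ∀ t, HasDerivAt (fun t => ee (β * t) / c) (ee (β * t)) t := fun t => by
    have := (ee_deriv ((hasDerivAt_id t).const_mul β)).div_const c
    refine this.congr_deriv ?_
    rw [div_eq_iff c0, hc]; simp; ring
  have hp : ∀ t : ℝ, HasDerivAt (fun t : ℝ => ((t ^ k : ℝ) : ℂ)) ((k * t ^ (k - 1) : ℝ) : ℂ) t := fun t => (hasDerivAt_pow k t).ofReal_comp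
  have ce : Continuous fun t : ℝ => ee (β * t) := ee_cont.comp (by fun_prop)
  have cp : Continuous fun t : ℝ => ((k * t ^ (k - 1) : ℝ) : ℂ) := by fun_prop
  rw [intervalIntegral.integral_mul_deriv_eq_deriv_mul (fun t _ => hp t) (fun t _ => hd t) (cp.intervalIntegrable _ _) (ce.intervalIntegrable _ _)]
  have ne : ∀ t, ‖ee (β * t) / c‖ = 1 / ‖c‖ := fun t => by rw [norm_div, ee_norm]
  have b1 : ‖∫ t in u..v, ((k * t ^ (k - 1) : ℝ) : ℂ) * (ee (β * t) / c)‖ ≤ (v ^ k - u ^ k) * (1 / ‖c‖) := by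
    have e : ∫ t in u..v, (k * t ^ (k - 1) : ℝ) * (1 / ‖c‖) = (v ^ k - u ^ k) * (1 / ‖c‖) := by
      rw [intervalIntegral.integral_mul_const, intervalIntegral.integral_eq_sub_of_hasDerivAt (fun t _ => hasDerivAt_pow k t)]
      exact Continuous.intervalIntegrable (by fun_prop) _ _
    rw [← e]
    refine intervalIntegral.norm_integral_le_of_norm_le hv (Filter.Eventually.of_forall fun t ht => ?_) (Continuous.intervalIntegrable (by fun_prop) _ _)
    have : 0 ≤ t := hu.trans ht.1.le
    rw [norm_mul, ne, Complex.norm_real, norm_of_nonneg (by positivity)]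
  have v0 : 0 ≤ v := hu.trans hv
  refine (norm_sub_le _ _).trans ((add_le_add ((norm_sub_le _ _).trans (le_of_eq ?_)) b1).trans (?_ : v ^ k * (1 / ‖c‖) + u ^ k * (1 / ‖c‖) + (v ^ k - u ^ k) * (1 / ‖c‖) ≤ _))
  · rw [norm_mul, norm_mul, ne, ne, Complex.norm_real, Complex.norm_real, norm_of_nonneg (pow_nonneg hu k), norm_of_nonneg (pow_nonneg v0 k)]
  · have bp : 0 < |β| := abs_pos.2 hβ
    rw [nc, show v ^ k * (1 / (2 * π * |β|)) + u ^ k * (1 / (2 * π * |β|)) + (v ^ k - u ^ k) * (1 / (2 * π * |β|)) = v ^ k / (π * |β|) by field_simp; ring]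
    exact div_le_div_of_nonneg_left (by positivity) bp (by nlinarith [pi_gt_three])

lemma ms_pair {n m : ℕ} {u U D : ℝ} (hu : 0 ≤ u) (hU : 0 ≤ U) (hn : 1 ≤ n) (hm : n < m) {a b : ℂ} (ha : ‖a‖ ≤ D * (n:ℝ) ^ (-(3:ℝ) / 4)) (hb : ‖b‖ ≤ D * (m:ℝ) ^ (-(3:ℝ) / 4)) {β : ℝ}
    (hβ : |β| = 2 * (sqrt m - sqrt n)) : ‖a‖ * ‖b‖ * ‖∫ t in u..u + U, ee (β * t)‖ ≤ D ^ 2 * (2 * ((1 / (n:ℝ)) * (1 / (1 + |(n:ℝ) - m|)))) := by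
  have n0 : (0:ℝ) < n := by exact_mod_cast hn
  have nm : (n:ℝ) + 1 ≤ m := by exact_mod_cast hm
  have m0 : (0:ℝ) < m := by linarith
  have sl : sqrt n < sqrt m := sqrt_lt_sqrt n0.le (by linarith)
  have bp : 0 < |β| := by rw [hβ]; linarith
  have o := osc 0 hu (show u ≤ u + U by linarith) (abs_pos.1 bp)
  simp only [pow_zero, Complex.ofReal_one, one_mul] at o
  have k : 1 / |β| ≤ sqrt m * (2 * (1 / (1 + |(n:ℝ) - m|))) := by
    rw [abs_of_nonpos (show (n:ℝ) - m ≤ 0 by linarith), hβ, mul_one_div, mul_div_assoc', div_le_div_iff₀ (by linarith) (by linarith)]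
    have h1 := mul_self_sqrt n0.le
    have h2 := mul_self_sqrt m0.le
    nlinarith
  have D0 : 0 ≤ D := by by_contra h; push Not at h; have := (norm_nonneg a).trans ha; nlinarith [rpow_pos_of_pos n0 (-(3:ℝ) / 4)]
  calc _ ≤ (D * (n:ℝ) ^ (-(3:ℝ) / 4)) * (D * (m:ℝ) ^ (-(3:ℝ) / 4)) * (sqrt m * (2 * (1 / (1 + |(n:ℝ) - m|)))) :=
        mul_le_mul (mul_le_mul ha hb (norm_nonneg _) (by positivity)) (o.trans k) (norm_nonneg _) (by positivity)
    _ = D ^ 2 * (2 * (((n:ℝ) ^ (-(3:ℝ) / 4) * ((m:ℝ) ^ (-(3:ℝ) / 4) * sqrt m)) * (1 / (1 + |(n:ℝ) - m|)))) := by ring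
    _ ≤ _ := by
        refine mul_le_mul_of_nonneg_left (mul_le_mul_of_nonneg_left (mul_le_mul_of_nonneg_right ?_ (by positivity)) (by norm_num)) (by positivity)
        calc _ = (n:ℝ) ^ (-(3:ℝ) / 4) * (m:ℝ) ^ (-(1:ℝ) / 4) := by rw [sqrt_eq_rpow, ← rpow_add m0]; norm_num
          _ ≤ (n:ℝ) ^ (-(3:ℝ) / 4) * (n:ℝ) ^ (-(1:ℝ) / 4) := mul_le_mul_of_nonneg_left (rpow_le_rpow_of_nonpos n0 (by linarith) (by norm_num)) (by positivity)
          _ = 1 / (n:ℝ) := by rw [← rpow_add n0]; norm_num [rpow_neg_one]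

lemma ms0 {a : ℕ → ℂ} {N : ℕ} {y u U D : ℝ} (hN : 1 ≤ N) (hy : 0 < y) (hu : 0 ≤ u) (hU : 0 ≤ U)
    (ha : ∀ n ∈ Finset.Icc 1 N, ‖a n‖ ≤ D * (n:ℝ) ^ (-(3:ℝ) / 4)) (h0 : ∀ n : ℕ, (n:ℝ) ≤ y → a n = 0) :
    ∫ t in u..u + U, ‖SS a N t‖ ^ 2 ≤ D ^ 2 * (16 * (1 + log N) ^ 2) * (U * y ^ (-(1:ℝ) / 2) + 1) := by
  set I : ℕ → ℕ → ℂ := fun n m => ∫ t in u..u + U, ee ((2 * (sqrt n - sqrt m)) * t) with hI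
  set W : ℕ → ℕ → ℝ := fun n m => 2 * ((1 / (n:ℝ)) * (1 / (1 + |(n:ℝ) - m|))) with hW
  have W0 : ∀ n m, 0 ≤ W n m := fun n m => by simp only [hW]; positivity
  have e1 : ((∫ t in u..u + U, ‖SS a N t‖ ^ 2 : ℝ) : ℂ) = ∑ n ∈ Finset.Icc 1 N, ∑ m ∈ Finset.Icc 1 N, a n * starRingEnd ℂ (a m) * I n m := by
    rw [← intervalIntegral.integral_ofReal]
    have ce : ∀ n m : ℕ, Continuous fun t : ℝ => a n * starRingEnd ℂ (a m) * ee ((2 * (sqrt n - sqrt m)) * t) := fun n m => continuous_const.mul (ee_cont.comp (by fun_prop))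
    calc _ = ∫ t in u..u + U, ∑ n ∈ Finset.Icc 1 N, ∑ m ∈ Finset.Icc 1 N, a n * starRingEnd ℂ (a m) * ee ((2 * (sqrt n - sqrt m)) * t) := by
          refine intervalIntegral.integral_congr fun t _ => ?_
          rw [Complex.ofReal_pow, ← Complex.mul_conj', SS, map_sum, Finset.sum_mul_sum]
          refine Finset.sum_congr rfl fun n _ => Finset.sum_congr rfl fun m _ => ?_
          rw [show 2 * (sqrt n - sqrt m) * t = 2 * t * sqrt n - 2 * t * sqrt m by ring, ee_sub, map_mul]; ring
      _ = _ := by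
          rw [intervalIntegral.integral_finsetSum fun n _ => (continuous_finsetSum _ fun m _ => ce n m).intervalIntegrable _ _]
          refine Finset.sum_congr rfl fun n _ => ?_
          rw [intervalIntegral.integral_finsetSum fun m _ => (ce n m).intervalIntegrable _ _]
          refine Finset.sum_congr rfl fun m _ => ?_
          rw [intervalIntegral.integral_const_mul]
  have N1 : (1:ℝ) ≤ N := by exact_mod_cast hN
  have lN := log_nonneg N1
  have pr : ∀ n ∈ Finset.Icc 1 N, ∀ m ∈ Finset.Icc 1 N, ‖a n * starRingEnd ℂ (a m) * I n m‖ ≤ D ^ 2 * ((if n = m then U * y ^ (-(1:ℝ) / 2) * (1 / (n:ℝ)) else 0) + (W n m + W m n)) := by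
    intro n hn m hm
    have n1 := (Finset.mem_Icc.1 hn).1
    have m1 := (Finset.mem_Icc.1 hm).1
    rw [norm_mul, norm_mul, Complex.norm_conj]
    rcases lt_trichotomy n m with c | c | c
    · rw [if_neg c.ne, zero_add]
      refine (ms_pair hu hU n1 c (ha n hn) (ha m hm) ?_).trans (mul_le_mul_of_nonneg_left (le_add_of_nonneg_right (W0 m n)) (by positivity))
      have : sqrt n < sqrt m := sqrt_lt_sqrt (by positivity) (by exact_mod_cast c)
      rw [abs_of_neg (by linarith)]; ring
    · subst c
      rw [if_pos rfl]
      refine le_trans ?_ (mul_le_mul_of_nonneg_left (le_add_of_nonneg_right (add_nonneg (W0 n n) (W0 n n))) (by positivity))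
      have n0 : (0:ℝ) < n := by exact_mod_cast n1
      have : ‖I n n‖ = U := by simp [hI, ee_zero, abs_of_nonneg hU]
      rw [this]
      by_cases q : (n:ℝ) ≤ y
      · rw [h0 n q]; simp only [norm_zero, zero_mul]; positivity
      · push Not at q
        calc _ ≤ (D * (n:ℝ) ^ (-(3:ℝ) / 4)) * (D * (n:ℝ) ^ (-(3:ℝ) / 4)) * U := mul_le_mul_of_nonneg_right (mul_le_mul (ha n hn) (ha n hn) (norm_nonneg _) ((norm_nonneg _).trans (ha n hn))) hU
          _ = D ^ 2 * (U * (n:ℝ) ^ (-(1:ℝ) / 2) * (1 / (n:ℝ))) := by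
              have : (n:ℝ) ^ (-(3:ℝ) / 4) * (n:ℝ) ^ (-(3:ℝ) / 4) = (n:ℝ) ^ (-(1:ℝ) / 2) * (1 / (n:ℝ)) := by
                rw [one_div, ← rpow_neg_one, ← rpow_add n0, ← rpow_add n0]; norm_num
              linear_combination D ^ 2 * U * this
          _ ≤ _ := mul_le_mul_of_nonneg_left (mul_le_mul_of_nonneg_right (mul_le_mul_of_nonneg_left (rpow_le_rpow_of_nonpos hy q.le (by norm_num)) hU) (by positivity)) (by positivity)
    · rw [if_neg c.ne', zero_add, mul_comm ‖a n‖]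
      refine (ms_pair hu hU m1 c (ha m hm) (ha n hn) ?_).trans (mul_le_mul_of_nonneg_left (le_add_of_nonneg_left (W0 n m)) (by positivity))
      have : sqrt m < sqrt n := sqrt_lt_sqrt (by positivity) (by exact_mod_cast c)
      rw [abs_of_pos (by linarith)]
  have hs : ∑ n ∈ Finset.Icc 1 N, 1 / (n:ℝ) ≤ 1 + log N := by
    have := harm_le N
    rwa [sum_r1 (fun n : ℕ => 1 / (n:ℝ))] at this
  have sW : ∑ n ∈ Finset.Icc 1 N, ∑ m ∈ Finset.Icc 1 N, W n m ≤ 8 * (1 + log N) ^ 2 := by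
    calc _ ≤ ∑ n ∈ Finset.Icc 1 N, 1 / (n:ℝ) * (8 * (1 + log N)) := Finset.sum_le_sum fun n hn => by
          have := harm_near n (by exact_mod_cast (Finset.mem_Icc.1 hn).1) N (by simpa using (Finset.mem_Icc.1 hn).2)
          simp only [hW]
          rw [← Finset.mul_sum, ← Finset.mul_sum, mul_left_comm]
          exact mul_le_mul_of_nonneg_left (by linarith) (by positivity)
      _ ≤ _ := by rw [← Finset.sum_mul]; nlinarith
  have nn : 0 ≤ ∫ t in u..u + U, ‖SS a N t‖ ^ 2 := intervalIntegral.integral_nonneg (by linarith) fun t _ => by positivity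
  rw [← norm_of_nonneg nn, ← Complex.norm_real, e1]
  calc _ ≤ ∑ n ∈ Finset.Icc 1 N, ∑ m ∈ Finset.Icc 1 N, D ^ 2 * ((if n = m then U * y ^ (-(1:ℝ) / 2) * (1 / (n:ℝ)) else 0) + (W n m + W m n)) :=
        (norm_sum_le _ _).trans (Finset.sum_le_sum fun n hn => (norm_sum_le _ _).trans (Finset.sum_le_sum fun m hm => pr n hn m hm))
    _ = D ^ 2 * (U * y ^ (-(1:ℝ) / 2) * (∑ n ∈ Finset.Icc 1 N, 1 / (n:ℝ)) + 2 * ∑ n ∈ Finset.Icc 1 N, ∑ m ∈ Finset.Icc 1 N, W n m) := by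
        simp only [← Finset.mul_sum, Finset.sum_add_distrib, Finset.sum_ite_eq]
        rw [Finset.sum_comm (f := fun n m => W m n), Finset.mul_sum, ← two_mul]
        congr 2
        exact Finset.sum_congr rfl fun n hn => if_pos hn
    _ ≤ D ^ 2 * (U * y ^ (-(1:ℝ) / 2) * (1 + log N) + 2 * (8 * (1 + log N) ^ 2)) := by gcongr
    _ ≤ _ := by
        rw [mul_assoc (D ^ 2)]
        refine mul_le_mul_of_nonneg_left ?_ (by positivity)
        have : 0 ≤ U * y ^ (-(1:ℝ) / 2) := by positivity
        linarith [mul_nonneg this lN, mul_nonneg this (mul_nonneg lN lN)]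

lemma ms (ε : ℝ) (hε : 0 < ε) : ∃ C : ℝ, 1 ≤ C ∧ ∀ (a : ℕ → ℂ) (N : ℕ) (y u U : ℝ), 1 ≤ N → 0 < y → 0 ≤ u → 0 ≤ U →
    (∀ n ∈ Finset.Icc 1 N, ‖a n‖ ≤ dd n * (n:ℝ) ^ (-(3:ℝ) / 4)) → (∀ n : ℕ, (n:ℝ) ≤ y → a n = 0) →
    ∫ t in u..u + U, ‖SS a N t‖ ^ 2 ≤ C * (N:ℝ) ^ ε * (U * y ^ (-(1:ℝ) / 2) + 1) := by
  obtain ⟨C, hC, H⟩ := eps_pack ε hε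
  refine ⟨16 * C, by linarith, fun a N y u U hN hy hu hU ha h0 => ?_⟩
  obtain ⟨D, D1, hD, hDC⟩ := H N hN
  have l1 : 1 ≤ 1 + log N := by have := log_nonneg (show (1:ℝ) ≤ N by exact_mod_cast hN); linarith
  refine (ms0 hN hy hu hU (fun n hn => (ha n hn).trans (mul_le_mul_of_nonneg_right (hD n hn) (by positivity))) h0).trans (mul_le_mul_of_nonneg_right ?_ (by positivity))
  have : D ^ 2 * (1 + log N) ^ 2 ≤ D ^ 10 * (1 + log N) ^ 17 := mul_le_mul (pow_le_pow_right₀ D1 (by norm_num)) (pow_le_pow_right₀ l1 (by norm_num)) (by positivity) (by positivity)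
  linarith

abbrev KQ := AlgebraicClosure ℚ
abbrev GQ := KQ ≃ₐ[ℚ] KQ
instance : Algebra.IsAlgebraic ℚ KQ := by
  convert AlgebraicClosure.isAlgebraic ℚ
  · rfl
  · exact Subsingleton.elim _ _
instance : Normal ℚ KQ where splits' _ := IsAlgClosed.splits _
instance : IsGalois ℚ KQ where
noncomputable def phi : KQ →ₐ[ℚ] ℂ := IsAlgClosed.lift

lemma rt_ex (n : ℕ) : ∃ z : KQ, z ^ 2 = n ∧ phi z = (sqrt n : ℝ) := by
  obtain ⟨z, hz⟩ := IsAlgClosed.exists_pow_nat_eq (n : KQ) (n := 2) (by norm_num)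
  have h : (phi z) ^ 2 = ((sqrt n : ℝ) : ℂ) ^ 2 := by
    rw [← map_pow, hz, map_natCast, ← Complex.ofReal_pow, sq_sqrt (by positivity)]; simp
  rcases sq_eq_sq_iff_eq_or_eq_neg.1 h with h | h
  · exact ⟨z, hz, h⟩
  · exact ⟨-z, by rw [neg_sq, hz], by rw [map_neg, h, neg_neg]⟩
noncomputable def rt (n : ℕ) : KQ := (rt_ex n).choose
lemma rt_sq (n : ℕ) : rt n ^ 2 = n := (rt_ex n).choose_spec.1
lemma rt_phi (n : ℕ) : phi (rt n) = (sqrt n : ℝ) := (rt_ex n).choose_spec.2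

lemma X_ex (n : ℕ) : ∃ χ : GQ →* ℤˣ, ∀ σ : GQ, σ (rt n) = ((χ σ : ℤ) : KQ) * rt n := by
  by_cases h0 : rt n = 0
  · exact ⟨1, fun σ => by simp [h0]⟩
  have h : ∀ σ : GQ, ∃ u : ℤˣ, σ (rt n) = ((u : ℤ) : KQ) * rt n := fun σ => by
    have : (σ (rt n)) ^ 2 = rt n ^ 2 := by rw [← map_pow, rt_sq, map_natCast]
    rcases sq_eq_sq_iff_eq_or_eq_neg.1 this with h | h
    · exact ⟨1, by simp [h]⟩
    · exact ⟨-1, by simp [h]⟩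
  choose u hu using h
  refine ⟨MonoidHom.mk' u fun σ τ => ?_, hu⟩
  have h1 := hu (σ * τ)
  rw [AlgEquiv.mul_apply, hu τ, map_mul, map_intCast, hu σ, ← mul_assoc] at h1
  have := mul_right_cancel₀ h0 h1
  rw [← Int.cast_mul, Int.cast_inj] at this
  exact Units.ext (by rw [Units.val_mul, ← this, mul_comm])
noncomputable def Xc (n : ℕ) : GQ →* ℤˣ := (X_ex n).choose
lemma Xc_spec (n : ℕ) (σ : GQ) : σ (rt n) = ((Xc n σ : ℤ) : KQ) * rt n := (X_ex n).choose_spec σ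

open Classical in
lemma liou {ι : Type} [Fintype ι] (n : ι → ℕ) (c : ι → ℤ) {B : ℝ} {k : ℕ} (hk : (Finset.univ.image fun i => Xc (n i)).card ≤ k) (hB : 1 ≤ B)
    (h : ∀ g : ι → ℤˣ, (∀ i j, Xc (n i) = Xc (n j) → g i = g j) → |∑ i, ((g i : ℤ) : ℝ) * (c i * sqrt (n i))| ≤ B)
    (h0 : ∑ i, (c i : ℝ) * sqrt (n i) ≠ 0) : 1 ≤ (∑ i, (c i : ℝ) * sqrt (n i)) ^ 2 * B ^ (2 ^ k - 2) := by
  set S := Finset.univ.image fun i => Xc (n i)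
  let m : ι → S := fun i => ⟨Xc (n i), Finset.mem_image_of_mem _ (Finset.mem_univ i)⟩
  let β : (S → ℤˣ) → KQ := fun g => ∑ i, ((g (m i) : ℤ) : KQ) * (c i * rt (n i))
  let f : (S → ℤˣ) → KQ := fun g => if β g = 0 then 1 else β g
  have hφ : ∀ g, phi (β g) = ((∑ i, ((g (m i) : ℤ) : ℝ) * (c i * sqrt (n i)) : ℝ) : ℂ) := fun g => by
    simp only [β, map_sum, map_mul, map_intCast, rt_phi]; push_cast; rfl
  have nf : ∀ g, ‖phi (f g)‖ ≤ B := fun g => by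
    by_cases q : β g = 0
    · simpa [f, q] using hB
    · simp only [f, q, if_false, hφ, Complex.norm_real]
      exact h _ fun i j hij => congrArg g (Subtype.ext hij)
  have hσ : ∀ (σ : GQ) g, σ (β g) = β ((fun s : S => s.1 σ) * g) := fun σ g => by
    simp only [β, map_sum, map_mul, map_intCast, Xc_spec, Pi.mul_apply, Units.val_mul, Int.cast_mul, m]
    exact Finset.sum_congr rfl fun i _ => by ring
  have fσ : ∀ (σ : GQ) g, σ (f g) = f ((fun s : S => s.1 σ) * g) := fun σ g => by
    by_cases q : β g = 0
    · simp [f, q, ← hσ]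
    · simp only [f, ← hσ, map_eq_zero_iff σ σ.injective, q, if_false]
  have fP : ∀ σ : GQ, σ (∏ g, f g) = ∏ g, f g := fun σ => by
    rw [map_prod, ← Equiv.prod_comp (Equiv.mulLeft (fun s : S => s.1 σ)) f]
    exact Finset.prod_congr rfl fun g _ => fσ σ g
  have iP : IsIntegral ℤ (∏ g, f g) := IsIntegral.prod _ fun g _ => by
    by_cases q : β g = 0
    · simpa [f, q] using isIntegral_one
    · simp only [f, q, if_false, β]
      refine IsIntegral.sum _ fun i _ => (isIntegral_algebraMap (x := _)).mul ((isIntegral_algebraMap (x := c i)).mul ?_)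
      exact IsIntegral.of_pow (n := 2) (by norm_num) (by rw [rt_sq]; exact_mod_cast isIntegral_algebraMap (x := (n i : ℤ)))
  obtain ⟨r, hr⟩ := (InfiniteGalois.mem_bot_iff_fixed (∏ g, f g)).2 fP
  obtain ⟨z, hz⟩ := IsIntegrallyClosed.isIntegral_iff.1 ((isIntegral_algebraMap_iff (algebraMap ℚ KQ).injective).1 (hr ▸ iP))
  have fn : ∏ g, f g ≠ 0 := Finset.prod_ne_zero_iff.2 fun g _ => by
    by_cases q : β g = 0 <;> simp [f, q]
  have z1 : 1 ≤ ‖phi (∏ g, f g)‖ := by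
    rw [← hr, ← hz] at fn ⊢
    simp only [eq_intCast, map_intCast, ne_eq, Int.cast_eq_zero, Complex.norm_intCast] at fn ⊢
    exact_mod_cast Int.one_le_abs fn
  have f1 : ∀ u : ℤˣ, ‖phi (f fun _ => u)‖ = |∑ i, (c i : ℝ) * sqrt (n i)| := fun u => by
    have e : phi (β fun _ => u) = (((u : ℤ) * ∑ i, (c i : ℝ) * sqrt (n i) : ℝ) : ℂ) := (hφ fun _ => u).trans (by rw [Finset.mul_sum])
    have q : β (fun _ => u) ≠ 0 := fun q => by
      rw [q, map_zero] at e
      have := mul_eq_zero.1 (Complex.ofReal_eq_zero.1 e.symm)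
      simp [h0] at this
    simp only [f, q, if_false, e, Complex.norm_real, norm_mul, norm_eq_abs]
    rcases Int.units_eq_one_or u with rfl | rfl <;> simp
  have ne : (fun _ => -1 : S → ℤˣ) ≠ fun _ => 1 := fun e => by
    obtain ⟨i, -, -⟩ := Finset.exists_ne_zero_of_sum_ne_zero h0
    exact absurd (congrFun e (m i)) (by decide)
  rw [map_prod, norm_prod, ← Finset.mul_prod_erase _ _ (Finset.mem_univ fun _ => 1), ← Finset.mul_prod_erase _ _ (Finset.mem_erase.2 ⟨ne, Finset.mem_univ _⟩), f1, f1, ← mul_assoc, abs_mul_abs_self, ← sq] at z1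
  refine z1.trans (mul_le_mul_of_nonneg_left ((Finset.prod_le_prod (fun g _ => norm_nonneg _) fun g _ => nf g).trans ?_) (sq_nonneg _))
  rw [Finset.prod_const]
  refine pow_le_pow_right₀ hB ?_
  rw [Finset.card_erase_of_mem (Finset.mem_erase.2 ⟨ne, Finset.mem_univ _⟩), Finset.card_erase_of_mem (Finset.mem_univ _), Finset.card_univ, Fintype.card_fun, Fintype.card_coe, Fintype.card_units_int]
  exact Nat.sub_le_sub_right (Nat.pow_le_pow_right (by norm_num) hk) 2

open Classical in
lemma lind {ι : Type} [Fintype ι] (n : ι → ℕ) (c : ι → ℤ) (h : ∑ i, (c i : ℝ) * sqrt (n i) = 0) (j : ι) :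
    ∑ i with Xc (n i) = Xc (n j), (c i : ℝ) * sqrt (n i) = 0 := by
  let ψ : (GQ →* ℤˣ) → (GQ →* KQ) := fun x => ((Int.castRingHom KQ).toMonoidHom.comp (Units.coeHom ℤ)).comp x
  have ψi : Function.Injective ψ := fun x y h => by
    ext σ
    have := DFunLike.congr_fun h σ
    simpa [ψ] using this
  have hφ : ∀ s : Finset ι, phi (∑ i ∈ s, c i * rt (n i)) = ((∑ i ∈ s, (c i : ℝ) * sqrt (n i) : ℝ) : ℂ) := fun s => by
    simp only [map_sum, map_mul, map_intCast, rt_phi]; push_cast; rfl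
  have e : ∑ i, (c i : KQ) * rt (n i) = 0 := by
    have := hφ Finset.univ
    rw [h, Complex.ofReal_zero] at this
    exact (map_eq_zero_iff phi phi.injective).1 this
  have L := linearIndependent_iff'.1 (linearIndependent_monoidHom GQ KQ) (Finset.univ.image fun i => ψ (Xc (n i)))
    (fun f => ∑ i with ψ (Xc (n i)) = f, c i * rt (n i)) ?_ (ψ (Xc (n j))) (Finset.mem_image_of_mem _ (Finset.mem_univ j))
  · simp only [ψi.eq_iff] at L
    have := hφ {i | Xc (n i) = Xc (n j)}
    rw [L, map_zero] at this
    exact_mod_cast this.symm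
  · funext σ
    have := congrArg σ e
    simp only [map_sum, map_mul, map_intCast, Xc_spec, map_zero] at this
    rw [Pi.zero_apply, ← this, Finset.sum_apply, ← Finset.sum_fiberwise_of_maps_to (fun i _ => Finset.mem_image_of_mem (fun i => ψ (Xc (n i))) (Finset.mem_univ i))]
    refine Finset.sum_congr rfl fun f _ => ?_
    rw [Pi.smul_apply, smul_eq_mul, Finset.sum_mul]
    refine Finset.sum_congr rfl fun i hi => ?_
    rw [← (Finset.mem_filter.1 hi).2]; simp [ψ]; ring

noncomputable def al (s : Fin 8 → ℤ) (p : Fin 8 → ℕ) : ℝ := ∑ i, (s i : ℝ) * sqrt (p i)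

lemma sgn_abs {s : ℤ} (hs : |s| = 1) (g : ℤˣ) (x : ℝ) : |((g : ℤ) : ℝ) * (s * x)| = |x| := by
  have h : |(s : ℝ)| = 1 := by exact_mod_cast congrArg (Int.cast (R := ℝ)) hs
  rcases Int.units_eq_one_or g with rfl | rfl <;> simp [abs_mul, h]

lemma sgn_bd {ι : Type} [Fintype ι] {n : ι → ℕ} {s : ι → ℤ} (hs : ∀ i, |s i| = 1) {M : ℝ} (hn : ∀ i, (n i : ℝ) ≤ M) (g : ι → ℤˣ) :
    |∑ i, ((g i : ℤ) : ℝ) * (s i * sqrt (n i))| ≤ Fintype.card ι * sqrt M := by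
  refine (Finset.abs_sum_le_sum_abs _ _).trans ((Finset.sum_le_card_nsmul _ _ (sqrt M) fun i _ => ?_).trans (by simp))
  rw [sgn_abs (hs i), abs_of_nonneg (sqrt_nonneg _)]
  exact sqrt_le_sqrt (hn i)

lemma one_cls {x x0 x1 x2 : ℕ} {c c0 c1 c2 : ℤ} (hx : 1 ≤ x) (hc : |c| = 1) (h0 : |c0| = 1) (h1 : |c1| = 1) (h2 : |c2| = 1) (h01 : Xc x0 ≠ Xc x1) (h02 : Xc x0 ≠ Xc x2) (h12 : Xc x1 ≠ Xc x2)
    [DecidableEq (GQ →* ℤˣ)] (h : (c : ℝ) * sqrt x + ((if Xc x0 = Xc x then -((c0 : ℝ) * sqrt x0) else 0) + ((if Xc x1 = Xc x then -((c1 : ℝ) * sqrt x1) else 0) + if Xc x2 = Xc x then -((c2 : ℝ) * sqrt x2) else 0)) = 0) : x = x0 ∨ x = x1 ∨ x = x2 := by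
  have k : ∀ {y : ℕ} {d : ℤ}, |d| = 1 → (c : ℝ) * sqrt x + -(d * sqrt y) = 0 → x = y := fun {y d} hd h => by
    have e : |(c : ℝ) * sqrt x| = |(d : ℝ) * sqrt y| := by congr 1; linarith
    have a := sgn_abs hc 1 (sqrt x)
    have b := sgn_abs hd 1 (sqrt y)
    simp only [Units.val_one, Int.cast_one, one_mul] at a b
    rw [a, b, abs_of_nonneg (sqrt_nonneg _), abs_of_nonneg (sqrt_nonneg _), sqrt_inj (by positivity) (by positivity)] at e
    exact_mod_cast e
  split_ifs at h with q0 q1 q2 q2 q1 q2 q2 <;> try simp only [add_zero, zero_add] at h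
  · exact absurd (q0.trans q1.symm) h01
  · exact absurd (q0.trans q1.symm) h01
  · exact absurd (q0.trans q2.symm) h02
  · exact .inl (k h0 h)
  · exact absurd (q1.trans q2.symm) h12
  · exact .inr (.inl (k h1 h))
  · exact .inr (.inr (k h2 h))
  · exact absurd (k (y := 0) (d := 1) rfl (by simpa using h)) (by omega)

lemma six {a b d a' b' d' Y : ℕ} {s t r : ℤ} {δ : ℝ} (hs : |s| = 1) (ht : |t| = 1) (hr : |r| = 1)
    (h6 : (2 * δ) ^ 2 * (8 * sqrt Y) ^ 62 < 1) (hn : ∀ i, 1 ≤ ![a, b, d, a', b', d'] i ∧ ![a, b, d, a', b', d'] i ≤ Y)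
    (hα : |(s * sqrt a + t * sqrt b + r * sqrt d) - (s * sqrt a' + t * sqrt b' + r * sqrt d')| ≤ 2 * δ)
    (h01 : Xc a ≠ Xc b) (h02 : Xc a ≠ Xc d) (h12 : Xc b ≠ Xc d) (h01' : Xc a' ≠ Xc b') (h02' : Xc a' ≠ Xc d') (h12' : Xc b' ≠ Xc d')
    (o1 : a ≤ b) (o2 : b ≤ d) (o1' : a' ≤ b') (o2' : b' ≤ d') : a = a' ∧ b = b' ∧ d = d' := by
  classical
  set n := ![a, b, d, a', b', d'] with hnd
  set c : Fin 6 → ℤ := ![s, t, r, -s, -t, -r] with hc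
  have c1 : ∀ i, |c i| = 1 := by intro i; fin_cases i <;> simp [hc, hs, ht, hr]
  have e : ∑ i, (c i : ℝ) * sqrt (n i) = (s * sqrt a + t * sqrt b + r * sqrt d) - (s * sqrt a' + t * sqrt b' + r * sqrt d') := by
    simp [hc, hnd, Fin.sum_univ_succ]; ring
  have Y1 : (1:ℝ) ≤ Y := by exact_mod_cast (hn 0).1.trans (hn 0).2
  have z : ∑ i, (c i : ℝ) * sqrt (n i) = 0 := by
    by_contra h0
    have := liou n c (k := 6) (B := 8 * sqrt Y) (Finset.card_image_le.trans (by simp)) (by linarith [one_le_sqrt.2 Y1])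
      (fun g _ => (sgn_bd c1 (M := Y) (fun i => by exact_mod_cast (hn i).2) g).trans (by simp; linarith [sqrt_nonneg Y])) h0
    rw [e, ← sq_abs, show 2 ^ 6 - 2 = 62 from rfl] at this
    have := mul_le_mul_of_nonneg_right (pow_le_pow_left₀ (abs_nonneg _) hα 2) (show 0 ≤ (8 * sqrt Y) ^ 62 by positivity)
    linarith
  have L := lind n c z
  have n0 := hn 0; have n1 := hn 1; have n2 := hn 2
  have g0 := L 0; have g1 := L 1; have g2 := L 2
  simp only [Finset.sum_filter, Fin.sum_univ_succ] at g0 g1 g2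
  simp [hc, hnd, h01, h02, h12, h01.symm, h02.symm, h12.symm] at g0 g1 g2 n0 n1 n2
  have ne : a ≠ b ∧ b ≠ d ∧ a' ≠ b' ∧ b' ≠ d' := ⟨fun h => h01 (h ▸ rfl), fun h => h12 (h ▸ rfl), fun h => h01' (h ▸ rfl), fun h => h12' (h ▸ rfl)⟩
  have r0 := one_cls n0.1 hs hs ht hr h01' h02' h12' g0
  have r1 := one_cls n1.1 ht hs ht hr h01' h02' h12' g1
  have r2 := one_cls n2.1 hr hs ht hr h01' h02' h12' g2
  omega

lemma elim_card {q : Fin 8 → ℕ} [DecidableEq (GQ →* ℤˣ)] (x y u v : Fin 8) (hxy : x ≠ y) (hu : u ≠ x ∧ u ≠ y) (hv : v ≠ x ∧ v ≠ y) (eu : Xc (q x) = Xc (q u)) (ev : Xc (q y) = Xc (q v)) :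
    (Finset.univ.image fun i => Xc (q i)).card ≤ 6 := by
  have : (Finset.univ.image fun i => Xc (q i)) ⊆ ((Finset.univ.erase x).erase y).image fun i => Xc (q i) := by
    intro c hc
    obtain ⟨i, -, rfl⟩ := Finset.mem_image.1 hc
    by_cases ix : i = x
    · exact Finset.mem_image.2 ⟨u, by simp [hu], by rw [ix, eu]⟩
    by_cases iy : i = y
    · exact Finset.mem_image.2 ⟨v, by simp [hv], by rw [iy, ev]⟩
    exact Finset.mem_image.2 ⟨i, by simp [ix, iy], rfl⟩
  refine (Finset.card_le_card this).trans (Finset.card_image_le.trans (le_of_eq ?_))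
  rw [Finset.card_erase_of_mem (by simp [hxy.symm]), Finset.card_erase_of_mem (by simp)]; simp

/-- tail of `p` after reordering by `e` -/
def tl (e : Equiv.Perm (Fin 8)) (p : Fin 8 → ℕ) : Fin 5 → ℕ := ![p (e 0), p (e 1), p (e 2), p (e 3), p (e 4)]
def Good (z : ℝ) (p : Fin 8 → ℕ) (e : Equiv.Perm (Fin 8)) : Prop :=
  Xc (p (e 5)) ≠ Xc (p (e 6)) ∧ Xc (p (e 5)) ≠ Xc (p (e 7)) ∧ Xc (p (e 6)) ≠ Xc (p (e 7)) ∧ p (e 5) ≤ p (e 6) ∧ p (e 6) ≤ p (e 7) ∧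
  ∏ i, (p i : ℝ) ^ (-(3:ℝ) / 4) ≤ z ^ (-(3:ℝ) / 4) * ∏ i, 1 / (tl e p i : ℝ)

lemma near_good {s : Fin 8 → ℤ} (hs : ∀ i, |s i| = 1) {Y : ℕ} {q : Fin 8 → ℕ} {δ z : ℝ} (hδ : δ ≤ 1) (hz : 1 ≤ z) (h6 : (2 * δ) ^ 2 * (8 * sqrt Y) ^ 62 < 1) (h8 : δ ^ 2 * (16 * sqrt z) ^ 254 < 1)
    (hq : ∀ i, 1 ≤ q i ∧ q i ≤ Y) (hm : Monotone q) (hα : |al s q| ≤ δ) (h0 : al s q ≠ 0) : ∃ e, Good z q e := by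
  classical
  have q1 : ∀ i, (1:ℝ) ≤ q i := fun i => by exact_mod_cast (hq i).1
  have qm : ∀ i j, i ≤ j → (q i:ℝ) ≤ q j := fun i j h => by exact_mod_cast hm h
  have sq1 : ∀ i, 1 ≤ sqrt (q i) := fun i => one_le_sqrt.2 (q1 i)
  have δ2 : (al s q) ^ 2 ≤ δ ^ 2 := by rw [← sq_abs]; exact pow_le_pow_left₀ (abs_nonneg _) hα 2
  have c7 : ¬ (Finset.univ.image fun i => Xc (q i)).card ≤ 6 := fun hc => by
    have := liou q s hc (B := 8 * sqrt Y) (by linarith [one_le_sqrt.2 ((q1 0).trans (by exact_mod_cast (hq 0).2 : (q 0:ℝ) ≤ Y))])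
      (fun g _ => (sgn_bd hs (M := Y) (fun i => by exact_mod_cast (hq i).2) g).trans (by simp)) h0
    rw [show 2 ^ 6 - 2 = 62 from rfl] at this
    have k : δ ^ 2 ≤ (2 * δ) ^ 2 := by rw [mul_pow]; linarith [sq_nonneg δ]
    exact absurd (this.trans (mul_le_mul_of_nonneg_right (δ2.trans k) (by positivity))) (not_le.2 h6)
  have L : ∀ i, (∀ g : Fin 8 → ℤˣ, (∀ i j, Xc (q i) = Xc (q j) → g i = g j) → |∑ i, ((g i : ℤ) : ℝ) * (s i * sqrt (q i))| ≤ 13 * sqrt (q i)) → z ≤ q i := fun i hB => by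
    by_contra hlt
    push Not at hlt
    have := liou q s (k := 8) (B := 13 * sqrt (q i)) (Finset.card_image_le.trans (by simp)) (by linarith [sq1 i]) hB h0
    rw [show 2 ^ 8 - 2 = 254 from rfl] at this
    have h2 : (13 * sqrt (q i)) ^ 254 ≤ (16 * sqrt z) ^ 254 := pow_le_pow_left₀ (by positivity) (by linarith [sqrt_le_sqrt hlt.le, sqrt_nonneg z]) _
    exact absurd (this.trans (mul_le_mul δ2 h2 (pow_nonneg (by positivity) _) (sq_nonneg δ))) (not_le.2 h8)
  have L7 := L 7 fun g _ => (sgn_bd hs (M := q 7) (fun i => qm i 7 (Fin.le_last i)) g).trans (by simp; linarith [sq1 7])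
  have W : ∀ e : Equiv.Perm (Fin 8), -(3:ℝ) / 4 * (log (q 0) + log (q 1) + log (q 2) + log (q 3) + log (q 4) + log (q 5) + log (q 6) + log (q 7)) ≤
      -(3:ℝ) / 4 * log z - (log (q (e 0)) + log (q (e 1)) + log (q (e 2)) + log (q (e 3)) + log (q (e 4))) →
      ∏ i, (q i : ℝ) ^ (-(3:ℝ) / 4) ≤ z ^ (-(3:ℝ) / 4) * ∏ i, 1 / (tl e q i : ℝ) := fun e h => by
    have E : ∀ i, (1:ℝ) / q i = exp (-log (q i)) := fun i => by rw [exp_neg, exp_log (by linarith [q1 i]), one_div]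
    have R : ∀ i, (q i:ℝ) ^ (-(3:ℝ) / 4) = exp (log (q i) * (-(3:ℝ) / 4)) := fun i => rpow_def_of_pos (by linarith [q1 i]) _
    simp only [R, rpow_def_of_pos (show 0 < z by linarith), Fin.prod_univ_eight, Fin.prod_univ_five, tl]
    simp [-one_div, E, ← exp_add]
    linarith
  have l : ∀ i j, i ≤ j → log (q i) ≤ log (q j) := fun i j h => log_le_log (by linarith [q1 i]) (qm i j h)
  have l0 := log_nonneg (q1 0)
  have l01 := l 0 1 (by decide); have l12 := l 1 2 (by decide); have l23 := l 2 3 (by decide); have l34 := l 3 4 (by decide)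
  have l45 := l 4 5 (by decide); have l56 := l 5 6 (by decide); have l67 := l 6 7 (by decide)
  have lz := log_le_log (by linarith) L7
  by_cases k1 : Xc (q 5) = Xc (q 6) ∨ Xc (q 5) = Xc (q 7)
  · refine ⟨Equiv.swap 4 5, ?_, ?_, ?_, hm (by decide), hm (by decide), W _ ?_⟩
    · exact fun h => c7 (k1.elim (elim_card 4 5 6 6 (by decide) (by decide) (by decide) h) (elim_card 4 5 6 7 (by decide) (by decide) (by decide) h))
    · exact fun h => c7 (k1.elim (elim_card 4 5 7 6 (by decide) (by decide) (by decide) h) (elim_card 4 5 7 7 (by decide) (by decide) (by decide) h))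
    · exact fun h => c7 (elim_card 6 5 7 7 (by decide) (by decide) (by decide) h (k1.elim (·.trans h) id))
    · simp [Equiv.swap_apply_def]
      linarith
  push Not at k1
  by_cases k2 : Xc (q 6) = Xc (q 7)
  · have L5 := L 5 fun g hg => by
      have := hg 6 7 k2
      rw [Fin.sum_univ_eight, this]
      have G : ∀ i : Fin 8, i ≤ 5 → |((g i : ℤ) : ℝ) * (s i * sqrt (q i))| ≤ sqrt (q 5) ∧ |(s i * sqrt (q i))| ≤ sqrt (q 5) := fun i hi => by
        have h1 := sgn_abs (hs i) 1 (sqrt (q i))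
        rw [Units.val_one, Int.cast_one, one_mul] at h1
        rw [sgn_abs (hs i), h1, abs_of_nonneg (sqrt_nonneg _), and_self]
        exact sqrt_le_sqrt (qm i 5 hi)
      have G0 := G 0 (by decide); have G1 := G 1 (by decide); have G2 := G 2 (by decide)
      have G3 := G 3 (by decide); have G4 := G 4 (by decide); have G5 := G 5 (by decide)
      have A := hα
      rw [al, Fin.sum_univ_eight] at A
      simp only [abs_le] at *
      have := sq1 5
      rcases Int.units_eq_one_or (g 7) with k | k <;> rw [k] <;> push_cast <;> constructor <;> linarith
    have lz5 := log_le_log (by linarith) L5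
    refine ⟨Equiv.swap 4 5 * Equiv.swap 4 6, ?_, ?_, ?_, hm (by decide), hm (by decide), W _ ?_⟩
    · exact fun h => c7 (elim_card 4 6 5 7 (by decide) (by decide) (by decide) h k2)
    · exact fun h => c7 (elim_card 4 6 7 7 (by decide) (by decide) (by decide) h k2)
    · exact k1.2
    · simp [Equiv.swap_apply_def]
      linarith
  · refine ⟨1, k1.1, k1.2, k2, hm (by decide), hm (by decide), W _ ?_⟩
    simp
    linarith

lemma al_perm (s : Fin 8 → ℤ) (p : Fin 8 → ℕ) (e : Equiv.Perm (Fin 8)) : al (s ∘ e) (p ∘ e) = al s p := Equiv.sum_comp e fun i => (s i : ℝ) * sqrt (p i)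

open Classical in
lemma near_sol {s : Fin 8 → ℤ} (hs : ∀ i, |s i| = 1) {Y : ℕ} {δ z : ℝ} (hδ : δ ≤ 1) (hz : 1 ≤ z) (h6 : (2 * δ) ^ 2 * (8 * sqrt Y) ^ 62 < 1) (h8 : δ ^ 2 * (16 * sqrt z) ^ 254 < 1) :
    ∑ p ∈ Fintype.piFinset fun _ : Fin 8 => Finset.Icc 1 Y with al s p ≠ 0 ∧ |al s p| ≤ δ, ∏ i, (p i : ℝ) ^ (-(3:ℝ) / 4) ≤ 40320 * (z ^ (-(3:ℝ) / 4) * (1 + log Y) ^ 5) := by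
  set N := (Fintype.piFinset fun _ : Fin 8 => Finset.Icc 1 Y).filter fun p => al s p ≠ 0 ∧ |al s p| ≤ δ with hN
  set F : (Fin 5 → ℕ) → ℝ := fun t => ∏ i, 1 / (t i : ℝ) with hF
  have z0 : 0 ≤ z ^ (-(3:ℝ) / 4) := by positivity
  have F0 : ∀ t, 0 ≤ F t := fun t => by simp only [hF]; positivity
  have mem : ∀ p ∈ N, (∀ i, 1 ≤ p i ∧ p i ≤ Y) ∧ al s p ≠ 0 ∧ |al s p| ≤ δ := fun p hp => by
    simpa [hN, Fintype.mem_piFinset] using hp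
  have ex : ∀ p ∈ N, ∃ e, Good z p e := fun p hp => by
    obtain ⟨h1, h2, h3⟩ := mem p hp
    rw [← al_perm s p (Tuple.sort p)] at h2 h3
    obtain ⟨e, he⟩ := near_good (fun i => hs _) hδ hz h6 h8 (q := p ∘ Tuple.sort p) (fun i => h1 _) (Tuple.monotone_sort p) h3 h2
    refine ⟨Tuple.sort p * e, he.1, he.2.1, he.2.2.1, he.2.2.2.1, he.2.2.2.2.1, ?_⟩
    rw [← Equiv.prod_comp (Tuple.sort p)]
    exact he.2.2.2.2.2
  have inj : ∀ e, Set.InjOn (tl e) (N.filter fun p => Good z p e) := fun e p hp p' hp' ht => by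
    obtain ⟨hp, g⟩ := Finset.mem_filter.1 hp
    obtain ⟨hp', g'⟩ := Finset.mem_filter.1 hp'
    obtain ⟨h1, -, h3⟩ := mem p hp
    obtain ⟨h1', -, h3'⟩ := mem p' hp'
    have t0 : ∀ i, tl e p i = tl e p' i := fun i => congrFun ht i
    have t0' := t0 0; have t1 := t0 1; have t2 := t0 2; have t3 := t0 3; have t4 := t0 4
    simp only [tl] at t0' t1 t2 t3 t4
    simp at t0' t1 t2 t3 t4
    have D : |al s p - al s p'| ≤ 2 * δ := (abs_sub _ _).trans (by linarith)
    rw [← al_perm s p e, ← al_perm s p' e, al, al, Fin.sum_univ_eight, Fin.sum_univ_eight] at D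
    simp only [Function.comp_apply, t0', t1, t2, t3, t4] at D
    obtain ⟨a, b, c⟩ := six (hs (e 5)) (hs (e 6)) (hs (e 7)) h6 (fun i => by fin_cases i <;> simp [h1, h1']) (le_trans (le_of_eq (by ring_nf)) D) g.1 g.2.1 g.2.2.1 g'.1 g'.2.1 g'.2.2.1
      g.2.2.2.1 g.2.2.2.2.1 g'.2.2.2.1 g'.2.2.2.2.1
    funext i
    obtain ⟨j, rfl⟩ := e.surjective i
    fin_cases j <;> assumption
  have tot : ∑ t ∈ Fintype.piFinset fun _ : Fin 5 => Finset.Icc 1 Y, F t ≤ (1 + log Y) ^ 5 := by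
    have := harm_le Y
    rw [sum_r1 (fun n : ℕ => 1 / (n:ℝ))] at this
    rw [hF, ← Finset.prod_univ_sum (fun _ => Finset.Icc 1 Y) (fun _ n => 1 / (n:ℝ)), Finset.prod_const, Finset.card_univ, Fintype.card_fin]
    exact pow_le_pow_left₀ (Finset.sum_nonneg fun n _ => by positivity) this 5
  calc _ ≤ ∑ p ∈ N, ∑ e : Equiv.Perm (Fin 8), if Good z p e then z ^ (-(3:ℝ) / 4) * F (tl e p) else 0 := Finset.sum_le_sum fun p hp => by
        obtain ⟨e, he⟩ := ex p hp
        refine le_trans (by rw [if_pos he]; exact he.2.2.2.2.2) (Finset.single_le_sum (f := fun e => if Good z p e then z ^ (-(3:ℝ) / 4) * F (tl e p) else 0) (fun e _ => ?_) (Finset.mem_univ e))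
        split_ifs
        exacts [mul_nonneg z0 (F0 _), le_rfl]
    _ = ∑ e : Equiv.Perm (Fin 8), z ^ (-(3:ℝ) / 4) * ∑ p ∈ N with Good z p e, F (tl e p) := by
        rw [Finset.sum_comm]
        exact Finset.sum_congr rfl fun e _ => by rw [← Finset.sum_filter, Finset.mul_sum]
    _ ≤ ∑ e : Equiv.Perm (Fin 8), z ^ (-(3:ℝ) / 4) * (1 + log Y) ^ 5 := Finset.sum_le_sum fun e _ => mul_le_mul_of_nonneg_left (by
        rw [← Finset.sum_image (inj e)]
        refine (Finset.sum_le_sum_of_subset_of_nonneg (fun t ht => ?_) fun t _ _ => F0 t).trans tot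
        obtain ⟨p, hp, rfl⟩ := Finset.mem_image.1 ht
        have := (mem p (Finset.mem_filter.1 hp).1).1
        refine Fintype.mem_piFinset.2 fun i => Finset.mem_Icc.2 ?_
        fin_cases i <;> exact this _) z0
    _ = _ := by rw [Finset.sum_const, Finset.card_univ, Fintype.card_perm, Fintype.card_fin, nsmul_eq_mul]; norm_num [Nat.factorial]

lemma wt {ι : Type} (P : Finset ι) {b α : ι → ℝ} (hb : ∀ p ∈ P, 0 ≤ b p) {R : ℝ} (hR : 0 < R) :
    ∑ p ∈ P with |α p| ≤ 1 / (16 * R), b p ≤ 8 / R * ∫ u in 0..R, ‖∑ p ∈ P, (b p : ℂ) * ee (2 * u * α p)‖ := by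
  set f : ℝ → ℂ := fun u => ∑ p ∈ P, (b p : ℂ) * ee (2 * u * α p) with hf
  have ce : ∀ a : ℝ, Continuous fun u : ℝ => ee (2 * u * a) := fun a => ee_cont.comp (by fun_prop)
  have cf : Continuous f := continuous_finsetSum _ fun p _ => continuous_const.mul (ce _)
  set I : ι → ℂ := fun p => ∫ t in 0..R, ee (2 * t * α p) with hI
  have conjI : ∀ p, ∫ t in 0..R, ee (-(2 * t * α p)) = starRingEnd ℂ (I p) := fun p => by
    simp only [hI, ee_neg, intervalIntegral.integral_of_le hR.le]
    exact integral_conj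
  have key : ((∑ p ∈ P, b p * ‖I p‖ ^ 2 : ℝ) : ℂ) = ∫ t' in 0..R, ∫ t in 0..R, f (t - t') := by
    have e : ∀ t', ∫ t in 0..R, f (t - t') = ∑ p ∈ P, b p * (I p * ee (-(2 * t' * α p))) := fun t' => by
      have : ∀ t, f (t - t') = ∑ p ∈ P, b p * (ee (2 * t * α p) * ee (-(2 * t' * α p))) := fun t => by
        refine Finset.sum_congr rfl fun p _ => ?_
        rw [← ee_add]; congr 2; ring
      simp only [this]
      have ci : ∀ p, Continuous fun t : ℝ => (b p : ℂ) * (ee (2 * t * α p) * ee (-(2 * t' * α p))) := fun p => continuous_const.mul ((ce _).mul continuous_const)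
      rw [intervalIntegral.integral_finsetSum fun p _ => (ci p).intervalIntegrable _ _]
      exact Finset.sum_congr rfl fun p _ => by rw [intervalIntegral.integral_const_mul, intervalIntegral.integral_mul_const]
    simp only [e]
    have ci : ∀ p, Continuous fun t' : ℝ => (b p : ℂ) * (I p * ee (-(2 * t' * α p))) := fun p => continuous_const.mul (continuous_const.mul (ee_cont.comp (by fun_prop)))
    rw [intervalIntegral.integral_finsetSum fun p _ => (ci p).intervalIntegrable _ _]
    push_cast
    refine Finset.sum_congr rfl fun p _ => ?_
    rw [intervalIntegral.integral_const_mul, intervalIntegral.integral_const_mul, conjI, Complex.mul_conj']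
  have sym : ∀ u, ‖f (-u)‖ = ‖f u‖ := fun u => by
    rw [← Complex.norm_conj (f u)]
    congr 1
    simp only [hf, map_sum, map_mul, Complex.conj_ofReal, ← ee_neg]
    exact Finset.sum_congr rfl fun p _ => by congr 2; ring
  have cn : ∀ a b, IntervalIntegrable (fun u => ‖f u‖) volume a b := fun a b => cf.norm.intervalIntegrable a b
  set M := ∫ u in 0..R, ‖f u‖ with hM
  have up : ‖∫ t' in 0..R, ∫ t in 0..R, f (t - t')‖ ≤ 2 * M * R := by
    have := intervalIntegral.norm_integral_le_of_norm_le_const (a := 0) (b := R) (C := 2 * M) (f := fun t' => ∫ t in 0..R, f (t - t')) fun t' ht => by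
      rw [Set.uIoc_of_le hR.le] at ht
      refine (intervalIntegral.norm_integral_le_integral_norm hR.le).trans ?_
      rw [intervalIntegral.integral_comp_sub_right (fun u => ‖f u‖) t', ← intervalIntegral.integral_add_adjacent_intervals (cn _ 0) (cn 0 _)]
      have h1 : ∫ u in 0 - t'..0, ‖f u‖ ≤ M := by
        have := intervalIntegral.integral_comp_neg (a := 0) (b := t') fun u => ‖f u‖
        simp only [sym, neg_zero] at this
        rw [zero_sub, ← this]
        exact intervalIntegral.integral_mono_interval le_rfl ht.1.le ht.2 (Filter.Eventually.of_forall fun _ => norm_nonneg _) (cn _ _)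
      have h2 : ∫ u in 0..R - t', ‖f u‖ ≤ M := intervalIntegral.integral_mono_interval le_rfl (by linarith [ht.2]) (by linarith [ht.1]) (Filter.Eventually.of_forall fun _ => norm_nonneg _) (cn _ _)
      linarith
    rwa [sub_zero, abs_of_pos hR] at this
  rw [← key, Complex.norm_real, norm_of_nonneg (Finset.sum_nonneg fun p hp => mul_nonneg (hb p hp) (sq_nonneg _))] at up
  have lo : ∀ p, |α p| ≤ 1 / (16 * R) → R / 2 * (R / 2) ≤ ‖I p‖ ^ 2 := fun p hp => by
    have h : R * (2 / 3) ≤ (I p).re := by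
      have e : (I p).re = ∫ t in 0..R, cos (2 * π * (2 * t * α p)) := by
        have := Complex.reCLM.intervalIntegral_comp_comm ((ce (α p)).intervalIntegrable (μ := volume) 0 R)
        simp only [Complex.reCLM_apply, ee_re] at this
        exact this.symm
      have := intervalIntegral.integral_mono_on (μ := volume) hR.le (f := fun _ => (2:ℝ) / 3) (g := fun t => cos (2 * π * (2 * t * α p))) intervalIntegrable_const (Continuous.intervalIntegrable (by fun_prop) _ _) fun t ht => by
        have k : |t * α p| ≤ 1 / 16 := by
          rw [abs_mul, abs_of_nonneg ht.1]
          refine (mul_le_mul ht.2 hp (abs_nonneg _) hR.le).trans (le_of_eq (by field_simp))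
        have k2 : (t * α p) ^ 2 ≤ (1 / 16) ^ 2 := by rw [← sq_abs]; exact pow_le_pow_left₀ (abs_nonneg _) k 2
        have := one_sub_sq_div_two_le_cos (x := 2 * π * (2 * t * α p))
        have p10 : π ^ 2 ≤ (3.15:ℝ) ^ 2 := pow_le_pow_left₀ pi_pos.le pi_lt_d2.le 2
        have k3 := mul_le_mul p10 k2 (sq_nonneg _) (by norm_num)
        rw [show (2 * π * (2 * t * α p)) ^ 2 = 16 * (π ^ 2 * (t * α p) ^ 2) by ring] at this
        linarith
      rw [e]
      rwa [intervalIntegral.integral_const, sub_zero, smul_eq_mul] at this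
    have := pow_le_pow_left₀ (by positivity) (h.trans (Complex.re_le_norm _)) 2
    nlinarith
  have : (∑ p ∈ P with |α p| ≤ 1 / (16 * R), b p) * (R / 2 * (R / 2)) ≤ 2 * M * R := by
    refine le_trans ?_ up
    rw [Finset.sum_mul]
    refine (Finset.sum_le_sum fun p hp => mul_le_mul_of_nonneg_left (lo p (Finset.mem_filter.1 hp).2) (hb p (Finset.mem_filter.1 hp).1)).trans ?_
    exact Finset.sum_le_sum_of_subset_of_nonneg (Finset.filter_subset _ _) fun p hp _ => mul_nonneg (hb p hp) (sq_nonneg _)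
  rw [div_mul_eq_mul_div, le_div_iff₀ hR]
  have := le_of_mul_le_mul_right (by linarith : (∑ p ∈ P with |α p| ≤ 1 / (16 * R), b p) * R * R ≤ 8 * M * R) hR
  linarith

/-- positive octuples up to `N` -/
def bx (N : ℕ) : Finset (Fin 8 → ℕ) := Fintype.piFinset fun _ => Finset.Icc 1 N

lemma prodSS {s : Fin 8 → ℤ} (hs : ∀ i, |s i| = 1) (b : Fin 8 → ℕ → ℝ) (N : ℕ) (u : ℝ) :
    ‖∑ p ∈ bx N, ((∏ i, b i (p i) : ℝ) : ℂ) * ee (2 * u * al s p)‖ = ∏ i, ‖SS (fun n => (b i n : ℂ)) N u‖ := by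
  have e : ∑ p ∈ bx N, ((∏ i, b i (p i) : ℝ) : ℂ) * ee (2 * u * al s p) = ∏ i, ∑ n ∈ Finset.Icc 1 N, (b i n : ℂ) * ee (2 * u * (s i * sqrt n)) := by
    rw [Finset.prod_univ_sum]
    refine Finset.sum_congr rfl fun p _ => ?_
    rw [Finset.prod_mul_distrib, Complex.ofReal_prod]
    congr 1
    simp only [ee, al, Finset.mul_sum, Complex.ofReal_sum, Finset.sum_mul, Complex.exp_sum]
  rw [e, norm_prod]
  refine Finset.prod_congr rfl fun i _ => ?_
  rcases eq_or_eq_neg_of_abs_eq (hs i) with h | h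
  · simp [h, SS]
  · rw [← Complex.norm_conj, SS, map_sum]
    congr 1
    refine Finset.sum_congr rfl fun n _ => ?_
    rw [map_mul, Complex.conj_ofReal, ← ee_neg, h]; congr 2; push_cast; ring

lemma ba7 {a b q : ℝ} (ha : 0 ≤ a) (hb : 0 ≤ b) (hq : 0 < q) : b * a ^ 7 ≤ q ^ 3 * b ^ 2 + (a ^ 10 + b ^ 10) / q := by
  have P : 0 ≤ q ^ 3 * b ^ 2 := by positivity
  rw [← sub_le_iff_le_add', le_div_iff₀ hq]
  have a10 := pow_nonneg ha 10
  have b10 := pow_nonneg hb 10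
  by_cases h : a ^ 2 < q
  · by_cases k : a ^ 7 ≤ q ^ 3 * b
    · nlinarith [mul_le_mul_of_nonneg_left k hb]
    · push Not at k
      have h4 : (a ^ 2) ^ 2 ≤ q ^ 2 := pow_le_pow_left₀ (sq_nonneg a) h.le 2
      have : q ^ 3 * (b * a ^ 7) ≤ q ^ 2 * a ^ 10 := by
        linarith [mul_le_mul_of_nonneg_right k.le (pow_nonneg ha 7), mul_le_mul_of_nonneg_right h4 a10]
      have : q * (b * a ^ 7) ≤ a ^ 10 := le_of_mul_le_mul_left (by linarith : q ^ 2 * (q * (b * a ^ 7)) ≤ q ^ 2 * a ^ 10) (by positivity)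
      linarith [mul_nonneg P hq.le]
  · push Not at h
    rcases le_total a b with k | k
    · have h1 : a ^ 7 ≤ b ^ 7 := pow_le_pow_left₀ ha k 7
      have h2 : q ≤ b ^ 2 := h.trans (pow_le_pow_left₀ ha k 2)
      have : b * a ^ 7 * q ≤ b * b ^ 7 * b ^ 2 := mul_le_mul (mul_le_mul_of_nonneg_left h1 hb) h2 hq.le (by positivity)
      linarith [mul_nonneg P hq.le]
    · have : b * a ^ 7 * q ≤ a * a ^ 7 * a ^ 2 := mul_le_mul (mul_le_mul_of_nonneg_right k (by positivity)) h hq.le (by positivity)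
      linarith [mul_nonneg P hq.le]

noncomputable def bb (n : ℕ) : ℝ := dd n * (n:ℝ) ^ (-(3:ℝ) / 4)

lemma bb_nonneg (n : ℕ) : 0 ≤ bb n := mul_nonneg (dd_nonneg n) (by positivity)

lemma oct_bb (p : Fin 8 → ℕ) : octTerm p = ∏ i, bb (p i) := by
  simp only [octTerm, bb, Finset.prod_mul_distrib]
  rw [finsetProd_rpow _ _ fun i _ => Nat.cast_nonneg _]

lemma oct_nonneg (p : Fin 8 → ℕ) : 0 ≤ octTerm p := oct_bb p ▸ Finset.prod_nonneg fun _ _ => bb_nonneg _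

open Classical in
/-- partial diagonal sums -/
noncomputable def EE (s : Fin 8 → ℤ) (N : ℕ) : ℝ := ∑ p ∈ bx N with al s p = 0, octTerm p

lemma mem_bx {N : ℕ} {p : Fin 8 → ℕ} : p ∈ bx N ↔ ∀ i, 1 ≤ p i ∧ p i ≤ N := by simp [bx]

lemma dy {s : Fin 8 → ℤ} (hs : ∀ i, |s i| = 1) {ε : ℝ} (hε : 0 < ε) : ∃ C ≥ (1:ℝ), ∀ M : ℕ, 1 ≤ M →
    EE s (2 * M) ≤ EE s M + C * (M:ℝ) ^ (ε - 1 / 8) := by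
  obtain ⟨C₁, h1, H1⟩ := ms ε hε
  obtain ⟨C₂, h2, H2⟩ := mom10 ε hε
  refine ⟨64 * (2 ^ ε * (2 * C₁ + 4 * C₂)), ?_, fun M hM => ?_⟩
  · nlinarith [one_le_rpow (x := 2) (by norm_num) hε.le]
  set N := 2 * M with hN
  have M0 : (1:ℝ) ≤ M := by exact_mod_cast hM
  set R : ℝ := (N:ℝ) ^ 2 with hR
  have NM : (N:ℝ) = 2 * M := by rw [hN]; push_cast; ring
  have R0 : (M:ℝ) ^ 2 ≤ R := by rw [hR, NM]; nlinarith
  have Rp : 0 < R := by nlinarith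
  set B : ℕ → ℝ := fun n => if n ≤ M then 0 else bb n with hB
  have B0 : ∀ n, 0 ≤ B n := fun n => by simp only [hB]; split_ifs; exacts [le_rfl, bb_nonneg n]
  have Bb : ∀ n, B n ≤ bb n := fun n => by simp only [hB]; split_ifs; exacts [bb_nonneg n, le_rfl]
  set b : Fin 8 → Fin 8 → ℕ → ℝ := fun i j => if j = i then B else bb with hb
  have b0 : ∀ i j n, 0 ≤ b i j n := fun i j n => by simp only [hb]; split_ifs; exacts [B0 n, bb_nonneg n]
  have pw : ∀ p ∈ bx N, octTerm p ≤ (if p ∈ bx M then octTerm p else 0) + ∑ i, ∏ j, b i j (p j) := fun p hp => by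
    have np : ∀ i, 0 ≤ ∏ j, b i j (p j) := fun i => Finset.prod_nonneg fun j _ => b0 _ _ _
    split_ifs with h
    · exact le_add_of_nonneg_right (Finset.sum_nonneg fun i _ => np i)
    · rw [mem_bx] at h hp
      push Not at h
      obtain ⟨i, hi⟩ := h
      rw [zero_add]
      refine le_trans (le_of_eq ?_) (Finset.single_le_sum (fun i _ => np i) (Finset.mem_univ i))
      rw [oct_bb]
      refine Finset.prod_congr rfl fun j _ => ?_
      simp only [hb, hB]
      split_ifs with h1
      · subst h1; simp [hi (hp j).1]
      · rfl
  have each : ∀ i, ∑ p ∈ bx N with |al s p| ≤ 1 / (16 * R), ∏ j, b i j (p j) ≤ 8 * (2 ^ ε * (2 * C₁ + 4 * C₂)) * (M:ℝ) ^ (ε - 1 / 8) := fun i => by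
    refine (wt (bx N) (b := fun p => ∏ j, b i j (p j)) (α := al s) (fun p _ => Finset.prod_nonneg fun j _ => b0 _ _ _) Rp).trans ?_
    simp only [prodSS hs (b i)]
    have e : ∀ u, ∏ j, ‖SS (fun n => (b i j n : ℂ)) N u‖ = ‖SS (fun n => (B n : ℂ)) N u‖ * ‖SS (fun n => (bb n : ℂ)) N u‖ ^ 7 := fun u => by
      rw [← Finset.mul_prod_erase _ _ (Finset.mem_univ i)]
      congr 1
      · simp [hb]
      · rw [Finset.prod_congr rfl fun j hj => by rw [show b i j = bb by simp [hb, Finset.ne_of_mem_erase hj]], Finset.prod_const]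
        simp
    simp only [e]
    set q := (M:ℝ) ^ ((1:ℝ) / 8) with hq
    have q0 : 0 < q := by positivity
    have cB := (SS_cont (fun n => (B n : ℂ)) N).norm
    have cA := (SS_cont (fun n => (bb n : ℂ)) N).norm
    set f := fun u => ‖SS (fun n => (B n : ℂ)) N u‖ with hf
    set g := fun u => ‖SS (fun n => (bb n : ℂ)) N u‖ with hg
    have nA : ∀ n ∈ Finset.Icc 1 N, ‖(bb n : ℂ)‖ ≤ dd n * (n:ℝ) ^ (-(3:ℝ) / 4) := fun n _ => by
      rw [Complex.norm_real, norm_of_nonneg (bb_nonneg n)]; exact le_rfl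
    have nB : ∀ n ∈ Finset.Icc 1 N, ‖(B n : ℂ)‖ ≤ dd n * (n:ℝ) ^ (-(3:ℝ) / 4) := fun n _ => by
      rw [Complex.norm_real, norm_of_nonneg (B0 n)]; exact Bb n
    have N1 : 1 ≤ N := by omega
    have a2 := H1 (fun n => (B n : ℂ)) N M 0 R N1 (by linarith) le_rfl Rp.le nB fun n hn => by simp [hB, Nat.cast_le.1 hn]
    have a3 := (H2 (fun n => (bb n : ℂ)) N 0 R N1 Rp.le nA).1
    have a4 := (H2 (fun n => (B n : ℂ)) N 0 R N1 Rp.le nB).1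
    rw [zero_add] at a2 a3 a4
    have I : ∫ u in 0..R, f u * g u ^ 7 ≤ ∫ u in 0..R, (q ^ 3 * f u ^ 2 + (g u ^ 10 + f u ^ 10) / q) :=
      intervalIntegral.integral_mono_on Rp.le (Continuous.intervalIntegrable (by fun_prop) _ _) (Continuous.intervalIntegrable (by fun_prop) _ _) fun u _ => ba7 (norm_nonneg _) (norm_nonneg _) q0
    rw [intervalIntegral.integral_add (Continuous.intervalIntegrable (by fun_prop) _ _) (Continuous.intervalIntegrable (by fun_prop) _ _), intervalIntegral.integral_const_mul, intervalIntegral.integral_div,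
      intervalIntegral.integral_add (Continuous.intervalIntegrable (by fun_prop) _ _) (Continuous.intervalIntegrable (by fun_prop) _ _)] at I
    have Nε : (N:ℝ) ^ ε = 2 ^ ε * (M:ℝ) ^ ε := by rw [NM, mul_rpow (by norm_num) (by linarith)]
    have q3 : q ^ 3 * (M:ℝ) ^ (-(1:ℝ) / 2) = q⁻¹ := by
      rw [hq, ← rpow_natCast, ← rpow_mul (by linarith), ← rpow_add (by linarith), ← rpow_neg (by linarith)]; norm_num
    have q4 : q ^ 3 / R ≤ q⁻¹ := by
      rw [div_le_iff₀ Rp, inv_mul_eq_div, le_div_iff₀ q0, ← pow_succ]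
      refine le_trans ?_ R0
      rw [hq, ← rpow_natCast, ← rpow_mul (by linarith), ← rpow_natCast]
      exact rpow_le_rpow_of_exponent_le M0 (by norm_num)
    have last : (M:ℝ) ^ (ε - 1 / 8) = (M:ℝ) ^ ε * q⁻¹ := by rw [rpow_sub (by linarith)]; rfl
    calc 8 / R * ∫ u in 0..R, f u * g u ^ 7 ≤ 8 / R * (q ^ 3 * (C₁ * (N:ℝ) ^ ε * (R * (M:ℝ) ^ (-(1:ℝ) / 2) + 1)) + (C₂ * (N:ℝ) ^ ε * (R + R) + C₂ * (N:ℝ) ^ ε * (R + R)) / q) := by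
          refine mul_le_mul_of_nonneg_left (I.trans (add_le_add (mul_le_mul_of_nonneg_left a2 (by positivity)) (div_le_div_of_nonneg_right (add_le_add a3 a4) q0.le))) (by positivity)
      _ = 8 * (N:ℝ) ^ ε * (C₁ * (q ^ 3 * (M:ℝ) ^ (-(1:ℝ) / 2) + q ^ 3 / R) + 4 * C₂ * q⁻¹) := by field_simp; ring
      _ ≤ 8 * (N:ℝ) ^ ε * (C₁ * (q⁻¹ + q⁻¹) + 4 * C₂ * q⁻¹) := by rw [q3]; gcongr
      _ = _ := by rw [Nε, last]; ring
  classical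
  have : EE s N ≤ EE s M + ∑ i, ∑ p ∈ bx N with |al s p| ≤ 1 / (16 * R), ∏ j, b i j (p j) := by
    rw [EE, EE, Finset.sum_comm (s := Finset.univ)]
    refine (Finset.sum_le_sum fun p hp => pw p (Finset.mem_filter.1 hp).1).trans ?_
    rw [Finset.sum_add_distrib]
    refine add_le_add ?_ (Finset.sum_le_sum_of_subset_of_nonneg (fun p hp => ?_) fun p _ _ => Finset.sum_nonneg fun i _ => Finset.prod_nonneg fun j _ => b0 _ _ _)
    · rw [← Finset.sum_filter]
      refine Finset.sum_le_sum_of_subset_of_nonneg (fun p hp => ?_) fun p _ _ => oct_nonneg p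
      simp only [Finset.mem_filter] at hp ⊢
      exact ⟨hp.2, hp.1.2⟩
    · simp only [Finset.mem_filter] at hp ⊢
      exact ⟨hp.1, by rw [hp.2, abs_zero]; positivity⟩
  refine this.trans (add_le_add_right ((Finset.sum_le_sum fun i _ => each i).trans (le_of_eq ?_)) _)
  simp; ring

lemma tails {s : Fin 8 → ℤ} (hs : ∀ i, |s i| = 1) {κ : ℝ} (h0 : 0 < κ) (hκ : κ < 1 / 8) (cond : (Fin 8 → ℕ) → Prop)
    (hc : ∀ p, cond p ↔ al s p = 0) : ∃ C ≥ (1:ℝ), ∀ Y : ℕ, 1 ≤ Y →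
    |(∑' p : {p : Fin 8 → ℕ // (∀ i, 0 < p i) ∧ cond p}, octTerm p.1) - EE s Y| ≤ C * (Y:ℝ) ^ (-κ) := by
  obtain ⟨C, h1, H⟩ := dy hs (ε := 1 / 8 - κ) (by linarith)
  rw [show 1 / 8 - κ - 1 / 8 = -κ by ring] at H
  set r : ℝ := 2 ^ (-κ) with hr
  have r0 : 0 < r := by positivity
  have r1 : r < 1 := rpow_lt_one_of_one_lt_of_neg (by norm_num) (by linarith)
  have st : ∀ Y : ℕ, 1 ≤ Y → ∀ K : ℕ, EE s (2 ^ K * Y) ≤ EE s Y + C * (Y:ℝ) ^ (-κ) * ∑ k ∈ Finset.range K, r ^ k := fun Y hY K => by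
    induction K with
    | zero => simp
    | succ K ih =>
      have := H (2 ^ K * Y) (Nat.mul_pos (by positivity) hY)
      rw [← mul_assoc, ← pow_succ'] at this
      push_cast at this
      rw [mul_rpow (by positivity) (by positivity), ← rpow_natCast, ← rpow_mul (by norm_num), mul_comm (K:ℝ), rpow_mul (by norm_num), rpow_natCast] at this
      rw [Finset.sum_range_succ]
      linarith
  have geo : ∀ K, ∑ k ∈ Finset.range K, r ^ k ≤ 1 / (1 - r) := fun K => by
    rw [le_div_iff₀ (by linarith), geom_sum_mul_neg]; linarith [pow_pos r0 K]
  have fin : ∀ Y : ℕ, 1 ≤ Y → ∀ F : Finset {p : Fin 8 → ℕ // (∀ i, 0 < p i) ∧ cond p}, ∑ x ∈ F, octTerm x.1 ≤ EE s Y + C * (Y:ℝ) ^ (-κ) * (1 / (1 - r)) := fun Y hY F => by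
    classical
    refine le_trans ?_ ((st Y hY (∑ x ∈ F, ∑ i, x.1 i)).trans (add_le_add_right (mul_le_mul_of_nonneg_left (geo _) (by positivity)) _))
    refine (Finset.sum_map F (Function.Embedding.subtype _) octTerm).symm.le.trans ?_
    rw [EE]
    refine Finset.sum_le_sum_of_subset_of_nonneg (fun p hp => ?_) fun p _ _ => oct_nonneg p
    obtain ⟨x, hx, rfl⟩ := Finset.mem_map.1 hp
    rw [Finset.mem_filter, mem_bx]
    refine ⟨fun i => ⟨x.2.1 i, ?_⟩, (hc _).1 x.2.2⟩
    calc x.1 i ≤ ∑ i, x.1 i := Finset.single_le_sum (fun _ _ => Nat.zero_le _) (Finset.mem_univ i)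
      _ ≤ ∑ x ∈ F, ∑ i, x.1 i := Finset.single_le_sum (f := fun x : {p : Fin 8 → ℕ // (∀ i, 0 < p i) ∧ cond p} => ∑ i, x.1 i) (fun _ _ => Nat.zero_le _) hx
      _ ≤ _ := (Nat.lt_two_pow_self.le).trans (Nat.le_mul_of_pos_right _ hY)
  have sm : Summable fun p : {p : Fin 8 → ℕ // (∀ i, 0 < p i) ∧ cond p} => octTerm p.1 := summable_of_sum_le (fun p => oct_nonneg _) (fin 1 le_rfl)
  refine ⟨C * (1 / (1 - r)), ?_, fun Y hY => ?_⟩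
  · have : 1 ≤ 1 / (1 - r) := by rw [le_div_iff₀ (by linarith)]; linarith
    nlinarith
  have up := sm.tsum_le_of_sum_le (fin Y hY)
  classical
  have lo : EE s Y ≤ ∑' p : {p : Fin 8 → ℕ // (∀ i, 0 < p i) ∧ cond p}, octTerm p.1 := by
    rw [EE, ← Finset.sum_subtype_of_mem octTerm (p := fun p => (∀ i, 0 < p i) ∧ cond p) fun p hp => ?_]
    · exact sm.sum_le_tsum _ fun p _ => oct_nonneg _
    · rw [Finset.mem_filter, mem_bx] at hp
      exact ⟨fun i => (hp.1 i).1, (hc p).2 hp.2⟩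
  rw [abs_of_nonneg (by linarith)]
  linarith

/-- `8-j` plus signs, then `j` minus signs -/
def sg (j : ℕ) : Fin 8 → ℤ := fun i => if i.val < 8 - j then 1 else -1

lemma sg_abs (j : ℕ) (i : Fin 8) : |sg j i| = 1 := by simp only [sg]; split_ifs <;> rfl

lemma c7_iff (p : Fin 8 → ℕ) : cond7 p ↔ al (sg 4) p = 0 := by
  simp only [cond7, al, Fin.sum_univ_eight, sg]
  norm_num
  constructor <;> intro h <;> linarith

lemma c4_iff (p : Fin 8 → ℕ) : cond4 p ↔ al (sg 2) p = 0 := by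
  simp only [cond4, al, Fin.sum_univ_eight, sg]
  norm_num
  constructor <;> intro h <;> linarith

lemma bb_norm (N : ℕ) : ∀ n ∈ Finset.Icc 1 N, ‖(bb n : ℂ)‖ ≤ dd n * (n:ℝ) ^ (-(3:ℝ) / 4) := fun n _ => by
  rw [Complex.norm_real, norm_of_nonneg (bb_nonneg n)]; exact le_rfl

lemma wgt {s : Fin 8 → ℤ} (hs : ∀ i, |s i| = 1) {ε : ℝ} (hε : 0 < ε) : ∃ C ≥ (1:ℝ), ∀ (Y : ℕ) (δ : ℝ), 1 ≤ Y → 0 < δ →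
    ∑ p ∈ bx Y with |al s p| ≤ δ, octTerm p ≤ C * (Y:ℝ) ^ ε * (1 + δ * Y ^ 2) := by
  obtain ⟨C, h1, H⟩ := mom10 ε hε
  refine ⟨256 * C, by linarith, fun Y δ hY hδ => ?_⟩
  set R := 1 / (16 * δ) with hR
  have Rp : 0 < R := by positivity
  have w := wt (bx Y) (b := octTerm) (α := al s) (fun p _ => oct_nonneg p) Rp
  rw [show 1 / (16 * R) = δ by rw [hR]; field_simp] at w
  refine w.trans ?_
  simp only [oct_bb, prodSS hs fun _ => bb, Finset.prod_const, Finset.card_univ, Fintype.card_fin]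
  have c := (SS_cont (fun n => (bb n : ℂ)) Y).norm
  have m := (H (fun n => (bb n : ℂ)) Y 0 R hY Rp.le (bb_norm Y)).1
  rw [zero_add] at m
  have I : ∫ u in 0..R, ‖SS (fun n => (bb n : ℂ)) Y u‖ ^ 8 ≤ ∫ u in 0..R, (1 + ‖SS (fun n => (bb n : ℂ)) Y u‖ ^ 10) :=
    intervalIntegral.integral_mono_on Rp.le ((c.pow 8).intervalIntegrable _ _) ((continuous_const.add (c.pow 10)).intervalIntegrable _ _) fun u _ => by
      set x := ‖SS (fun n => (bb n : ℂ)) Y u‖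
      rcases le_total x 1 with h | h
      · have := pow_le_one₀ (n := 8) (norm_nonneg _ : 0 ≤ x) h; have := pow_nonneg (norm_nonneg _ : 0 ≤ x) 10; linarith
      · have := pow_le_pow_right₀ h (show 8 ≤ 10 by norm_num); linarith
  rw [intervalIntegral.integral_add (by simp) (Continuous.intervalIntegrable (by fun_prop) _ _), intervalIntegral.integral_const, sub_zero, smul_eq_mul, mul_one] at I
  have Y1 : 1 ≤ (Y:ℝ) ^ ε := one_le_rpow (by exact_mod_cast hY) hε.le
  have CY : 1 ≤ C * (Y:ℝ) ^ ε := by nlinarith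
  calc _ ≤ 8 / R * (R + C * (Y:ℝ) ^ ε * (R + Y ^ 2)) := mul_le_mul_of_nonneg_left (I.trans (add_le_add_right m _)) (by positivity)
    _ = 8 + C * (Y:ℝ) ^ ε * (8 + 128 * (δ * Y ^ 2)) := by rw [hR]; field_simp; ring
    _ ≤ _ := by nlinarith [show 0 ≤ δ * (Y:ℝ) ^ 2 by positivity]

lemma prodC (s : Fin 8 → ℤ) (N : ℕ) (u : ℝ) : ∑ p ∈ bx N, (octTerm p : ℂ) * ee (2 * u * al s p) = ∏ i, ∑ n ∈ Finset.Icc 1 N, (bb n : ℂ) * ee (2 * u * (s i * sqrt n)) := by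
  rw [Finset.prod_univ_sum]
  refine Finset.sum_congr rfl fun p _ => ?_
  rw [Finset.prod_mul_distrib, oct_bb, Complex.ofReal_prod]
  congr 1
  simp only [ee, al, Finset.mul_sum, Complex.ofReal_sum, Finset.sum_mul, Complex.exp_sum]

lemma ee_pow (x : ℝ) (k : ℕ) : ee x ^ k = ee (k * x) := by
  simp only [ee, ← Complex.exp_nat_mul]; congr 1; push_cast; ring

/-- main trigonometric polynomial -/
noncomputable def AA (Y : ℕ) (t : ℝ) : ℝ := (ee (-(1 / 8)) * SS (fun n => (bb n : ℂ)) Y t).re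

lemma A8 (Y : ℕ) (t : ℝ) : (((2 * AA Y t) ^ 8 : ℝ) : ℂ) = ∑ j ∈ Finset.range 9, ((8:ℕ).choose j : ℂ) * (ee (-((8 - 2 * j) / 8)) * ∑ p ∈ bx Y, (octTerm p : ℂ) * ee (2 * t * al (sg j) p)) := by
  set S := SS (fun n => (bb n : ℂ)) Y t with hS
  have h : ((2 * AA Y t : ℝ) : ℂ) = starRingEnd ℂ (ee (-(1 / 8)) * S) + ee (-(1 / 8)) * S := by
    rw [AA, add_comm, Complex.add_conj]
  rw [Complex.ofReal_pow, h, add_pow]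
  refine Finset.sum_congr rfl fun j hj => ?_
  rw [mul_comm, prodC]
  congr 1
  have pl : ∑ n ∈ Finset.Icc 1 Y, (bb n : ℂ) * ee (2 * t * (((1:ℤ):ℝ) * sqrt n)) = S := by simp [hS, SS]
  have mi : ∑ n ∈ Finset.Icc 1 Y, (bb n : ℂ) * ee (2 * t * (((-1:ℤ):ℝ) * sqrt n)) = starRingEnd ℂ S := by
    rw [hS, SS, map_sum]
    refine Finset.sum_congr rfl fun n _ => ?_
    rw [map_mul, Complex.conj_ofReal, ← ee_neg]; congr 2; push_cast; ring
  have e : ∀ i, ∑ n ∈ Finset.Icc 1 Y, (bb n : ℂ) * ee (2 * t * ((sg j i : ℝ) * sqrt n)) = if i.val < 8 - j then S else starRingEnd ℂ S := fun i => by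
    simp only [sg]; split_ifs; exacts [pl, mi]
  have j8 : j ≤ 8 := Nat.lt_succ_iff.1 (Finset.mem_range.1 hj)
  have eev : ee (-((8 - 2 * (j:ℝ)) / 8)) = (starRingEnd ℂ (ee (-(1 / 8)))) ^ j * ee (-(1 / 8)) ^ (8 - j) := by
    rw [← ee_neg, ee_pow, ee_pow, ← ee_add, Nat.cast_sub j8]; congr 1; push_cast; ring
  simp only [e]
  rw [map_mul, mul_pow, mul_pow, mul_mul_mul_comm, eev]
  congr 1
  clear eev hj
  interval_cases j <;> simp [Fin.prod_univ_eight] <;> ring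

lemma EE6 (Y : ℕ) : EE (sg 6) Y = EE (sg 2) Y := by
  classical
  have h : ∀ p : Fin 8 → ℕ, al (sg 2) (p ∘ Fin.rev) = - al (sg 6) p := fun p => by
    have k : ∀ i : Fin 8, sg 2 i.rev = -sg 6 i := by decide
    rw [al, al, ← Finset.sum_neg_distrib, ← Equiv.sum_comp Fin.revPerm]
    exact Finset.sum_congr rfl fun i _ => by simp [k]
  refine Finset.sum_nbij' (fun p => p ∘ Fin.rev) (fun p => p ∘ Fin.rev) (fun p hp => ?_) (fun p hp => ?_) (fun p _ => ?_) (fun p _ => ?_) fun p _ => ?_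
  · simp only [Finset.mem_filter, mem_bx] at hp ⊢
    exact ⟨fun i => hp.1 _, by rw [h, hp.2, neg_zero]⟩
  · simp only [Finset.mem_filter, mem_bx] at hp ⊢
    refine ⟨fun i => hp.1 _, ?_⟩
    rw [← neg_eq_zero, ← h]
    convert hp.2
    ext i; simp
  · ext i; simp
  · ext i; simp
  · simp only [oct_bb, Function.comp]
    exact (Equiv.prod_comp Fin.revPerm fun i => bb (p i)).symm

lemma EE0 (Y : ℕ) : EE (sg 0) Y = 0 ∧ EE (sg 8) Y = 0 := by
  classical
  constructor <;>
  · refine Finset.sum_eq_zero fun p hp => absurd (Finset.mem_filter.1 hp).2 ?_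
    have : 0 < ∑ i, sqrt (p i) := Finset.sum_pos (fun i _ => sqrt_pos.2 (by exact_mod_cast (mem_bx.1 (Finset.mem_filter.1 hp).1 i).1)) ⟨0, Finset.mem_univ _⟩
    simp only [al, sg]
    simp [this.ne']

lemma diag (Y : ℕ) : ∑ j ∈ Finset.range 9, ((8:ℕ).choose j : ℝ) * ((ee (-((8 - 2 * j) / 8))).re * EE (sg j) Y) = 70 * EE (sg 4) Y - 56 * EE (sg 2) Y := by
  have c0 : ∀ n : ℤ, (ee ((2 * n + 1) / 4)).re = 0 := fun n => by
    rw [ee_re, cos_eq_zero_iff]; exact ⟨n, by ring⟩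
  have c1 := c0 (-2); have c3 := c0 (-1); have c5 := c0 0; have c7 := c0 1
  have c2 : (ee (-(1 / 2))).re = -1 := by rw [ee_re, show 2 * π * -(1 / 2) = -π by ring, cos_neg, cos_pi]
  have c6 : (ee (1 / 2)).re = -1 := by rw [ee_re, show 2 * π * (1 / 2) = π by ring, cos_pi]
  have c4 : (ee 0).re = 1 := by simp [ee_re]
  have := EE0 Y
  norm_num at c1 c3 c5 c7 c2
  simp only [Finset.sum_range_succ, Finset.range_zero, Finset.sum_empty, this.1, this.2, EE6]
  norm_num [Nat.choose, c1, c3, c5, c7, c2, c4, c6]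
  ring

lemma dya {x δ : ℝ} {K : ℕ} (hδ : 0 < δ) (hx : δ < x) (hK : x ≤ 2 ^ K * δ) : 1 / x ≤ ∑ k ∈ Finset.range (K + 1), if x ≤ 2 ^ k * δ then 2 / (2 ^ k * δ) else 0 := by
  have ex : ∃ k : ℕ, x ≤ 2 ^ k * δ := ⟨K, hK⟩
  classical
  obtain ⟨m, hm⟩ : ∃ m, Nat.find ex = m + 1 := Nat.exists_eq_succ_of_ne_zero fun h => by
    have := Nat.find_spec ex; rw [h] at this; linarith
  have h1 := Nat.find_spec ex
  have h2 := Nat.find_min ex (show m < Nat.find ex by omega)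
  have h3 := Nat.find_min' ex hK
  rw [hm] at h1 h3
  push Not at h2
  refine le_trans ?_ (Finset.single_le_sum (fun k _ => by split_ifs <;> positivity) (Finset.mem_range.2 (show m + 1 < K + 1 by omega)))
  rw [if_pos h1, div_le_div_iff₀ (by linarith) (by positivity), pow_succ]
  linarith

lemma kk {ε : ℝ} (hε : 0 < ε) : ∃ C ≥ (1:ℝ), ∀ v : ℝ, 1 ≤ v → ∃ K : ℕ, 8 * v ^ 2 ≤ 2 ^ K ∧ (K + 1 : ℝ) ≤ C * v ^ ε := by
  obtain ⟨C, h, H⟩ := one_add_log_le ε hε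
  refine ⟨8 * C, by linarith, fun v hv => ?_⟩
  have hl := log_nonneg hv
  refine ⟨⌈3 + 4 * log v⌉₊, ?_, ?_⟩
  · rw [← rpow_natCast (2:ℝ) (Nat.ceil _)]
    refine le_trans ?_ (rpow_le_rpow_of_exponent_le one_le_two (Nat.le_ceil _))
    rw [rpow_add two_pos, show (2:ℝ) ^ (3:ℝ) = 8 by norm_num]
    refine mul_le_mul_of_nonneg_left ?_ (by norm_num)
    rw [rpow_def_of_pos two_pos, ← exp_log (show 0 < v by linarith), ← exp_nat_mul, exp_le_exp, log_exp]
    have := log_two_gt_d9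
    push_cast
    nlinarith
  · have := Nat.ceil_lt_add_one (show 0 ≤ 3 + 4 * log v by linarith)
    have := H v hv
    linarith

open Classical in
lemma offd {s : Fin 8 → ℤ} (hs : ∀ i, |s i| = 1) {ε : ℝ} (hε : 0 < ε) : ∃ C ≥ (1:ℝ), ∀ᶠ v : ℝ in Filter.atTop,
    ∑ p ∈ bx ⌊v ^ ((8:ℝ) / 127)⌋₊ with al s p ≠ 0, octTerm p * ‖∫ t in v / 2..v, ((t ^ 5 : ℝ) : ℂ) * ee (2 * al s p * t)‖ ≤ C * v ^ (6 - 1 / 127 + ε) := by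
  obtain ⟨C1, h1, H1⟩ := eps_pack (ε / 2) (by positivity)
  obtain ⟨C2, h2, H2⟩ := wgt hs (show 0 < ε / 2 by positivity)
  obtain ⟨C3, h3, H3⟩ := kk (show 0 < ε / 2 by positivity)
  refine ⟨40320 * 300 * C1 + 4 * C2 * C3, by nlinarith, ?_⟩
  filter_upwards [Filter.eventually_ge_atTop 1, (tendsto_rpow_atTop (show (0:ℝ) < 4 / 127 by norm_num)).eventually_gt_atTop (8 ^ 63), (tendsto_rpow_atTop (show (0:ℝ) < 252 / 16129 by norm_num)).eventually_ge_atTop 300] with v v1 hw hz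
  have v0 : 0 < v := by linarith
  set y := v ^ ((8:ℝ) / 127) with hy
  set Y := ⌊y⌋₊ with hY
  have y1 : 1 ≤ y := one_le_rpow v1 (by norm_num)
  have Yy : (Y:ℝ) ≤ y := Nat.floor_le (by linarith)
  have yv : y ≤ v := by simpa using rpow_le_rpow_of_exponent_le v1 (show (8:ℝ) / 127 ≤ 1 by norm_num)
  have Y1 : 1 ≤ Y := Nat.one_le_floor_iff _ |>.2 y1
  have Yε : (Y:ℝ) ^ (ε / 2) ≤ v ^ (ε / 2) := rpow_le_rpow (by positivity) (Yy.trans yv) (by positivity)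
  set δ := v ^ (-(126:ℝ) / 127) with hδ
  have δ0 : 0 < δ := by positivity
  have δ1 : δ ≤ 1 := rpow_le_one_of_one_le_of_nonpos v1 (by norm_num)
  have J1 : ∀ a : ℝ, a ≠ 0 → ‖∫ t in v / 2..v, ((t ^ 5 : ℝ) : ℂ) * ee (2 * a * t)‖ ≤ v ^ 5 * (1 / |a|) := fun a ha => by
    refine (osc 5 (by linarith) (by linarith) (mul_ne_zero two_ne_zero ha)).trans ?_
    rw [abs_mul, abs_two, mul_one_div]
    exact div_le_div_of_nonneg_left (by positivity) (abs_pos.2 ha) (by linarith [abs_nonneg a])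
  have J2 : ∀ a : ℝ, ‖∫ t in v / 2..v, ((t ^ 5 : ℝ) : ℂ) * ee (2 * a * t)‖ ≤ v ^ 6 := fun a => by
    refine (intervalIntegral.norm_integral_le_of_norm_le_const (C := v ^ 5) fun t ht => ?_).trans ?_
    · rw [Set.uIoc_of_le (by linarith)] at ht
      rw [norm_mul, ee_norm, mul_one, Complex.norm_real, norm_of_nonneg (pow_nonneg (by linarith [ht.1]) 5)]
      exact pow_le_pow_left₀ (by linarith [ht.1]) ht.2 5
    · rw [abs_of_nonneg (by linarith), pow_succ v 5]
      exact mul_le_mul_of_nonneg_left (by linarith) (by positivity)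
  have P1 : ∑ p ∈ bx Y with al s p ≠ 0 ∧ |al s p| ≤ δ, octTerm p ≤ 40320 * 300 * C1 * (v ^ (-(1:ℝ) / 127) * v ^ ε) := by
    obtain ⟨D, D1, hD, hC⟩ := H1 Y Y1
    set z := v ^ ((252:ℝ) / 16129) / 300 with hzd
    have l1 : 1 ≤ 1 + log Y := by have := log_nonneg (show (1:ℝ) ≤ Y by exact_mod_cast Y1); linarith
    have z1 : 1 ≤ z := by rw [hzd, le_div_iff₀ (by norm_num)]; linarith
    have h6 : (2 * δ) ^ 2 * (8 * sqrt Y) ^ 62 < 1 := by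
      have e : δ ^ 2 * y ^ 31 = (v ^ ((4:ℝ) / 127))⁻¹ := by
        rw [hδ, hy, ← rpow_natCast, ← rpow_natCast, ← rpow_mul v0.le, ← rpow_mul v0.le, ← rpow_add v0, ← rpow_neg v0.le]; norm_num
      have k : δ ^ 2 * (Y:ℝ) ^ 31 ≤ (v ^ ((4:ℝ) / 127))⁻¹ := e ▸ mul_le_mul_of_nonneg_left (pow_le_pow_left₀ (by positivity) Yy 31) (by positivity)
      have k2 : (v ^ ((4:ℝ) / 127))⁻¹ < (8 ^ 63)⁻¹ := inv_strictAnti₀ (by norm_num) hw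
      calc (2 * δ) ^ 2 * (8 * sqrt Y) ^ 62 = 4 * 8 ^ 62 * (δ ^ 2 * (sqrt Y ^ 2) ^ 31) := by ring
        _ = 4 * 8 ^ 62 * (δ ^ 2 * (Y:ℝ) ^ 31) := by rw [sq_sqrt (Nat.cast_nonneg _)]
        _ ≤ 4 * 8 ^ 62 * (8 ^ 63)⁻¹ := mul_le_mul_of_nonneg_left (k.trans k2.le) (by norm_num)
        _ < 1 := by norm_num
    have h8 : δ ^ 2 * (16 * sqrt z) ^ 254 < 1 := by
      have e : δ ^ 2 * (v ^ ((252:ℝ) / 16129)) ^ 127 = 1 := by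
        rw [hδ, ← rpow_natCast, ← rpow_natCast, ← rpow_mul v0.le, ← rpow_mul v0.le, ← rpow_add v0]; norm_num
      calc δ ^ 2 * (16 * sqrt z) ^ 254 = δ ^ 2 * (256 * sqrt z ^ 2) ^ 127 := by rw [show (256:ℝ) = 16 ^ 2 by norm_num, ← mul_pow, ← pow_mul]
        _ = δ ^ 2 * (256 / 300 * v ^ ((252:ℝ) / 16129)) ^ 127 := by rw [sq_sqrt (by linarith), hzd]; congr 2; ring
        _ = (256 / 300) ^ 127 * (δ ^ 2 * (v ^ ((252:ℝ) / 16129)) ^ 127) := by rw [mul_pow, mul_left_comm]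
        _ < 1 := by rw [e, mul_one]; exact pow_lt_one₀ (by norm_num) (by norm_num) (by norm_num)
    have ns := near_sol hs δ1 z1 h6 h8
    have zb : z ^ (-(3:ℝ) / 4) ≤ 300 * v ^ (-(1:ℝ) / 127) := by
      rw [hzd, div_rpow (by positivity) (by norm_num), ← rpow_mul v0.le, div_eq_mul_inv, mul_comm, ← rpow_neg (by norm_num)]
      refine mul_le_mul ?_ (rpow_le_rpow_of_exponent_le v1 (by norm_num)) (by positivity) (by norm_num)
      simpa using rpow_le_rpow_of_exponent_le (show (1:ℝ) ≤ 300 by norm_num) (show -(-(3:ℝ) / 4) ≤ 1 by norm_num)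
    calc ∑ p ∈ bx Y with al s p ≠ 0 ∧ |al s p| ≤ δ, octTerm p ≤ ∑ p ∈ bx Y with al s p ≠ 0 ∧ |al s p| ≤ δ, D ^ 8 * ∏ i, (p i : ℝ) ^ (-(3:ℝ) / 4) := by
          refine Finset.sum_le_sum fun p hp => ?_
          have hb := mem_bx.1 (Finset.mem_filter.1 hp).1
          rw [oct_bb, show D ^ 8 = ∏ _i : Fin 8, D by simp, ← Finset.prod_mul_distrib]
          exact Finset.prod_le_prod (fun i _ => bb_nonneg _) fun i _ => mul_le_mul_of_nonneg_right (hD _ (Finset.mem_Icc.2 (hb i))) (by positivity)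
      _ ≤ D ^ 8 * (40320 * (z ^ (-(3:ℝ) / 4) * (1 + log Y) ^ 5)) := by rw [← Finset.mul_sum]; exact mul_le_mul_of_nonneg_left ns (by positivity)
      _ = 40320 * z ^ (-(3:ℝ) / 4) * (D ^ 8 * (1 + log Y) ^ 5) := by ring
      _ ≤ 40320 * z ^ (-(3:ℝ) / 4) * (D ^ 10 * (1 + log Y) ^ 17) := by
          refine mul_le_mul_of_nonneg_left (mul_le_mul (pow_le_pow_right₀ D1 (by norm_num)) (pow_le_pow_right₀ l1 (by norm_num)) (by positivity) (by positivity)) (by positivity)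
      _ ≤ 40320 * (300 * v ^ (-(1:ℝ) / 127)) * (C1 * v ^ ε) := by
          refine mul_le_mul (mul_le_mul_of_nonneg_left zb (by norm_num)) (hC.trans (mul_le_mul_of_nonneg_left (Yε.trans (rpow_le_rpow_of_exponent_le v1 (by linarith))) (by linarith))) (by positivity) (by positivity)
      _ = _ := by ring
  have P2 : ∑ p ∈ bx Y with ¬ |al s p| ≤ δ, octTerm p * (1 / |al s p|) ≤ 4 * C2 * C3 * (v ^ ((126:ℝ) / 127) * v ^ ε) := by
    clear hw hz P1
    obtain ⟨K, K1, K2⟩ := H3 v v1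
    have δi : δ * v ^ ((126:ℝ) / 127) = 1 := by rw [hδ, ← rpow_add v0]; norm_num
    have δv : 1 ≤ δ * v := by
      rw [← δi]; exact mul_le_mul_of_nonneg_left (by simpa using rpow_le_rpow_of_exponent_le v1 (show (126:ℝ) / 127 ≤ 1 by norm_num)) δ0.le
    have Y2 : (Y:ℝ) ^ 2 ≤ v ^ ((126:ℝ) / 127) := by
      refine (pow_le_pow_left₀ (by positivity) Yy 2).trans ?_
      rw [hy, ← rpow_natCast, ← rpow_mul v0.le]
      exact rpow_le_rpow_of_exponent_le v1 (by norm_num)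
    calc ∑ p ∈ bx Y with ¬ |al s p| ≤ δ, octTerm p * (1 / |al s p|)
        ≤ ∑ p ∈ bx Y with ¬ |al s p| ≤ δ, octTerm p * ∑ k ∈ Finset.range (K + 1), (if |al s p| ≤ 2 ^ k * δ then 2 / (2 ^ k * δ) else 0) := by
          refine Finset.sum_le_sum fun p hp => mul_le_mul_of_nonneg_left ?_ (oct_nonneg p)
          rw [Finset.mem_filter, mem_bx, not_le] at hp
          refine dya δ0 hp.2 ?_
          have : |al s p| ≤ 8 * v := by
            refine (Finset.abs_sum_le_sum_abs _ _).trans ((Finset.sum_le_card_nsmul _ _ v fun i _ => ?_).trans (by simp))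
            have hh : |(s i : ℝ)| = 1 := by exact_mod_cast congrArg (Int.cast (R := ℝ)) (hs i)
            rw [abs_mul, hh, one_mul, abs_of_nonneg (sqrt_nonneg _)]
            have : (p i : ℝ) ≤ v := (Nat.cast_le.2 (hp.1 i).2).trans (Yy.trans yv)
            exact sqrt_le_iff.2 ⟨v0.le, this.trans (le_self_pow₀ v1 two_ne_zero)⟩
          calc _ ≤ 8 * v * 1 := by linarith
            _ ≤ 8 * v * (δ * v) := mul_le_mul_of_nonneg_left δv (by positivity)
            _ = 8 * v ^ 2 * δ := by ring
            _ ≤ _ := mul_le_mul_of_nonneg_right K1 δ0.le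
      _ ≤ ∑ p ∈ bx Y, octTerm p * ∑ k ∈ Finset.range (K + 1), (if |al s p| ≤ 2 ^ k * δ then 2 / (2 ^ k * δ) else 0) :=
          Finset.sum_le_sum_of_subset_of_nonneg (Finset.filter_subset _ _) fun p _ _ => mul_nonneg (oct_nonneg p) (Finset.sum_nonneg fun k _ => by split_ifs <;> positivity)
      _ = ∑ k ∈ Finset.range (K + 1), (∑ p ∈ bx Y with |al s p| ≤ 2 ^ k * δ, octTerm p) * (2 / (2 ^ k * δ)) := by
          simp only [Finset.mul_sum]
          rw [Finset.sum_comm]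
          refine Finset.sum_congr rfl fun k _ => ?_
          rw [Finset.sum_filter, Finset.sum_mul]
          exact Finset.sum_congr rfl fun p _ => by split_ifs <;> simp
      _ ≤ ∑ k ∈ Finset.range (K + 1), 4 * C2 * v ^ (ε / 2) * v ^ ((126:ℝ) / 127) := by
          refine Finset.sum_le_sum fun k _ => ?_
          have X0 : 0 < 2 ^ k * δ := by positivity
          refine (mul_le_mul_of_nonneg_right (H2 Y _ Y1 X0) (by positivity)).trans ?_
          have : 1 / (2 ^ k * δ) ≤ v ^ ((126:ℝ) / 127) := by
            rw [div_le_iff₀ X0, ← δi, mul_comm]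
            exact mul_le_mul_of_nonneg_left (le_mul_of_one_le_left δ0.le (one_le_pow₀ one_le_two)) (by positivity)
          calc C2 * (Y:ℝ) ^ (ε / 2) * (1 + 2 ^ k * δ * Y ^ 2) * (2 / (2 ^ k * δ)) = C2 * (Y:ℝ) ^ (ε / 2) * (2 * (1 / (2 ^ k * δ) + Y ^ 2)) := by field_simp
            _ ≤ C2 * v ^ (ε / 2) * (2 * (v ^ ((126:ℝ) / 127) + v ^ ((126:ℝ) / 127))) := by gcongr
            _ = _ := by ring
      _ = (K + 1) * (4 * C2 * v ^ (ε / 2) * v ^ ((126:ℝ) / 127)) := by simp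
      _ ≤ C3 * v ^ (ε / 2) * (4 * C2 * v ^ (ε / 2) * v ^ ((126:ℝ) / 127)) := mul_le_mul_of_nonneg_right K2 (by positivity)
      _ = _ := by rw [show v ^ ε = v ^ (ε / 2) * v ^ (ε / 2) by rw [← rpow_add v0]; ring_nf]; ring
  have E1 : v ^ (6 - 1 / 127 + ε) = v ^ 6 * (v ^ (-(1:ℝ) / 127) * v ^ ε) := by
    rw [← rpow_natCast, ← rpow_add v0, ← rpow_add v0]; congr 1; push_cast; ring
  have E2 : v ^ (6 - 1 / 127 + ε) = v ^ 5 * (v ^ ((126:ℝ) / 127) * v ^ ε) := by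
    rw [← rpow_natCast, ← rpow_add v0, ← rpow_add v0]; congr 1; push_cast; ring
  rw [← Finset.sum_filter_add_sum_filter_not _ (fun p => |al s p| ≤ δ), Finset.filter_filter, Finset.filter_filter, add_mul]
  refine add_le_add ?_ ?_
  · refine (Finset.sum_le_sum fun p _ => mul_le_mul_of_nonneg_left (J2 (al s p)) (oct_nonneg p)).trans ?_
    rw [← Finset.sum_mul, E1]
    refine (mul_le_mul_of_nonneg_right P1 (by positivity)).trans (le_of_eq (by ring))
  · refine (Finset.sum_le_sum fun p hp => mul_le_mul_of_nonneg_left (J1 (al s p) (Finset.mem_filter.1 hp).2.1) (oct_nonneg p)).trans ?_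
    simp only [mul_left_comm (octTerm _)]
    rw [← Finset.mul_sum, E2]
    refine (mul_le_mul_of_nonneg_left ((Finset.sum_le_sum_of_subset_of_nonneg (fun p hp => ?_) fun p _ _ => mul_nonneg (oct_nonneg p) (by positivity)).trans P2) (by positivity)).trans (le_of_eq (by ring))
    simp only [Finset.mem_filter] at hp ⊢
    exact ⟨hp.1, hp.2.2⟩

lemma AA_cont (Y : ℕ) : Continuous (AA Y) := Complex.continuous_re.comp (continuous_const.mul (SS_cont _ Y))

lemma int5 {v : ℝ} (hv : 0 ≤ v) : |∫ t in v / 2..v, t ^ 5| ≤ v ^ 6 := by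
  rw [integral_pow, abs_le]
  have : (v / 2) ^ 6 ≤ v ^ 6 := pow_le_pow_left₀ (by linarith) (by linarith) 6
  have := pow_nonneg hv 6
  have := pow_nonneg (half_pos (show 0 < v + 1 by linarith)).le 6
  have := pow_nonneg (show 0 ≤ v / 2 by linarith) 6
  norm_num
  constructor <;> linarith

open Classical in
lemma split8 {v B : ℝ} (Y : ℕ) (hB : ∀ j ∈ Finset.range 9, ∑ p ∈ bx Y with al (sg j) p ≠ 0, octTerm p * ‖∫ t in v / 2..v, ((t ^ 5 : ℝ) : ℂ) * ee (2 * al (sg j) p * t)‖ ≤ B) :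
    |(∫ t in v / 2..v, t ^ 5 * (2 * AA Y t) ^ 8) - (70 * EE (sg 4) Y - 56 * EE (sg 2) Y) * ∫ t in v / 2..v, t ^ 5| ≤ 256 * B := by
  set T := ∫ t in v / 2..v, t ^ 5 with hT
  set J : ℝ → ℂ := fun a => ∫ t in v / 2..v, ((t ^ 5 : ℝ) : ℂ) * ee (2 * a * t) with hJ
  have J0 : J 0 = T := by
    rw [hT, ← intervalIntegral.integral_ofReal]; simp only [hJ, mul_zero, zero_mul, ee_zero, mul_one]
  set O : ℕ → ℂ := fun j => ∑ p ∈ bx Y with al (sg j) p ≠ 0, (octTerm p : ℂ) * J (al (sg j) p) with hO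
  have cc : ∀ a : ℝ, Continuous fun t : ℝ => ((t ^ 5 : ℝ) : ℂ) * ee (2 * a * t) := fun a => (Complex.continuous_ofReal.comp (continuous_pow 5)).mul (ee_cont.comp (by fun_prop))
  have e : ((∫ t in v / 2..v, t ^ 5 * (2 * AA Y t) ^ 8 : ℝ) : ℂ) = ∑ j ∈ Finset.range 9, ((8:ℕ).choose j : ℂ) * (ee (-((8 - 2 * j) / 8)) * (EE (sg j) Y * T + O j)) := by
    rw [← intervalIntegral.integral_ofReal]
    have e1 : ∀ t : ℝ, ((t ^ 5 * (2 * AA Y t) ^ 8 : ℝ) : ℂ) = ∑ j ∈ Finset.range 9, ((8:ℕ).choose j : ℂ) * (ee (-((8 - 2 * j) / 8)) * ∑ p ∈ bx Y, (octTerm p : ℂ) * (((t ^ 5 : ℝ) : ℂ) * ee (2 * al (sg j) p * t))) := fun t => by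
      rw [Complex.ofReal_mul, A8, Finset.mul_sum]
      refine Finset.sum_congr rfl fun j _ => ?_
      rw [Finset.mul_sum, Finset.mul_sum, Finset.mul_sum, Finset.mul_sum, Finset.mul_sum]
      refine Finset.sum_congr rfl fun p _ => ?_
      rw [show 2 * t * al (sg j) p = 2 * al (sg j) p * t by ring]; ring
    simp only [e1]
    have c2 : ∀ j : ℕ, Continuous fun t : ℝ => ∑ p ∈ bx Y, (octTerm p : ℂ) * (((t ^ 5 : ℝ) : ℂ) * ee (2 * al (sg j) p * t)) := fun j => continuous_finsetSum _ fun p _ => continuous_const.mul (cc _)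
    have c3 : ∀ j : ℕ, Continuous fun t : ℝ => ((8:ℕ).choose j : ℂ) * (ee (-((8 - 2 * j) / 8)) * ∑ p ∈ bx Y, (octTerm p : ℂ) * (((t ^ 5 : ℝ) : ℂ) * ee (2 * al (sg j) p * t))) := fun j => continuous_const.mul (continuous_const.mul (c2 j))
    rw [intervalIntegral.integral_finsetSum fun j _ => (c3 j).intervalIntegrable _ _]
    refine Finset.sum_congr rfl fun j _ => ?_
    rw [intervalIntegral.integral_const_mul, intervalIntegral.integral_const_mul]
    congr 2
    have c4 : ∀ p, Continuous fun t : ℝ => (octTerm p : ℂ) * (((t ^ 5 : ℝ) : ℂ) * ee (2 * al (sg j) p * t)) := fun p => continuous_const.mul (cc _)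
    rw [intervalIntegral.integral_finsetSum fun p _ => (c4 p).intervalIntegrable _ _]
    simp only [intervalIntegral.integral_const_mul]
    rw [← Finset.sum_filter_add_sum_filter_not _ (fun p => al (sg j) p = 0), EE, Complex.ofReal_sum, Finset.sum_mul]
    refine congrArg₂ _ (Finset.sum_congr rfl fun p hp => ?_) rfl
    rw [← J0, (Finset.mem_filter.1 hp).2]
  have r : (((∫ t in v / 2..v, t ^ 5 * (2 * AA Y t) ^ 8) - (70 * EE (sg 4) Y - 56 * EE (sg 2) Y) * T : ℝ)) = (∑ j ∈ Finset.range 9, ((8:ℕ).choose j : ℂ) * (ee (-((8 - 2 * j) / 8)) * O j)).re := by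
    have := congrArg Complex.re e
    rw [Complex.ofReal_re] at this
    rw [this, ← diag, Finset.sum_mul, Complex.re_sum, Complex.re_sum, ← Finset.sum_sub_distrib]
    refine Finset.sum_congr rfl fun j _ => ?_
    rw [mul_add, mul_add, Complex.add_re, ← Complex.ofReal_natCast, Complex.re_ofReal_mul, ← Complex.ofReal_mul, Complex.re_mul_ofReal]
    ring
  rw [r]
  refine (Complex.abs_re_le_norm _).trans ((norm_sum_le _ _).trans ?_)
  calc _ ≤ ∑ j ∈ Finset.range 9, ((8:ℕ).choose j : ℝ) * B := by
        refine Finset.sum_le_sum fun j hj => ?_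
        rw [norm_mul, norm_mul, ee_norm, one_mul, Complex.norm_natCast]
        refine mul_le_mul_of_nonneg_left (((norm_sum_le _ _).trans (Finset.sum_le_sum fun p _ => ?_)).trans (hB j hj)) (by positivity)
        rw [norm_mul, Complex.norm_real, norm_of_nonneg (oct_nonneg p)]
    _ = _ := by
        rw [← Finset.sum_mul]; norm_num [Finset.sum_range_succ, Nat.choose]

lemma main8 {ε : ℝ} (hε : 0 < ε) : ∃ C ≥ (1:ℝ), ∀ᶠ v : ℝ in Filter.atTop,
    |(∫ t in v / 2..v, t ^ 5 * (2 * AA ⌊v ^ ((8:ℝ) / 127)⌋₊ t) ^ 8) - (70 * C7 - 56 * C4) * ∫ t in v / 2..v, t ^ 5| ≤ C * v ^ (6 - 1 / 127 + ε) := by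
  choose C h H using fun j => offd (sg_abs j) hε
  set κ := 1 / 8 - min ε (1 / 16) with hκ
  have m1 := min_le_left ε (1 / 16)
  have m2 := min_le_right ε (1 / 16)
  have m3 : 0 < min ε (1 / 16) := lt_min hε (by norm_num)
  obtain ⟨D7, d7, T7⟩ := tails (sg_abs 4) (κ := κ) (by linarith) (by linarith) cond7 c7_iff
  obtain ⟨D4, d4, T4⟩ := tails (sg_abs 2) (κ := κ) (by linarith) (by linarith) cond4 c4_iff
  set B := ∑ j ∈ Finset.range 9, C j with hB
  have B9 : 1 ≤ B := (h 0).trans (Finset.single_le_sum (fun j _ => by linarith [h j]) (Finset.mem_range.2 (by norm_num)))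
  refine ⟨256 * B + 2 * (70 * D7 + 56 * D4), by linarith, ?_⟩
  filter_upwards [Filter.eventually_ge_atTop 1, (Finset.range 9).eventually_all.2 fun j _ => H j] with v v1 hj
  have v0 : 0 < v := by linarith
  set y := v ^ ((8:ℝ) / 127) with hy
  have y1 : 1 ≤ y := one_le_rpow v1 (by norm_num)
  set Y := ⌊y⌋₊ with hY
  have Y1 : 1 ≤ Y := Nat.one_le_floor_iff _ |>.2 y1
  have Y1' : (1:ℝ) ≤ Y := by exact_mod_cast Y1
  have yY : y / 2 ≤ Y := by have := Nat.lt_floor_add_one y; linarith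
  have s8 := split8 Y (B := B * v ^ (6 - 1 / 127 + ε)) fun j hjr => (hj j hjr).trans
    (mul_le_mul_of_nonneg_right (Finset.single_le_sum (fun j _ => by linarith [h j]) hjr) (by positivity))
  have t7 := T7 Y Y1
  have t4 := T4 Y Y1
  rw [← C7] at t7
  rw [← C4] at t4
  have Yk : (Y:ℝ) ^ (-κ) ≤ 2 * v ^ (-(1:ℝ) / 127 + ε) := by
    calc (Y:ℝ) ^ (-κ) ≤ (y / 2) ^ (-κ) := rpow_le_rpow_of_nonpos (by linarith) yY (by linarith)
      _ = 2 ^ κ * v ^ ((8:ℝ) / 127 * -κ) := by rw [div_rpow (by linarith) (by norm_num), hy, ← rpow_mul v0.le, div_eq_mul_inv, ← rpow_neg (by norm_num), neg_neg, mul_comm]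
      _ ≤ 2 * v ^ (-(1:ℝ) / 127 + ε) := by
        refine mul_le_mul ?_ (rpow_le_rpow_of_exponent_le v1 (by linarith)) (by positivity) (by norm_num)
        simpa using rpow_le_rpow_of_exponent_le (one_le_two (α := ℝ)) (show κ ≤ 1 by linarith)
  set T := ∫ t in v / 2..v, t ^ 5
  have hT : |T| ≤ v ^ 6 := int5 v0.le
  have E1 : v ^ (6 - 1 / 127 + ε) = v ^ (-(1:ℝ) / 127 + ε) * v ^ 6 := by
    rw [← rpow_natCast, ← rpow_add v0]; congr 1; push_cast; ring
  set W := v ^ (-(1:ℝ) / 127 + ε)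
  have k : |(70 * EE (sg 4) Y - 56 * EE (sg 2) Y) * T - (70 * C7 - 56 * C4) * T| ≤ 2 * (70 * D7 + 56 * D4) * (W * v ^ 6) := by
    rw [← sub_mul, abs_mul]
    refine (mul_le_mul (b := 2 * (70 * D7 + 56 * D4) * W) ?_ hT (abs_nonneg _) (by positivity)).trans (le_of_eq (by ring))
    have := abs_le.1 (t7.trans (mul_le_mul_of_nonneg_left Yk (by linarith)))
    have := abs_le.1 (t4.trans (mul_le_mul_of_nonneg_left Yk (by linarith)))
    rw [abs_le]
    constructor <;> linarith
  refine (abs_sub_le _ _ _).trans ((add_le_add s8 k).trans (le_of_eq ?_))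
  rw [E1]; ring

noncomputable def GG (t : ℝ) : ℝ := Δ (t ^ 2) * (π * sqrt 2 / sqrt t)

lemma Δ_meas : Measurable Δ :=
  (((measurable_from_nat (f := fun N => ∑ n ∈ Finset.Icc 1 N, dd n)).comp Nat.measurable_floor).sub (measurable_id.mul measurable_log)).sub (measurable_const.mul measurable_id)

lemma GG_meas : Measurable GG := (Δ_meas.comp (measurable_id.pow_const 2)).mul (measurable_const.div continuous_sqrt.measurable)

lemma ps_le : π * sqrt 2 ≤ 5 := by
  have h : sqrt 2 ≤ 3 / 2 := sqrt_le_iff.2 (by norm_num)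
  have := pi_lt_d2
  nlinarith [pi_pos, sqrt_nonneg 2]

lemma GG_le {t x d : ℝ} (ht : 1 ≤ t) (h : |Δ (t ^ 2) - sqrt t / (π * sqrt 2) * x| ≤ d) : |GG t - x| ≤ 5 * d * t ^ (-(1:ℝ) / 2) := by
  have s : 0 < sqrt t := sqrt_pos.2 (by linarith)
  have p : 0 < π * sqrt 2 := by positivity
  have d0 := (abs_nonneg _).trans h
  rw [GG, show Δ (t ^ 2) * (π * sqrt 2 / sqrt t) - x = (Δ (t ^ 2) - sqrt t / (π * sqrt 2) * x) * (π * sqrt 2 / sqrt t) by field_simp, abs_mul, abs_of_pos (div_pos p s), neg_div, rpow_neg (by linarith), ← sqrt_eq_rpow, div_eq_mul_inv (π * _), ← mul_assoc]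
  refine mul_le_mul_of_nonneg_right ?_ (by positivity)
  rw [mul_comm 5]
  exact mul_le_mul h ps_le p.le d0

lemma GG_pt : ∃ C : ℝ, 1 ≤ C ∧ ∀ t, 1 ≤ t → |GG t| ≤ C * t ^ ((81:ℝ) / 500) := by
  obtain ⟨C, h, H⟩ := pointwise
  refine ⟨5 * C, by linarith, fun t ht => ?_⟩
  have := GG_le (x := 0) ht (by simpa using H t ht)
  rw [sub_zero] at this
  refine this.trans (le_of_eq ?_)
  rw [← mul_assoc, mul_assoc, ← rpow_add (by linarith)]; norm_num

lemma apx {ε : ℝ} (hε : 0 < ε) : ∃ C : ℝ, 1 ≤ C ∧ ∀ (t v η : ℝ) (N : ℕ), 1 ≤ t → t ≤ v → 1 ≤ η * t → 1 ≤ η ^ 2 * N →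
    |GG t - (ee (-(1 / 8)) * SS (fun n => (bw η n : ℂ)) N t).re| ≤ C * (η * v ^ (1 / 2 + ε)) := by
  obtain ⟨C, h, H⟩ := vor ε hε
  refine ⟨5 * C, by linarith, fun t v η N ht tv h1 h2 => ?_⟩
  have t0 : 0 < t := by linarith
  have η0 : 0 < η := pos_of_mul_pos_left (by linarith) t0.le
  refine (GG_le ht (H t η N ht h1 h2)).trans ?_
  calc _ = 5 * C * (η * (t ^ (1:ℝ) * t ^ ε * t ^ (-(1:ℝ) / 2))) := by rw [rpow_one]; ring
    _ = 5 * C * (η * t ^ (1 / 2 + ε)) := by rw [← rpow_add t0, ← rpow_add t0]; ring_nf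
    _ ≤ _ := mul_le_mul_of_nonneg_left (mul_le_mul_of_nonneg_left (rpow_le_rpow t0.le tv (by positivity)) η0.le) (by linarith)

lemma ev_rp {a : ℝ} (ha : 0 < a) (K : ℝ) : ∀ᶠ v : ℝ in Filter.atTop, K ≤ v ^ a := (tendsto_rpow_atTop ha).eventually_ge_atTop K

lemma lvl {ε : ℝ} (hε : 0 < ε) (h4 : ε < 1 / 4) : ∃ C : ℝ, 1 ≤ C ∧ ∀ᶠ v : ℝ in Filter.atTop, ∀ V, 1 ≤ V →
    volume.real {t | t ∈ Set.Ioc (v / 2) v ∧ V ≤ |GG t|} ≤ C * v ^ (2 * ε) * ((V ^ 2)⁻¹ + v * (V ^ 10)⁻¹) := by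
  obtain ⟨C₁, c1, H1⟩ := apx hε
  obtain ⟨C₂, c2, H2⟩ := mom10 ε hε
  refine ⟨C₂ * (8 * C₁ ^ 2) * 1024, by nlinarith, ?_⟩
  filter_upwards [Filter.eventually_ge_atTop 2, ev_rp (show (0:ℝ) < 1 / 2 - ε by linarith) (4 * C₁)] with v v2 hv V V1
  have v0 : 0 < v := by linarith
  set s := v ^ (1 / 2 + ε) with hs
  have s0 : 0 < s := by positivity
  have vs : v = v ^ (1 / 2 - ε) * s := by rw [hs, ← rpow_add v0]; ring_nf; rw [rpow_one]
  set η := V / (2 * C₁ * s) with hη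
  have η0 : 0 < η := by positivity
  have ηv : 2 ≤ η * v := by
    rw [hη, div_mul_eq_mul_div, le_div_iff₀ (by positivity)]
    calc 2 * (2 * C₁ * s) = 4 * C₁ * s := by ring
      _ ≤ v := by rw [vs]; exact mul_le_mul_of_nonneg_right hv s0.le
      _ ≤ V * v := le_mul_of_one_le_left v0.le V1
  set N := ⌈(η ^ 2)⁻¹⌉₊ with hN
  have N0 : (η ^ 2)⁻¹ ≤ N := Nat.le_ceil _
  have N1 : 1 ≤ N := Nat.one_le_ceil_iff.2 (by positivity)
  have Nη : 1 ≤ η ^ 2 * N := by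
    calc (1:ℝ) = η ^ 2 * (η ^ 2)⁻¹ := by field_simp
      _ ≤ _ := mul_le_mul_of_nonneg_left N0 (by positivity)
  have ss : s ^ 2 ≤ v ^ 2 := by
    refine pow_le_pow_left₀ s0.le ?_ 2
    rw [hs]; simpa using rpow_le_rpow_of_exponent_le (show 1 ≤ v by linarith) (show 1 / 2 + ε ≤ 1 by linarith)
  have Nle : (N:ℝ) ≤ 8 * C₁ ^ 2 * v ^ 2 := by
    refine (Nat.ceil_lt_add_one (by positivity)).le.trans ?_
    have e : (η ^ 2)⁻¹ ≤ 4 * C₁ ^ 2 * v ^ 2 := by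
      rw [hη, div_pow, inv_div, div_le_iff₀ (by positivity)]
      calc (2 * C₁ * s) ^ 2 = 4 * C₁ ^ 2 * s ^ 2 := by ring
        _ ≤ 4 * C₁ ^ 2 * v ^ 2 := mul_le_mul_of_nonneg_left ss (by positivity)
        _ ≤ _ := le_mul_of_one_le_right (by positivity) (one_le_pow₀ V1)
    have : 1 ≤ C₁ ^ 2 * v ^ 2 := one_le_mul_of_one_le_of_one_le (one_le_pow₀ c1) (one_le_pow₀ (by linarith))
    linarith
  have Ne : (N:ℝ) ^ ε ≤ 8 * C₁ ^ 2 * v ^ (2 * ε) := by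
    refine (rpow_le_rpow (by positivity) Nle hε.le).trans ?_
    rw [mul_rpow (by positivity) (by positivity), rpow_mul v0.le, rpow_two]
    refine mul_le_mul_of_nonneg_right ?_ (by positivity)
    have : 1 ≤ 8 * C₁ ^ 2 := by linarith [one_le_pow₀ c1 (n := 2)]
    simpa using rpow_le_rpow_of_exponent_le this (show ε ≤ 1 by linarith)
  have sub : {t | t ∈ Set.Ioc (v / 2) v ∧ V ≤ |GG t|} ⊆ lvSet (fun n => (bw η n : ℂ)) N (v / 2) (v / 2) (V / 2) := fun t ht => by
    obtain ⟨⟨ta, tb⟩, hV⟩ := ht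
    refine ⟨ta.le, by linarith, ?_⟩
    have a := H1 t v η N (by linarith) tb (by nlinarith) Nη
    rw [← hs, show C₁ * (η * s) = V / 2 by rw [hη]; field_simp] at a
    have b := Complex.abs_re_le_norm (ee (-(1 / 8)) * SS (fun n => (bw η n : ℂ)) N t)
    rw [norm_mul, ee_norm, one_mul] at b
    have := abs_sub_abs_le_abs_sub (GG t) (ee (-(1 / 8)) * SS (fun n => (bw η n : ℂ)) N t).re
    linarith
  refine (measureReal_mono sub (lvSet_fin _ _ _ _ _)).trans ?_
  refine ((H2 _ N (v / 2) (v / 2) N1 (by linarith) fun n _ => bw_norm η n).2 (V / 2) (by linarith)).trans ?_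
  have k : ((V / 2) ^ 2)⁻¹ + v / 2 * ((V / 2) ^ 10)⁻¹ ≤ 1024 * ((V ^ 2)⁻¹ + v * (V ^ 10)⁻¹) := by
    rw [div_pow, div_pow, inv_div, inv_div, div_eq_mul_inv, div_eq_mul_inv (2 ^ 10)]
    have := inv_nonneg.2 (sq_nonneg V)
    have : 0 ≤ v * (V ^ 10)⁻¹ := by positivity
    linarith
  calc _ ≤ C₂ * (8 * C₁ ^ 2 * v ^ (2 * ε)) * (1024 * ((V ^ 2)⁻¹ + v * (V ^ 10)⁻¹)) :=
        mul_le_mul (mul_le_mul_of_nonneg_left Ne (by linarith)) k (by positivity) (by positivity)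
    _ = _ := by ring

lemma lay {S : Set ℝ} (mS : MeasurableSet S) (fS : volume S ≠ ⊤) {f h : ℝ → ℝ} {X : ℝ} {J : ℕ} (hf : Measurable f) (f0 : ∀ t, 0 ≤ f t) (h0 : ∀ x, 0 ≤ h x) (hm : ∀ x y, 0 ≤ x → x ≤ y → h x ≤ h y)
    (h1 : ∀ t ∈ S, f t < 2 ^ J) (hX : ∀ j : ℕ, h (2 ^ (j + 1)) * volume.real {t | t ∈ S ∧ 2 ^ j ≤ f t} ≤ X) :
    ∫ t in S, h (f t) ≤ h 1 * volume.real S + J * X := by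
  have ms : ∀ j : ℕ, MeasurableSet {t | (2:ℝ) ^ j ≤ f t} := fun j => measurableSet_le measurable_const hf
  have : IsFiniteMeasure (volume.restrict S) := ⟨by rw [Measure.restrict_apply_univ]; exact fS.lt_top⟩
  have ii : ∀ j : ℕ, IntegrableOn (Set.indicator {t | (2:ℝ) ^ j ≤ f t} fun _ => h (2 ^ (j + 1))) S := fun j => (integrable_const _).indicator (ms j)
  have pt : ∀ (J : ℕ) (x : ℝ), 0 ≤ x → x < 2 ^ J → h x ≤ h 1 + ∑ j ∈ Finset.range J, if 2 ^ j ≤ x then h (2 ^ (j + 1)) else 0 := fun J x x0 => by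
    induction J with
    | zero => intro hx; simpa using hm x 1 x0 (by simpa using hx.le)
    | succ J ih =>
      intro hx
      rw [Finset.sum_range_succ, ← add_assoc]
      by_cases c : x < 2 ^ J
      · rw [if_neg (not_le.2 c), add_zero]; exact ih c
      · rw [if_pos (not_lt.1 c)]
        refine le_add_of_nonneg_of_le (add_nonneg (h0 1) (Finset.sum_nonneg fun j _ => ?_)) (hm _ _ x0 hx.le)
        split_ifs <;> simp [h0]
  calc ∫ t in S, h (f t) ≤ ∫ t in S, (h 1 + ∑ j ∈ Finset.range J, Set.indicator {t | (2:ℝ) ^ j ≤ f t} (fun _ => h (2 ^ (j + 1))) t) := by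
        refine integral_mono_of_nonneg (Filter.Eventually.of_forall fun t => h0 _) ((integrable_const _).add (integrable_finsetSum _ fun j _ => ii j)) ?_
        filter_upwards [ae_restrict_mem mS] with t ht
        exact pt J _ (f0 t) (h1 t ht)
    _ ≤ _ := by
        rw [integral_add (integrable_const _) (integrable_finsetSum _ fun j _ => ii j), integral_finsetSum _ fun j _ => ii j, setIntegral_const, smul_eq_mul, mul_comm]
        refine add_le_add_right ?_ _
        refine (Finset.sum_le_card_nsmul _ _ X fun j _ => ?_).trans (le_of_eq (by simp))
        rw [integral_indicator (ms j), setIntegral_const, measureReal_restrict_apply (ms j), Set.inter_comm, smul_eq_mul, mul_comm]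
        exact hX j

noncomputable def hh (q x : ℝ) : ℝ := min (x ^ 10 / q) (x ^ 8)

lemma G10 {ε : ℝ} (hε : 0 < ε) (h4 : ε < 1 / 4) : ∃ C : ℝ, 1 ≤ C ∧ ∀ᶠ v : ℝ in Filter.atTop,
    ∫ t in v / 2..v, hh (v ^ ((1:ℝ) / 127)) |GG t| ≤ C * v ^ (1 - 1 / 127 + 3 * ε) := by
  obtain ⟨C, c1, H⟩ := lvl hε h4
  obtain ⟨P, p1, HP⟩ := GG_pt
  obtain ⟨K, k1, HK⟩ := kk hε
  refine ⟨1 + K * (C * 2048 * P ^ 6), by nlinarith [one_le_pow₀ p1 (n := 6), mul_pos (show 0 < K by linarith) (show 0 < C by linarith)], ?_⟩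
  filter_upwards [H, Filter.eventually_ge_atTop (P + 2)] with v hv vP
  have v0 : 0 < v := by linarith
  have v1 : 1 ≤ v := by linarith
  obtain ⟨J, J1, J2⟩ := HK v v1
  set q := v ^ ((1:ℝ) / 127) with hq
  have q0 : 1 ≤ q := one_le_rpow v1 (by norm_num)
  have Gb : ∀ t ∈ Set.Ioc (v / 2) v, |GG t| ≤ P * v ^ ((81:ℝ) / 500) := fun t ht =>
    (HP t (by linarith [ht.1])).trans (mul_le_mul_of_nonneg_left (rpow_le_rpow (by linarith [ht.1]) ht.2 (by norm_num)) (by linarith))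
  have vq : v / q = v ^ (1 - (1:ℝ) / 127) := by rw [rpow_sub v0, rpow_one]
  have vol : volume.real (Set.Ioc (v / 2) v) = v / 2 := by rw [volume_real_Ioc_of_le (by linarith)]; ring
  set W := v ^ (1 - (1:ℝ) / 127) with hW
  have W0 : 0 < W := by positivity
  have e0 : 0 < v ^ (2 * ε) := by positivity
  have L := lay (S := Set.Ioc (v / 2) v) measurableSet_Ioc (by simp) (f := fun t => |GG t|) (h := hh q) (J := J) (X := C * 2048 * P ^ 6 * v ^ (2 * ε) * W) GG_meas.abs (fun _ => abs_nonneg _)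
    (fun x => le_min (by positivity) (by positivity)) (fun x y x0 xy => min_le_min (by gcongr) (by gcongr))
    (fun t ht => (Gb t ht).trans_lt ?_) fun j => ?_
  · rw [intervalIntegral.integral_of_le (by linarith)]
    refine L.trans ?_
    rw [vol]
    have a : hh q 1 * (v / 2) ≤ W := by
      calc _ ≤ 1 ^ 10 / q * v := mul_le_mul (min_le_left _ _) (by linarith) (by linarith) (by positivity)
        _ = W := by rw [← vq]; ring
    have e1 : 1 ≤ v ^ (3 * ε) := one_le_rpow v1 (by linarith)
    calc _ ≤ W * v ^ (3 * ε) + K * v ^ ε * (C * 2048 * P ^ 6 * v ^ (2 * ε) * W) :=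
          add_le_add (a.trans (le_mul_of_one_le_right W0.le e1)) (mul_le_mul_of_nonneg_right (by linarith) (by positivity))
      _ = _ := by rw [rpow_add v0 (1 - 1 / 127), show 3 * ε = ε + 2 * ε by ring, rpow_add v0 ε]; ring
  · refine lt_of_lt_of_le ?_ J1
    have := rpow_le_rpow_of_exponent_le v1 (show (81:ℝ) / 500 ≤ 1 by norm_num)
    rw [rpow_one] at this
    nlinarith
  · have h2 := hv (2 ^ j) (one_le_pow₀ (by norm_num))
    set V : ℝ := 2 ^ j with hV
    have V0 : 0 < V := by positivity
    by_cases c : V ≤ P * v ^ ((81:ℝ) / 500)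
    · have V6 : V ^ 6 ≤ P ^ 6 * W := by
        refine (pow_le_pow_left₀ V0.le c 6).trans ?_
        rw [mul_pow, ← rpow_natCast (v ^ _), ← rpow_mul v0.le]
        exact mul_le_mul_of_nonneg_left (rpow_le_rpow_of_exponent_le v1 (by norm_num)) (by positivity)
      have m0 : 0 ≤ hh q (2 * V) := le_min (by positivity) (by positivity)
      have m1 : hh q (2 * V) * (V ^ 2)⁻¹ ≤ 1024 * (P ^ 6 * W) := by
        calc _ ≤ (2 * V) ^ 8 * (V ^ 2)⁻¹ := mul_le_mul_of_nonneg_right (min_le_right _ _) (by positivity)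
          _ = 256 * V ^ 6 := by field_simp; ring
          _ ≤ _ := by linarith [pow_pos V0 6]
      have m2 : hh q (2 * V) * (v * (V ^ 10)⁻¹) ≤ 1024 * (P ^ 6 * W) := by
        calc _ ≤ (2 * V) ^ 10 / q * (v * (V ^ 10)⁻¹) := mul_le_mul_of_nonneg_right (min_le_left _ _) (by positivity)
          _ = 1024 * (1 * W) := by rw [← vq]; field_simp; ring
          _ ≤ _ := mul_le_mul_of_nonneg_left (mul_le_mul_of_nonneg_right (one_le_pow₀ p1) W0.le) (by norm_num)
      rw [pow_succ', ← hV]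
      refine (mul_le_mul_of_nonneg_left h2 m0).trans ?_
      calc _ = C * v ^ (2 * ε) * (hh q (2 * V) * (V ^ 2)⁻¹ + hh q (2 * V) * (v * (V ^ 10)⁻¹)) := by ring
        _ ≤ C * v ^ (2 * ε) * (1024 * (P ^ 6 * W) + 1024 * (P ^ 6 * W)) := mul_le_mul_of_nonneg_left (add_le_add m1 m2) (by positivity)
        _ = _ := by ring
    · have : {t | t ∈ Set.Ioc (v / 2) v ∧ V ≤ |GG t|} = ∅ := Set.eq_empty_of_forall_notMem fun t ht => c (ht.2.trans (Gb t ht.1))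
      rw [this, measureReal_empty, mul_zero]; positivity

lemma B2 {ε : ℝ} (hε : 0 < ε) (h4 : ε < 1 / 8) : ∃ C : ℝ, 1 ≤ C ∧ ∀ᶠ v : ℝ in Filter.atTop,
    ∫ t in v / 2..v, (GG t - AA ⌊v ^ ((8:ℝ) / 127)⌋₊ t) ^ 2 ≤ C * v ^ (1 - 4 / 127 + 2 * ε) := by
  obtain ⟨C₁, c1, H1⟩ := apx hε
  obtain ⟨C₂, c2, H2⟩ := ms ε hε
  refine ⟨8 * C₂ + 2 * C₁ ^ 2, by nlinarith, ?_⟩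
  filter_upwards [Filter.eventually_ge_atTop 16, ev_rp (show (0:ℝ) < 1 / 4 by norm_num) 2] with v v2 hv
  have v0 : 0 < v := by linarith
  have v1 : 1 ≤ v := by linarith
  set y := v ^ ((8:ℝ) / 127) with hy
  have y1 : 1 ≤ y := one_le_rpow v1 (by norm_num)
  set Y := ⌊y⌋₊ with hY
  have Y1 : 1 ≤ Y := Nat.one_le_floor_iff _ |>.2 y1
  have Y1' : (1:ℝ) ≤ Y := by exact_mod_cast Y1
  have yY : y / 2 ≤ Y := by have := Nat.lt_floor_add_one y; linarith
  have Yy : (Y:ℝ) ≤ y := Nat.floor_le (by linarith)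
  set w := v ^ ((3:ℝ) / 2) with hw
  have w1 : 1 ≤ w := one_le_rpow v1 (by norm_num)
  set N := ⌈w⌉₊ with hN
  have wN : w ≤ N := Nat.le_ceil _
  have Nw : (N:ℝ) ≤ 2 * w := by have := Nat.ceil_lt_add_one (show 0 ≤ w by linarith); linarith
  have N1 : 1 ≤ N := by exact_mod_cast w1.trans wN
  set η := v ^ (-(3:ℝ) / 4) with hη
  have η0 : 0 < η := by positivity
  have ηw : η ^ 2 * w = 1 := by rw [hη, ← rpow_natCast, ← rpow_mul v0.le, hw, ← rpow_add v0]; norm_num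
  have ηv : η * v = v ^ ((1:ℝ) / 4) := by rw [hη, ← rpow_add_one v0.ne']; norm_num
  have yw : 2 * y ≤ w := by
    calc 2 * y ≤ v ^ ((1:ℝ) / 4) * y := mul_le_mul_of_nonneg_right hv (by linarith)
      _ = v ^ ((1:ℝ) / 4 + 8 / 127) := (rpow_add v0 _ _).symm
      _ ≤ w := rpow_le_rpow_of_exponent_le v1 (by norm_num)
  have YN : Y ≤ N := by have : (Y:ℝ) ≤ N := by linarith
                        exact_mod_cast this
  set a : ℕ → ℂ := fun n => if n ≤ Y then 0 else (bw η n : ℂ) with ha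
  have Sa : ∀ t, SS (fun n => (bw η n : ℂ)) N t = SS (fun n => (bb n : ℂ)) Y t + SS a N t := fun t => by
    have e : ∀ n ∈ Finset.Icc 1 N, (bw η n : ℂ) * ee (2 * t * sqrt n) = (if n ≤ Y then (bb n : ℂ) * ee (2 * t * sqrt n) else 0) + a n * ee (2 * t * sqrt n) := fun n _ => by
      simp only [ha]
      split_ifs with c
      · rw [bw, chi_one, mul_one, bb]; · ring
        rw [mul_pow, sq_sqrt (by positivity)]
        have : (n:ℝ) ≤ Y := by exact_mod_cast c
        linarith [mul_le_mul_of_nonneg_left (show (n:ℝ) ≤ w / 2 by linarith) (sq_nonneg η)]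
      · ring
    rw [SS, SS, SS, Finset.sum_congr rfl e, Finset.sum_add_distrib, ← Finset.sum_filter]
    congr 2
    ext n; simp only [Finset.mem_filter, Finset.mem_Icc]; omega
  have M := H2 a N Y (v / 2) (v / 2) N1 (by linarith) (by linarith) (by linarith) (fun n _ => by
    simp only [ha]; split_ifs
    · rw [norm_zero]; exact mul_nonneg (dd_nonneg n) (by positivity)
    · exact bw_norm η n) fun n hn => if_pos (by exact_mod_cast hn)
  rw [add_halves] at M
  set s := v ^ (1 / 2 + ε) with hs
  have c := (SS_cont a N).norm
  have D : ∀ t ∈ Set.Ioc (v / 2) v, (GG t - AA Y t) ^ 2 ≤ 2 * ‖SS a N t‖ ^ 2 + 2 * (C₁ * (η * s)) ^ 2 := fun t ht => by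
    have A := H1 t v η N (by linarith [ht.1]) ht.2 (by linarith [mul_le_mul_of_nonneg_left ht.1.le η0.le]) (by linarith [mul_le_mul_of_nonneg_left wN (sq_nonneg η)])
    rw [Sa, mul_add, Complex.add_re, ← AA, ← sub_sub] at A
    have b := Complex.abs_re_le_norm (ee (-(1 / 8)) * SS a N t)
    rw [norm_mul, ee_norm, one_mul] at b
    rw [← sq_abs (_ - _)]
    have : |GG t - AA Y t| ≤ ‖SS a N t‖ + C₁ * (η * s) := by linarith [abs_sub_abs_le_abs_sub (GG t - AA Y t) (ee (-(1 / 8)) * SS a N t).re]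
    refine (pow_le_pow_left₀ (abs_nonneg _) this 2).trans (add_sq_le.trans (le_of_eq (mul_add _ _ _)))
  have vv : v / 2 ≤ v := by linarith
  have F : ∫ t in v / 2..v, (GG t - AA Y t) ^ 2 ≤ ∫ t in v / 2..v, (2 * ‖SS a N t‖ ^ 2 + 2 * (C₁ * (η * s)) ^ 2) := by
    have i : Continuous fun t => 2 * ‖SS a N t‖ ^ 2 + 2 * (C₁ * (η * s)) ^ 2 := by fun_prop
    refine (le_abs_self _).trans (intervalIntegral.norm_integral_le_of_norm_le (μ := volume) (f := fun t => (GG t - AA Y t) ^ 2) vv (Filter.Eventually.of_forall fun t ht => ?_) (i.intervalIntegrable _ _))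
    rw [norm_of_nonneg (sq_nonneg _)]; exact D t ht
  refine F.trans ?_
  rw [intervalIntegral.integral_add (Continuous.intervalIntegrable (by fun_prop) _ _) (Continuous.intervalIntegrable (by fun_prop) _ _), intervalIntegral.integral_const_mul, intervalIntegral.integral_const, smul_eq_mul]
  have Ne : (N:ℝ) ^ ε ≤ 2 * v ^ (2 * ε) := by
    refine (rpow_le_rpow (by positivity) Nw hε.le).trans ?_
    rw [mul_rpow (by norm_num) (by linarith), hw, ← rpow_mul v0.le]
    refine mul_le_mul ?_ (rpow_le_rpow_of_exponent_le v1 (by linarith)) (by positivity) (by norm_num)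
    simpa using rpow_le_rpow_of_exponent_le (one_le_two (α := ℝ)) (show ε ≤ 1 by linarith)
  set X := v ^ (1 - (4:ℝ) / 127) with hX
  have X1 : 1 ≤ X := one_le_rpow v1 (by norm_num)
  have Yk : v / 2 * (Y:ℝ) ^ (-(1:ℝ) / 2) ≤ X := by
    have : (Y:ℝ) ^ (-(1:ℝ) / 2) ≤ 2 * v ^ (-(4:ℝ) / 127) := by
      calc _ ≤ (y / 2) ^ (-(1:ℝ) / 2) := rpow_le_rpow_of_nonpos (by linarith) yY (by norm_num)
        _ = 2 ^ ((1:ℝ) / 2) * v ^ (-(4:ℝ) / 127) := by rw [div_rpow (by linarith) (by norm_num), hy, ← rpow_mul v0.le, div_eq_mul_inv, ← rpow_neg (by norm_num), mul_comm]; norm_num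
        _ ≤ _ := mul_le_mul_of_nonneg_right (by simpa using rpow_le_rpow_of_exponent_le (one_le_two (α := ℝ)) (show (1:ℝ) / 2 ≤ 1 by norm_num)) (by positivity)
    refine (mul_le_mul_of_nonneg_left this (by linarith)).trans (le_of_eq ?_)
    rw [hX, sub_eq_add_neg, rpow_add v0, rpow_one, ← neg_div]; ring
  have e1 : v ^ (1 - 4 / 127 + 2 * ε) = v ^ (2 * ε) * X := by rw [rpow_add v0, mul_comm]
  have t2 : v * (η * s) ^ 2 ≤ v ^ (2 * ε) * X := by
    rw [hη, hs, ← rpow_add v0, ← rpow_natCast, ← rpow_mul v0.le, hX, ← rpow_add v0]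
    nth_rw 1 [← rpow_one v]
    rw [← rpow_add v0]
    exact rpow_le_rpow_of_exponent_le v1 (by push_cast; linarith)
  rw [e1]
  have t1 : C₂ * (N:ℝ) ^ ε * (v / 2 * (Y:ℝ) ^ (-(1:ℝ) / 2) + 1) ≤ C₂ * (2 * v ^ (2 * ε)) * (X + X) :=
    mul_le_mul (mul_le_mul_of_nonneg_left Ne (by linarith)) (add_le_add Yk X1) (by positivity) (by positivity)
  have t3 : C₁ ^ 2 * (v * (η * s) ^ 2) ≤ C₁ ^ 2 * (v ^ (2 * ε) * X) := mul_le_mul_of_nonneg_left t2 (by positivity)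
  have : 0 ≤ C₁ ^ 2 * (v ^ (2 * ε) * X) := by positivity
  calc _ ≤ 2 * (C₂ * (2 * v ^ (2 * ε)) * (X + X)) + C₁ ^ 2 * (v ^ (2 * ε) * X) := by
        refine add_le_add (by linarith) (le_trans (le_of_eq ?_) t3); ring
    _ ≤ _ := by linarith

lemma pt8 (G A : ℝ) {q : ℝ} (hq : 0 < q) : |G ^ 8 - A ^ 8| ≤ 8 * q ^ 3 * (G - A) ^ 2 + 8200 * (hh q |G| + A ^ 10 / q) := by
  have A0 : 0 ≤ A ^ 10 / q := by positivity
  have Ga : |G| ^ 10 = G ^ 10 := (show Even 10 by decide).pow_abs G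
  have Aa : |A| ^ 10 = A ^ 10 := (show Even 10 by decide).pow_abs A
  have Ga8 : |G| ^ 8 = G ^ 8 := (show Even 8 by decide).pow_abs G
  have Aa8 : |A| ^ 8 = A ^ 8 := (show Even 8 by decide).pow_abs A
  rcases le_total (|G| ^ 2) q with c | c
  · have e : hh q |G| = G ^ 10 / q := by
      rw [hh, ← Ga, min_eq_left]
      rw [div_le_iff₀ hq, show |G| ^ 10 = |G| ^ 8 * |G| ^ 2 by ring]
      exact mul_le_mul_of_nonneg_left c (by positivity)
    set m := max |G| |A| with hm
    have m0 : 0 ≤ m := (abs_nonneg G).trans (le_max_left _ _)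
    have b := ba7 m0 (abs_nonneg (G - A)) hq
    rw [sq_abs] at b
    have b2 : |G - A| ^ 10 ≤ 1024 * m ^ 10 := by
      have : |G - A| ≤ 2 * m := (abs_sub G A).trans (by linarith [le_max_left |G| |A|, le_max_right |G| |A|])
      refine (pow_le_pow_left₀ (abs_nonneg _) this 10).trans (le_of_eq (by ring))
    have m10 : m ^ 10 ≤ G ^ 10 + A ^ 10 := by
      rcases max_choice |G| |A| with c | c <;> rw [hm, c, ← Ga, ← Aa]
      · exact le_add_of_nonneg_right (by positivity)
      · exact le_add_of_nonneg_left (by positivity)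
    have d : (m ^ 10 + |G - A| ^ 10) / q ≤ 1025 * (G ^ 10 / q + A ^ 10 / q) := by
      rw [← add_div, ← mul_div_assoc]; exact div_le_div_of_nonneg_right (by linarith) hq.le
    rw [e]
    refine (abs_pow_sub_pow_le G A 8).trans ?_
    rw [← hm]; push_cast; linarith
  · have e : hh q |G| = G ^ 8 := by
      rw [hh, ← Ga8, min_eq_right]
      rw [le_div_iff₀ hq, show |G| ^ 10 = |G| ^ 8 * |G| ^ 2 by ring]
      exact mul_le_mul_of_nonneg_left c (by positivity)
    have A8 : A ^ 8 ≤ G ^ 8 + A ^ 10 / q := by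
      rcases le_total |A| |G| with d | d
      · rw [← Ga8, ← Aa8]; exact le_add_of_le_of_nonneg (pow_le_pow_left₀ (abs_nonneg _) d 8) A0
      · refine le_add_of_nonneg_of_le (by positivity) ?_
        rw [← Aa8, ← Aa, le_div_iff₀ hq, show |A| ^ 10 = |A| ^ 8 * |A| ^ 2 by ring]
        exact mul_le_mul_of_nonneg_left (c.trans (pow_le_pow_left₀ (abs_nonneg _) d 2)) (by positivity)
    have : 0 ≤ 8 * q ^ 3 * (G - A) ^ 2 := by positivity
    have g0 : 0 ≤ G ^ 8 := by positivity
    have a0 : 0 ≤ A ^ 8 := by positivity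
    rw [e]
    refine (abs_sub _ _).trans ?_
    rw [abs_of_nonneg g0, abs_of_nonneg a0]
    clear Ga Aa Ga8 Aa8
    linarith

lemma cmp8 {ε : ℝ} (hε : 0 < ε) (h4 : ε < 1 / 8) : ∃ C : ℝ, 1 ≤ C ∧ ∀ᶠ v : ℝ in Filter.atTop,
    IntervalIntegrable (fun t => GG t ^ 8) volume (v / 2) v ∧
    |(∫ t in v / 2..v, t ^ 5 * GG t ^ 8) - ∫ t in v / 2..v, t ^ 5 * AA ⌊v ^ ((8:ℝ) / 127)⌋₊ t ^ 8| ≤ C * v ^ (6 - 1 / 127 + 3 * ε) := by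
  obtain ⟨C₁, c1, H1⟩ := B2 hε h4
  obtain ⟨C₂, c2, H2⟩ := G10 hε (by linarith)
  obtain ⟨C₃, c3, H3⟩ := mom10 ε hε
  obtain ⟨P, p1, HP⟩ := GG_pt
  refine ⟨8 * C₁ + 8200 * (C₂ + 2 * C₃), by linarith, ?_⟩
  filter_upwards [Filter.eventually_ge_atTop 2, H1, H2] with v v2 h1 h2
  have v0 : 0 < v := by linarith
  have v1 : 1 ≤ v := by linarith
  have vv : v / 2 ≤ v := by linarith
  set y := v ^ ((8:ℝ) / 127) with hy
  have y1 : 1 ≤ y := one_le_rpow v1 (by norm_num)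
  set Y := ⌊y⌋₊ with hY
  have Y1 : 1 ≤ Y := Nat.one_le_floor_iff _ |>.2 y1
  have Yy : (Y:ℝ) ≤ y := Nat.floor_le (by linarith)
  have Ye : (Y:ℝ) ^ ε ≤ v ^ (3 * ε) := by
    refine (rpow_le_rpow (by positivity) Yy hε.le).trans ?_
    rw [← rpow_mul v0.le]; exact rpow_le_rpow_of_exponent_le v1 (by linarith)
  have Y2 : (Y:ℝ) ^ 2 ≤ v := by
    refine (pow_le_pow_left₀ (by positivity) Yy 2).trans ?_
    rw [← rpow_natCast, ← rpow_mul v0.le]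
    simpa using rpow_le_rpow_of_exponent_le v1 (show (8:ℝ) / 127 * (2:ℕ) ≤ 1 by norm_num)
  have c := (SS_cont (fun n => (bb n : ℂ)) Y).norm
  have cA := AA_cont Y
  have i10 : IntervalIntegrable (fun t => AA Y t ^ 10) volume (v / 2) v := (cA.pow 10).intervalIntegrable _ _
  have h3 : ∫ t in v / 2..v, AA Y t ^ 10 ≤ 2 * C₃ * v ^ (3 * ε) * v := by
    have a := (H3 _ Y (v / 2) (v / 2) Y1 (by linarith) (bb_norm Y)).1
    rw [add_halves] at a
    calc _ ≤ ∫ t in v / 2..v, ‖SS (fun n => (bb n : ℂ)) Y t‖ ^ 10 := by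
          refine intervalIntegral.integral_mono_on vv i10 ((c.pow 10).intervalIntegrable _ _) fun t _ => ?_
          rw [← (show Even 10 by decide).pow_abs]
          refine pow_le_pow_left₀ (abs_nonneg _) ((Complex.abs_re_le_norm _).trans (le_of_eq ?_)) 10
          rw [norm_mul, ee_norm, one_mul]
      _ ≤ C₃ * v ^ (3 * ε) * (2 * v) := a.trans (mul_le_mul (mul_le_mul_of_nonneg_left Ye (by linarith)) (by linarith) (by positivity) (by positivity))
      _ = _ := by ring
  clear H1 H2 H3
  set q := v ^ ((1:ℝ) / 127) with hq
  have q0 : 0 < q := by positivity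
  have bd : ∀ {f : ℝ → ℝ} (M : ℝ), Measurable f → (∀ t ∈ Set.Ioc (v / 2) v, |f t| ≤ M) → IntervalIntegrable f volume (v / 2) v := fun {f} M hf hM => by
    rw [intervalIntegrable_iff_integrableOn_Ioc_of_le vv]
    exact Measure.integrableOn_of_bounded (M := M) (by simp) hf.aestronglyMeasurable ((ae_restrict_mem measurableSet_Ioc).mono hM)
  set M := P * v ^ ((81:ℝ) / 500)
  have Gb : ∀ t ∈ Set.Ioc (v / 2) v, |GG t| ≤ M := fun t ht =>
    (HP t (by linarith [ht.1])).trans (mul_le_mul_of_nonneg_left (rpow_le_rpow (by linarith [ht.1]) ht.2 (by norm_num)) (by linarith))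
  have ig : ∀ n : ℕ, IntervalIntegrable (fun t => GG t ^ n) volume (v / 2) v := fun n => bd (M ^ n) (GG_meas.pow_const n) fun t ht => by
    rw [abs_pow]; exact pow_le_pow_left₀ (abs_nonneg _) (Gb t ht) n
  have ih : IntervalIntegrable (fun t => hh q |GG t|) volume (v / 2) v := bd (M ^ 8) (((GG_meas.abs.pow_const 10).div_const q).min (GG_meas.abs.pow_const 8)) fun t ht => by
    rw [abs_of_nonneg (le_min (by positivity) (by positivity))]
    exact (min_le_right _ _).trans (pow_le_pow_left₀ (abs_nonneg _) (Gb t ht) 8)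
  have i2 : IntervalIntegrable (fun t => (GG t - AA Y t) ^ 2) volume (v / 2) v := by
    have : (fun t => (GG t - AA Y t) ^ 2) = fun t => GG t ^ 2 - 2 * AA Y t * GG t ^ 1 + AA Y t ^ 2 := by funext t; ring
    rw [this]
    exact ((ig 2).sub ((ig 1).continuousOn_mul (by fun_prop))).add (Continuous.intervalIntegrable (by fun_prop) _ _)
  refine ⟨ig 8, ?_⟩
  rw [← intervalIntegral.integral_sub ((ig 8).continuousOn_mul (by fun_prop)) (Continuous.intervalIntegrable (by fun_prop) _ _)]
  have F := intervalIntegral.norm_integral_le_of_norm_le (μ := volume) (f := fun t => t ^ 5 * GG t ^ 8 - t ^ 5 * AA Y t ^ 8)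
    (g := fun t => v ^ 5 * (8 * q ^ 3 * (GG t - AA Y t) ^ 2 + 8200 * (hh q |GG t| + AA Y t ^ 10 / q))) vv
    (Filter.Eventually.of_forall fun t ht => by
      rw [← mul_sub, norm_mul, norm_pow]
      refine mul_le_mul (pow_le_pow_left₀ (norm_nonneg _) ?_ 5) (pt8 _ _ q0) (norm_nonneg _) (by positivity)
      rw [norm_of_nonneg (by linarith [ht.1])]; exact ht.2)
    (((i2.const_mul _).add ((ih.add (i10.div_const q)).const_mul _)).const_mul _)
  refine F.trans ?_
  rw [intervalIntegral.integral_const_mul, intervalIntegral.integral_add (i2.const_mul _) ((ih.add (i10.div_const q)).const_mul _), intervalIntegral.integral_const_mul, intervalIntegral.integral_const_mul, intervalIntegral.integral_add ih (i10.div_const q), intervalIntegral.integral_div]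
  clear F i2 ih i10 ig Gb bd
  set W := v ^ (1 - 1 / 127 + 3 * ε) with hW
  have W0 : 0 < W := by positivity
  have e : v ^ (6 - 1 / 127 + 3 * ε) = v ^ 5 * W := by
    rw [← rpow_natCast v 5, hW, ← rpow_add v0]; congr 1; push_cast; ring
  have a1 : q ^ 3 * (∫ t in v / 2..v, (GG t - AA Y t) ^ 2) ≤ C₁ * W := by
    refine (mul_le_mul_of_nonneg_left h1 (by positivity)).trans ?_
    rw [mul_left_comm]
    refine mul_le_mul_of_nonneg_left ?_ (by linarith)
    rw [hq, ← rpow_natCast, ← rpow_mul v0.le, ← rpow_add v0]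
    exact rpow_le_rpow_of_exponent_le v1 (by push_cast; linarith)
  have a3 : (∫ t in v / 2..v, AA Y t ^ 10) / q ≤ 2 * C₃ * W := by
    rw [div_le_iff₀ q0]
    refine h3.trans (le_of_eq ?_)
    rw [hW, hq, mul_assoc, mul_assoc (2 * C₃), ← rpow_add v0, ← rpow_add_one v0.ne']; ring_nf
  rw [e, mul_left_comm]
  refine mul_le_mul_of_nonneg_left ?_ (by positivity)
  linarith

lemma blk {ε : ℝ} (hε : 0 < ε) (h4 : ε < 1 / 8) : ∃ C : ℝ, 1 ≤ C ∧ ∀ᶠ v : ℝ in Filter.atTop,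
    |∫ x in (v / 2) ^ 2..v ^ 2, (Δ x ^ 8 - (35 * C7 - 28 * C4) / (2048 * π ^ 8) * x ^ 2)| ≤ C * v ^ (6 - 1 / 127 + 3 * ε) := by
  obtain ⟨C₁, c1, H1⟩ := cmp8 hε h4
  obtain ⟨C₂, c2, H2⟩ := main8 (show 0 < 3 * ε by linarith)
  refine ⟨C₁ + C₂, by linarith, ?_⟩
  filter_upwards [Filter.eventually_ge_atTop 2, H1, H2] with v v2 ⟨ig, h1⟩ h2
  have vv : v / 2 ≤ v := by linarith
  set A := AA ⌊v ^ ((8:ℝ) / 127)⌋₊ with hA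
  set T := ∫ t in v / 2..v, t ^ 5 with hT
  set I := ∫ t in v / 2..v, t ^ 5 * GG t ^ 8 with hI
  have e2 : ∫ t in v / 2..v, t ^ 5 * (2 * A t) ^ 8 = 256 * ∫ t in v / 2..v, t ^ 5 * A t ^ 8 := by
    rw [← intervalIntegral.integral_const_mul]; congr 1; funext t; ring
  rw [e2] at h2
  have e : ∫ x in (v / 2) ^ 2..v ^ 2, (Δ x ^ 8 - (35 * C7 - 28 * C4) / (2048 * π ^ 8) * x ^ 2) = 1 / (8 * π ^ 8) * (I - 1 / 256 * ((70 * C7 - 56 * C4) * T)) := by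
    rw [← intervalIntegral.integral_comp_mul_deriv_of_deriv_nonneg (f := fun t => t ^ 2) (f' := fun t => 2 * t) (by fun_prop) (fun t _ => (hasDerivAt_pow 2 t).congr_deriv (by ring)) (fun t ht => by rw [min_eq_left vv] at ht; linarith [ht.1])]
    rw [hI, hT, ← mul_assoc (1 / 256), ← intervalIntegral.integral_const_mul, ← intervalIntegral.integral_sub (ig.continuousOn_mul (by fun_prop)) (Continuous.intervalIntegrable (by fun_prop) _ _), ← intervalIntegral.integral_const_mul]
    refine intervalIntegral.integral_congr fun t ht => ?_
    rw [Set.uIcc_of_le vv] at ht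
    have t0 : 0 < t := by linarith [ht.1]
    have g : GG t ^ 8 * t ^ 4 = Δ (t ^ 2) ^ 8 * (16 * π ^ 8) := by
      rw [GG, mul_pow, div_pow, mul_pow, show sqrt 2 ^ 8 = (sqrt 2 ^ 2) ^ 4 by ring, show sqrt t ^ 8 = (sqrt t ^ 2) ^ 4 by ring, sq_sqrt t0.le, sq_sqrt (by norm_num)]
      field_simp; ring
    have g' : Δ (t ^ 2) ^ 8 = GG t ^ 8 * t ^ 4 / (16 * π ^ 8) := by rw [g]; field_simp
    simp only [Function.comp]
    rw [g']; field_simp; ring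
  rw [e, abs_mul]
  have p1 : |1 / (8 * π ^ 8)| ≤ 1 := by
    rw [abs_of_pos (by positivity)]
    refine div_le_one_of_le₀ ?_ (by positivity)
    linarith [one_le_pow₀ (show 1 ≤ π by linarith [pi_gt_three]) (n := 8)]
  refine (mul_le_of_le_one_left (abs_nonneg _) p1).trans ?_
  have W0 : 0 ≤ C₂ * v ^ (6 - 1 / 127 + 3 * ε) := by positivity
  rw [add_mul]
  rw [abs_le] at *
  constructor <;> linarith

lemma F_int {a b : ℝ} (ha : 1 ≤ a) (hb : 1 ≤ b) : IntervalIntegrable (fun x => Δ x ^ 8) volume a b := by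
  wlog h : a ≤ b
  · exact (this hb ha (by linarith)).symm
  obtain ⟨C, h1, H⟩ := pointwise
  rw [intervalIntegrable_iff_integrableOn_Ioc_of_le h]
  refine Measure.integrableOn_of_bounded (M := (C * b) ^ 8) (by simp) (Δ_meas.pow_const 8).aestronglyMeasurable ((ae_restrict_mem measurableSet_Ioc).mono fun x hx => ?_)
  rw [norm_pow]
  refine pow_le_pow_left₀ (norm_nonneg _) ?_ 8
  have x1 : 1 ≤ sqrt x := one_le_sqrt.2 (by linarith [hx.1])
  have := H (sqrt x) x1
  rw [sq_sqrt (by linarith [hx.1])] at this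
  refine this.trans (mul_le_mul_of_nonneg_left ?_ (by linarith))
  calc _ ≤ sqrt x ^ (2:ℝ) := rpow_le_rpow_of_exponent_le x1 (by norm_num)
    _ = x := by rw [rpow_two, sq_sqrt (by linarith [hx.1])]
    _ ≤ b := hx.2

theorem eighth_moment_asymptotic :
    ∀ ε : ℝ, 0 < ε → ∃ C : ℝ, 0 < C ∧ ∀ X : ℝ, 10 ≤ X →
      |(∫ x in (2 : ℝ)..X, Δ x ^ 8) -
          ((35 * C7 - 28 * C4) / (2048 * Real.pi ^ 8)) * ∫ x in (2 : ℝ)..X, x ^ 2| ≤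
        C * X ^ (3 - 1 / 254 + ε : ℝ) := by
  intro ε hε
  set δ := min (ε / 2) (1 / 16) with hδ
  have d0 : 0 < δ := lt_min (by linarith) (by norm_num)
  have d1 : δ ≤ ε / 2 := min_le_left _ _
  have d2 : δ ≤ 1 / 16 := min_le_right _ _
  obtain ⟨C, c1, H⟩ := blk d0 (by linarith)
  set c := (35 * C7 - 28 * C4) / (2048 * π ^ 8)
  set κ := 6 - 1 / 127 + 3 * δ with hκ
  obtain ⟨v0, H0⟩ := Filter.eventually_atTop.1 (H.and (Filter.eventually_ge_atTop 2))
  have v2 := (H0 v0 le_rfl).2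
  set F : ℝ → ℝ := fun x => Δ x ^ 8 - c * x ^ 2 with hF
  have Fi : ∀ {a b : ℝ}, 1 ≤ a → 1 ≤ b → IntervalIntegrable F volume a b := fun ha hb => (F_int ha hb).sub (Continuous.intervalIntegrable (by fun_prop) _ _)
  set M := ∫ x in (1:ℝ)..v0 ^ 2 + 2, |F x| with hM
  have M0 : 0 ≤ M := intervalIntegral.integral_nonneg (by nlinarith) fun _ _ => abs_nonneg _
  have L : ∀ (n : ℕ) (v : ℝ), 1 ≤ v → v ≤ 2 ^ n → |∫ x in (2:ℝ)..v ^ 2, F x| ≤ M + 2 * C * v ^ κ := fun n => by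
    have s : ∀ v : ℝ, 1 ≤ v → v ≤ v0 → |∫ x in (2:ℝ)..v ^ 2, F x| ≤ M + 2 * C * v ^ κ := fun v v1 hv => by
      refine le_add_of_le_of_nonneg ?_ (by positivity)
      have i := intervalIntegral.norm_integral_le_abs_integral_norm (f := F) (a := 2) (b := v ^ 2) (μ := volume)
      refine i.trans ?_
      refine (intervalIntegral.abs_integral_mono_interval (c := 1) (d := v0 ^ 2 + 2) ?_ (Filter.Eventually.of_forall fun _ => norm_nonneg _) (Fi le_rfl (by nlinarith)).norm).trans (le_of_eq (abs_of_nonneg M0))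
      refine Set.uIoc_subset_uIoc_of_uIcc_subset_uIcc (Set.uIcc_subset_uIcc ?_ ?_) <;> rw [Set.uIcc_of_le (by nlinarith)] <;> constructor <;> nlinarith
    induction n with
    | zero => exact fun v h1 h2 => s v h1 (by linarith [pow_zero (2:ℝ)])
    | succ n ih =>
      intro v h1 h2
      rcases le_or_gt v v0 with h | h
      · exact s v h1 h
      have a := ih (v / 2) (by linarith) (by rw [pow_succ] at h2; linarith)
      have b := (H0 v h.le).1
      rw [← intervalIntegral.integral_add_adjacent_intervals (b := (v / 2) ^ 2) (Fi (by norm_num) (by nlinarith)) (Fi (by nlinarith) (by nlinarith))]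
      have k : (v / 2) ^ κ ≤ v ^ κ / 2 := by
        rw [div_rpow (by linarith) (by norm_num)]
        refine div_le_div_of_nonneg_left (by positivity) (by norm_num) ?_
        simpa using rpow_le_rpow_of_exponent_le (one_le_two (α := ℝ)) (show 1 ≤ κ by linarith)
      have := mul_le_mul_of_nonneg_left k (show 0 ≤ 2 * C by linarith)
      exact (abs_add_le _ _).trans (by linarith)
  refine ⟨M + 2 * C, by linarith, fun X hX => ?_⟩
  have X0 : 0 ≤ X := by linarith
  obtain ⟨n, hn⟩ := pow_unbounded_of_one_lt (sqrt X) (one_lt_two (α := ℝ))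
  have l := L n (sqrt X) (one_le_sqrt.2 (by linarith)) hn.le
  rw [sq_sqrt X0, hF, intervalIntegral.integral_sub (F_int (by norm_num) (by linarith)) (Continuous.intervalIntegrable (by fun_prop) _ _), intervalIntegral.integral_const_mul] at l
  refine l.trans ?_
  have e : sqrt X ^ κ ≤ X ^ (3 - 1 / 254 + ε) := by
    rw [sqrt_eq_rpow, ← rpow_mul X0]
    exact rpow_le_rpow_of_exponent_le (by linarith) (by linarith)
  have e1 : 1 ≤ X ^ (3 - 1 / 254 + ε) := one_le_rpow (by linarith) (by linarith)
  rw [add_mul]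
  exact add_le_add (le_mul_of_one_le_right M0 e1) (mul_le_mul_of_nonneg_left e (by linarith))
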